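/- Let E be the elliptic curve over ℚ defined by y² = x³ − x, and let p ∉ {2,3} be a prime number satisfying condition (P). Then every point of E over the field ℚ(∛p) (the subfield of ℝ generated over ℚ by the real cube root of p) is a torsion point; in other words, the Mordell–Weil rank of E over ℚ(∛p) is 0. -/

import Mathlib

/-- The congruent number elliptic curve `y² = x³ - x` (Cremona label 32a2),
considered over an arbitrary commutative ring. -/
def Ecurve (F : Type*) [CommRing F] : WeierstrassCurve.Affine F :=
  { a₁ := 0, a₂ := 0, a₃ := 0, a₄ := -1, a₆ := 0 }

/-- Condition (P) on a prime `p ∉ {2,3}`: setting `f(p) = 1` if `p ≡ 1 (mod 3)` and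
`f(p) = 2` otherwise, the number of points of `y² = x³ - x` over the finite field with
`p ^ f(p)` elements is not divisible by `3`. -/
def ConditionP (p : ℕ) (hp : p.Prime) : Prop :=
  letI : Fact p.Prime := ⟨hp⟩
  ¬ (3 ∣ Nat.card (Ecurve (GaloisField p (if p % 3 = 1 then 1 else 2))).Point)

/-- The real cube root of a natural number `p`. -/
noncomputable def realCbrt (p : ℕ) : ℝ := (p : ℝ) ^ ((1 : ℝ) / 3)

/-- One-variable family of cubic inequalities behind `weierstrass_norm_bound`. -/
theorem cubic_ineq_of_le (a c : ℝ) (ha : 0 ≤ a) (hc : 0 ≤ c) (h : a ≤ 68 / 100) :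
    0 ≤ 400000 / 368219 * c ^ 3 - a * c ^ 2 - 100 / 79 * c + 295 / 158 * a ^ 2 * c
      + 5727 / 10000 - a ^ 3 := by
  rcases le_total a (13 / 100) with h2 | h1
  · have h3 := mul_nonneg ha (sub_nonneg.2 h2)
    linarith [mul_nonneg hc (sq_nonneg (c - 642 / 1000)),
      sq_nonneg (c - 644 / 1000 - 44 / 100 * (a - 13 / 200)),
      sq_nonneg (c - 640 / 1000 - 44 / 100 * (a - 13 / 200)),
      sq_nonneg (c - 644 / 1000 - 38 / 100 * (a - 13 / 200)),
      sq_nonneg (c - 640 / 1000 - 38 / 100 * (a - 13 / 200)),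
      h3,
      mul_nonneg ha h3,
      mul_nonneg hc (sq_nonneg (a - 13 / 200)),
      mul_nonneg (sub_nonneg.2 h2) (sq_nonneg (c - 642 / 1000)),
      mul_nonneg (sub_nonneg.2 h2) (sq_nonneg (a - 13 / 200))]
  rcases le_total a (19 / 100) with h2 | h1
  · have h3 := mul_nonneg (sub_nonneg.2 h1) (sub_nonneg.2 h2)
    linarith [mul_nonneg hc (sq_nonneg (c - 662 / 1000)),
      sq_nonneg (c - 664 / 1000 - 32 / 100 * (a - 32 / 200)),
      sq_nonneg (c - 660 / 1000 - 32 / 100 * (a - 32 / 200)),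
      sq_nonneg (c - 664 / 1000 - 26 / 100 * (a - 32 / 200)),
      sq_nonneg (c - 660 / 1000 - 26 / 100 * (a - 32 / 200)),
      h3,
      mul_nonneg ha h3,
      mul_nonneg hc (sq_nonneg (a - 32 / 200)),
      mul_nonneg (sub_nonneg.2 h2) (sq_nonneg (c - 662 / 1000)),
      mul_nonneg (sub_nonneg.2 h2) (sq_nonneg (a - 32 / 200))]
  rcases le_total a (23 / 100) with h2 | h1
  · have h3 := mul_nonneg (sub_nonneg.2 h1) (sub_nonneg.2 h2)
    linarith [mul_nonneg hc (sq_nonneg (c - 670 / 1000)),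
      sq_nonneg (c - 672 / 1000 - 26 / 100 * (a - 42 / 200)),
      sq_nonneg (c - 668 / 1000 - 26 / 100 * (a - 42 / 200)),
      sq_nonneg (c - 672 / 1000 - 20 / 100 * (a - 42 / 200)),
      sq_nonneg (c - 668 / 1000 - 20 / 100 * (a - 42 / 200)),
      h3,
      mul_nonneg ha h3,
      mul_nonneg hc (sq_nonneg (a - 42 / 200)),
      mul_nonneg (sub_nonneg.2 h2) (sq_nonneg (c - 670 / 1000)),
      mul_nonneg (sub_nonneg.2 h2) (sq_nonneg (a - 42 / 200))]
  rcases le_total a (26 / 100) with h2 | h1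
  · have h3 := mul_nonneg (sub_nonneg.2 h1) (sub_nonneg.2 h2)
    linarith [mul_nonneg hc (sq_nonneg (c - 675 / 1000)),
      sq_nonneg (c - 677 / 1000 - 21 / 100 * (a - 49 / 200)),
      sq_nonneg (c - 673 / 1000 - 21 / 100 * (a - 49 / 200)),
      sq_nonneg (c - 677 / 1000 - 15 / 100 * (a - 49 / 200)),
      sq_nonneg (c - 673 / 1000 - 15 / 100 * (a - 49 / 200)),
      h3,
      mul_nonneg ha h3,
      mul_nonneg hc (sq_nonneg (a - 49 / 200)),
      mul_nonneg (sub_nonneg.2 h2) (sq_nonneg (c - 675 / 1000)),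
      mul_nonneg (sub_nonneg.2 h2) (sq_nonneg (a - 49 / 200))]
  rcases le_total a (29 / 100) with h2 | h1
  · have h3 := mul_nonneg (sub_nonneg.2 h1) (sub_nonneg.2 h2)
    linarith [mul_nonneg hc (sq_nonneg (c - 678 / 1000)),
      sq_nonneg (c - 680 / 1000 - 17 / 100 * (a - 55 / 200)),
      sq_nonneg (c - 676 / 1000 - 17 / 100 * (a - 55 / 200)),
      sq_nonneg (c - 680 / 1000 - 11 / 100 * (a - 55 / 200)),
      sq_nonneg (c - 676 / 1000 - 11 / 100 * (a - 55 / 200)),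
      h3,
      mul_nonneg ha h3,
      mul_nonneg hc (sq_nonneg (a - 55 / 200)),
      mul_nonneg (sub_nonneg.2 h2) (sq_nonneg (c - 678 / 1000)),
      mul_nonneg (sub_nonneg.2 h2) (sq_nonneg (a - 55 / 200))]
  rcases le_total a (33 / 100) with h2 | h1
  · have h3 := mul_nonneg (sub_nonneg.2 h1) (sub_nonneg.2 h2)
    linarith [mul_nonneg hc (sq_nonneg (c - 680 / 1000)),
      sq_nonneg (c - 682 / 1000 - 12 / 100 * (a - 62 / 200)),
      sq_nonneg (c - 678 / 1000 - 12 / 100 * (a - 62 / 200)),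
      sq_nonneg (c - 682 / 1000 - 6 / 100 * (a - 62 / 200)),
      sq_nonneg (c - 678 / 1000 - 6 / 100 * (a - 62 / 200)),
      h3,
      mul_nonneg ha h3,
      mul_nonneg hc (sq_nonneg (a - 62 / 200)),
      mul_nonneg (sub_nonneg.2 h2) (sq_nonneg (c - 680 / 1000)),
      mul_nonneg (sub_nonneg.2 h2) (sq_nonneg (a - 62 / 200))]
  rcases le_total a (39 / 100) with h2 | h1
  · have h3 := mul_nonneg (sub_nonneg.2 h1) (sub_nonneg.2 h2)
    linarith [mul_nonneg hc (sq_nonneg (c - 682 / 1000)),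
      sq_nonneg (c - 684 / 1000 - 4 / 100 * (a - 72 / 200)),
      sq_nonneg (c - 680 / 1000 - 4 / 100 * (a - 72 / 200)),
      sq_nonneg (c - 684 / 1000 - -2 / 100 * (a - 72 / 200)),
      sq_nonneg (c - 680 / 1000 - -2 / 100 * (a - 72 / 200)),
      h3,
      mul_nonneg ha h3,
      mul_nonneg hc (sq_nonneg (a - 72 / 200)),
      mul_nonneg (sub_nonneg.2 h2) (sq_nonneg (c - 682 / 1000)),
      mul_nonneg (sub_nonneg.2 h2) (sq_nonneg (a - 72 / 200))]
  rcases le_total a (50 / 100) with h2 | h1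
  · have h3 := mul_nonneg (sub_nonneg.2 h1) (sub_nonneg.2 h2)
    linarith [mul_nonneg hc (sq_nonneg (c - 678 / 1000)),
      sq_nonneg (c - 680 / 1000 - -13 / 100 * (a - 89 / 200)),
      sq_nonneg (c - 676 / 1000 - -13 / 100 * (a - 89 / 200)),
      sq_nonneg (c - 680 / 1000 - -19 / 100 * (a - 89 / 200)),
      sq_nonneg (c - 676 / 1000 - -19 / 100 * (a - 89 / 200)),
      h3,
      mul_nonneg ha h3,
      mul_nonneg hc (sq_nonneg (a - 89 / 200)),
      mul_nonneg (sub_nonneg.2 h2) (sq_nonneg (c - 678 / 1000)),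
      mul_nonneg (sub_nonneg.2 h2) (sq_nonneg (a - 89 / 200))]
  rcases le_total a (60 / 100) with h2 | h1
  · have h3 := mul_nonneg (sub_nonneg.2 h1) (sub_nonneg.2 h2)
    linarith [mul_nonneg hc (sq_nonneg (c - 662 / 1000)),
      sq_nonneg (c - 664 / 1000 - -40 / 100 * (a - 110 / 200)),
      sq_nonneg (c - 660 / 1000 - -40 / 100 * (a - 110 / 200)),
      sq_nonneg (c - 664 / 1000 - -46 / 100 * (a - 110 / 200)),
      sq_nonneg (c - 660 / 1000 - -46 / 100 * (a - 110 / 200)),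
      h3,
      mul_nonneg ha h3,
      mul_nonneg hc (sq_nonneg (a - 110 / 200)),
      mul_nonneg (sub_nonneg.2 h2) (sq_nonneg (c - 662 / 1000)),
      mul_nonneg (sub_nonneg.2 h2) (sq_nonneg (a - 110 / 200))]
  rcases le_total a (65 / 100) with h2 | h1
  · have h3 := mul_nonneg (sub_nonneg.2 h1) (sub_nonneg.2 h2)
    linarith [mul_nonneg hc (sq_nonneg (c - 641 / 1000)),
      sq_nonneg (c - 643 / 1000 - -68 / 100 * (a - 125 / 200)),
      sq_nonneg (c - 639 / 1000 - -68 / 100 * (a - 125 / 200)),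
      sq_nonneg (c - 643 / 1000 - -74 / 100 * (a - 125 / 200)),
      sq_nonneg (c - 639 / 1000 - -74 / 100 * (a - 125 / 200)),
      h3,
      mul_nonneg ha h3,
      mul_nonneg hc (sq_nonneg (a - 125 / 200)),
      mul_nonneg (sub_nonneg.2 h2) (sq_nonneg (c - 641 / 1000)),
      mul_nonneg (sub_nonneg.2 h2) (sq_nonneg (a - 125 / 200))]
  have h3 := mul_nonneg (sub_nonneg.2 h1) (sub_nonneg.2 h)
  linarith [mul_nonneg hc (sq_nonneg (c - 624 / 1000)),
      sq_nonneg (c - 626 / 1000 - -88 / 100 * (a - 133 / 200)),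
      sq_nonneg (c - 622 / 1000 - -88 / 100 * (a - 133 / 200)),
      sq_nonneg (c - 626 / 1000 - -94 / 100 * (a - 133 / 200)),
      sq_nonneg (c - 622 / 1000 - -94 / 100 * (a - 133 / 200)),
      h3,
      mul_nonneg ha h3,
      mul_nonneg hc (sq_nonneg (a - 133 / 200)),
      mul_nonneg (sub_nonneg.2 h) (sq_nonneg (c - 624 / 1000)),
      mul_nonneg (sub_nonneg.2 h) (sq_nonneg (a - 133 / 200))]

theorem weierstrass_real_bound (a b c : ℝ) (ha : 0 ≤ a) (hc : 0 ≤ c)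
    (h : 59 / 40 * a ^ 2 + 79 / 100 * b ^ 2 + 4000 / 4661 * c ^ 2 ≤ 1) :
    b ^ 2 * c + a ^ 3 + a * c ^ 2 ≤ 5727 / 10000 := by
  have hb : 79 / 100 * b ^ 2 * c ≤ (1 - 59 / 40 * a ^ 2 - 4000 / 4661 * c ^ 2) * c :=
    mul_le_mul_of_nonneg_right (by linarith) hc
  rcases le_total a (68 / 100) with h1 | h1
  · have := cubic_ineq_of_le a c ha hc h1
    linarith
  · have hca : 400000 / 368219 * c ≤ a := by
      nlinarith [sq_nonneg b]
    have hac : a ^ 2 ≤ 40 / 59 := by nlinarith [sq_nonneg b, sq_nonneg c]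
    have h2 := mul_nonneg (sub_nonneg.2 hca) (show 0 ≤ 1 - 59 / 40 * a ^ 2 - 4000 / 4661 * c ^ 2 by nlinarith [sq_nonneg b])
    nlinarith [mul_nonneg ha (sq_nonneg (a - 76/100)), sq_nonneg (a - 76/100)]


theorem weierstrass_norm_bound (x y z : ℂ) (ρ : ℝ) (hρ : 0 ≤ ρ)
    (h : 59 / 40 * ‖x‖ ^ 2 + 79 / 100 * ‖y‖ ^ 2 + 4000 / 4661 * ‖z‖ ^ 2 ≤ ρ ^ 2) :
    ‖y ^ 2 * z - x ^ 3 + x * z ^ 2‖ ≤ 5727 / 10000 * ρ ^ 3 := by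
  have h1 : ‖y ^ 2 * z - x ^ 3 + x * z ^ 2‖ ≤ ‖y‖ ^ 2 * ‖z‖ + ‖x‖ ^ 3 + ‖x‖ * ‖z‖ ^ 2 := by
    calc ‖y ^ 2 * z - x ^ 3 + x * z ^ 2‖ ≤ ‖y ^ 2 * z - x ^ 3‖ + ‖x * z ^ 2‖ := norm_add_le _ _
      _ ≤ ‖y ^ 2 * z‖ + ‖x ^ 3‖ + ‖x * z ^ 2‖ := by gcongr; exact norm_sub_le _ _
      _ = _ := by simp
  refine h1.trans ?_
  rcases hρ.eq_or_lt with h0 | h0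
  · have hx : ‖x‖ = 0 := by
      have := sq_nonneg ‖y‖; have := sq_nonneg ‖z‖; have := sq_nonneg ‖x‖
      rw [← h0] at h
      have : ‖x‖ ^ 2 = 0 := by nlinarith
      exact pow_eq_zero_iff two_ne_zero |>.1 this
    have hz : ‖z‖ = 0 := by
      have := sq_nonneg ‖y‖; have := sq_nonneg ‖z‖; have := sq_nonneg ‖x‖
      rw [← h0] at h
      have : ‖z‖ ^ 2 = 0 := by nlinarith
      exact pow_eq_zero_iff two_ne_zero |>.1 this
    rw [hx, hz, ← h0]; norm_num
  · have := weierstrass_real_bound (‖x‖ / ρ) (‖y‖ / ρ) (‖z‖ / ρ) (by positivity) (by positivity) (by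
      simp only [div_pow]
      rw [← mul_div_assoc, ← mul_div_assoc, ← mul_div_assoc, ← add_div, ← add_div, div_le_one (by positivity)]
      exact h)
    have h2 : (‖y‖ / ρ) ^ 2 * (‖z‖ / ρ) + (‖x‖ / ρ) ^ 3 + ‖x‖ / ρ * (‖z‖ / ρ) ^ 2
      = (‖y‖ ^ 2 * ‖z‖ + ‖x‖ ^ 3 + ‖x‖ * ‖z‖ ^ 2) / ρ ^ 3 := by field_simp
    rwa [h2, div_le_iff₀ (by positivity)] at this

section Eisenstein

variable {ω : ℂ}

theorem normSq_add_mul_omega (hω : ω ^ 2 + ω + 1 = 0) (x y : ℝ) :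
    Complex.normSq (x + y * ω) = x ^ 2 - x * y + y ^ 2 := by
  have h1 := congrArg Complex.re hω
  have h2 := congrArg Complex.im hω
  simp [pow_two] at h1 h2
  have h3 : ω.re = -1 / 2 := by
    by_contra h
    have : ω.im = 0 := by
      have : ω.im * (2 * ω.re + 1) = 0 := by linarith
      rcases mul_eq_zero.1 this with h' | h'
      · exact h'
      · exact absurd (by linarith) h
    rw [this] at h1
    nlinarith [sq_nonneg (ω.re + 1 / 2)]
  simp only [Complex.normSq_apply, Complex.add_re, Complex.mul_re, Complex.ofReal_re,
    Complex.ofReal_im, Complex.add_im, Complex.mul_im, h3]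
  rw [h3] at h1
  linear_combination (- y ^ 2) * h1

theorem real_coords_omega (hω : ω ^ 2 + ω + 1 = 0) (z : ℂ) : ∃ x y : ℝ, z = x + y * ω := by
  have him : ω.im ≠ 0 := by
    intro h0
    have h1 := congrArg Complex.re hω
    simp [pow_two, h0] at h1
    nlinarith [sq_nonneg (ω.re + 1 / 2)]
  refine ⟨z.re - z.im / ω.im * ω.re, z.im / ω.im, ?_⟩
  apply Complex.ext <;> simp
  field_simp

/-- Sector decomposition of the plane with respect to the Eisenstein lattice. -/
theorem eisenstein_sector (hω : ω ^ 2 + ω + 1 = 0) (S : Subring ℂ) (hωS : ω ∈ S) (z : ℂ) :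
    ∃ v ∈ S, ∃ u ∈ S, Complex.normSq u = 1 ∧ ∃ b c : ℝ, 0 ≤ b ∧ 0 ≤ c ∧ b + c + b ≤ 1 ∧
      b + c + c ≤ 1 ∧ z = v + u * (b + c * (1 + ω)) := by
  obtain ⟨x, y, rfl⟩ := real_coords_omega hω z
  have hx0 := Int.floor_le x
  have hx1 := (Int.lt_floor_add_one x).le
  have hy0 := Int.floor_le y
  have hy1 := (Int.lt_floor_add_one y).le
  set m := ⌊x⌋
  set n := ⌊y⌋
  have hv : (m + n * ω : ℂ) ∈ S := add_mem (intCast_mem S m) (mul_mem (intCast_mem S n) hωS)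
  have hN := normSq_add_mul_omega hω
  have hone : (1 : ℂ) ∈ S := one_mem S
  have hN1 : Complex.normSq (1 + ω) = 1 := by simpa using hN 1 1
  have hN2 : Complex.normSq ω = 1 := by simpa using hN 0 1
  rcases le_total (y - n) (x - m) with h | h
  · by_cases h1 : (x - m - (y - n)) ≤ 1 - (x - m) ∧ y - n ≤ 1 - (x - m)
    · refine ⟨_, hv, 1, hone, by simp, x - m - (y - n), y - n, by linarith, by linarith,
        by linarith, by linarith, ?_⟩
      push_cast; ring
    · by_cases h2 : 1 - (x - m) ≤ x - m - (y - n) ∧ y - n ≤ x - m - (y - n)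
      · refine ⟨_, add_mem hv hone, ω, hωS, hN2, y - n, 1 - (x - m), by linarith, by linarith,
          by linarith, by linarith, ?_⟩
        push_cast; linear_combination (-(1 - (x - m)) : ℂ) * hω
      · refine ⟨_, add_mem hv (add_mem hone hωS), ω ^ 2, pow_mem hωS 2, by simp [hN2],
          1 - (x - m), x - m - (y - n), by linarith, by linarith, ?_, ?_, ?_⟩
        · by_contra h3
          by_cases h4 : 1 - (x - m) ≤ x - m - (y - n)
          · exact h2 ⟨h4, by linarith⟩
          · exact h1 ⟨by linarith, by linarith⟩
        · by_contra h3
          by_cases h4 : 1 - (x - m) ≤ x - m - (y - n)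
          · exact h2 ⟨h4, by linarith⟩
          · exact h1 ⟨by linarith, by linarith⟩
        · push_cast; linear_combination (-(1 - (x - m)) - (x - m - (y - n)) * ω : ℂ) * hω
  · by_cases h1 : (y - n - (x - m)) ≤ 1 - (y - n) ∧ x - m ≤ 1 - (y - n)
    · refine ⟨_, hv, 1 + ω, add_mem hone hωS, hN1, x - m, y - n - (x - m), by linarith,
        by linarith, by linarith, by linarith, ?_⟩
      push_cast; linear_combination (-(y - n - (x - m)) : ℂ) * hω
    · by_cases h2 : 1 - (y - n) ≤ y - n - (x - m) ∧ x - m ≤ y - n - (x - m)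
      · refine ⟨_, add_mem hv hωS, -ω, neg_mem hωS, by simp [hN2], 1 - (y - n), x - m,
          by linarith, by linarith, by linarith, by linarith, ?_⟩
        push_cast; linear_combination ((x - m) : ℂ) * hω
      · refine ⟨_, add_mem hv (add_mem hone hωS), -1, neg_mem hone, by simp,
          y - n - (x - m), 1 - (y - n), by linarith, by linarith, ?_, ?_, ?_⟩
        · by_contra h3
          by_cases h4 : 1 - (y - n) ≤ y - n - (x - m)
          · exact h2 ⟨h4, by linarith⟩
          · exact h1 ⟨by linarith, by linarith⟩
        · by_contra h3
          by_cases h4 : 1 - (y - n) ≤ y - n - (x - m)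
          · exact h2 ⟨h4, by linarith⟩
          · exact h1 ⟨by linarith, by linarith⟩
        · push_cast; ring

/-- Covering of the plane by the Eisenstein lattice, with a quantitative statement near the deep
holes `v + u / (1 - ω)`. -/
theorem eisenstein_covering (hω : ω ^ 2 + ω + 1 = 0) (S : Subring ℂ) (hωS : ω ∈ S) (z : ℂ) :
    ∃ v ∈ S, ∃ u ∈ S, Complex.normSq u = 1 ∧ ∃ (δ : ℂ) (d : ℝ), z = v + u / (1 - ω) + δ ∧
      Complex.normSq (z - v) ≤ 1 / 3 ∧ 0 ≤ d ∧ Complex.normSq δ ≤ 3 * d ^ 2 ∧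
      (Complex.normSq (z - v) ≤ 26 / 100 ∨
        (d ≤ 11 / 100 ∧ Complex.normSq (z - v) ≤ 1 / 3 - d + 3 * d ^ 2)) := by
  obtain ⟨v, hv, u, hu, hu1, b, c, hb, hc, h1, h2, rfl⟩ := eisenstein_sector hω S hωS z
  have hl : (1 - ω) ≠ 0 := by
    intro h
    have : ω = 1 := by linear_combination -h
    rw [this] at hω; norm_num at hω
  have e1 : Complex.normSq (v + u * (b + c * (1 + ω)) - v) = b ^ 2 + b * c + c ^ 2 := by
    rw [add_sub_cancel_left, Complex.normSq_mul, hu1, one_mul]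
    have := normSq_add_mul_omega hω (b + c) c
    push_cast at this
    rw [show (b : ℂ) + c * (1 + ω) = b + c + c * ω by ring, this]; ring
  have e2 : Complex.normSq (u * ((b - 1 / 3 : ℝ) + (c - 1 / 3 : ℝ) * (1 + ω))) =
      (b - 1 / 3) ^ 2 + (b - 1 / 3) * (c - 1 / 3) + (c - 1 / 3) ^ 2 := by
    rw [Complex.normSq_mul, hu1, one_mul]
    have := normSq_add_mul_omega hω (b - 1 / 3 + (c - 1 / 3)) (c - 1 / 3)
    push_cast at this ⊢
    rw [show (b - 1 / 3 : ℂ) + (c - 1 / 3) * (1 + ω) = (b - 1 / 3) + (c - 1 / 3) + (c - 1 / 3) * ω by ring, this]; ring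
  refine ⟨v, hv, u, hu, hu1, u * ((b - 1 / 3 : ℝ) + (c - 1 / 3 : ℝ) * (1 + ω)), 2 / 3 - b - c, ?_, ?_, ?_, ?_, ?_⟩
  · field_simp
    push_cast
    linear_combination (-u / 3 : ℂ) * hω
  · rw [e1]; nlinarith
  · linarith
  · rw [e2]; nlinarith
  · rw [e1]
    by_cases hd : 2 / 3 - b - c ≤ 11 / 100
    · right; refine ⟨hd, ?_⟩; nlinarith
    · left
      rcases le_total (b + c) (1 / 2) with h | h
      · nlinarith [mul_nonneg hb hc]
      · nlinarith [mul_nonneg (sub_nonneg.2 h1) (sub_nonneg.2 h2)]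

end Eisenstein

section Hermite

variable {ω : ℂ}

/-- Real inequalities finishing the reduction of ternary Hermitian forms. -/
theorem hermite_real_ineq {B C D D' d d' t t' : ℝ} (hD : D ≤ 1 / 3) (hD' : D' ≤ 1 / 3)
    (hd : 0 ≤ d) (hd' : 0 ≤ d') (ht : 0 ≤ t) (ht' : 0 ≤ t') (htd : t ^ 2 ≤ 3 * d ^ 2)
    (htd' : t' ^ 2 ≤ 3 * d' ^ 2) (h : D ≤ 26 / 100 ∨ (d ≤ 11 / 100 ∧ D ≤ 1 / 3 - d + 3 * d ^ 2))
    (h' : D' ≤ 26 / 100 ∨ (d' ≤ 11 / 100 ∧ D' ≤ 1 / 3 - d' + 3 * d' ^ 2))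
    (h1 : 9999 / 10000 ≤ D + B) (h2 : 9999 / 10000 * B ≤ D' * B + C)
    (h3 : 9999 / 10000 ≤ (1 / 3 + t) ^ 2 + (5774 / 10000 + t') ^ 2 * B + C) :
    328 / 1000 < B * C := by
  have hB : 6665 / 10000 ≤ B := by linarith
  have hB00 : 0 ≤ B := by linarith
  by_cases hB2 : 7017 / 10000 ≤ B
  · have e0 := mul_le_mul_of_nonneg_right hD' hB00
    have e1 : 6665 / 10000 * B ≤ C := by linarith
    have e2 : B * (6665 / 10000 * B) ≤ B * C := mul_le_mul_of_nonneg_left e1 hB00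
    have e3 := mul_le_mul hB2 hB2 (by norm_num) hB00
    linarith
  push Not at hB2
  rcases h with h | ⟨h, hdd⟩
  · linarith
  rcases h' with h' | ⟨h', hdd'⟩
  · have e0 := mul_le_mul_of_nonneg_right h' hB00
    have e1 : 7399 / 10000 * B ≤ C := by linarith
    have e2 : B * (7399 / 10000 * B) ≤ B * C := mul_le_mul_of_nonneg_left e1 hB00
    have e3 := mul_le_mul hB hB (by norm_num) hB00
    linarith
  by_contra hlt
  push Not at hlt
  have hC : B * (6665 / 10000 + d' - 3 * d' ^ 2) ≤ C := by
    have e0 := mul_le_mul_of_nonneg_right hdd' hB00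
    linarith
  have hd1 : d - 3 * d ^ 2 ≤ B - 6665 / 10000 := by linarith
  have hm0 : B * (B * (6665 / 10000 + d' - 3 * d' ^ 2)) ≤ 328 / 1000 := by
    have : B * (B * (6665 / 10000 + d' - 3 * d' ^ 2)) ≤ B * C := mul_le_mul_of_nonneg_left hC hB00
    linarith
  have fin : ∀ p q b₁ b₂ : ℝ, t ≤ p → t' ≤ q → b₁ ≤ B → B ≤ b₂ → 0 ≤ b₁ →
      328 / 1000 < b₁ * (9999 / 10000 - (1 / 3 + p) ^ 2 - (5774 / 10000 + q) ^ 2 * b₂) → False := by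
    intro p q b₁ b₂ hp hq hb1 hb2 hb0 hlast
    have e1 : (1 / 3 + t) ^ 2 ≤ (1 / 3 + p) ^ 2 := by gcongr
    have e2 : (5774 / 10000 + t') ^ 2 * B ≤ (5774 / 10000 + q) ^ 2 * b₂ := by gcongr
    have e3 : 9999 / 10000 - (1 / 3 + p) ^ 2 - (5774 / 10000 + q) ^ 2 * b₂ ≤ C := by linarith
    have e4 : b₁ * (9999 / 10000 - (1 / 3 + p) ^ 2 - (5774 / 10000 + q) ^ 2 * b₂) ≤ b₁ * C :=
      mul_le_mul_of_nonneg_left e3 hb0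
    have e5 : 0 < C := by
      by_contra h0
      push Not at h0
      have := mul_nonpos_of_nonneg_of_nonpos hb0 h0
      linarith
    have e6 : b₁ * C ≤ B * C := mul_le_mul_of_nonneg_right hb1 e5.le
    linarith
  have tsq : ∀ s e x : ℝ, 0 ≤ s → s ≤ e → x ^ 2 ≤ 3 * s ^ 2 → 0 ≤ x →
      x ≤ 17321 / 10000 * e := by
    intro s e x hs hse hx hx0
    refine le_of_sq_le_sq ?_ (by linarith)
    have e1 : s ^ 2 ≤ e ^ 2 := by gcongr
    have e2 := sq_nonneg e
    rw [mul_pow]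
    linarith
  have mono : ∀ e x : ℝ, e < x → x ≤ 11 / 100 → e - 3 * e ^ 2 < x - 3 * x ^ 2 := by
    intro e x h1 h2
    have := mul_pos (sub_pos.2 h1) (show 0 < 1 - 3 * (x + e) by linarith)
    linarith
  have hdl : ∀ e : ℝ, B - 6665 / 10000 < e - 3 * e ^ 2 → d ≤ e := by
    intro e he
    by_contra hc
    push Not at hc
    have := mono e d hc h
    linarith
  have hsub : ∀ b e : ℝ, b ≤ B → 0 ≤ b → 0 ≤ e → e ≤ 11 / 100 →
      328 / 1000 < b * (b * (6665 / 10000 + e - 3 * e ^ 2)) → d' ≤ e := by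
    intro b e hb hb0 he0 he1 hlt2
    by_contra hc
    push Not at hc
    have e1 : 6665 / 10000 + e - 3 * e ^ 2 ≤ 6665 / 10000 + d' - 3 * d' ^ 2 := by
      have := mono e d' hc h'
      linarith
    have e2 : 0 ≤ 6665 / 10000 + e - 3 * e ^ 2 := by
      have := mul_nonneg he0 (sub_nonneg.2 he1)
      linarith
    have e3 := mul_le_mul hb e1 e2 hB00
    have e4 := mul_le_mul hb e3 (mul_nonneg hb0 e2) hB00
    linarith
  rcases le_total B (6706 / 10000) with hb | hb
  · have hd2 : d ≤ 42 / 10000 := hdl _ (by norm_num; linarith)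
    have hd3 : d' ≤ 105 / 1000 := hsub (6665 / 10000) _ hB (by norm_num) (by norm_num) (by norm_num) (by norm_num)
    exact fin _ _ _ _ (tsq _ _ _ hd hd2 htd ht) (tsq _ _ _ hd' hd3 htd' ht') hB hb (by norm_num)
      (by norm_num)
  rcases le_total B (6767 / 10000) with hb' | hb'
  · have hd2 : d ≤ 106 / 10000 := hdl _ (by norm_num; linarith)
    have hd3 : d' ≤ 87 / 1000 := hsub (6706 / 10000) _ hb (by norm_num) (by norm_num) (by norm_num) (by norm_num)
    exact fin _ _ _ _ (tsq _ _ _ hd hd2 htd ht) (tsq _ _ _ hd' hd3 htd' ht') hb hb' (by norm_num)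
      (by norm_num)
  · have hd2 : d ≤ 41 / 1000 := hdl _ (by norm_num; linarith)
    have hd3 : d' ≤ 63 / 1000 := hsub (6767 / 10000) _ hb' (by norm_num) (by norm_num) (by norm_num) (by norm_num)
    exact fin _ _ _ _ (tsq _ _ _ hd hd2 htd ht) (tsq _ _ _ hd' hd3 htd' ht') hb' hB2.le (by norm_num)
      (by norm_num)

end Hermite

section HermiteComplex

variable {ω : ℂ}

theorem exists_unit_congr (hω : ω ^ 2 + ω + 1 = 0) (S : Subring ℂ) (hωS : ω ∈ S)
    (hS : ∀ z, z ∈ S ↔ ∃ a b : ℤ, z = a + b * ω) {o w : ℂ} (ho : o ∈ S) (hw : w ∈ S)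
    (hw1 : Complex.normSq w = 1) :
    ∃ k ∈ S, o = (1 - ω) * k ∨ o - w = (1 - ω) * k ∨ o - w * (1 + ω) = (1 - ω) * k := by
  obtain ⟨a, b, rfl⟩ := (hS o).1 ho
  obtain ⟨c, d, rfl⟩ := (hS w).1 hw
  have h1 : c ^ 2 - c * d + d ^ 2 = 1 := by
    have := normSq_add_mul_omega hω c d
    push_cast at this
    rw [hw1] at this
    exact_mod_cast this.symm
  have key : ∀ x y : ℤ, (3 : ℤ) ∣ x + y → ∃ k ∈ S, (x + y * ω : ℂ) = (1 - ω) * k := by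
    rintro x y ⟨m, hm⟩
    refine ⟨(x - m : ℤ) + (m : ℤ) * ω, (hS _).2 ⟨_, _, rfl⟩, ?_⟩
    have : (y : ℂ) = 3 * m - x := by
      have : y = 3 * m - x := by linarith
      exact_mod_cast this
    rw [this]; push_cast
    linear_combination (m : ℂ) * hω
  have h2 : (3 : ℤ) ∣ a + b ∨ (3 : ℤ) ∣ (a - c) + (b - d) ∨
      (3 : ℤ) ∣ (a - (c - d)) + (b - c) := by
    have h3 : (c + d) % 3 ≠ 0 := by
      intro h
      have h4 : (3 : ℤ) ∣ c + d := Int.dvd_of_emod_eq_zero h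
      have h5 : (3 : ℤ) ∣ (c + d) * (c + d) - 3 * (c * d) :=
        dvd_sub (h4.mul_right _) (dvd_mul_right _ _)
      have h6 : (c + d) * (c + d) - 3 * (c * d) = 1 := by linarith
      rw [h6] at h5; norm_num at h5
    have h7 : ∀ x y : ℤ, y % 3 ≠ 0 → x % 3 = 0 ∨ (x - y) % 3 = 0 ∨ (x - 2 * y) % 3 = 0 := by
      intro x y hy
      have hy' : y % 3 = 1 ∨ y % 3 = 2 := by omega
      have hx' : x % 3 = 0 ∨ x % 3 = 1 ∨ x % 3 = 2 := by omega
      rcases hy' with hy' | hy' <;> rcases hx' with hx' | hx' | hx' <;> omega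
    rcases h7 (a + b) (c + d) h3 with h | h | h
    · left; omega
    · right; left; omega
    · right; right; omega
  rcases h2 with h | h | h
  · obtain ⟨k, hk, e⟩ := key _ _ h
    exact ⟨k, hk, Or.inl e⟩
  · obtain ⟨k, hk, e⟩ := key _ _ h
    refine ⟨k, hk, Or.inr (Or.inl ?_)⟩
    rw [← e]; push_cast; ring
  · obtain ⟨k, hk, e⟩ := key _ _ h
    refine ⟨k, hk, Or.inr (Or.inr ?_)⟩
    rw [← e]; push_cast; linear_combination (-d : ℂ) * hω

theorem hermite_core (hω : ω ^ 2 + ω + 1 = 0) (S : Subring ℂ) (hωS : ω ∈ S)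
    (hS : ∀ z, z ∈ S ↔ ∃ a b : ℤ, z = a + b * ω) {B C : ℝ} (hB : 0 ≤ B) {μ₂ μ₃ ν : ℂ}
    (h1 : ∀ c ∈ S, 9999 / 10000 ≤ ‖μ₂ + c‖ ^ 2 + B)
    (h2 : ∀ a ∈ S, 9999 / 10000 * B ≤ ‖ν + a‖ ^ 2 * B + C)
    (h3 : ∀ a ∈ S, ∀ b ∈ S, 9999 / 10000 ≤ ‖μ₃ + a * μ₂ + b‖ ^ 2 + ‖ν + a‖ ^ 2 * B + C) :
    328 / 1000 < B * C := by
  have hl : (1 - ω) ≠ 0 := by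
    intro h
    have : ω = 1 := by linear_combination -h
    rw [this] at hω; norm_num at hω
  have hnl : ‖1 - ω‖ ^ 2 = 3 := by
    rw [← Complex.normSq_eq_norm_sq]
    have := normSq_add_mul_omega hω 1 (-1)
    push_cast at this
    rw [show 1 - ω = 1 + -1 * ω by ring, this]; norm_num
  obtain ⟨v, hv, u, hu, hu1, δ, d, hz, hD, hd, hδ, hor⟩ := eisenstein_covering hω S hωS μ₂
  obtain ⟨v', hv', u', hu', hu1', δ', d', hz', hD', hd', hδ', hor'⟩ :=
    eisenstein_covering hω S hωS ν
  obtain ⟨o, ho, -, -, -, -, -, -, hDo, -, -, -⟩ :=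
    eisenstein_covering hω S hωS ((1 - ω) * (μ₃ - v' * μ₂))
  simp only [Complex.normSq_eq_norm_sq] at hD hδ hor hD' hδ' hor' hDo
  obtain ⟨k, hk, hk3⟩ := exists_unit_congr hω S hωS hS ho (mul_mem hu' hu) (by simp [hu1, hu1'])
  have hx : ‖μ₃ - v' * μ₂ - o / (1 - ω)‖ ≤ 1 / 3 := by
    have e : (1 - ω) * (μ₃ - v' * μ₂) - o = (1 - ω) * (μ₃ - v' * μ₂ - o / (1 - ω)) := by
      field_simp
    rw [e, norm_mul, mul_pow, hnl] at hDo
    refine le_of_sq_le_sq ?_ (by norm_num)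
    linarith
  have hu1n : ‖u'‖ = 1 := by
    rw [Complex.normSq_eq_norm_sq] at hu1'
    nlinarith [norm_nonneg u']
  have hn1 : ‖1 + ω‖ = 1 := by
    have := normSq_add_mul_omega hω 1 1
    push_cast at this
    rw [one_mul, Complex.normSq_eq_norm_sq] at this
    nlinarith [norm_nonneg (1 + ω)]
  -- choice of the vertex
  obtain ⟨s, hs, hs1, hs2, k', hk', hs3⟩ : ∃ s ∈ S, ‖s‖ ≤ 1 ∧ ‖s - u' / (1 - ω)‖ ^ 2 = 1 / 3 ∧
      ∃ k' ∈ S, o - s * u = (1 - ω) * k' := by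
    have hω3 : ω ^ 3 = 1 := by linear_combination (ω - 1) * hω
    have hωn : ‖ω‖ = 1 := by
      have := normSq_add_mul_omega hω 0 1
      simp only [Complex.normSq_eq_norm_sq] at this
      norm_num at this
      rcases this with h | h
      · exact h
      · linarith [norm_nonneg ω]
    rcases hk3 with e | e | e
    · refine ⟨0, zero_mem _, by simp, ?_, k, hk, by rw [← e]; ring⟩
      rw [zero_sub, norm_neg, norm_div, div_pow, hnl, hu1n]; norm_num
    · refine ⟨u', hu', hu1n.le, ?_, k, hk, by rw [← e]⟩
      rw [show u' - u' / (1 - ω) = u' * (-ω) / (1 - ω) by field_simp; ring, norm_div, div_pow, hnl,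
        norm_mul, norm_neg, hωn, hu1n]; norm_num
    · refine ⟨u' * (1 + ω), mul_mem hu' (add_mem (one_mem S) hωS), by rw [norm_mul, hu1n, hn1, one_mul], ?_, k, hk,
        by rw [← e]; ring⟩
      rw [show u' * (1 + ω) - u' / (1 - ω) = u' * (-ω ^ 2) / (1 - ω) by field_simp; ring, norm_div,
        div_pow, hnl, norm_mul, norm_neg, norm_pow, hωn, hu1n]; norm_num
  have hs4 : ‖s - u' / (1 - ω)‖ ≤ 5774 / 10000 := by
    refine le_of_sq_le_sq ?_ (by norm_num)
    rw [hs2]; norm_num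
  refine hermite_real_ineq hD hD' hd hd' (norm_nonneg δ) (norm_nonneg δ') hδ hδ' hor hor' ?_ ?_ ?_
  · simpa [sub_eq_add_neg] using h1 (-v) (neg_mem hv)
  · simpa [sub_eq_add_neg] using h2 (-v') (neg_mem hv')
  · have := h3 (-v' - s) (sub_mem (neg_mem hv') hs) (s * v - k') (sub_mem (mul_mem hs hv) hk')
    refine this.trans ?_
    have e1 : ν + (-v' - s) = δ' - (s - u' / (1 - ω)) := by
      linear_combination hz'
    have e2 : μ₃ + (-v' - s) * μ₂ + (s * v - k') = (μ₃ - v' * μ₂ - o / (1 - ω)) - s * δ := by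
      have : k' = (o - s * u) / (1 - ω) := by rw [hs3]; field_simp
      rw [this]
      linear_combination (-s) * hz
    rw [e1, e2]
    have e3 : ‖δ' - (s - u' / (1 - ω))‖ ≤ 5774 / 10000 + ‖δ'‖ :=
      (norm_sub_le _ _).trans (by linarith)
    have e4 : ‖(μ₃ - v' * μ₂ - o / (1 - ω)) - s * δ‖ ≤ 1 / 3 + ‖δ‖ := by
      refine (norm_sub_le _ _).trans ?_
      rw [norm_mul]
      have := mul_le_mul_of_nonneg_right hs1 (norm_nonneg δ)
      linarith
    gcongr

end HermiteComplex

section HermiteLattice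

open Matrix

theorem exists_near_inf {s : Set ℝ} (hs : s.Nonempty) {m : ℝ} (hm : 0 < m)
    (h : ∀ b ∈ s, m ≤ b) : ∃ a ∈ s, ∀ b ∈ s, 9999 / 10000 * a ≤ b := by
  have hbdd : BddBelow s := ⟨m, h⟩
  have h1 : m ≤ sInf s := le_csInf hs h
  obtain ⟨a, ha, h2⟩ := exists_lt_of_csInf_lt (b := 10000 / 9999 * sInf s) hs (by linarith)
  exact ⟨a, ha, fun b hb => by linarith [csInf_le hbdd hb]⟩

/-- The determinant of three vectors of `ℂ³`. -/
noncomputable def detThree (a b c : EuclideanSpace ℂ (Fin 3)) : ℂ :=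
  Matrix.det !![a 0, b 0, c 0; a 1, b 1, c 1; a 2, b 2, c 2]

theorem detThree_add_smul (a b c : EuclideanSpace ℂ (Fin 3)) (x y z : ℂ) :
    detThree a (b + x • a) (c + y • b + z • a) = detThree a b c := by
  simp [detThree, det_fin_three]; ring

theorem detThree_perm (a b c : EuclideanSpace ℂ (Fin 3)) :
    detThree b a c = - detThree a b c ∧ detThree a c b = - detThree a b c ∧
      detThree c b a = - detThree a b c := by
  simp only [detThree, det_fin_three]
  refine ⟨?_, ?_, ?_⟩ <;> simp <;> ring

theorem normSq_detThree_of_orthogonal {a b c : EuclideanSpace ℂ (Fin 3)} (h1 : inner ℂ a b = 0)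
    (h2 : inner ℂ a c = 0) (h3 : inner ℂ b c = 0) :
    Complex.normSq (detThree a b c) = ‖a‖ ^ 2 * ‖b‖ ^ 2 * ‖c‖ ^ 2 := by
  have h1' : inner ℂ b a = 0 := inner_eq_zero_symm.1 h1
  have h2' : inner ℂ c a = 0 := inner_eq_zero_symm.1 h2
  have h3' : inner ℂ c b = 0 := inner_eq_zero_symm.1 h3
  have ha := inner_self_eq_norm_sq_to_K (𝕜 := ℂ) a
  have hb := inner_self_eq_norm_sq_to_K (𝕜 := ℂ) b
  have hc := inner_self_eq_norm_sq_to_K (𝕜 := ℂ) c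
  set A : Matrix (Fin 3) (Fin 3) ℂ := !![a 0, b 0, c 0; a 1, b 1, c 1; a 2, b 2, c 2] with hA
  simp only [PiLp.inner_apply, Fin.sum_univ_three, RCLike.inner_apply, Complex.coe_algebraMap] at *
  have h : Aᴴ * A = diagonal ![(‖a‖ : ℂ) ^ 2, (‖b‖ : ℂ) ^ 2, (‖c‖ : ℂ) ^ 2] := by
    ext i j
    fin_cases i <;> fin_cases j <;>
      simp [hA, mul_apply, Fin.sum_univ_three, conjTranspose_apply] <;>
      first
        | linear_combination h1
        | linear_combination h2
        | linear_combination h3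
        | linear_combination h1'
        | linear_combination h2'
        | linear_combination h3'
        | linear_combination ha
        | linear_combination hb
        | linear_combination hc
  have h4 := congrArg det h
  rw [det_mul, det_conjTranspose, det_diagonal, Fin.prod_univ_three] at h4
  have h5 : detThree a b c = det A := rfl
  rw [h5]
  have h6 : (Complex.normSq (det A) : ℂ) = star (det A) * det A := by
    rw [Complex.normSq_eq_conj_mul_self]; rfl
  rw [h4] at h6
  simp at h6
  exact_mod_cast h6

theorem norm_sq_add_of_inner_eq_zero {a b : EuclideanSpace ℂ (Fin 3)} (h : inner ℂ a b = 0)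
    (x : ℂ) : ‖x • a + b‖ ^ 2 = ‖x‖ ^ 2 * ‖a‖ ^ 2 + ‖b‖ ^ 2 := by
  have := norm_add_sq_eq_norm_sq_add_norm_sq_of_inner_eq_zero (𝕜 := ℂ) (x • a) b
    (by rw [inner_smul_left, h, mul_zero])
  rw [pow_two, this, norm_smul]; ring

/-- Hermite's bound for rank three lattices over the Eisenstein integers. -/
theorem hermite_lattice {ω : ℂ} (hω : ω ^ 2 + ω + 1 = 0) (S : Subring ℂ)
    (hS : ∀ z, z ∈ S ↔ ∃ a b : ℤ, z = a + b * ω)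
    (Λ : Submodule S (EuclideanSpace ℂ (Fin 3))) {v₁ v₂ v₃ : EuclideanSpace ℂ (Fin 3)}
    (hv₁ : v₁ ∈ Λ) (hv₂ : v₂ ∈ Λ) (hv₃ : v₃ ∈ Λ) (hv : detThree v₁ v₂ v₃ ≠ 0) :
    ∃ v ∈ Λ, v ≠ 0 ∧ 328 / 1000 * ‖v‖ ^ 6 < Complex.normSq (detThree v₁ v₂ v₃) := by
  by_contra! hno
  set Δ := Complex.normSq (detThree v₁ v₂ v₃) with hΔ
  have hΔ0 : 0 < Δ := Complex.normSq_pos.2 hv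
  have hωS : ω ∈ S := (hS ω).2 ⟨0, 1, by simp⟩
  have hsm : ∀ c ∈ S, ∀ v ∈ Λ, c • v ∈ Λ := fun c hc v hv => Λ.smul_mem (⟨c, hc⟩ : S) hv
  let T : EuclideanSpace ℂ (Fin 3) → EuclideanSpace ℂ (Fin 3) → EuclideanSpace ℂ (Fin 3) → Prop :=
    fun a b c => a ∈ Λ ∧ b ∈ Λ ∧ c ∈ Λ ∧ Complex.normSq (detThree a b c) = Δ
  have hT0 : ∀ {a b c}, T a b c → a ≠ 0 := by
    rintro a b c ⟨_, _, _, h⟩ rfl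
    rw [← h] at hΔ0
    simp [detThree, det_fin_three] at hΔ0
  -- a nearly shortest first vector
  obtain ⟨m, hm0, hm⟩ : ∃ m : ℝ, 0 < m ∧ ∀ a b c, T a b c → m ≤ ‖a‖ ^ 2 := by
    refine ⟨min 1 Δ, by positivity, fun a b c h => ?_⟩
    have h1 := hno a h.1 (hT0 h)
    by_contra! h2
    obtain ⟨h3, h4⟩ := lt_min_iff.1 h2
    have h5 : ‖a‖ ^ 6 ≤ ‖a‖ ^ 2 := by
      have h6 : 0 ≤ ‖a‖ ^ 2 := by positivity
      have : ‖a‖ ^ 6 = ‖a‖ ^ 2 * (‖a‖ ^ 2 * ‖a‖ ^ 2) := by ring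
      rw [this]
      exact mul_le_of_le_one_right h6 (mul_le_one₀ h3.le h6 h3.le)
    have h7 : 0 ≤ ‖a‖ ^ 6 := by positivity
    linarith
  obtain ⟨_, ⟨e₁, b₀, c₀, ht₀, rfl⟩, hmin1⟩ :=
    exists_near_inf (s := {t | ∃ a b c, T a b c ∧ ‖a‖ ^ 2 = t})
      ⟨_, v₁, v₂, v₃, ⟨hv₁, hv₂, hv₃, rfl⟩, rfl⟩ hm0
      (by rintro _ ⟨a, b, c, h, rfl⟩; exact hm a b c h)
  replace hmin1 : ∀ a b c, T a b c → 9999 / 10000 * ‖e₁‖ ^ 2 ≤ ‖a‖ ^ 2 :=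
    fun a b c h => hmin1 _ ⟨a, b, c, h, rfl⟩
  have he₁ : e₁ ≠ 0 := hT0 ht₀
  have hN : 0 < ‖e₁‖ ^ 2 := by have := norm_pos_iff.2 he₁; positivity
  have hNc : (‖e₁‖ : ℂ) ^ 2 ≠ 0 := by exact_mod_cast hN.ne'
  have hdec : ∀ v : EuclideanSpace ℂ (Fin 3), ∃ (μ : ℂ) (f : EuclideanSpace ℂ (Fin 3)),
      v = μ • e₁ + f ∧ inner ℂ e₁ f = 0 := by
    intro v
    refine ⟨inner ℂ e₁ v / (‖e₁‖ : ℂ) ^ 2, v - (inner ℂ e₁ v / (‖e₁‖ : ℂ) ^ 2) • e₁, by simp, ?_⟩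
    rw [inner_sub_right, inner_smul_right, inner_self_eq_norm_sq_to_K]
    exact sub_eq_zero.2 (div_mul_cancel₀ _ hNc).symm
  have hlow : ∀ b c μ f, T e₁ b c → b = μ • e₁ + f → inner ℂ e₁ f = 0 →
      ∀ s ∈ S, 9999 / 10000 * ‖e₁‖ ^ 2 ≤ ‖μ + s‖ ^ 2 * ‖e₁‖ ^ 2 + ‖f‖ ^ 2 := by
    rintro b c μ f ⟨h1, h2, h3, h4⟩ rfl hf s hs
    have h := hmin1 (μ • e₁ + f + s • e₁) e₁ c ⟨Λ.add_mem h2 (hsm s hs _ h1), h1, h3, by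
      rw [(detThree_perm _ _ _).1, Complex.normSq_neg, ← h4]
      congr 1
      have := detThree_add_smul e₁ (μ • e₁ + f) c s 0 0
      simpa using this⟩
    rw [← norm_sq_add_of_inner_eq_zero hf]
    convert h using 3
    rw [add_smul]; abel
  -- a second vector nearly closest to the first
  obtain ⟨_, ⟨e₂, e₃, μ₂, f₂, ht, he₂, hf₂, rfl⟩, hmin2⟩ :=
    exists_near_inf (s := {t | ∃ b c μ f, T e₁ b c ∧ b = μ • e₁ + f ∧ inner ℂ e₁ f = 0 ∧
      ‖f‖ ^ 2 = t}) (by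
        obtain ⟨μ, f, h1, h2⟩ := hdec b₀
        exact ⟨_, b₀, c₀, μ, f, ht₀, h1, h2, rfl⟩) (m := 66 / 100 * ‖e₁‖ ^ 2) (by positivity)
      (by
        rintro _ ⟨b, c, μ, f, h1, h2, h3, rfl⟩
        obtain ⟨v, hv, -, -, -, -, -, -, h4, -⟩ := eisenstein_covering hω S hωS μ
        have h5 := hlow b c μ f h1 h2 h3 (-v) (S.neg_mem hv)
        rw [← sub_eq_add_neg, ← Complex.normSq_eq_norm_sq] at h5
        have h6 := mul_le_mul_of_nonneg_right h4 hN.le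
        linarith)
  replace hmin2 : ∀ b c μ f, T e₁ b c → b = μ • e₁ + f → inner ℂ e₁ f = 0 →
      9999 / 10000 * ‖f₂‖ ^ 2 ≤ ‖f‖ ^ 2 :=
    fun b c μ f h1 h2 h3 => hmin2 _ ⟨b, c, μ, f, h1, h2, h3, rfl⟩
  obtain ⟨ht1, ht2, ht3, ht4⟩ := ht
  have hdet : ∀ ν μ : ℂ, detThree e₁ f₂ (e₃ - ν • f₂ - μ • e₁) = detThree e₁ e₂ e₃ := by
    intro ν μ
    rw [he₂]
    simp [detThree, det_fin_three]; ring
  have hf₂0 : f₂ ≠ 0 := by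
    rintro rfl
    have := hdet 0 0
    rw [← this] at ht4
    rw [← ht4] at hΔ0
    simp [detThree, det_fin_three] at hΔ0
  have hB : 0 < ‖f₂‖ ^ 2 := by have := norm_pos_iff.2 hf₂0; positivity
  have hBc : (‖f₂‖ : ℂ) ^ 2 ≠ 0 := by exact_mod_cast hB.ne'
  obtain ⟨μ₃, g, he₃, hg⟩ := hdec e₃
  obtain ⟨ν, f₃, hg₃, hf₃⟩ : ∃ (ν : ℂ) (f : EuclideanSpace ℂ (Fin 3)),
      g = ν • f₂ + f ∧ inner ℂ f₂ f = 0 := by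
    refine ⟨inner ℂ f₂ g / (‖f₂‖ : ℂ) ^ 2, g - (inner ℂ f₂ g / (‖f₂‖ : ℂ) ^ 2) • f₂, by simp, ?_⟩
    rw [inner_sub_right, inner_smul_right, inner_self_eq_norm_sq_to_K]
    exact sub_eq_zero.2 (div_mul_cancel₀ _ hBc).symm
  have hf₁₃ : inner ℂ e₁ f₃ = 0 := by
    rw [hg₃, inner_add_right, inner_smul_right, hf₂, mul_zero, zero_add] at hg
    exact hg
  have hprod : ‖e₁‖ ^ 2 * ‖f₂‖ ^ 2 * ‖f₃‖ ^ 2 = Δ := by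
    rw [← normSq_detThree_of_orthogonal hf₂ hf₁₃ hf₃, ← ht4, ← hdet ν μ₃]
    congr 2
    rw [he₃, hg₃]; abel
  set N := ‖e₁‖ ^ 2 with hNdef
  set B := ‖f₂‖ ^ 2 with hBdef
  set C := ‖f₃‖ ^ 2 with hCdef
  have hcore := hermite_core (B := B / N) (C := C / N) (μ₂ := μ₂) (μ₃ := μ₃) (ν := ν) hω S hωS hS
    (by positivity)
    (by
      intro c hc
      have := hlow e₂ e₃ μ₂ f₂ ⟨ht1, ht2, ht3, ht4⟩ he₂ hf₂ c hc
      have h1 : ‖μ₂ + c‖ ^ 2 + B / N = (‖μ₂ + c‖ ^ 2 * N + B) / N := by field_simp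
      rw [h1, le_div_iff₀ hN]; exact this)
    (by
      intro a ha
      have hi : inner ℂ e₁ ((ν + a) • f₂ + f₃) = 0 := by
        rw [inner_add_right, inner_smul_right, hf₂, hf₁₃]; simp
      have := hmin2 (e₃ + a • e₂) e₂ (μ₃ + a * μ₂) ((ν + a) • f₂ + f₃)
        ⟨ht1, Λ.add_mem ht3 (hsm a ha _ ht2), ht2, by
          rw [(detThree_perm _ _ _).2.1, Complex.normSq_neg, ← ht4]
          congr 1
          have := detThree_add_smul e₁ e₂ e₃ 0 a 0
          simpa using this⟩
        (by rw [he₂, he₃, hg₃]; module) hi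
      rw [norm_sq_add_of_inner_eq_zero hf₃] at this
      have h1 : ‖ν + a‖ ^ 2 * (B / N) + C / N = (‖ν + a‖ ^ 2 * B + C) / N := by field_simp
      rw [h1, ← mul_div_assoc]
      exact div_le_div_of_nonneg_right this hN.le)
    (by
      intro a ha b hb
      have hi : inner ℂ e₁ ((ν + a) • f₂ + f₃) = 0 := by
        rw [inner_add_right, inner_smul_right, hf₂, hf₁₃]; simp
      have := hmin1 (e₃ + a • e₂ + b • e₁) e₂ e₁
        ⟨Λ.add_mem (Λ.add_mem ht3 (hsm a ha _ ht2)) (hsm b hb _ ht1), ht2, ht1, by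
          rw [(detThree_perm _ _ _).2.2, Complex.normSq_neg, ← ht4]
          congr 1
          have := detThree_add_smul e₁ e₂ e₃ 0 a b
          simpa using this⟩
      have he : e₃ + a • e₂ + b • e₁ = (μ₃ + a * μ₂ + b) • e₁ + ((ν + a) • f₂ + f₃) := by
        rw [he₂, he₃, hg₃]; module
      rw [he, norm_sq_add_of_inner_eq_zero hi, norm_sq_add_of_inner_eq_zero hf₃] at this
      have h1 : ‖μ₃ + a * μ₂ + b‖ ^ 2 + ‖ν + a‖ ^ 2 * (B / N) + C / N =
        (‖μ₃ + a * μ₂ + b‖ ^ 2 * N + (‖ν + a‖ ^ 2 * B + C)) / N := by field_simp; ring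
      rw [h1, le_div_iff₀ hN]; exact this)
  have h1 := hno e₁ ht1 he₁
  have h2 : ‖e₁‖ ^ 6 = N ^ 3 := by rw [hNdef]; ring
  rw [h2, ← hprod] at h1
  have h3 : B / N * (C / N) = N * B * C / N ^ 3 := by field_simp
  rw [h3, lt_div_iff₀ (by positivity)] at hcore
  linarith

end HermiteLattice

section ComplexFlex

/-- The ternary cubic attached to a point `(r, s)` of the curve. -/
def pointCubic {R : Type*} [CommRing R] (r s e x u : R) : R :=
  u ^ 2 * (x - r * e) - 2 * s * u * e ^ 2 - e * (x ^ 2 + r * x * e + (r ^ 2 - 1) * e ^ 2)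

theorem pointCubic_flex_identity {ξ μ k η e x u : ℂ}
    (hη : 2 * η = (k + μ) * (3 * ξ - μ ^ 2)) (h4 : 2 * η * μ - 3 * ξ ^ 2 = -1)
    (h6 : η ^ 2 = ξ ^ 3 - ξ) {X Y Z : ℂ}
    (hx : x = k * (u - k * e) + ξ * e + μ * (u - k * e) - 2 * η * Z)
    (hX : X = (u - k * e) - ξ * Z)
    (hY : Complex.I * Y = x - k * (u - k * e) - (μ ^ 2 - 2 * ξ) * e + η * Z) :
    (3 * ξ - μ ^ 2) * pointCubic (k ^ 2 + ξ - μ ^ 2) (-η - k * (k ^ 2 - μ ^ 2)) e x u =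
      -2 * η * (Y ^ 2 * Z - X ^ 3 + X * Z ^ 2) := by
  have hY2 : Y ^ 2 = -(x - k * (u - k * e) - (μ ^ 2 - 2 * ξ) * e + η * Z) ^ 2 := by
    rw [← hY]; linear_combination (Y ^ 2) * Complex.I_sq
  have hη' : η = (k + μ) * (3 * ξ - μ ^ 2) / 2 := by rw [← hη]; ring
  have key : (3 * ξ - μ ^ 2) * (u ^ 2 * (x - (k ^ 2 + ξ - μ ^ 2) * e) -
      2 * (-η - k * (k ^ 2 - μ ^ 2)) * u * e ^ 2 -
      e * (x ^ 2 + (k ^ 2 + ξ - μ ^ 2) * x * e +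
        ((k ^ 2 + ξ - μ ^ 2) ^ 2 + (2 * η * μ - 3 * ξ ^ 2)) * e ^ 2)) =
      -2 * η * (Y ^ 2 * Z - X ^ 3 - (2 * η * μ - 3 * ξ ^ 2) * X * Z ^ 2 +
        (η ^ 2 - ξ ^ 3 - (2 * η * μ - 3 * ξ ^ 2) * ξ) * Z ^ 3) := by
    rw [hY2, hX, hx, hη']
    ring
  rw [h4, h6] at key
  rw [pointCubic]
  linear_combination key

theorem exists_pointCubic_flex {r s : ℂ} (h : s ^ 2 = r ^ 3 - r) (hs : s ≠ 0) :
    ∃ ξ μ k η : ℂ, η ≠ 0 ∧ 3 * ξ - μ ^ 2 ≠ 0 ∧ 2 * η = (k + μ) * (3 * ξ - μ ^ 2) ∧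
      2 * η * μ - 3 * ξ ^ 2 = -1 ∧ η ^ 2 = ξ ^ 3 - ξ ∧ r = k ^ 2 + ξ - μ ^ 2 ∧
      s = -η - k * (k ^ 2 - μ ^ 2) := by
  obtain ⟨ξ, hξ⟩ : ∃ ξ : ℂ, ξ ^ 9 + 12 * ξ ^ 7 + 30 * ξ ^ 5 - 36 * ξ ^ 3 + 9 * ξ =
      r * (3 * ξ ^ 4 - 6 * ξ ^ 2 - 1) ^ 2 := by
    open Polynomial in
    have hd : (X ^ 9 + 12 * X ^ 7 + 30 * X ^ 5 - 36 * X ^ 3 + 9 * X -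
        C r * (3 * X ^ 4 - 6 * X ^ 2 - 1) ^ 2 : ℂ[X]).natDegree = 9 := by
      compute_degree!
    obtain ⟨ξ, hξ⟩ := IsAlgClosed.exists_root _ (fun h0 => by
      rw [Polynomial.natDegree_eq_of_degree_eq_some h0] at hd; norm_num at hd)
    refine ⟨ξ, ?_⟩
    simp [Polynomial.IsRoot] at hξ
    linear_combination hξ
  have hr0 : r ≠ 0 := by rintro rfl; apply hs; simpa using h
  have hψ : 3 * ξ ^ 4 - 6 * ξ ^ 2 - 1 ≠ 0 := by
    intro h0
    rw [h0] at hξ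
    have h1 : ξ * (3 * ξ ^ 2 + 1) = 0 := by
      linear_combination (9 / 256 : ℂ) * (hξ - ξ * (ξ ^ 4 / 3 + 14 / 3 * ξ ^ 2 + 175 / 9) * h0)
    rcases mul_eq_zero.1 h1 with h2 | h2
    · rw [h2] at h0; norm_num at h0
    · have h3 : (4 / 3 : ℂ) = 0 := by linear_combination h0 - (ξ ^ 2 - 7 / 3) * h2
      norm_num at h3
  have hη0 : ξ ^ 3 - ξ ≠ 0 := by
    intro h0
    have h1 : r * (15 * ξ ^ 2 + 1) = 16 * ξ := by
      linear_combination -hξ + (ξ ^ 6 + 13 * ξ ^ 4 + 43 * ξ ^ 2 + 7 -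
        r * (9 * ξ ^ 5 - 27 * ξ ^ 3 + 3 * ξ)) * h0
    have h2 : ξ * (ξ ^ 2 - 1) = 0 := by linear_combination h0
    rcases mul_eq_zero.1 h2 with h3 | h3
    · rw [h3] at h1; apply hr0; simpa using h1
    · have h4 : r = ξ := by linear_combination h1 / 16 - 15 / 16 * r * h3
      apply hs
      rw [h4, h0] at h
      simpa using h
  have hroot : ∀ η : ℂ, η ^ 2 = ξ ^ 3 - ξ → ∃ μ k : ℂ, η ≠ 0 ∧ 3 * ξ - μ ^ 2 ≠ 0 ∧
      2 * η = (k + μ) * (3 * ξ - μ ^ 2) ∧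
      2 * η * μ - 3 * ξ ^ 2 = -1 ∧ η ^ 2 = ξ ^ 3 - ξ ∧ r = k ^ 2 + ξ - μ ^ 2 ∧
      -η - k * (k ^ 2 - μ ^ 2) = -η * (1 + (8 * η ^ 2 / (3 * ξ ^ 4 - 6 * ξ ^ 2 - 1) -
        (3 * ξ ^ 2 - 1) / (2 * η ^ 2)) * (r - ξ)) := by
    intro η hη
    have hη1 : η ≠ 0 := by rintro rfl; apply hη0; rw [← hη]; ring
    have hD : 3 * ξ - ((3 * ξ ^ 2 - 1) / (2 * η)) ^ 2 =
        (3 * ξ ^ 4 - 6 * ξ ^ 2 - 1) / (4 * η ^ 2) := by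
      field_simp
      linear_combination 48 * ξ * hη
    set ψ := 3 * ξ ^ 4 - 6 * ξ ^ 2 - 1 with hψd
    have hr : r = (8 * η ^ 3 / ψ - (3 * ξ ^ 2 - 1) / (2 * η)) ^ 2 + ξ -
        ((3 * ξ ^ 2 - 1) / (2 * η)) ^ 2 := by
      have h1 : (8 * η ^ 3 / ψ - (3 * ξ ^ 2 - 1) / (2 * η)) ^ 2 + ξ -
        ((3 * ξ ^ 2 - 1) / (2 * η)) ^ 2 = (64 * (η ^ 2) ^ 3 - 8 * η ^ 2 * (3 * ξ ^ 2 - 1) * ψ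
          + ξ * ψ ^ 2) / ψ ^ 2 := by
        field_simp
        ring
      rw [h1, hη, eq_div_iff (pow_ne_zero 2 hψ), ← hξ, hψd]
      ring
    refine ⟨(3 * ξ ^ 2 - 1) / (2 * η), 8 * η ^ 3 / ψ - (3 * ξ ^ 2 - 1) / (2 * η), hη1, ?_, ?_, ?_,
      hη, hr, ?_⟩
    · rw [hD]; exact div_ne_zero hψ (by simpa using hη1)
    · rw [hD]; field_simp; ring
    · field_simp; ring
    · have h1 : (8 * η ^ 3 / ψ - (3 * ξ ^ 2 - 1) / (2 * η)) ^ 2 - ((3 * ξ ^ 2 - 1) / (2 * η)) ^ 2 =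
        r - ξ := by rw [hr]; ring
      rw [h1]
      field_simp
      ring
  obtain ⟨η, hη⟩ := IsAlgClosed.exists_pow_nat_eq (ξ ^ 3 - ξ) (n := 2) (by norm_num)
  obtain ⟨μ, k, h1, h2, h3, h4, h5, h6, h7⟩ := hroot η hη
  have hs2 : s ^ 2 = (-η - k * (k ^ 2 - μ ^ 2)) ^ 2 := by
    rw [h]
    have key : (-η - k * (k ^ 2 - μ ^ 2)) ^ 2 = (k ^ 2 + ξ - μ ^ 2) ^ 3 +
        (2 * η * μ - 3 * ξ ^ 2) * (k ^ 2 + ξ - μ ^ 2) +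
        (η ^ 2 - ξ ^ 3 - (2 * η * μ - 3 * ξ ^ 2) * ξ) := by
      have hη' : η = (k + μ) * (3 * ξ - μ ^ 2) / 2 := by rw [← h3]; ring
      rw [hη']; ring
    rw [h4, h5, ← h6] at key
    linear_combination -key
  rcases sq_eq_sq_iff_eq_or_eq_neg.1 hs2 with h8 | h8
  · exact ⟨ξ, μ, k, η, h1, h2, h3, h4, h5, h6, h8⟩
  · obtain ⟨μ', k', g1, g2, g3, g4, g5, g6, g7⟩ := hroot (-η) (by rw [← hη]; ring)
    refine ⟨ξ, μ', k', -η, g1, g2, g3, g4, g5, g6, ?_⟩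
    rw [h8, h7, g7]; ring

open Matrix in
theorem exists_flex_change {r s : ℂ} (h : s ^ 2 = r ^ 3 - r) :
    ∃ A : Matrix (Fin 3) (Fin 3) ℂ, A.det ≠ 0 ∧ ∀ e x u X Y Z : ℂ, A *ᵥ ![e, x, u] = ![X, Y, Z] →
      Complex.normSq (pointCubic r s e x u) * Complex.normSq A.det =
        Complex.normSq (Y ^ 2 * Z - X ^ 3 + X * Z ^ 2) := by
  by_cases hs : s = 0
  · subst hs
    have hr : r * (r ^ 2 - 1) = 0 := by linear_combination -h
    rcases mul_eq_zero.1 hr with hr | hr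
    · subst hr
      refine ⟨!![-1, 0, 0; 0, 0, 1; 0, 1, 0], ?_, ?_⟩
      · simp [det_fin_three]
      · intro e x u X Y Z hA
        have h0 := congrFun hA 0
        have h1 := congrFun hA 1
        have h2 := congrFun hA 2
        simp [mulVec, dotProduct, Fin.sum_univ_three] at h0 h1 h2
        subst h0 h1 h2
        rw [det_fin_three, ← Complex.normSq_mul, pointCubic]
        simp
        congr 1; ring
    · refine ⟨!![1 - r * r / 2, r / 2, 0; 0, 0, 1; -r / 2, 1 / 2, 0], ?_, ?_⟩
      · simp [det_fin_three]
        intro h0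
        have : (1 : ℂ) = 0 := by linear_combination -2 * h0
        norm_num at this
      · intro e x u X Y Z hA
        have h0 := congrFun hA 0
        have h1 := congrFun hA 1
        have h2 := congrFun hA 2
        simp [mulVec, dotProduct, Fin.sum_univ_three] at h0 h1 h2
        have hr2 : r ^ 2 = 1 := by linear_combination hr
        rw [← Complex.normSq_neg (Y ^ 2 * Z - X ^ 3 + X * Z ^ 2), ← Complex.normSq_mul, pointCubic,
          det_fin_three]
        simp
        rw [← h0, ← h1, ← h2, ← Complex.normSq_mul]
        congr 1
        rcases (sq_eq_sq_iff_eq_or_eq_neg.1 (hr2.trans (one_pow 2).symm)) with rfl | rfl <;> ring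
  · obtain ⟨ξ, μ, k, η, h1, h2, h3, h4, h5, rfl, rfl⟩ := exists_pointCubic_flex h hs
    let A : Matrix (Fin 3) (Fin 3) ℂ := !![-k - ξ * ((-k ^ 2 + ξ - μ * k) / (2 * η)), ξ / (2 * η), 1 - ξ * (k + μ) / (2 * η);
      -Complex.I * (k ^ 2 - μ ^ 2 + 2 * ξ + (-k ^ 2 + ξ - μ * k) / 2), -Complex.I / 2,
        -Complex.I * (-k + (k + μ) / 2);
      (-k ^ 2 + ξ - μ * k) / (2 * η), -1 / (2 * η), (k + μ) / (2 * η)]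
    have hdet : A.det * (2 * η) =
        Complex.I * (3 * ξ - μ ^ 2) := by
      rw [det_fin_three]
      simp [A]
      field_simp
      ring
    refine ⟨A, ?_, ?_⟩
    · intro h0
      rw [h0, zero_mul] at hdet
      exact mul_ne_zero Complex.I_ne_zero h2 hdet.symm
    · intro e x u X Y Z hA
      have g0 := congrFun hA 0
      have g1 := congrFun hA 1
      have g2 := congrFun hA 2
      simp [A, mulVec, dotProduct, Fin.sum_univ_three] at g0 g1 g2
      have hZ : 2 * η * Z = -(x - k * (u - k * e)) + ξ * e + μ * (u - k * e) := by
        rw [← g2]; field_simp; ring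
      have key := pointCubic_flex_identity (e := e) (x := x) (u := u) (X := X) (Y := Y) (Z := Z)
        h3 h4 h5 (by linear_combination hZ) (by rw [← g0, ← g2]; field_simp; ring)
        (by rw [← g1, ← g2]; field_simp; linear_combination (k * μ * e + k * u - k ^ 2 * e - μ * u +
          2 * μ ^ 2 * e - 5 * ξ * e - x) * Complex.I_sq)
      have hη : Complex.normSq (2 * η) ≠ 0 := by simpa using h1
      apply mul_right_cancel₀ hη
      have h6 : pointCubic (k ^ 2 + ξ - μ ^ 2) (-η - k * (k ^ 2 - μ ^ 2)) e x u *
          (Complex.I * (3 * ξ - μ ^ 2)) =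
          -Complex.I * ((Y ^ 2 * Z - X ^ 3 + X * Z ^ 2) * (2 * η)) := by
        linear_combination Complex.I * key
      rw [mul_assoc, ← Complex.normSq_mul, hdet, ← Complex.normSq_mul, h6, Complex.normSq_mul]
      simp

open Matrix in
/-- Every lattice of `ℂ³` over the Eisenstein integers has a nonzero vector at which the cubic
attached to a point is smaller than the covolume. -/
theorem exists_small_value {ω : ℂ} (hω : ω ^ 2 + ω + 1 = 0) (S : Subring ℂ)
    (hS : ∀ z, z ∈ S ↔ ∃ a b : ℤ, z = a + b * ω) {r s : ℂ} (h : s ^ 2 = r ^ 3 - r)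
    (N : Matrix (Fin 3) (Fin 3) ℂ) (hN : N.det ≠ 0) :
    ∃ y : Fin 3 → ℂ, (∀ i, y i ∈ S) ∧ y ≠ 0 ∧
      Complex.normSq (pointCubic r s ((N *ᵥ y) 0) ((N *ᵥ y) 1) ((N *ᵥ y) 2)) <
        Complex.normSq N.det := by
  obtain ⟨A, hA0, hA⟩ := exists_flex_change h
  set a : ℝ := Real.sqrt (59 / 40) with ha
  set b : ℝ := Real.sqrt (79 / 100) with hb
  set c : ℝ := Real.sqrt (4000 / 4661) with hc
  have ha2 : a ^ 2 = 59 / 40 := Real.sq_sqrt (by norm_num)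
  have hb2 : b ^ 2 = 79 / 100 := Real.sq_sqrt (by norm_num)
  have hc2 : c ^ 2 = 4000 / 4661 := Real.sq_sqrt (by norm_num)
  set D : Matrix (Fin 3) (Fin 3) ℂ := diagonal ![(a : ℂ), b, c] with hD
  have hDdet : Complex.normSq D.det = 1 := by
    rw [hD, det_diagonal, Fin.prod_univ_three]
    simp
    rw [← pow_two, ← pow_two, ← pow_two, ha2, hb2, hc2]; norm_num
  set M := D * A * N with hM
  have hMdet : Complex.normSq M.det = Complex.normSq A.det * Complex.normSq N.det := by
    rw [hM, det_mul, det_mul, Complex.normSq_mul, Complex.normSq_mul, hDdet, one_mul]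
  let col : Fin 3 → EuclideanSpace ℂ (Fin 3) := fun j => WithLp.toLp 2 (fun i => M i j)
  have hdet : detThree (col 0) (col 1) (col 2) = M.det := by
    rw [detThree]
    congr 1
    ext i j
    fin_cases i <;> fin_cases j <;> rfl
  obtain ⟨v, hv, hv0, hsmall⟩ := hermite_lattice hω S hS
    (Submodule.span S {col 0, col 1, col 2}) (v₁ := col 0) (v₂ := col 1) (v₃ := col 2)
    (Submodule.subset_span (by simp)) (Submodule.subset_span (by simp))
    (Submodule.subset_span (by simp)) (by
      rw [hdet]
      intro h0
      rw [h0] at hMdet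
      simp at hMdet
      exact hMdet.elim hA0 hN)
  obtain ⟨y₀, y₁, y₂, hy⟩ := Submodule.mem_span_triple.1 hv
  have hvy : ∀ i, v i = (M *ᵥ ![(y₀ : ℂ), y₁, y₂]) i := by
    intro i
    rw [← hy]
    simp [mulVec, dotProduct, Fin.sum_univ_three, col, Subring.smul_def, mul_comm]
  refine ⟨![(y₀ : ℂ), y₁, y₂], ?_, ?_, ?_⟩
  · intro i; fin_cases i <;> simp
  · intro h0
    apply hv0
    ext i
    rw [hvy i, h0]; simp
  · set x := N *ᵥ ![(y₀ : ℂ), y₁, y₂] with hx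
    set X := A *ᵥ x with hX
    have hx3 : x = ![x 0, x 1, x 2] := by ext i; fin_cases i <;> rfl
    have hX3 : A *ᵥ ![x 0, x 1, x 2] = ![X 0, X 1, X 2] := by
      rw [← hx3]; ext i; fin_cases i <;> rfl
    have hvX : ∀ i, v i = ![(a : ℂ), b, c] i * X i := by
      intro i
      rw [hvy i, hM, ← mulVec_mulVec, ← mulVec_mulVec, hD, mulVec_diagonal]
    have hnorm : ‖v‖ ^ 2 = 59 / 40 * ‖X 0‖ ^ 2 + 79 / 100 * ‖X 1‖ ^ 2 + 4000 / 4661 * ‖X 2‖ ^ 2 := by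
      rw [EuclideanSpace.norm_sq_eq, Fin.sum_univ_three, hvX, hvX, hvX]
      simp [mul_pow, ha2, hb2, hc2]
    have h1 := weierstrass_norm_bound (X 0) (X 1) (X 2) ‖v‖ (norm_nonneg _) hnorm.ge
    have h2 := hA _ _ _ _ _ _ hX3
    rw [hdet, hMdet] at hsmall
    have h3 : Complex.normSq (X 1 ^ 2 * X 2 - X 0 ^ 3 + X 0 * X 2 ^ 2) ≤
        328 / 1000 * ‖v‖ ^ 6 := by
      rw [Complex.normSq_eq_norm_sq]
      calc _ ≤ (5727 / 10000 * ‖v‖ ^ 3) ^ 2 := by gcongr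
        _ = (5727 / 10000) ^ 2 * ‖v‖ ^ 6 := by ring
        _ ≤ _ := by gcongr; norm_num
    have h4 : 0 < Complex.normSq A.det := Complex.normSq_pos.2 hA0
    have h5 := h3.trans_lt hsmall
    rw [← h2, mul_comm] at h5
    exact lt_of_mul_lt_mul_left h5 h4.le

end ComplexFlex

section Gluing

open IsDedekindDomain Matrix

variable {O F : Type*} [CommRing O] [IsDedekindDomain O] [IsPrincipalIdealRing O] [Field F]
  [Algebra O F] [IsFractionRing O F]

theorem valuation_sum_mul_le_one {Γ : Type*} [LinearOrderedCommGroupWithZero Γ]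
    (v : Valuation F Γ) {n : ℕ} {a b : Fin n → F} (ha : ∀ i, v (a i) ≤ 1) (hb : ∀ i, v (b i) ≤ 1) :
    v (∑ i, a i * b i) ≤ 1 :=
  v.map_sum_le fun i _ => by rw [map_mul]; exact mul_le_one₀ (ha i) zero_le (hb i)

theorem exists_denominator_away (v : HeightOneSpectrum O) (x : F) :
    ∃ t : O, v.valuation F (algebraMap O F t) = 1 ∧
      ∀ u : HeightOneSpectrum O, u ≠ v → u.valuation F (algebraMap O F t * x) ≤ 1 := by
  obtain ⟨n, d, hd, rfl⟩ := IsFractionRing.div_surjective O x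
  have hd0 : d ≠ 0 := nonZeroDivisors.ne_zero hd
  obtain ⟨π, hπ⟩ := (IsPrincipalIdealRing.principal v.asIdeal)
  change v.asIdeal = Ideal.span {π} at hπ
  have hπp : Prime π := by
    have := v.isPrime
    rw [hπ] at this
    exact (Ideal.span_singleton_prime (by
      rintro rfl; exact v.ne_bot (by simpa using hπ))).1 this
  have hfin : FiniteMultiplicity π d := FiniteMultiplicity.of_prime_left hπp hd0
  obtain ⟨c, hc, hnd⟩ := hfin.exists_eq_pow_mul_and_not_dvd
  refine ⟨c, ?_, fun u hu => ?_⟩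
  · rw [HeightOneSpectrum.valuation_eq_one_iff_notMem, hπ, Ideal.mem_span_singleton]; exact hnd
  · have hc0 : algebraMap O F c ≠ 0 := by
      intro h
      have : c = 0 := by simpa using h
      exact hnd (this ▸ dvd_zero _)
    have hπ0 : algebraMap O F π ≠ 0 := by simpa using hπp.ne_zero
    have hu1 : u.valuation F (algebraMap O F π) = 1 := by
      rw [HeightOneSpectrum.valuation_eq_one_iff_notMem]
      intro hmem
      apply hu
      have hle : v.asIdeal ≤ u.asIdeal := by rw [hπ, Ideal.span_singleton_le_iff_mem]; exact hmem
      have hmax := v.isPrime.isMaximal v.ne_bot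
      exact HeightOneSpectrum.ext (hmax.eq_of_le u.isPrime.ne_top hle).symm
    have h1 : algebraMap O F c * (algebraMap O F n / algebraMap O F d) =
        algebraMap O F n / algebraMap O F π ^ multiplicity π d := by
      have hd' : algebraMap O F d = algebraMap O F π ^ multiplicity π d * algebraMap O F c := by
        conv_lhs => rw [hc]
        rw [map_mul, map_pow]
      rw [hd']; field_simp
    rw [h1, map_div₀, map_pow, hu1, one_pow, div_one]
    exact u.valuation_le_one n

theorem exists_denominator_away_finset (v : HeightOneSpectrum O) (s : Finset F) :
    ∃ t : O, v.valuation F (algebraMap O F t) = 1 ∧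
      ∀ x ∈ s, ∀ u : HeightOneSpectrum O, u ≠ v → u.valuation F (algebraMap O F t * x) ≤ 1 := by
  classical
  induction s using Finset.induction_on with
  | empty => exact ⟨1, by simp, by simp⟩
  | insert a s ha ih =>
    obtain ⟨t, ht, h⟩ := ih
    obtain ⟨t', ht', h'⟩ := exists_denominator_away v a
    refine ⟨t * t', by rw [map_mul, map_mul, ht, ht', one_mul], ?_⟩
    intro x hx u hu
    rw [map_mul (algebraMap O F)]
    rcases Finset.mem_insert.1 hx with rfl | hx
    · rw [mul_assoc, map_mul]
      exact mul_le_one₀ (u.valuation_le_one t) zero_le (h' u hu)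
    · rw [mul_right_comm, map_mul]
      exact mul_le_one₀ (h x hx u hu) zero_le (u.valuation_le_one t')

/-- A submodule of `F³` with bounded denominators is generated by three elements. -/
theorem exists_matrix_generating (M : Submodule O (Fin 3 → F)) (N : F) (hN0 : N ≠ 0)
    (hM : ∀ m ∈ M, ∀ i, N * m i ∈ (algebraMap O F).range) :
    ∃ A : Matrix (Fin 3) (Fin 3) F, (∀ j, (fun i => A i j) ∈ M) ∧
      ∀ m ∈ M, ∃ c : Fin 3 → O, ∀ i, m i = ∑ j, A i j * algebraMap O F (c j) := by
  classical
  let ι : (Fin 3 → O) →ₗ[O] (Fin 3 → F) :=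
    { toFun := fun y i => algebraMap O F (y i) / N
      map_add' := by intro a b; ext i; simp [add_div]
      map_smul' := by intro c a; ext i; simp [Algebra.smul_def, mul_div_assoc] }
  have hι : ∀ y i, ι y i = algebraMap O F (y i) / N := fun y i => rfl
  let M' : Submodule O (Fin 3 → O) := M.comap ι
  have hM' : ∀ m ∈ M, ∃ y ∈ M', ι y = m := by
    intro m hm
    choose y hy using hM m hm
    have h1 : ι y = m := by
      ext i; rw [hι, hy]; field_simp
    exact ⟨y, by change ι y ∈ M; rw [h1]; exact hm, h1⟩
  obtain ⟨n, ⟨b⟩⟩ := Submodule.nonempty_basis_of_pid (Pi.basisFun O (Fin 3)) M'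
  have hn : n ≤ 3 := by
    have h1 := Submodule.finrank_le M'
    rw [Module.finrank_eq_card_basis b] at h1
    simpa using h1
  let w : Fin 3 → (Fin 3 → F) := fun j => if h : (j : ℕ) < n then ι (b ⟨j, h⟩) else 0
  have hw1 : ∀ j : Fin n, w (Fin.castLE hn j) = ι (b j) := fun j => by
    change (if h : (j : ℕ) < n then ι (b ⟨j, h⟩) else 0) = _
    rw [dif_pos j.2]
  have hw0 : ∀ j : Fin 3, ¬ (j : ℕ) < n → w j = 0 := fun j hj => dif_neg hj
  refine ⟨fun i j => w j i, fun j => ?_, fun m hm => ?_⟩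
  · change w j ∈ M
    by_cases h : (j : ℕ) < n
    · have := hw1 ⟨j, h⟩
      change w j = _ at this
      rw [this]
      exact (b ⟨j, h⟩).2
    · rw [hw0 j h]; exact M.zero_mem
  · obtain ⟨y, hy, rfl⟩ := hM' m hm
    let r : Fin n → O := fun j => b.repr ⟨y, hy⟩ j
    refine ⟨fun j => if h : (j : ℕ) < n then r ⟨j, h⟩ else 0, fun i => ?_⟩
    have h1 : ι y = ∑ j, r j • ι (b j) := by
      have h := congrArg (fun z : M' => ι z) (b.sum_repr ⟨y, hy⟩)
      simp only [Submodule.coe_sum, map_sum, Submodule.coe_smul, map_smul] at h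
      exact h.symm
    rw [h1, Finset.sum_apply]
    have h2 : ∀ f : Fin 3 → F, (∀ j : Fin 3, ¬ (j : ℕ) < n → f j = 0) →
        ∑ j, f j = ∑ j : Fin n, f (Fin.castLE hn j) := by
      intro f hf
      rw [← Finset.sum_image (s := Finset.univ) (g := Fin.castLE hn) (f := f)
        (fun x _ y _ h => Fin.castLE_injective hn h)]
      symm
      apply Finset.sum_subset (Finset.subset_univ _)
      intro j _ hj
      apply hf
      intro hlt
      exact hj (Finset.mem_image.2 ⟨⟨j, hlt⟩, Finset.mem_univ _, rfl⟩)
    rw [h2 _ (fun j hj => by beta_reduce; rw [hw0 j hj, Pi.zero_apply, zero_mul])]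
    refine Finset.sum_congr rfl fun j _ => ?_
    beta_reduce
    rw [hw1, Pi.smul_apply, Algebra.smul_def, mul_comm]
    congr 2
    have hj : ((Fin.castLE hn j : Fin 3) : ℕ) < n := j.2
    rw [dif_pos hj]
    rfl

/-- A lattice over a principal ideal domain with prescribed localizations. -/
theorem exists_global_basis (B : HeightOneSpectrum O → Matrix (Fin 3) (Fin 3) F)
    (hB : ∀ v, (B v).det ≠ 0) (S : Finset (HeightOneSpectrum O)) (hS : ∀ v ∉ S, B v = 1) :
    ∃ A : Matrix (Fin 3) (Fin 3) F, A.det ≠ 0 ∧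
      (∀ (v : HeightOneSpectrum O) (i j : Fin 3), v.valuation F (((B v)⁻¹ * A) i j) ≤ 1) ∧
      ∀ v : HeightOneSpectrum O, v.valuation F (B v).det ≤ v.valuation F A.det := by
  classical
  let M : Submodule O (Fin 3 → F) :=
    { carrier := {m | ∀ (v : HeightOneSpectrum O) i, v.valuation F (((B v)⁻¹ *ᵥ m) i) ≤ 1}
      zero_mem' := by intro v i; simp
      add_mem' := by
        intro a b ha hb v i
        rw [mulVec_add]
        exact (v.valuation F).map_add_le (ha v i) (hb v i)
      smul_mem' := by
        intro c a ha v i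
        rw [mulVec_smul, Pi.smul_apply, Algebra.smul_def, map_mul]
        exact mul_le_one₀ (v.valuation_le_one c) zero_le (ha v i) }
  have hM : ∀ m, m ∈ M ↔ ∀ (v : HeightOneSpectrum O) i,
    v.valuation F (((B v)⁻¹ *ᵥ m) i) ≤ 1 := fun m => Iff.rfl
  -- common denominator
  obtain ⟨N, hN⟩ := IsLocalization.exist_integer_multiples_of_finset (nonZeroDivisors O)
    (S.biUnion fun v => Finset.univ.image fun ij : Fin 3 × Fin 3 => B v ij.1 ij.2)
  have hN0 : algebraMap O F N ≠ 0 := by simp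
  have hNB : ∀ (v : HeightOneSpectrum O) i j, v.valuation F (algebraMap O F N * B v i j) ≤ 1 := by
    intro v i j
    by_cases hv : v ∈ S
    · obtain ⟨a, ha⟩ := hN (B v i j) (Finset.mem_biUnion.2 ⟨v, hv, Finset.mem_image.2
        ⟨(i, j), Finset.mem_univ _, rfl⟩⟩)
      change algebraMap O F a = (N : O) • B v i j at ha
      rw [Algebra.smul_def] at ha
      rw [← ha]; exact v.valuation_le_one a
    · rw [hS v hv, map_mul]
      refine mul_le_one₀ (v.valuation_le_one _) zero_le ?_
      rw [one_apply]; split_ifs <;> simp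
  have hMint : ∀ m ∈ M, ∀ i, algebraMap O F N * m i ∈ (algebraMap O F).range := by
    intro m hm i
    apply HeightOneSpectrum.mem_integers_of_valuation_le_one
    intro v
    have h1 : m = B v *ᵥ ((B v)⁻¹ *ᵥ m) := by
      rw [mulVec_mulVec, mul_nonsing_inv _ (isUnit_iff_ne_zero.2 (hB v)), one_mulVec]
    have h2 : algebraMap O F N * m i =
        ∑ j, (algebraMap O F N * B v i j) * ((B v)⁻¹ *ᵥ m) j := by
      conv_lhs => rw [h1]
      rw [mulVec, dotProduct, Finset.mul_sum]
      simp_rw [mul_assoc]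
    rw [h2]
    exact valuation_sum_mul_le_one _ (hNB v i) (fun j => hm v j)
  -- enough elements of the lattice, locally
  have hlocal : ∀ v : HeightOneSpectrum O, ∃ t : O, v.valuation F (algebraMap O F t) = 1 ∧
      ∀ j, (fun i => algebraMap O F t * B v i j) ∈ M := by
    intro v
    obtain ⟨t, ht, h⟩ := exists_denominator_away_finset (F := F) v
      ((Finset.univ.image fun ij : Fin 3 × Fin 3 => B v ij.1 ij.2) ∪
        S.biUnion fun u => Finset.univ.image fun ij : Fin 3 × Fin 3 => ((B u)⁻¹ * B v) ij.1 ij.2)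
    refine ⟨t, ht, fun j => ?_⟩
    rw [hM]
    intro u i
    have h1 : ((B u)⁻¹ *ᵥ fun i => algebraMap O F t * B v i j) i =
        algebraMap O F t * ((B u)⁻¹ * B v) i j := by
      simp only [mulVec, dotProduct, mul_apply, Finset.mul_sum]
      exact Finset.sum_congr rfl fun k _ => by ring
    rw [h1]
    by_cases huv : u = v
    · subst huv
      rw [nonsing_inv_mul _ (isUnit_iff_ne_zero.2 (hB u)), map_mul, ht, one_mul]
      rw [one_apply]; split_ifs <;> simp
    · by_cases hu : u ∈ S
      · exact h _ (Finset.mem_union_right _ (Finset.mem_biUnion.2 ⟨u, hu, Finset.mem_image.2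
          ⟨(i, j), Finset.mem_univ _, rfl⟩⟩)) u huv
      · rw [hS u hu, inv_one, one_mul]
        exact h _ (Finset.mem_union_left _ (Finset.mem_image.2 ⟨(i, j), Finset.mem_univ _, rfl⟩))
          u huv
  obtain ⟨A, hAM, hspan⟩ := exists_matrix_generating M (algebraMap O F N) hN0 hMint
  have hdet : ∀ v : HeightOneSpectrum O, v.valuation F (B v).det ≤ v.valuation F A.det := by
    intro v
    obtain ⟨t, ht, h⟩ := hlocal v
    choose c hc using fun j => hspan _ (h j)
    have h1 : algebraMap O F t • B v = A * (Matrix.of fun i j => algebraMap O F (c j i)) := by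
      ext i j
      rw [Matrix.smul_apply, smul_eq_mul, hc j i, mul_apply]; rfl
    have h2 : (Matrix.of fun i j => algebraMap O F (c j i)).det =
        algebraMap O F (Matrix.of fun i j => c j i).det := by
      rw [RingHom.map_det]; rfl
    have h3 := congrArg (fun X => v.valuation F (det X)) h1
    simp only [det_smul, det_mul, h2, map_mul, map_pow, ht, one_pow, one_mul] at h3
    rw [h3]
    exact mul_le_of_le_one_right' (v.valuation_le_one _)
  have hmem : ∀ (v : HeightOneSpectrum O) (i j : Fin 3),
      v.valuation F (((B v)⁻¹ * A) i j) ≤ 1 := fun v i j => hAM j v i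
  by_cases hne : Nonempty (HeightOneSpectrum O)
  · obtain ⟨v⟩ := hne
    refine ⟨A, ?_, hmem, hdet⟩
    intro h0
    have := hdet v
    rw [h0, map_zero, le_zero_iff, map_eq_zero] at this
    exact hB v this
  · exact ⟨1, by simp, fun v => (hne ⟨v⟩).elim, fun v => (hne ⟨v⟩).elim⟩

/-- Local integrality statements glue to a global one. -/
theorem exists_global_matrix (Φ : (Fin 3 → F) → F) (δ : F) (hδ : δ ≠ 0)
    (S : Finset (HeightOneSpectrum O))
    (h : ∀ v : HeightOneSpectrum O, ∃ B : Matrix (Fin 3) (Fin 3) F, B.det ≠ 0 ∧ (v ∉ S → B = 1) ∧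
      ∀ y : Fin 3 → F, (∀ i, v.valuation F (y i) ≤ 1) →
        v.valuation F (Φ (B *ᵥ y)) ≤ v.valuation F (δ * B.det)) :
    ∃ A : Matrix (Fin 3) (Fin 3) F, A.det ≠ 0 ∧ ∀ y : Fin 3 → O,
      Φ (A *ᵥ fun i => algebraMap O F (y i)) / (δ * A.det) ∈ (algebraMap O F).range := by
  choose B hB hBS hΦ using h
  obtain ⟨A, hA, h1, h2⟩ := exists_global_basis B hB S hBS
  refine ⟨A, hA, fun y => ?_⟩
  apply HeightOneSpectrum.mem_integers_of_valuation_le_one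
  intro v
  have h3 : A *ᵥ (fun i => algebraMap O F (y i)) =
      B v *ᵥ (((B v)⁻¹ * A) *ᵥ fun i => algebraMap O F (y i)) := by
    rw [mulVec_mulVec, ← mul_assoc, mul_nonsing_inv _ (isUnit_iff_ne_zero.2 (hB v)), one_mul]
  have h4 := hΦ v (((B v)⁻¹ * A) *ᵥ fun i => algebraMap O F (y i)) (fun i =>
    valuation_sum_mul_le_one _ (h1 v i) fun j => v.valuation_le_one (y j))
  rw [← h3] at h4
  rw [map_div₀]
  have h5 : v.valuation F (δ * A.det) ≠ 0 := by simp [hδ, hA]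
  apply div_le_one_of_le₀ _ zero_le
  refine h4.trans ?_
  rw [map_mul, map_mul]
  exact mul_le_mul_right (h2 v) _

end Gluing

section Residue

theorem ValuationSubring.residue_eq_zero_iff_valuation_lt_one {L : Type*} [Field L]
    (A : ValuationSubring L) (a : A) :
    IsLocalRing.residue A a = 0 ↔ A.valuation (a : L) < 1 := by
  rw [IsLocalRing.residue_eq_zero_iff, ← ValuationSubring.valuation_lt_one_iff]

theorem map_pointCubic {R S : Type*} [CommRing R] [CommRing S] (f : R →+* S) (r s e x u : R) :
    f (pointCubic r s e x u) = pointCubic (f r) (f s) (f e) (f x) (f u) := by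
  simp only [pointCubic, map_sub, map_mul, map_pow, map_add, map_one, map_ofNat]

/-- The derivative of `pointCubic r s` at `(e, x, u)` in the direction `(e', x', u')`. -/
def pointCubicDeriv {R : Type*} [CommRing R] (r s e x u e' x' u' : R) : R :=
  (-r * u ^ 2 - 4 * s * u * e - x ^ 2 - 2 * r * x * e - 3 * (r ^ 2 - 1) * e ^ 2) * e' +
    (u ^ 2 - 2 * x * e - r * e ^ 2) * x' + (2 * u * (x - r * e) - 2 * s * e ^ 2) * u'

theorem map_pointCubicDeriv {R S : Type*} [CommRing R] [CommRing S] (f : R →+* S)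
    (r s e x u e' x' u' : R) :
    f (pointCubicDeriv r s e x u e' x' u') =
      pointCubicDeriv (f r) (f s) (f e) (f x) (f u) (f e') (f x') (f u') := by
  simp only [pointCubicDeriv, map_sub, map_mul, map_pow, map_add, map_one, map_ofNat, map_neg]

theorem two_mul_pointCubicDeriv {R : Type*} [CommRing R] (r s e x u e' x' u' : R) :
    2 * pointCubicDeriv r s e x u e' x' u' =
      pointCubic r s (e + e') (x + x') (u + u') - pointCubic r s (e - e') (x - x') (u - u') -
        2 * pointCubic r s e' x' u' := by
  unfold pointCubicDeriv pointCubic; ring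

/-- The plane cubic `pointCubic r s = 0` is smooth. -/
theorem pointCubic_smooth {k : Type*} [Field k] (h2 : (2 : k) ≠ 0) {r s e x u : k}
    (hrs : s ^ 2 = r ^ 3 - r) (h : pointCubic r s e x u = 0)
    (he : pointCubicDeriv r s e x u 1 0 0 = 0) (hx : pointCubicDeriv r s e x u 0 1 0 = 0)
    (hu : pointCubicDeriv r s e x u 0 0 1 = 0) : e = 0 ∧ x = 0 ∧ u = 0 := by
  unfold pointCubicDeriv at he hx hu
  unfold pointCubic at h
  by_cases h0 : e = 0
  · subst h0
    have h3 : u = 0 := by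
      have : u ^ 2 = 0 := by linear_combination hx
      exact pow_eq_zero_iff (two_ne_zero) |>.1 this
    subst h3
    have h4 : x = 0 := by
      have : x ^ 2 = 0 := by linear_combination -he
      exact pow_eq_zero_iff (two_ne_zero) |>.1 this
    exact ⟨rfl, h4, rfl⟩
  · exfalso
    obtain ⟨X, rfl⟩ : ∃ X, x = X * e := ⟨x / e, by field_simp⟩
    obtain ⟨U, rfl⟩ : ∃ U, u = U * e := ⟨u / e, by field_simp⟩
    have e2 : e ^ 2 ≠ 0 := pow_ne_zero 2 h0
    have e3 : e ^ 3 ≠ 0 := pow_ne_zero 3 h0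
    have g : U ^ 2 * (X - r) - 2 * s * U - (X ^ 2 + r * X + r ^ 2 - 1) = 0 := by
      apply mul_left_cancel₀ e3; linear_combination h
    have gu : U * (X - r) = s := by
      apply mul_left_cancel₀ (mul_ne_zero h2 e2); linear_combination hu
    have gx : U ^ 2 = 2 * X + r := by
      apply mul_left_cancel₀ e2; linear_combination hx
    have a1 : 3 * X ^ 2 = 1 := by
      linear_combination (-1 : k) * g + 2 * U * gu - (X - r) * gx
    have a2 : 2 * X ^ 3 - 3 * r * X ^ 2 + r = 0 := by
      linear_combination (U * (X - r) + s) * gu - (X - r) ^ 2 * gx + hrs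
    have a3 : 2 * X ^ 3 = 0 := by linear_combination a2 + r * a1
    have a4 : X = 0 := by
      have := (mul_eq_zero.1 a3).resolve_left h2
      exact pow_eq_zero_iff (three_ne_zero) |>.1 this
    rw [a4] at a1; norm_num at a1

end Residue

section Integrality

open Matrix

variable {L : Type*} [Field L] (A : ValuationSubring L)

/-- The cubic form `pointCubic` as a function of a vector. -/
def cubicForm {R : Type*} [CommRing R] (r s : R) (y : Fin 3 → R) : R :=
  pointCubic r s (y 0) (y 1) (y 2)

/-- The polarization `pointCubicDeriv` as a function of two vectors. -/
def cubicDeriv {R : Type*} [CommRing R] (r s : R) (y v : Fin 3 → R) : R :=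
  pointCubicDeriv r s (y 0) (y 1) (y 2) (v 0) (v 1) (v 2)

theorem two_mul_cubicDeriv {R : Type*} [CommRing R] (r s : R) (y v : Fin 3 → R) :
    2 * cubicDeriv r s y v =
      cubicForm r s (y + v) - cubicForm r s (y - v) - 2 * cubicForm r s v :=
  two_mul_pointCubicDeriv ..

theorem cubicForm_smul {R : Type*} [CommRing R] (r s a : R) (y : Fin 3 → R) :
    cubicForm r s (a • y) = a ^ 3 * cubicForm r s y := by
  simp only [cubicForm, pointCubic, Pi.smul_apply, smul_eq_mul]; ring

theorem cubicDeriv_smul {R : Type*} [CommRing R] (r s a : R) (y v : Fin 3 → R) :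
    cubicDeriv r s (a • y) v = a ^ 2 * cubicDeriv r s y v := by
  simp only [cubicDeriv, pointCubicDeriv, Pi.smul_apply, smul_eq_mul]; ring

theorem exists_cubicDeriv_valuation_eq_one (h2 : A.valuation 2 = 1) (r s : A)
    (hrs : s ^ 2 = r ^ 3 - r) (Y : Fin 3 → A) (i : Fin 3) (hi : A.valuation (Y i : L) = 1)
    (hY : A.valuation ((cubicForm r s Y : A) : L) < 1) :
    ∃ l : Fin 3, A.valuation ((cubicDeriv r s Y (Pi.single l 1) : A) : L) = 1 := by
  by_contra! hne
  have hlt : ∀ l, IsLocalRing.residue A (cubicDeriv r s Y (Pi.single l 1)) = 0 := fun l =>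
    (A.residue_eq_zero_iff_valuation_lt_one _).2
      (lt_of_le_of_ne (A.valuation_le_one _) (hne l))
  have h2' : (2 : IsLocalRing.ResidueField A) ≠ 0 := by
    rw [← map_ofNat (IsLocalRing.residue A) 2, Ne, A.residue_eq_zero_iff_valuation_lt_one]
    exact fun h => (h.ne h2)
  have hrs' : (IsLocalRing.residue A s) ^ 2 =
      (IsLocalRing.residue A r) ^ 3 - IsLocalRing.residue A r := by
    rw [← map_pow, hrs, map_sub, map_pow]
  have hf := (A.residue_eq_zero_iff_valuation_lt_one _).2 hY
  rw [cubicForm, map_pointCubic] at hf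
  have h0 := hlt 0
  have h1 := hlt 1
  have h3 := hlt 2
  rw [cubicDeriv, map_pointCubicDeriv] at h0 h1 h3
  have := pointCubic_smooth h2' hrs' hf (by simpa using h0) (by simpa using h1) (by simpa using h3)
  have hz : ∀ i, IsLocalRing.residue A (Y i) = 0 := by
    intro i; fin_cases i
    · exact this.1
    · exact this.2.1
    · exact this.2.2
  exact ((A.residue_eq_zero_iff_valuation_lt_one _).1 (hz i)).ne hi

theorem exists_sq_le_of_one_lt (h2 : A.valuation 2 = 1) (r₁ s₁ r₂ s₂ : A)
    (hrs : s₁ ^ 2 = r₁ ^ 3 - r₁) {c : L} (hc : A.valuation c = 1)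
    {M M' : Matrix (Fin 3) (Fin 3) L} (hM : M * M' = 1)
    (hf : ∀ y, cubicForm (r₁ : L) s₁ (M *ᵥ y) = c * cubicForm (r₂ : L) s₂ y) (i j : Fin 3)
    (hmax : ∀ i', A.valuation (M i' j) ≤ A.valuation (M i j)) (h1 : 1 < A.valuation (M i j)) :
    ∃ i' j', A.valuation (M i j) ^ 2 ≤ A.valuation (M' i' j') := by
  by_contra! hlt
  have h20 : (2 : L) ≠ 0 := by
    intro h; rw [h, map_zero] at h2; exact zero_ne_one h2
  set α := M i j with hα
  have hα0 : α ≠ 0 := by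
    intro h; rw [h, map_zero] at h1; exact not_lt_zero h1
  have hint : ∀ l, α⁻¹ * M l j ∈ A := fun l => by
    rw [← A.valuation_le_one_iff, map_mul, map_inv₀]
    have := hmax l
    rw [inv_mul_le_iff₀ (zero_lt_one.trans h1), mul_one]; exact this
  let Y : Fin 3 → A := fun l => ⟨α⁻¹ * M l j, hint l⟩
  have hYM : (fun l => (Y l : L)) = α⁻¹ • (M *ᵥ Pi.single j 1) := by
    ext l; simp [Y]
  have hMY : M *ᵥ Pi.single j 1 = α • fun l => (Y l : L) := by
    rw [hYM, smul_smul, mul_inv_cancel₀ hα0, one_smul]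
  have hcoe : ((cubicForm r₁ s₁ Y : A) : L) = cubicForm (r₁ : L) s₁ (fun l => (Y l : L)) :=
    map_pointCubic A.subtype ..
  have hY : A.valuation ((cubicForm r₁ s₁ Y : A) : L) < 1 := by
    rw [hcoe, hYM, cubicForm_smul, hf, map_mul, map_mul, hc, one_mul, map_pow, map_inv₀]
    have e1 : cubicForm (r₂ : L) s₂ (Pi.single j 1) =
        ((cubicForm r₂ s₂ (Pi.single j 1) : A) : L) := by
      refine Eq.trans ?_ (map_pointCubic A.subtype ..).symm
      rw [cubicForm]
      congr 1 <;> fin_cases j <;> simp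
    rw [e1]
    exact mul_lt_one_of_lt_of_le (pow_lt_one₀ zero_le (inv_lt_one_of_one_lt₀ h1) three_ne_zero)
      (A.valuation_le_one _)
  obtain ⟨l, hl⟩ := exists_cubicDeriv_valuation_eq_one A h2 r₁ s₁ hrs Y i
    (by simp [Y, ← hα, hα0]) hY
  have hcoe' : ((cubicDeriv r₁ s₁ Y (Pi.single l 1) : A) : L) =
      cubicDeriv (r₁ : L) s₁ (fun l => (Y l : L)) (Pi.single l 1) := by
    rw [cubicDeriv, cubicDeriv, ← A.subtype_apply, map_pointCubicDeriv]
    congr 1 <;> fin_cases l <;> simp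
  have hD : cubicDeriv (r₁ : L) s₁ (M *ᵥ Pi.single j 1) (Pi.single l 1) =
      c * cubicDeriv (r₂ : L) s₂ (Pi.single j 1) (M' *ᵥ Pi.single l 1) := by
    apply mul_left_cancel₀ h20
    rw [mul_left_comm, two_mul_cubicDeriv, two_mul_cubicDeriv]
    have e1 : (Pi.single l 1 : Fin 3 → L) = M *ᵥ (M' *ᵥ Pi.single l 1) := by
      rw [mulVec_mulVec, hM, one_mulVec]
    rw [e1, ← mulVec_add, ← mulVec_sub, hf, hf, hf, ← e1]
    ring
  rw [hMY, cubicDeriv_smul] at hD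
  rw [hcoe'] at hl
  have hval := congrArg A.valuation hD
  rw [map_mul, map_mul, hl, hc, mul_one, one_mul, map_pow] at hval
  have hv : ∀ m, A.valuation ((M' *ᵥ Pi.single l 1) m) < A.valuation α ^ 2 := fun m => by
    simpa using hlt m l
  have hmem : ∀ m, (Pi.single j 1 : Fin 3 → L) m ∈ A := fun m => by
    by_cases h : m = j
    · subst h; simp
    · simp [h]
  refine hval.symm.not_lt ?_
  generalize (Pi.single j 1 : Fin 3 → L) = y at hmem ⊢
  generalize M' *ᵥ Pi.single l 1 = v at hv ⊢
  lift y to Fin 3 → A using hmem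
  have aux : ∀ (a : A) (m : Fin 3), A.valuation ((a : L) * v m) < A.valuation α ^ 2 := fun a m => by
    rw [map_mul]
    exact (mul_le_of_le_one_left' (A.valuation_le_one a)).trans_lt (hv m)
  unfold cubicDeriv pointCubicDeriv
  beta_reduce
  have a0 := aux (-r₂ * y 2 ^ 2 - 4 * s₂ * y 2 * y 0 - y 1 ^ 2 - 2 * r₂ * y 1 * y 0 -
      3 * (r₂ ^ 2 - 1) * y 0 ^ 2) 0
  have a1 := aux (y 2 ^ 2 - 2 * y 1 * y 0 - r₂ * y 0 ^ 2) 1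
  have a2 := aux (2 * y 2 * (y 1 - r₂ * y 0) - 2 * s₂ * y 0 ^ 2) 2
  exact Valuation.map_add_lt _ (Valuation.map_add_lt _ a0 a1) a2

/-- Linear changes of variables between two integral smooth cubics `pointCubic r s`
are integral. -/
theorem entries_mem_of_cubicForm_comp (h2 : A.valuation 2 = 1) (r₁ s₁ r₂ s₂ : A)
    (hrs₁ : s₁ ^ 2 = r₁ ^ 3 - r₁) (hrs₂ : s₂ ^ 2 = r₂ ^ 3 - r₂) {c : L} (hc : A.valuation c = 1)
    {M M' : Matrix (Fin 3) (Fin 3) L} (hM : M * M' = 1)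
    (hf : ∀ y, cubicForm (r₁ : L) s₁ (M *ᵥ y) = c * cubicForm (r₂ : L) s₂ y) (i j : Fin 3) :
    M i j ∈ A := by
  have hM' : M' * M = 1 := mul_eq_one_comm.1 hM
  have hc0 : c ≠ 0 := by
    rintro rfl; rw [map_zero] at hc; exact zero_ne_one hc
  have hf' : ∀ y, cubicForm (r₂ : L) s₂ (M' *ᵥ y) = c⁻¹ * cubicForm (r₁ : L) s₁ y := by
    intro y
    have := hf (M' *ᵥ y)
    rw [mulVec_mulVec, hM, one_mulVec] at this
    rw [this, inv_mul_cancel_left₀ hc0]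
  have hmaxex : ∀ N : Matrix (Fin 3) (Fin 3) L, ∃ i j, ∀ i' j',
      A.valuation (N i' j') ≤ A.valuation (N i j) := fun N => by
    obtain ⟨p, hp⟩ := Finite.exists_max (fun p : Fin 3 × Fin 3 => A.valuation (N p.1 p.2))
    exact ⟨p.1, p.2, fun i' j' => hp (i', j')⟩
  obtain ⟨a, b, hab⟩ := hmaxex M
  obtain ⟨a', b', hab'⟩ := hmaxex M'
  rw [← A.valuation_le_one_iff]
  refine (hab i j).trans ?_
  by_contra! h1
  obtain ⟨i', j', h3⟩ := exists_sq_le_of_one_lt A h2 r₁ s₁ r₂ s₂ hrs₁ hc hM hf a b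
    (fun l => hab l b) h1
  have h4 := h3.trans (hab' i' j')
  have h5 : A.valuation (M a b) < A.valuation (M a b) ^ 2 := lt_self_pow₀ h1 one_lt_two
  have h6 : 1 < A.valuation (M' a' b') := h1.trans (h5.trans_le h4)
  obtain ⟨i'', j'', h7⟩ := exists_sq_le_of_one_lt A h2 r₂ s₂ r₁ s₁ hrs₂
    (by rw [map_inv₀, hc, inv_one]) hM' hf' a' b' (fun l => hab' l b') h6
  have h8 := h7.trans (hab i'' j'')
  have h9 : A.valuation (M' a' b') < A.valuation (M' a' b') ^ 2 := lt_self_pow₀ h6 one_lt_two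
  exact lt_irrefl _ ((h5.trans_le h4).trans (h9.trans_le h8))

end Integrality

section LocalDescent

open Matrix

variable {F L : Type*} [Field F] [Field L] [Algebra F L] (A : ValuationSubring L)

/-- The lattice spanned over `A` by the columns of `G` has a basis defined over `F`. -/
def LocallySplit (F : Type*) {L : Type*} [Field F] [Field L] [Algebra F L]
    (A : ValuationSubring L) (G : Matrix (Fin 3) (Fin 3) L) : Prop :=
  ∃ B : Matrix (Fin 3) (Fin 3) F, (∀ i j, (G⁻¹ * B.map (algebraMap F L)) i j ∈ A) ∧
    A.valuation (G⁻¹ * B.map (algebraMap F L)).det = 1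

theorem entries_mem_and_det_of_sub_one {E : Matrix (Fin 3) (Fin 3) L}
    (hE : ∀ i j, A.valuation ((E - 1) i j) < 1) :
    (∀ i j, E i j ∈ A) ∧ A.valuation E.det = 1 := by
  have h1 : ∀ i j, (1 : Matrix (Fin 3) (Fin 3) L) i j ∈ A := fun i j => by
    rw [one_apply]; split_ifs
    · exact A.one_mem
    · exact A.zero_mem
  have hmem : ∀ i j, E i j ∈ A := fun i j => by
    have := A.add_mem _ _ ((A.valuation_le_one_iff _).1 (hE i j).le) (h1 i j)
    simpa using this
  refine ⟨hmem, ?_⟩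
  let E' : Matrix (Fin 3) (Fin 3) A := fun i j => ⟨E i j, hmem i j⟩
  have hres : E'.map (IsLocalRing.residue A) = 1 := by
    ext i j
    rw [map_apply, ← sub_eq_zero]
    have h2 : (1 : Matrix (Fin 3) (Fin 3) (IsLocalRing.ResidueField A)) i j =
        IsLocalRing.residue A ((1 : Matrix (Fin 3) (Fin 3) A) i j) := by
      rw [one_apply, one_apply]; split_ifs <;> simp
    rw [h2, ← map_sub, A.residue_eq_zero_iff_valuation_lt_one]
    convert hE i j
    rw [Matrix.sub_apply, one_apply, one_apply]
    split_ifs <;> rfl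
  have hdet : IsLocalRing.residue A E'.det ≠ 0 := by
    rw [RingHom.map_det, RingHom.mapMatrix_apply, hres, det_one]; exact one_ne_zero
  have hcoe : ((E'.det : A) : L) = E.det := by
    rw [← A.subtype_apply, RingHom.map_det]; rfl
  rw [Ne, A.residue_eq_zero_iff_valuation_lt_one, hcoe] at hdet
  have := A.valuation_le_one E'.det
  rw [hcoe] at this
  exact le_antisymm this (not_lt.1 hdet)

theorem valuation_sum_lt {Γ : Type*} [LinearOrderedCommGroupWithZero Γ] (w : Valuation L Γ)
    {b : Γ} (hb : 0 < b) {f : Fin 3 → L} (h : ∀ i, w (f i) < b) : w (∑ i, f i) < b :=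
  w.map_sum_lt hb.ne' fun i _ => h i

theorem locallySplit_of_dense {η : L} (hη0 : η ≠ 0) (hη : A.valuation η < 1)
    (hd : ∀ x ε : L, ε ≠ 0 → ∃ a : F, A.valuation (x - algebraMap F L a) ≤ A.valuation ε)
    {G : Matrix (Fin 3) (Fin 3) L} (hG : G.det ≠ 0) : LocallySplit F A G := by
  obtain ⟨p, hp⟩ := Finite.exists_max (fun p : Fin 3 × Fin 3 => A.valuation (G⁻¹ p.1 p.2))
  have hGG : G⁻¹ * G = 1 := nonsing_inv_mul _ (isUnit_iff_ne_zero.2 hG)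
  have hβ : G⁻¹ p.1 p.2 ≠ 0 := by
    intro h0
    have hz : G⁻¹ = 0 := by
      ext i j
      have := hp (i, j)
      rw [h0, map_zero, le_zero_iff, map_eq_zero] at this
      exact this
    rw [hz, zero_mul] at hGG
    exact zero_ne_one hGG
  choose B hB using fun i j => hd (G i j) (η / G⁻¹ p.1 p.2) (div_ne_zero hη0 hβ)
  refine ⟨fun i j => B i j, ?_⟩
  apply entries_mem_and_det_of_sub_one
  intro i j
  rw [← hGG, ← mul_sub, mul_apply]
  refine valuation_sum_lt _ zero_lt_one fun k => ?_
  rw [map_mul]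
  have h1 := hB k j
  rw [← Valuation.map_sub_swap, map_div₀] at h1
  refine (mul_le_mul' (hp (i, k)) h1).trans_lt ?_
  rw [mul_div_cancel₀ _ ((map_ne_zero _).2 hβ)]
  exact hη

variable (σ : L ≃ₐ[F] L)

theorem exists_matrix_of_map_eq (hfix : ∀ x : L, σ x = x → ∃ a : F, algebraMap F L a = x)
    {G : Matrix (Fin 3) (Fin 3) L} (h : ∀ i j, σ (G i j) = G i j) :
    ∃ B : Matrix (Fin 3) (Fin 3) F, B.map (algebraMap F L) = G := by
  choose B hB using fun i j => hfix _ (h i j)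
  exact ⟨fun i j => B i j, by ext i j; exact hB i j⟩

/-- Descent by averaging, when the cocycle of the lattice is close to trivial. -/
theorem locallySplit_of_cocycle_near_one
    (hfix : ∀ x : L, σ x = x → ∃ a : F, algebraMap F L a = x)
    (hσ3 : ∀ x, σ (σ (σ x)) = x) (hw : ∀ x, A.valuation (σ x) = A.valuation x)
    {G M : Matrix (Fin 3) (Fin 3) L} (hG : G.det ≠ 0) (hM : G.map σ = G * M)
    {c : L} (hc : c + σ c + σ (σ c) = 1)
    (h : ∀ i j, A.valuation (c * (M - 1) i j) < 1) : LocallySplit F A G := by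
  have hGG : G⁻¹ * G = 1 := nonsing_inv_mul _ (isUnit_iff_ne_zero.2 hG)
  obtain ⟨B, hB⟩ := exists_matrix_of_map_eq σ hfix
    (G := c • G + (c • G).map σ + ((c • G).map σ).map σ) (by
      intro i j
      simp only [Matrix.add_apply, map_apply, Matrix.smul_apply, smul_eq_mul, map_add, map_mul, hσ3]
      ring)
  refine ⟨B, ?_⟩
  apply entries_mem_and_det_of_sub_one
  have hmap : ∀ (a : L) (X : Matrix (Fin 3) (Fin 3) L), (a • X).map σ = σ a • X.map σ :=
    fun a X => by ext i j; simp
  have hmul : ∀ X Y : Matrix (Fin 3) (Fin 3) L, (X * Y).map σ = X.map σ * Y.map σ := fun X Y => by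
    ext i j; simp [mul_apply]
  have hone : (1 : Matrix (Fin 3) (Fin 3) L).map σ = 1 := by simp
  have h1 : G⁻¹ * B.map (algebraMap F L) - 1 = σ c • (M - 1) +
      (σ (σ c) • (M - 1) + M * (σ (σ c) • (M - 1).map σ)) := by
    rw [hB, hmap, hmap, hM, hmul, hM]
    have e1 : (M - 1).map σ = M.map σ - 1 := by
      ext i j
      rw [map_apply, Matrix.sub_apply, Matrix.sub_apply, map_apply, map_sub, one_apply]
      split_ifs <;> simp
    rw [e1]
    conv_lhs => rw [← one_smul L (1 : Matrix (Fin 3) (Fin 3) L), ← hc]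
    simp only [mul_add, mul_smul_comm, add_smul, smul_sub, hGG, mul_sub, mul_one]
    rw [← mul_assoc, ← mul_assoc, ← mul_assoc, hGG, one_mul]
    abel
  have hMA : ∀ i j, A.valuation (M i j) ≤ 1 := by
    have hc1 : 1 ≤ A.valuation c := by
      by_contra! hlt
      have : A.valuation (c + σ c + σ (σ c)) < 1 :=
        Valuation.map_add_lt _ (Valuation.map_add_lt _ hlt (by rwa [hw])) (by rwa [hw, hw])
      rw [hc, map_one] at this
      exact lt_irrefl _ this
    intro i j
    have h2 : A.valuation ((M - 1) i j) ≤ 1 := by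
      have := h i j
      rw [map_mul] at this
      exact (le_mul_of_one_le_left' hc1).trans this.le
    have h3 : A.valuation ((1 : Matrix (Fin 3) (Fin 3) L) i j) ≤ 1 := by
      rw [one_apply]; split_ifs <;> simp
    have := A.valuation.map_add_le h2 h3
    simpa using this
  intro i j
  rw [h1]
  refine Valuation.map_add_lt _ ?_ (Valuation.map_add_lt _ ?_ ?_)
  · have := h i j
    rwa [Matrix.smul_apply, smul_eq_mul, map_mul, hw, ← map_mul]
  · have := h i j
    rwa [Matrix.smul_apply, smul_eq_mul, map_mul, hw, hw, ← map_mul]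
  · rw [mul_apply]
    refine valuation_sum_lt _ zero_lt_one fun k => ?_
    rw [map_mul]
    refine (mul_le_of_le_one_left' (hMA i k)).trans_lt ?_
    have := h k j
    rwa [Matrix.smul_apply, smul_eq_mul, map_apply, map_mul, hw, hw, hw, ← map_mul]

/-- Descent at tame places. -/
theorem locallySplit_of_three_unit
    (hfix : ∀ x : L, σ x = x → ∃ a : F, algebraMap F L a = x)
    (hσ3 : ∀ x, σ (σ (σ x)) = x) (hw : ∀ x, A.valuation (σ x) = A.valuation x)
    {G M : Matrix (Fin 3) (Fin 3) L} (hG : G.det ≠ 0) (hM : G.map σ = G * M)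
    (hMA : ∀ i j, M i j ∈ A) {θ : L} {ω : F} (hω : ω ^ 2 + ω + 1 = 0)
    (hθ : σ θ = algebraMap F L ω * θ) (hθ1 : A.valuation θ = 1) (h3 : A.valuation 3 = 1) :
    LocallySplit F A G := by
  have hGG : G⁻¹ * G = 1 := nonsing_inv_mul _ (isUnit_iff_ne_zero.2 hG)
  have hGM : ∀ X : Matrix (Fin 3) (Fin 3) L, G⁻¹ * (G * X) = X := fun X => by
    rw [← mul_assoc, hGG, one_mul]
  have hmul : ∀ X Y : Matrix (Fin 3) (Fin 3) L, (X * Y).map σ = X.map σ * Y.map σ := fun X Y => by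
    ext i j; simp [mul_apply]
  have h30 : (3 : L) ≠ 0 := by
    intro h; rw [h, map_zero] at h3; exact zero_ne_one h3
  have hθ0 : θ ≠ 0 := by
    rintro rfl; rw [map_zero] at hθ1; exact zero_ne_one hθ1
  have hω' : (algebraMap F L ω) ^ 2 + algebraMap F L ω + 1 = 0 := by
    have := congrArg (algebraMap F L) hω
    simpa using this
  generalize hζ : algebraMap F L ω = ζ at hω' hθ
  have hσζ : σ ζ = ζ := by rw [← hζ]; simp
  have hζ1 : A.valuation ζ = 1 := by
    have : ζ ^ 3 = 1 := by linear_combination (ζ - 1) * hω'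
    have := congrArg A.valuation this
    rw [map_pow, map_one] at this
    exact (pow_eq_one_iff_of_nonneg zero_le three_ne_zero).1 this
  -- traces of the columns twisted by powers of `θ`
  choose B hB using fun n : Fin 3 => exists_matrix_of_map_eq σ hfix
    (G := θ ^ (n : ℕ) • G + (θ ^ (n : ℕ) • G).map σ + ((θ ^ (n : ℕ) • G).map σ).map σ) (by
      intro i j
      simp only [Matrix.add_apply, map_apply, Matrix.smul_apply, smul_eq_mul, map_add, map_mul, hσ3]
      ring)
  have hmap : ∀ (a : L) (X : Matrix (Fin 3) (Fin 3) L), (a • X).map σ = σ a • X.map σ :=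
    fun a X => by ext i j; simp
  have hGB : ∀ n, G⁻¹ * (B n).map (algebraMap F L) = θ ^ (n : ℕ) •
      (1 + ζ ^ (n : ℕ) • M + (ζ ^ 2) ^ (n : ℕ) • (M * M.map σ)) := by
    intro n
    have e1 : σ (θ ^ (n : ℕ)) = θ ^ (n : ℕ) * ζ ^ (n : ℕ) := by rw [map_pow, hθ, mul_pow, mul_comm]
    have e2 : σ (σ (θ ^ (n : ℕ))) = θ ^ (n : ℕ) * (ζ ^ 2) ^ (n : ℕ) := by
      rw [map_pow, hθ, map_pow, map_mul, hσζ, hθ, ← mul_pow, ← mul_assoc, ← pow_two, mul_comm]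
    rw [hB, hmap, hmap, hM, hmul, hM, e2, e1, smul_add, smul_add, smul_smul, smul_smul, mul_add,
      mul_add, mul_smul_comm, mul_smul_comm, mul_smul_comm, hGG, hGM, mul_assoc, hGM]
  have hint : ∀ n i j, (G⁻¹ * (B n).map (algebraMap F L)) i j ∈ A := by
    intro n i j
    have hm1 : ∀ i j, (1 : Matrix (Fin 3) (Fin 3) L) i j ∈ A := fun i j => by
      rw [one_apply]; split_ifs
      · exact A.one_mem
      · exact A.zero_mem
    have hθA : θ ∈ A := (A.valuation_le_one_iff _).1 hθ1.le
    have hζA : ζ ∈ A := (A.valuation_le_one_iff _).1 hζ1.le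
    have hσM : ∀ i j, σ (M i j) ∈ A := fun i j => by
      rw [← A.valuation_le_one_iff, hw, A.valuation_le_one_iff]; exact hMA i j
    rw [hGB]
    simp only [Matrix.smul_apply, Matrix.add_apply, smul_eq_mul]
    refine A.mul_mem _ _ (pow_mem hθA _) (A.add_mem _ _ (A.add_mem _ _ (hm1 i j)
      (A.mul_mem _ _ (pow_mem hζA _) (hMA i j))) (A.mul_mem _ _ (pow_mem (pow_mem hζA _) _) ?_))
    rw [mul_apply]
    exact sum_mem fun k _ => A.mul_mem _ _ (hMA i k) (hσM k j)
  have hsum : (1 : Matrix (Fin 3) (Fin 3) L) = ∑ n : Fin 3, (3⁻¹ * (θ ^ (n : ℕ))⁻¹) •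
      (G⁻¹ * (B n).map (algebraMap F L)) := by
    simp only [Fin.sum_univ_three, hGB, smul_smul]
    have e : ∀ n : ℕ, 3⁻¹ * (θ ^ n)⁻¹ * θ ^ n = 3⁻¹ := fun n => by
      rw [inv_mul_cancel_right₀ (pow_ne_zero n hθ0)]
    rw [e, e, e]
    ext i j
    simp only [Matrix.add_apply, Matrix.smul_apply, smul_eq_mul, Fin.val_zero, Fin.val_one, Fin.val_two]
    field_simp
    linear_combination (-M i j - (M * M.map σ) i j * (ζ ^ 2 - ζ + 1)) * hω'
  -- multilinear expansion of the determinant, along columns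
  let V : Fin 3 → Fin 3 → (Fin 3 → L) := fun i n j => (G⁻¹ * (B n).map (algebraMap F L)) j i
  have hdet : (1 : L) = ∑ r : Fin 3 → Fin 3, (∏ i, (3⁻¹ * (θ ^ (r i : ℕ))⁻¹)) *
      (Matrix.of fun i => V i (r i)).det := by
    have e0 : (1 : Matrix (Fin 3) (Fin 3) L)ᵀ =
        fun i => ∑ n : Fin 3, (3⁻¹ * (θ ^ (n : ℕ))⁻¹) • V i n := by
      ext i j
      conv_lhs => rw [transpose_apply, hsum]
      rw [Finset.sum_apply, Matrix.sum_apply]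
      rfl
    have e1 : detRowAlternating (fun i : Fin 3 => ∑ n : Fin 3, (3⁻¹ * (θ ^ (n : ℕ))⁻¹) • V i n) =
        ∑ r : Fin 3 → Fin 3, detRowAlternating fun i => (3⁻¹ * (θ ^ (r i : ℕ))⁻¹) • V i (r i) :=
      (detRowAlternating (R := L) (n := Fin 3)).toMultilinearMap.map_sum _
    have e2 : detRowAlternating ((1 : Matrix (Fin 3) (Fin 3) L)ᵀ) = (1 : L) := by
      change det _ = _
      rw [det_transpose, det_one]
    rw [← e2, e0, e1]
    refine Finset.sum_congr rfl fun r _ => ?_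
    exact (detRowAlternating (R := L) (n := Fin 3)).toMultilinearMap.map_smul_univ _ _
  obtain ⟨r, hr⟩ : ∃ r : Fin 3 → Fin 3, 1 ≤ A.valuation (Matrix.of fun i => V i (r i)).det := by
    by_contra! hlt
    have : A.valuation (1 : L) < 1 := by
      rw [hdet]
      refine Valuation.map_sum_lt _ one_ne_zero fun r _ => ?_
      rw [map_mul, map_prod]
      simp only [map_mul, map_inv₀, h3, map_pow, hθ1, one_pow, inv_one, mul_one,
        Finset.prod_const_one, one_mul]
      exact hlt r
    rw [map_one] at this
    exact lt_irrefl _ this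
  refine ⟨fun j i => B (r i) j i, ?_⟩
  have hE : G⁻¹ * (Matrix.map (fun j i => B (r i) j i) (algebraMap F L)) =
      (Matrix.of fun i => V i (r i))ᵀ := by
    ext i j
    rfl
  rw [hE, det_transpose]
  refine ⟨fun i j => hint (r j) i j, le_antisymm ?_ hr⟩
  have hcoe : (Matrix.of fun i => V i (r i)).det =
      ((Matrix.of fun i j => (⟨V i (r i) j, hint _ _ _⟩ : A)).det : A) := by
    rw [← A.subtype_apply, RingHom.map_det]; rfl
  rw [hcoe]
  exact A.valuation_le_one _

end LocalDescent

section CollinearTriple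

open Matrix

/-- Three distinct collinear points `(xᵢ, μ xᵢ + b)` of the curve `y² = x³ - x`. -/
structure CollinearTriple (K : Type*) [Field K] where
  (x₁ x₂ x₃ μ b : K)
  sum_eq : x₁ + x₂ + x₃ = μ ^ 2
  pair_eq : x₁ * x₂ + x₁ * x₃ + x₂ * x₃ = -1 - 2 * μ * b
  prod_eq : x₁ * x₂ * x₃ = b ^ 2
  ne₁₂ : x₁ ≠ x₂
  ne₁₃ : x₁ ≠ x₃
  ne₂₃ : x₂ ≠ x₃

namespace CollinearTriple

variable {K : Type*} [Field K] (T : CollinearTriple K)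

/-- Cyclic rotation of a triple. -/
def rotate : CollinearTriple K where
  x₁ := T.x₂
  x₂ := T.x₃
  x₃ := T.x₁
  μ := T.μ
  b := T.b
  sum_eq := by linear_combination T.sum_eq
  pair_eq := by linear_combination T.pair_eq
  prod_eq := by linear_combination T.prod_eq
  ne₁₂ := T.ne₂₃
  ne₁₃ := T.ne₁₂.symm
  ne₂₃ := T.ne₁₃.symm

/-- The first ordinate. -/
def y₁ : K := T.μ * T.x₁ + T.b

/-- The last ordinate. -/
def y₃ : K := T.μ * T.x₃ + T.b

/-- The slope of the line through the first point and the opposite of the last one. -/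
def k : K := (T.y₁ + T.y₃) / (T.x₁ - T.x₃)

/-- The abscissa of the difference of the first and last points. -/
def r : K := T.k ^ 2 - T.x₁ - T.x₃

/-- The ordinate of the difference of the first and last points. -/
def s : K := -T.y₁ - T.k * (T.r - T.x₁)

theorem y₁_sq : T.y₁ ^ 2 = T.x₁ ^ 3 - T.x₁ := by
  rw [y₁]
  linear_combination -T.x₁ ^ 2 * T.sum_eq + T.x₁ * T.pair_eq - T.prod_eq

theorem y₃_sq : T.y₃ ^ 2 = T.x₃ ^ 3 - T.x₃ := by
  rw [y₃]
  linear_combination -T.x₃ ^ 2 * T.sum_eq + T.x₃ * T.pair_eq - T.prod_eq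

theorem sub_ne_zero : T.x₁ - T.x₃ ≠ 0 := _root_.sub_ne_zero.2 T.ne₁₃

theorem k_mul : T.k * (T.x₁ - T.x₃) = T.y₁ + T.y₃ := div_mul_cancel₀ _ T.sub_ne_zero

theorem two_b : 2 * T.b = T.k * (T.x₁ - T.x₃) - T.μ * (T.x₁ + T.x₃) := by
  rw [k_mul, y₁, y₃]; ring

theorem k_mul_μ : T.k * T.μ * (T.x₁ - T.x₃) =
    T.x₁ ^ 2 + T.x₁ * T.x₃ + T.x₃ ^ 2 - 1 := by
  linear_combination T.μ * T.k_mul + T.μ * (by rw [y₁, y₃]; ring :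
    T.y₁ + T.y₃ = T.μ * (T.x₁ + T.x₃) + 2 * T.b) - (T.x₁ + T.x₃) * T.sum_eq + T.pair_eq

theorem s_sq : T.s ^ 2 = T.r ^ 3 - T.r := by
  have h1 := T.y₁_sq
  have h3 := T.y₃_sq
  have hk := T.k_mul
  have hd := T.sub_ne_zero
  have hy : T.y₃ = T.k * (T.x₁ - T.x₃) - T.y₁ := by rw [hk]; ring
  rw [hy] at h3
  have hA : T.k ^ 2 * (T.x₁ - T.x₃) - 2 * T.k * T.y₁ =
      -(T.x₁ ^ 2 + T.x₁ * T.x₃ + T.x₃ ^ 2 - 1) := by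
    refine mul_right_cancel₀ hd ?_
    linear_combination h3 - h1
  simp only [s, r]
  linear_combination h1 - (T.k ^ 2 - T.x₁ - T.x₃ - T.x₁) * hA

/-- The covering form attached to a triple, in the coordinates `(z, s₁, s₃)`. -/
def form (v : Fin 3 → K) : K :=
  (v 1 + T.μ * v 0) * (-v 1 - v 2) * (v 2 + T.μ * v 0) - v 0 ^ 2 *
    ((v 1 + T.μ * v 0) * T.x₁ + (-v 1 - v 2) * T.x₂ + (v 2 + T.μ * v 0) * T.x₃) -
    2 * T.b * v 0 ^ 3

/-- The coordinates in which the covering form becomes a standard cubic. -/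
def frame : Matrix (Fin 3) (Fin 3) K :=
  !![-T.k, 0, 1; T.k ^ 2 - T.x₃, 1, -T.k; T.x₁ - T.k ^ 2, -1, T.k]

theorem det_frame : T.frame.det = -(T.x₁ - T.x₃) := by
  rw [frame, det_fin_three]
  simp

theorem form_frame (y : Fin 3 → K) :
    T.form (T.frame *ᵥ y) = -(T.x₁ - T.x₃) * cubicForm T.r T.s y := by
  have h2 : T.x₂ = T.μ ^ 2 - T.x₁ - T.x₃ := by linear_combination T.sum_eq
  have hA := T.k_mul_μ
  have hs : 2 * T.s = -(T.k + T.μ) * (T.x₁ - T.x₃) - 2 * T.k * (T.r - T.x₁) := by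
    have := T.two_b
    rw [s, y₁]; linear_combination -this
  simp only [form, frame, cubicForm, pointCubic, mulVec, dotProduct, Fin.sum_univ_three, h2,
    T.two_b, hs]
  simp only [r, of_apply, cons_val', cons_val_zero, cons_val_one, cons_val_two, empty_val',
    cons_val_fin_one, head_cons, tail_cons, head_fin_const]
  linear_combination ((T.x₁ - T.x₃) * y 0 ^ 3) * hA

/-- A coordinate change turning the covering form into a standard cubic form. -/
structure IsFrame (G : Matrix (Fin 3) (Fin 3) K) (κ r s : K) : Prop where
  curve : s ^ 2 = r ^ 3 - r
  ne_zero : κ ≠ 0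
  det_eq : G.det = κ
  form_eq : ∀ y, T.form (G *ᵥ y) = κ * cubicForm r s y

theorem isFrame_frame : T.IsFrame T.frame (-(T.x₁ - T.x₃)) T.r T.s where
  curve := T.s_sq
  ne_zero := neg_ne_zero.2 T.sub_ne_zero
  det_eq := T.det_frame
  form_eq := T.form_frame

variable {T}

theorem form_smul (c : K) (v : Fin 3 → K) : T.form (c • v) = c ^ 3 * T.form v := by
  simp only [form, Pi.smul_apply, smul_eq_mul]; ring

theorem IsFrame.smul {G : Matrix (Fin 3) (Fin 3) K} {κ r s : K} (h : T.IsFrame G κ r s) {c : K}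
    (hc : c ≠ 0) : T.IsFrame (c • G) (c ^ 3 * κ) r s where
  curve := h.curve
  ne_zero := mul_ne_zero (pow_ne_zero _ hc) h.ne_zero
  det_eq := by rw [det_smul, h.det_eq]; rfl
  form_eq y := by rw [smul_mulVec, form_smul, h.form_eq, mul_assoc]

/-- The coordinate change for translation by the point `(0, 0)`. -/
def translation (r s : K) : Matrix (Fin 3) (Fin 3) K :=
  !![0, -1, 0; 1, 0, 0; -s / r ^ 2, s / r, 1 / r]

theorem det_translation (r s : K) : (translation r s).det = 1 / r := by
  rw [translation, det_fin_three]
  simp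

theorem IsFrame.mul_translation {G : Matrix (Fin 3) (Fin 3) K} {κ r s : K}
    (h : T.IsFrame G κ r s) (hr : r ≠ 0) :
    T.IsFrame (G * translation r s) (κ / r) (-1 / r) (s / r ^ 2) where
  curve := by
    field_simp
    linear_combination h.curve
  ne_zero := div_ne_zero h.ne_zero hr
  det_eq := by rw [det_mul, h.det_eq, det_translation, mul_one_div]
  form_eq y := by
    rw [← mulVec_mulVec, h.form_eq, div_mul_eq_mul_div, mul_div_assoc]
    congr 1
    simp only [cubicForm, translation, pointCubic, mulVec, dotProduct, Fin.sum_univ_three,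
      of_apply, cons_val', cons_val_zero, cons_val_one, cons_val_two, empty_val',
      cons_val_fin_one, head_cons, tail_cons, head_fin_const]
    field_simp
    linear_combination (y 0 ^ 3 - y 0 ^ 2 * y 1 * r + y 0 * y 1 ^ 2 * r ^ 2 - y 1 ^ 3 * r ^ 3) * h.curve

variable (T)

/-- The cyclic rotation in the coordinates `(z, s₁, s₃)`. -/
def rot : Matrix (Fin 3) (Fin 3) K := !![1, 0, 0; -T.μ, -1, -1; 0, 1, 0]

theorem form_rotate (v : Fin 3 → K) : T.rotate.form (T.rot *ᵥ v) = T.form v := by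
  simp only [form, rot, rotate, mulVec, dotProduct, Fin.sum_univ_three,
      of_apply, cons_val', cons_val_zero, cons_val_one, cons_val_two, empty_val',
      cons_val_fin_one, head_cons, tail_cons, head_fin_const]
  ring

theorem det_rot : T.rot.det = 1 := by
  rw [rot, det_fin_three]
  simp

end CollinearTriple

end CollinearTriple

section Above

open IsDedekindDomain

variable {O F L : Type*} [CommRing O] [IsDedekindDomain O] [Field F] [Algebra O F]
  [IsFractionRing O F] [Field L] [Algebra F L]

/-- A valuation ring of `L` lying above a finite place of `F`. -/
def ValuationSubring.IsAbove (A : ValuationSubring L) (v : HeightOneSpectrum O)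
    (F : Type*) [Field F] [Algebra O F] [IsFractionRing O F] [Algebra F L] : Prop :=
  ∀ x : F, algebraMap F L x ∈ A ↔ v.valuation F x ≤ 1

variable (F L) in
theorem exists_isAbove (v : HeightOneSpectrum O) :
    ∃ A : ValuationSubring L, A.IsAbove v F := by
  let V : ValuationSubring F := (v.valuation F).valuationSubring
  obtain ⟨A, hA⟩ := (V.toLocalSubring.map (algebraMap F L)).exists_le_valuationSubring
  obtain ⟨hle, hloc⟩ := hA
  refine ⟨A, fun x => ⟨fun hx => ?_, fun hx => hle ⟨x, hx, rfl⟩⟩⟩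
  by_contra! hlt
  have hx0 : x ≠ 0 := by rintro rfl; simp at hlt
  have hinv : v.valuation F x⁻¹ ≤ 1 := by
    rw [map_inv₀]; exact inv_le_one_of_one_le₀ hlt.le
  have hmem : algebraMap F L x⁻¹ ∈ (V.toLocalSubring.map (algebraMap F L)).toSubring :=
    ⟨x⁻¹, hinv, rfl⟩
  have hu : IsUnit (Subring.inclusion hle ⟨_, hmem⟩) := by
    refine isUnit_iff_exists_inv.2 ⟨⟨algebraMap F L x, hx⟩, Subtype.ext ?_⟩
    change algebraMap F L x⁻¹ * algebraMap F L x = 1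
    rw [← map_mul, inv_mul_cancel₀ hx0, map_one]
  obtain ⟨⟨_, y, hy, rfl⟩, h⟩ := isUnit_iff_exists_inv.1 (hloc.map_nonunit _ hu)
  have h2 : algebraMap F L x⁻¹ * algebraMap F L y = 1 := congrArg Subtype.val h
  rw [← map_mul, ← map_one (algebraMap F L)] at h2
  have h3 : y = x := by
    have := (algebraMap F L).injective h2
    rwa [inv_mul_eq_one₀ hx0, eq_comm] at this
  rw [h3] at hy
  exact hlt.not_ge hy

namespace ValuationSubring

namespace IsAbove

variable {A : ValuationSubring L} {v : HeightOneSpectrum O}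

theorem valuation_le_iff (h : A.IsAbove v F) {x y : F} :
    A.valuation (algebraMap F L x) ≤ A.valuation (algebraMap F L y) ↔
      v.valuation F x ≤ v.valuation F y := by
  rcases eq_or_ne y 0 with rfl | hy
  · simp
  · have h1 : A.valuation (algebraMap F L y) ≠ 0 := by simpa using hy
    have h2 : v.valuation F y ≠ 0 := by simpa using hy
    rw [← div_le_one₀ (zero_lt_iff.2 h1), ← div_le_one₀ (zero_lt_iff.2 h2), ← map_div₀,
      ← map_div₀, ← map_div₀, A.valuation_le_one_iff]
    exact h _

theorem valuation_lt_iff (h : A.IsAbove v F) {x y : F} :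
    A.valuation (algebraMap F L x) < A.valuation (algebraMap F L y) ↔
      v.valuation F x < v.valuation F y := by
  rw [← not_le, ← not_le, h.valuation_le_iff]

theorem valuation_lt_one_iff (h : A.IsAbove v F) {x : F} :
    A.valuation (algebraMap F L x) < 1 ↔ v.valuation F x < 1 := by
  have := h.valuation_lt_iff (x := x) (y := 1)
  simpa using this

theorem valuation_le_one_iff (h : A.IsAbove v F) {x : F} :
    A.valuation (algebraMap F L x) ≤ 1 ↔ v.valuation F x ≤ 1 := by
  have := h.valuation_le_iff (x := x) (y := 1)
  simpa using this

theorem valuation_eq_one_iff (h : A.IsAbove v F) {x : F} :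
    A.valuation (algebraMap F L x) = 1 ↔ v.valuation F x = 1 := by
  rw [le_antisymm_iff, h.valuation_le_one_iff, le_antisymm_iff, ← not_lt (b := 1),
    h.valuation_lt_one_iff, not_lt]

end IsAbove

end ValuationSubring

theorem finite_not_mem_above [Algebra.IsAlgebraic F L] (x : L) :
    {v : HeightOneSpectrum O | ∃ A : ValuationSubring L, A.IsAbove v F ∧ x ∉ A}.Finite := by
  let _ : Algebra O L := ((algebraMap F L).comp (algebraMap O F)).toAlgebra
  have : IsScalarTower O F L := IsScalarTower.of_algebraMap_eq fun _ => rfl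
  have hx : IsAlgebraic O x :=
    (IsFractionRing.isAlgebraic_iff O F L).2 (Algebra.IsAlgebraic.isAlgebraic (R := F) x)
  obtain ⟨N, hN, hint⟩ := hx.exists_integral_multiple
  have hfin := Ideal.finite_factors (I := Ideal.span {N}) (by simpa using hN)
  refine hfin.subset ?_
  rintro v ⟨A, hA, hxA⟩
  rw [Set.mem_ofPred_eq, Ideal.dvd_span_singleton]
  by_contra hNv
  apply hxA
  have h1 : v.valuation F (algebraMap O F N) = 1 := by
    rw [HeightOneSpectrum.valuation_eq_one_iff_notMem]; exact hNv
  have hinv : algebraMap F L (algebraMap O F N)⁻¹ ∈ A := (hA _).2 (by rw [map_inv₀, h1, inv_one])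
  have hNx : N • x ∈ A := by
    have hO : ∀ a : O, algebraMap O L a ∈ A := fun a =>
      (hA _).2 (HeightOneSpectrum.valuation_le_one v a)
    let f : O →+* A := (algebraMap O L).codRestrict A.toSubring hO
    obtain ⟨q, hq, hq0⟩ := hint
    have : IsIntegral A (N • x) := ⟨q.map f, hq.map f, by
      rw [Polynomial.eval₂_map]; exact hq0⟩
    obtain ⟨a, ha⟩ := IsIntegrallyClosed.isIntegral_iff.1 this
    rw [← ha]; exact a.2
  have := A.mul_mem _ _ hinv hNx
  rw [Algebra.smul_def] at this
  change _ * (algebraMap F L (algebraMap O F N) * x) ∈ A at this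
  rwa [← mul_assoc, ← map_mul, inv_mul_cancel₀, map_one, one_mul] at this
  simpa using hN

end Above

section Kummer

open Matrix

/-- A cubic Kummer extension `L = F(θ)`, `θ³ = p`, with `σ θ = ω θ`. -/
structure CubicKummer (F L : Type*) [Field F] [Field L] [Algebra F L] where
  (σ : L ≃ₐ[F] L) (ω p : F) (θ : L)
  hω : ω ^ 2 + ω + 1 = 0
  hσ : σ θ = algebraMap F L ω * θ
  hθ : θ ^ 3 = algebraMap F L p
  span : ∀ x : L, ∃ a b c : F,
    x = algebraMap F L a + algebraMap F L b * θ + algebraMap F L c * θ ^ 2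
  indep : ∀ a b c : F,
    algebraMap F L a + algebraMap F L b * θ + algebraMap F L c * θ ^ 2 = 0 →
      a = 0 ∧ b = 0 ∧ c = 0

namespace CubicKummer

variable {F L : Type*} [Field F] [Field L] [Algebra F L] (K : CubicKummer F L)

theorem σ_algebraMap (a : F) : K.σ (algebraMap F L a) = algebraMap F L a := K.σ.commutes a

theorem hω' : algebraMap F L K.ω ^ 2 + algebraMap F L K.ω + 1 = 0 := by
  have := congrArg (algebraMap F L) K.hω
  simpa using this

theorem ω_cube : algebraMap F L K.ω ^ 3 = 1 := by
  linear_combination (algebraMap F L K.ω - 1) * K.hω'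

theorem σ_cube (x : L) : K.σ (K.σ (K.σ x)) = x := by
  obtain ⟨a, b, c, rfl⟩ := K.span x
  simp only [map_add, map_mul, map_pow, K.σ_algebraMap, K.hσ]
  linear_combination (algebraMap F L b * K.θ + algebraMap F L c * K.θ ^ 2 *
    (algebraMap F L K.ω ^ 3 + 1)) * K.ω_cube

theorem θ_ne_zero : K.θ ≠ 0 := by
  intro h
  have := K.indep 0 1 0 (by simp [h])
  exact one_ne_zero this.2.1

theorem p_ne_zero : K.p ≠ 0 := by
  intro h
  have := K.hθ
  rw [h, map_zero] at this
  exact K.θ_ne_zero (pow_eq_zero_iff three_ne_zero |>.1 this)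

theorem exists_of_fixed [CharZero F] {x : L} (hx : K.σ x = x) : ∃ a : F, algebraMap F L a = x := by
  obtain ⟨a, b, c, rfl⟩ := K.span x
  simp only [map_add, map_mul, map_pow, K.σ_algebraMap, K.hσ] at hx
  have h := K.indep 0 (b * (K.ω - 1)) (c * (K.ω ^ 2 - 1)) (by
    simp only [map_zero, map_mul, map_sub, map_pow, map_one]
    linear_combination hx)
  have hω1 : K.ω - 1 ≠ 0 := by
    intro h1
    have h2 := K.hω
    rw [sub_eq_zero.1 h1] at h2
    norm_num at h2
  have hω2 : K.ω ^ 2 - 1 ≠ 0 := by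
    intro h1
    have h2 := K.hω
    have h3 : K.ω = -2 := by linear_combination h2 - h1
    rw [h3] at h1
    norm_num at h1
  have hb : b = 0 := (mul_eq_zero.1 h.2.1).resolve_right hω1
  have hc : c = 0 := (mul_eq_zero.1 h.2.2).resolve_right hω2
  exact ⟨a, by simp [hb, hc]⟩

theorem isAlgebraic (K : CubicKummer F L) : Algebra.IsAlgebraic F L := by
  classical
  have : Module.Finite F L := by
    refine ⟨⟨{1, K.θ, K.θ ^ 2}, ?_⟩⟩
    rw [eq_top_iff]
    rintro x -
    obtain ⟨a, b, c, rfl⟩ := K.span x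
    have h1 : (1 : L) ∈ Submodule.span F (({1, K.θ, K.θ ^ 2} : Finset L) : Set L) :=
      Submodule.subset_span (by simp)
    have h2 : K.θ ∈ Submodule.span F (({1, K.θ, K.θ ^ 2} : Finset L) : Set L) :=
      Submodule.subset_span (by simp)
    have h3 : K.θ ^ 2 ∈ Submodule.span F (({1, K.θ, K.θ ^ 2} : Finset L) : Set L) :=
      Submodule.subset_span (by simp)
    have := Submodule.add_mem _ (Submodule.add_mem _ (Submodule.smul_mem _ a h1)
      (Submodule.smul_mem _ b h2)) (Submodule.smul_mem _ c h3)
    simpa [Algebra.smul_def] using this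
  infer_instance

end CubicKummer

/-- A collinear triple permuted cyclically by `σ`. -/
structure ConjugateTriple {F L : Type*} [Field F] [Field L] [Algebra F L] (K : CubicKummer F L)
    extends CollinearTriple L where
  σ_x₁ : K.σ x₁ = x₂
  σ_x₂ : K.σ x₂ = x₃
  σ_x₃ : K.σ x₃ = x₁
  σ_μ : K.σ μ = μ
  σ_b : K.σ b = b

namespace ConjugateTriple

variable {F L : Type*} [Field F] [Field L] [Algebra F L] {K : CubicKummer F L}
  (T : ConjugateTriple K)

/-- The coordinate change from `F`-rational coordinates to `(z, s₁, s₃)`. -/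
noncomputable def coord : Matrix (Fin 3) (Fin 3) L :=
  !![1, 0, 0; -T.μ / 3, K.θ, K.θ ^ 2;
    -T.μ / 3, algebraMap F L K.ω ^ 2 * K.θ, algebraMap F L K.ω * K.θ ^ 2]

theorem det_coord : T.coord.det = algebraMap F L (K.p * (K.ω - K.ω ^ 2)) := by
  rw [coord, det_fin_three]
  simp only [map_mul, map_sub, map_pow, ← K.hθ]
  simp
  ring

theorem coord_map [CharZero F] : T.coord.map K.σ = T.rot * T.coord := by
  have : CharZero L := charZero_of_injective_algebraMap (algebraMap F L).injective
  have h3 : (3 : L) ≠ 0 := by norm_num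
  have hω := K.hω'
  have hσ3 : K.σ 3 = 3 := map_ofNat K.σ 3
  ext i j
  fin_cases i <;> fin_cases j <;>
    simp [coord, CollinearTriple.rot, mul_apply, Fin.sum_univ_three, T.σ_μ, K.hσ,
      K.σ_algebraMap, hσ3]
  · field_simp
    ring
  · linear_combination K.θ * hω
  · linear_combination K.θ ^ 2 * hω
  · linear_combination K.θ * K.ω_cube
  · linear_combination K.θ ^ 2 * K.ω_cube

theorem map_form (v : Fin 3 → L) :
    K.σ (T.form v) = T.rotate.form (fun i => K.σ (v i)) := by
  simp only [CollinearTriple.form, CollinearTriple.rotate, map_sub, map_add, map_mul, map_neg,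
    map_pow, T.σ_x₁, T.σ_x₂, T.σ_x₃, T.σ_μ, T.σ_b, map_ofNat]

theorem mulVec_map (M : Matrix (Fin 3) (Fin 3) L) (y : Fin 3 → L) :
    (fun i => K.σ ((M *ᵥ y) i)) = M.map K.σ *ᵥ fun i => K.σ (y i) := by
  ext i
  simp [mulVec, dotProduct, Fin.sum_univ_three]

theorem map_form_coord [CharZero F] (m : Fin 3 → L) :
    K.σ (T.form (T.coord *ᵥ m)) = T.form (T.coord *ᵥ fun i => K.σ (m i)) := by
  rw [map_form, mulVec_map, coord_map, ← mulVec_mulVec, T.form_rotate]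

theorem exists_rational_form [CharZero F] :
    ∃ Φ : (Fin 3 → F) → F, ∀ m, algebraMap F L (Φ m) =
      T.form (T.coord *ᵥ fun i => algebraMap F L (m i)) := by
  have : ∀ m : Fin 3 → F, ∃ a : F, algebraMap F L a =
      T.form (T.coord *ᵥ fun i => algebraMap F L (m i)) := fun m => by
    apply K.exists_of_fixed
    rw [map_form_coord]
    simp only [K.σ_algebraMap]
  choose Φ hΦ using this
  exact ⟨Φ, hΦ⟩

theorem coord_det_ne_zero [CharZero F] : T.coord.det ≠ 0 := by
  rw [det_coord, Ne, map_eq_zero]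
  refine mul_ne_zero K.p_ne_zero fun h => ?_
  have h2 : K.ω * (1 - K.ω) = 0 := by linear_combination h
  have hω := K.hω
  rcases mul_eq_zero.1 h2 with h2 | h2
  · rw [h2] at hω; norm_num at hω
  · rw [← sub_eq_zero.1 h2] at hω; norm_num at hω

/-- The cocycle comparing a frame with its conjugate. -/
noncomputable def cocycle (G : Matrix (Fin 3) (Fin 3) L) : Matrix (Fin 3) (Fin 3) L :=
  (T.coord⁻¹ * G)⁻¹ * (T.coord⁻¹ * G).map K.σ

variable {T}

section

variable [CharZero F] {G : Matrix (Fin 3) (Fin 3) L} {κ r s : L}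

theorem det_coord_inv_mul_ne_zero (hG : T.IsFrame G κ r s) : (T.coord⁻¹ * G).det ≠ 0 := by
  rw [det_mul, hG.det_eq]
  refine mul_ne_zero ?_ hG.ne_zero
  rw [det_nonsing_inv, Ring.inverse_eq_inv]
  exact inv_ne_zero T.coord_det_ne_zero

theorem map_eq_mul_cocycle (hG : T.IsFrame G κ r s) :
    (T.coord⁻¹ * G).map K.σ = (T.coord⁻¹ * G) * T.cocycle G := by
  rw [cocycle, ← mul_assoc, mul_nonsing_inv _ (isUnit_iff_ne_zero.2 (det_coord_inv_mul_ne_zero hG)),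
    one_mul]

theorem coord_mul_coord_inv_mul (G : Matrix (Fin 3) (Fin 3) L) :
    T.coord * (T.coord⁻¹ * G) = G := by
  rw [← mul_assoc, mul_nonsing_inv _ (isUnit_iff_ne_zero.2 T.coord_det_ne_zero), one_mul]

theorem map_eq_rot_mul (hG : T.IsFrame G κ r s) :
    G.map K.σ = T.rot * G * T.cocycle G := by
  have h1 : (T.coord * (T.coord⁻¹ * G)).map K.σ = T.coord.map K.σ * (T.coord⁻¹ * G).map K.σ := by
    ext i j; simp [mul_apply]
  rw [coord_mul_coord_inv_mul, map_eq_mul_cocycle hG, coord_map] at h1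
  rw [h1, mul_assoc T.rot, ← mul_assoc T.coord, coord_mul_coord_inv_mul, mul_assoc T.rot]

theorem det_cocycle (hG : T.IsFrame G κ r s) : (T.cocycle G).det = K.σ κ / κ := by
  have h := congrArg det (map_eq_rot_mul hG)
  have h2 : (G.map K.σ).det = K.σ G.det := by
    have := RingHom.map_det (K.σ : L →+* L) G
    exact this.symm
  rw [h2, det_mul, det_mul, T.det_rot, hG.det_eq, one_mul] at h
  rw [h, mul_div_cancel_left₀ _ hG.ne_zero]

theorem cubicForm_cocycle (hG : T.IsFrame G κ r s) (y : Fin 3 → L) :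
    cubicForm r s (T.cocycle G *ᵥ y) = K.σ κ / κ * cubicForm (K.σ r) (K.σ s) y := by
  obtain ⟨z, rfl⟩ : ∃ z : Fin 3 → L, y = fun i => K.σ (z i) :=
    ⟨fun i => K.σ.symm (y i), by simp⟩
  have h1 := congrArg K.σ (hG.form_eq z)
  rw [map_form, mulVec_map, map_eq_rot_mul hG, mul_assoc, ← mulVec_mulVec, T.form_rotate,
    ← mulVec_mulVec, hG.form_eq, map_mul] at h1
  have h2 : K.σ (cubicForm r s z) = cubicForm (K.σ r) (K.σ s) fun i => K.σ (z i) :=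
    map_pointCubic (K.σ : L →+* L) ..
  rw [h2] at h1
  rw [div_mul_eq_mul_div, eq_div_iff hG.ne_zero, ← h1, mul_comm]

end

end ConjugateTriple

end Kummer

section GlobalZero

open Matrix IsDedekindDomain

variable {O F L : Type*} [CommRing O] [IsDedekindDomain O] [IsPrincipalIdealRing O] [Field F]
  [CharZero F] [Algebra O F] [IsFractionRing O F] [Field L] [Algebra F L] {K : CubicKummer F L}
  {T : ConjugateTriple K}

theorem ValuationSubring.det_mem (A : ValuationSubring L) {X : Matrix (Fin 3) (Fin 3) L}
    (hX : ∀ i j, X i j ∈ A) : X.det ∈ A := by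
  have : X.det = ((Matrix.of fun i j => (⟨X i j, hX i j⟩ : A)).det : A) := by
    rw [← A.subtype_apply, RingHom.map_det]; rfl
  rw [this]
  exact SetLike.coe_mem _

namespace ConjugateTriple

theorem form_coord_eq {G : Matrix (Fin 3) (Fin 3) L} {κ r s : L} (hG : T.IsFrame G κ r s)
    (m : Fin 3 → L) : T.form (T.coord *ᵥ m) =
      κ * cubicForm r s ((T.coord⁻¹ * G)⁻¹ *ᵥ m) := by
  rw [← hG.form_eq, mulVec_mulVec]
  have h1 := mul_nonsing_inv _ (isUnit_iff_ne_zero.2 (det_coord_inv_mul_ne_zero hG))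
  have h2 : G * (T.coord⁻¹ * G)⁻¹ = T.coord :=
    calc G * (T.coord⁻¹ * G)⁻¹ = T.coord * (T.coord⁻¹ * G) * (T.coord⁻¹ * G)⁻¹ := by
          rw [coord_mul_coord_inv_mul]
      _ = T.coord := by rw [mul_assoc, h1, mul_one]
  rw [h2]

theorem det_coord_mul_det {G : Matrix (Fin 3) (Fin 3) L} {κ r s : L} (hG : T.IsFrame G κ r s) :
    T.coord.det * (T.coord⁻¹ * G).det = κ := by
  rw [← det_mul, coord_mul_coord_inv_mul, hG.det_eq]

theorem map_det (B : Matrix (Fin 3) (Fin 3) F) :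
    (B.map (algebraMap F L)).det = algebraMap F L B.det :=
  ((algebraMap F L).map_det B).symm

theorem map_mulVec (B : Matrix (Fin 3) (Fin 3) F) (y : Fin 3 → F) :
    (fun i => algebraMap F L ((B *ᵥ y) i)) =
      B.map (algebraMap F L) *ᵥ fun i => algebraMap F L (y i) := by
  ext i
  simp [mulVec, dotProduct, Fin.sum_univ_three]

/-- The form is small on a lattice that becomes integral in an integral frame. -/
theorem valuation_form_le {A : ValuationSubring L} {G : Matrix (Fin 3) (Fin 3) L} {κ r s : L}
    (hG : T.IsFrame G κ r s) (hr : r ∈ A) (hs : s ∈ A) {B : Matrix (Fin 3) (Fin 3) F}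
    (hB : ∀ i j, ((T.coord⁻¹ * G)⁻¹ * B.map (algebraMap F L)) i j ∈ A)
    (hdet : A.valuation ((T.coord⁻¹ * G)⁻¹ * B.map (algebraMap F L)).det = 1)
    {y : Fin 3 → L} (hy : ∀ i, y i ∈ A) :
    A.valuation (T.form (T.coord *ᵥ (B.map (algebraMap F L) *ᵥ y))) ≤
      A.valuation (T.coord.det * algebraMap F L B.det) := by
  have hκ := det_coord_mul_det hG
  have hd := det_coord_inv_mul_ne_zero hG
  have h1 : T.coord.det * algebraMap F L B.det =
      κ * ((T.coord⁻¹ * G)⁻¹ * B.map (algebraMap F L)).det := by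
    rw [det_mul, det_nonsing_inv, Ring.inverse_eq_inv, map_det, ← hκ]
    field_simp
  rw [form_coord_eq hG, h1, map_mul, map_mul, hdet, mul_one, mulVec_mulVec]
  refine mul_le_of_le_one_right' ((A.valuation_le_one_iff _).2 ?_)
  have hv : ∀ i, (((T.coord⁻¹ * G)⁻¹ * B.map (algebraMap F L)) *ᵥ y) i ∈ A := fun i => by
    simp only [mulVec, dotProduct]
    exact sum_mem fun j _ => A.mul_mem _ _ (hB i j) (hy j)
  have := map_pointCubic A.subtype ⟨r, hr⟩ ⟨s, hs⟩ ⟨_, hv 0⟩ ⟨_, hv 1⟩ ⟨_, hv 2⟩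
  simp only [ValuationSubring.subtype_apply] at this
  rw [cubicForm, ← this]
  exact SetLike.coe_mem _

theorem exists_integral_matrix
    (h : ∀ v : HeightOneSpectrum O, ∃ A : ValuationSubring L, A.IsAbove v F ∧
      ∃ G κ r s, T.IsFrame G κ r s ∧ r ∈ A ∧ s ∈ A ∧ LocallySplit F A (T.coord⁻¹ * G))
    {Φ : (Fin 3 → F) → F}
    (hΦ : ∀ m, algebraMap F L (Φ m) = T.form (T.coord *ᵥ fun i => algebraMap F L (m i)))
    {δ : F} (hδ : algebraMap F L δ = T.coord.det) :
    ∃ B : Matrix (Fin 3) (Fin 3) F, B.det ≠ 0 ∧ ∀ y : Fin 3 → O,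
      Φ (B *ᵥ fun i => algebraMap O F (y i)) / (δ * B.det) ∈ (algebraMap O F).range := by
  have hδ0 : δ ≠ 0 := by
    rintro rfl
    rw [map_zero] at hδ
    exact T.coord_det_ne_zero hδ.symm
  have : Algebra.IsAlgebraic F L := K.isAlgebraic
  have hG₀ := T.isFrame_frame
  let G₀ := T.coord⁻¹ * T.frame
  have hfin : {v : HeightOneSpectrum O | ∃ A : ValuationSubring L, A.IsAbove v F ∧
      (T.r ∉ A ∨ T.s ∉ A ∨ ∃ i j, G₀ i j ∉ A ∨ G₀⁻¹ i j ∉ A)}.Finite := by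
    refine (((finite_not_mem_above (O := O) (F := F) T.r).union
      (finite_not_mem_above (O := O) (F := F) T.s)).union
      (Set.finite_iUnion fun i : Fin 3 => Set.finite_iUnion fun j : Fin 3 =>
        (finite_not_mem_above (O := O) (F := F) (G₀ i j)).union
        (finite_not_mem_above (O := O) (F := F) (G₀⁻¹ i j)))).subset ?_
    rintro v ⟨A, hA, h | h | ⟨i, j, h | h⟩⟩
    · exact Or.inl (Or.inl ⟨A, hA, h⟩)
    · exact Or.inl (Or.inr ⟨A, hA, h⟩)
    · exact Or.inr (Set.mem_iUnion.2 ⟨i, Set.mem_iUnion.2 ⟨j, Or.inl ⟨A, hA, h⟩⟩⟩)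
    · exact Or.inr (Set.mem_iUnion.2 ⟨i, Set.mem_iUnion.2 ⟨j, Or.inr ⟨A, hA, h⟩⟩⟩)
  have key : ∀ (v : HeightOneSpectrum O) (A : ValuationSubring L), A.IsAbove v F →
      ∀ (G : Matrix (Fin 3) (Fin 3) L) (κ r s : L), T.IsFrame G κ r s → r ∈ A → s ∈ A →
      ∀ B : Matrix (Fin 3) (Fin 3) F,
        (∀ i j, ((T.coord⁻¹ * G)⁻¹ * B.map (algebraMap F L)) i j ∈ A) →
        A.valuation ((T.coord⁻¹ * G)⁻¹ * B.map (algebraMap F L)).det = 1 →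
        B.det ≠ 0 ∧ ∀ y : Fin 3 → F, (∀ i, v.valuation F (y i) ≤ 1) →
          v.valuation F (Φ (B *ᵥ y)) ≤ v.valuation F (δ * B.det) := by
    intro v A hA G κ r s hG hr hs B hB hdet
    refine ⟨fun h0 => ?_, fun y hy => ?_⟩
    · rw [det_mul, map_det, h0, map_zero, mul_zero, map_zero] at hdet
      exact zero_ne_one hdet
    · rw [← hA.valuation_le_iff, hΦ, map_mulVec, map_mul, hδ]
      exact valuation_form_le hG hr hs hB hdet fun i => (hA _).2 (hy i)
  refine exists_global_matrix Φ δ hδ0 hfin.toFinset fun v => ?_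
  by_cases hv : v ∈ hfin.toFinset
  · obtain ⟨A, hA, G, κ, r, s, hG, hr, hs, B, hB, hdet⟩ := h v
    obtain ⟨h1, h2⟩ := key v A hA G κ r s hG hr hs B hB hdet
    exact ⟨B, h1, fun h => absurd hv h, h2⟩
  · obtain ⟨A, hA⟩ := exists_isAbove F L v
    rw [Set.Finite.mem_toFinset] at hv
    have hv' : ¬ (T.r ∉ A ∨ T.s ∉ A ∨ ∃ i j, G₀ i j ∉ A ∨ G₀⁻¹ i j ∉ A) := fun h => hv ⟨A, hA, h⟩
    push Not at hv'
    obtain ⟨hr, hs, hG⟩ := hv'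
    have h1 : ((1 : Matrix (Fin 3) (Fin 3) F).map (algebraMap F L)) = 1 := by simp
    have hdet : A.valuation (G₀⁻¹ * (1 : Matrix (Fin 3) (Fin 3) F).map (algebraMap F L)).det = 1 := by
      rw [h1, mul_one]
      have e1 := (A.valuation_le_one_iff _).2 (A.det_mem fun i j => (hG i j).1)
      have e2 := (A.valuation_le_one_iff _).2 (A.det_mem fun i j => (hG i j).2)
      refine le_antisymm e2 ?_
      have e3 : G₀.det * G₀⁻¹.det = 1 := by
        rw [← det_mul, mul_nonsing_inv _ (isUnit_iff_ne_zero.2 (det_coord_inv_mul_ne_zero hG₀)),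
          det_one]
      have e4 := congrArg A.valuation e3
      rw [map_mul, map_one] at e4
      rw [← e4]
      exact mul_le_of_le_one_left' e1
    obtain ⟨h2, h3⟩ := key v A hA _ _ _ _ hG₀ hr hs 1 (by
      intro i j; rw [h1, mul_one]; exact (hG i j).2) hdet
    exact ⟨1, h2, fun _ => rfl, h3⟩

theorem exists_zero (ι : L →+* ℂ)
    (hO : ∀ z : ℂ, (∃ a : O, ι (algebraMap F L (algebraMap O F a)) = z) ↔
      ∃ a b : ℤ, z = a + b * ι (algebraMap F L K.ω))
    (h : ∀ v : HeightOneSpectrum O, ∃ A : ValuationSubring L, A.IsAbove v F ∧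
      ∃ G κ r s, T.IsFrame G κ r s ∧ r ∈ A ∧ s ∈ A ∧ LocallySplit F A (T.coord⁻¹ * G)) :
    ∃ m : Fin 3 → F, m ≠ 0 ∧ T.form (T.coord *ᵥ fun i => algebraMap F L (m i)) = 0 := by
  obtain ⟨Φ, hΦ⟩ := T.exists_rational_form
  have hδ := T.det_coord.symm
  obtain ⟨B, hB, hint⟩ := exists_integral_matrix h hΦ hδ
  have hG := T.isFrame_frame
  set G₀ := T.coord⁻¹ * T.frame with hG₀
  have hd := det_coord_inv_mul_ne_zero hG
  set ζ : ℂ := ι (algebraMap F L K.ω) with hζ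
  have hζ1 : ζ ^ 2 + ζ + 1 = 0 := by
    have := congrArg ι K.hω'
    simpa using this
  have hcurve : (ι T.s) ^ 2 = (ι T.r) ^ 3 - ι T.r := by
    have := congrArg ι T.s_sq
    simpa using this
  set N : Matrix (Fin 3) (Fin 3) L := G₀⁻¹ * B.map (algebraMap F L) with hN
  have hNdet : N.det ≠ 0 := by
    rw [hN, det_mul, det_nonsing_inv, Ring.inverse_eq_inv, map_det]
    exact mul_ne_zero (inv_ne_zero hd) ((map_ne_zero _).2 hB)
  have hιdet : (N.map ι).det = ι N.det := (ι.map_det N).symm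
  obtain ⟨y, hyS, hy0, hy⟩ := exists_small_value hζ1
    (ι.comp ((algebraMap F L).comp (algebraMap O F))).range
    (fun z => hO z) hcurve (N.map ι) (by rw [hιdet]; exact (map_ne_zero _).2 hNdet)
  choose a ha using hyS
  have hya : y = fun i => ι (algebraMap F L (algebraMap O F (a i))) := funext fun i => (ha i).symm
  have hval : ι (algebraMap F L (Φ (B *ᵥ fun i => algebraMap O F (a i)) /
      (K.p * (K.ω - K.ω ^ 2) * B.det))) * (N.map ι).det =
      pointCubic (ι T.r) (ι T.s) ((N.map ι *ᵥ y) 0) ((N.map ι *ᵥ y) 1) ((N.map ι *ᵥ y) 2) := by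
    have hNy : ∀ i, (N.map ι *ᵥ y) i =
        ι ((N *ᵥ fun i => algebraMap F L (algebraMap O F (a i))) i) := fun i => by
      rw [hya]
      simp [mulVec, dotProduct, Fin.sum_univ_three]
    rw [hNy, hNy, hNy, ← map_pointCubic ι, hιdet, ← map_mul]
    congr 1
    change _ = cubicForm T.r T.s _
    have hκ := det_coord_mul_det hG
    have hNd : N.det = G₀.det⁻¹ * algebraMap F L B.det := by
      rw [hN, det_mul, det_nonsing_inv, Ring.inverse_eq_inv, map_det]
    rw [map_div₀, map_mul, hδ, hΦ, form_coord_eq hG, map_mulVec, mulVec_mulVec, ← hG₀, ← hN, hNd,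
      ← hκ]
    have h1 := T.coord_det_ne_zero
    have h2 : algebraMap F L B.det ≠ 0 := (map_ne_zero _).2 hB
    rw [← hG₀] at hd ⊢
    field_simp
  have hlt : Complex.normSq (ι (algebraMap F L (Φ (B *ᵥ fun i => algebraMap O F (a i)) /
      (K.p * (K.ω - K.ω ^ 2) * B.det)))) < 1 := by
    rw [← hval, map_mul] at hy
    have hpos : 0 < Complex.normSq (N.map ι).det := by
      rw [Complex.normSq_pos, hιdet]; exact (map_ne_zero _).2 hNdet
    exact (mul_lt_iff_lt_one_left hpos).1 hy
  obtain ⟨c, hc⟩ := hint a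
  rw [← hc] at hlt
  obtain ⟨u, w, huw⟩ := (hO _).1 ⟨c, rfl⟩
  have hzero : ι (algebraMap F L (algebraMap O F c)) = 0 := by
    rw [huw] at hlt ⊢
    have hre : ζ.re = -1 / 2 ∧ ζ.im ^ 2 = 3 / 4 := by
      have e1 := congrArg Complex.re hζ1
      have e2 := congrArg Complex.im hζ1
      simp [pow_two] at e1 e2
      have him : ζ.im ≠ 0 := by
        intro h0
        rw [h0] at e1
        nlinarith [sq_nonneg (ζ.re + 1 / 2)]
      have hre : ζ.re = -1 / 2 := by
        have : ζ.im * (2 * ζ.re + 1) = 0 := by linear_combination e2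
        have := (mul_eq_zero.1 this).resolve_left him
        linarith
      refine ⟨hre, ?_⟩
      rw [hre] at e1
      linarith
    have hn : Complex.normSq ((u : ℂ) + w * ζ) = ((u ^ 2 - u * w + w ^ 2 : ℤ) : ℝ) := by
      rw [Complex.normSq_apply]
      simp
      linear_combination (2 * u * w + w ^ 2 * (ζ.re - 1 / 2)) * hre.1 + w ^ 2 * hre.2
    rw [hn] at hlt
    have h1 : u ^ 2 - u * w + w ^ 2 < 1 := by exact_mod_cast hlt
    have h2 : Complex.normSq ((u : ℂ) + w * ζ) = 0 := by
      rw [hn]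
      have h3 : 0 ≤ u ^ 2 - u * w + w ^ 2 := by nlinarith [sq_nonneg (2 * u - w), sq_nonneg w]
      have : u ^ 2 - u * w + w ^ 2 = 0 := by omega
      rw [this]; simp
    exact Complex.normSq_eq_zero.1 h2
  have hc0 : algebraMap O F c = 0 := by
    simpa using hzero
  rw [hc0] at hc
  have hΦ0 : Φ (B *ᵥ fun i => algebraMap O F (a i)) = 0 := by
    rcases div_eq_zero_iff.1 hc.symm with h | h
    · exact h
    · exfalso
      rcases mul_eq_zero.1 h with h | h
      · rw [h, map_zero] at hδ
        exact T.coord_det_ne_zero hδ.symm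
      · exact hB h
  refine ⟨_, fun h0 => hy0 ?_, by rw [← hΦ, hΦ0, map_zero]⟩
  have h1 : (fun i => algebraMap O F (a i)) = 0 :=
    (mulVec_injective_of_isUnit ((isUnit_iff_isUnit_det _).2 (isUnit_iff_ne_zero.2 hB)))
      (by rw [h0, mulVec_zero])
  rw [hya]
  ext i
  have h2 : algebraMap O F (a i) = 0 := congrFun h1 i
  rw [h2]
  simp

end ConjugateTriple

end GlobalZero

section PointArithmetic

open WeierstrassCurve.Affine

namespace Ecurve

variable {K K' K'' : Type*} [Field K] [Field K'] [Field K'']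

theorem equation_iff {x y : K} : (Ecurve K).Equation x y ↔ y ^ 2 = x ^ 3 - x := by
  rw [WeierstrassCurve.Affine.equation_iff]
  simp [Ecurve, sub_eq_add_neg]

theorem nonsingular_iff [NeZero (2 : K)] {x y : K} :
    (Ecurve K).Nonsingular x y ↔ y ^ 2 = x ^ 3 - x := by
  rw [← equation_iff, ← equation_iff_nonsingular_of_Δ_ne_zero]
  have h2 : (2 : K) ≠ 0 := two_ne_zero
  have : (Ecurve K).Δ = 2 ^ 6 := by
    simp [Ecurve, WeierstrassCurve.Δ, WeierstrassCurve.b₂, WeierstrassCurve.b₄,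
      WeierstrassCurve.b₆, WeierstrassCurve.b₈]
    norm_num
  rw [this]
  exact pow_ne_zero _ h2

/-- The affine point `(x, y)`. -/
def mk [NeZero (2 : K)] {x y : K} (h : y ^ 2 = x ^ 3 - x) : (Ecurve K).Point :=
  .some x y (nonsingular_iff.2 h)

theorem mk_ne_zero [NeZero (2 : K)] {x y : K} (h : y ^ 2 = x ^ 3 - x) : mk h ≠ 0 :=
  Point.some_ne_zero _

theorem mk_inj [NeZero (2 : K)] {x y x' y' : K} (h : y ^ 2 = x ^ 3 - x)
    (h' : y' ^ 2 = x' ^ 3 - x') : mk h = mk h' ↔ x = x' ∧ y = y' := by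
  rw [mk, mk, Point.some.injEq]

theorem eq_zero_or_mk [NeZero (2 : K)] (P : (Ecurve K).Point) :
    P = 0 ∨ ∃ x y, ∃ h : y ^ 2 = x ^ 3 - x, P = mk h := by
  rcases P with _ | ⟨x, y, h⟩
  · exact Or.inl rfl
  · exact Or.inr ⟨x, y, nonsingular_iff.1 h, rfl⟩

theorem negY_eq (x y : K) : (Ecurve K).negY x y = -y := by
  simp [negY, Ecurve]

theorem neg_mk [NeZero (2 : K)] {x y : K} (h : y ^ 2 = x ^ 3 - x) :
    -mk h = mk (x := x) (y := -y) (by rw [neg_sq, h]) := by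
  rw [mk, Point.neg_some, mk]
  congr 1
  exact negY_eq x y

section Add

variable [DecidableEq K]

theorem mk_add_mk_neg [NeZero (2 : K)] {x y y' : K} (h : y ^ 2 = x ^ 3 - x)
    (h' : y' ^ 2 = x ^ 3 - x) (hy : y = -y') : mk h + mk h' = 0 := by
  rw [mk, mk, Point.add_of_Y_eq rfl (by rw [negY_eq, hy])]

theorem chord [NeZero (2 : K)] {x₁ y₁ x₂ y₂ x₃ y₃ : K} (h₁ : y₁ ^ 2 = x₁ ^ 3 - x₁)
    (h₂ : y₂ ^ 2 = x₂ ^ 3 - x₂) (h₃ : y₃ ^ 2 = x₃ ^ 3 - x₃) (hx : x₁ ≠ x₂) (l : K)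
    (hl : y₁ - y₂ = l * (x₁ - x₂)) (hx₃ : x₃ = l ^ 2 - x₁ - x₂)
    (hy₃ : y₃ = -(y₁ + l * (x₃ - x₁))) : mk h₁ + mk h₂ = mk h₃ := by
  have hsl : (Ecurve K).slope x₁ x₂ y₁ y₂ = l := by
    rw [slope_of_X_ne hx, hl, mul_div_cancel_right₀ _ (sub_ne_zero.2 hx)]
  rw [mk, mk, Point.add_some (fun h => hx h.1), mk]
  have e1 : (Ecurve K).addX x₁ x₂ l = x₃ := by rw [hx₃]; simp [addX, Ecurve]
  simp only [hsl, addY, e1, negAddY, negY_eq]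
  congr 1
  rw [hy₃]; ring

theorem tangent [NeZero (2 : K)] {x₁ y₁ x₃ y₃ : K} (h₁ : y₁ ^ 2 = x₁ ^ 3 - x₁)
    (h₃ : y₃ ^ 2 = x₃ ^ 3 - x₃) (hy : y₁ ≠ 0) (l : K)
    (hl : 3 * x₁ ^ 2 - 1 = l * (2 * y₁)) (hx₃ : x₃ = l ^ 2 - 2 * x₁)
    (hy₃ : y₃ = -(y₁ + l * (x₃ - x₁))) : mk h₁ + mk h₁ = mk h₃ := by
  have h2y : 2 * y₁ ≠ 0 := mul_ne_zero two_ne_zero hy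
  have hne : y₁ ≠ (Ecurve K).negY x₁ y₁ := by
    rw [negY_eq]
    intro h
    exact h2y (by linear_combination h)
  have hsl : (Ecurve K).slope x₁ x₁ y₁ y₁ = l := by
    rw [slope_of_Y_ne rfl hne, negY_eq, sub_neg_eq_add, ← two_mul, div_eq_iff h2y, ← hl]
    simp [Ecurve, sub_eq_add_neg]
  rw [mk, Point.add_self_of_Y_ne hne, mk]
  have e1 : (Ecurve K).addX x₁ x₁ l = x₃ := by rw [hx₃]; simp [addX, Ecurve]; ring
  simp only [hsl, addY, e1, negAddY, negY_eq]
  congr 1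
  rw [hy₃]; ring

end Add

theorem map_eq (f : K →+* K') : (Ecurve K).map f = Ecurve K' := by
  simp [Ecurve, WeierstrassCurve.map]

/-- The map on points induced by a homomorphism of fields. -/
def map [DecidableEq K] [DecidableEq K'] (f : K →+* K') :
    (Ecurve K).Point →+ (Ecurve K').Point where
  toFun P := match P with
    | 0 => 0
    | .some x y h => .some (f x) (f y) (by
        rw [← map_eq f, map_nonsingular _ f.injective]; exact h)
  map_zero' := rfl
  map_add' := by
    rintro (_ | ⟨x₁, y₁, h₁⟩) (_ | ⟨x₂, y₂, h₂⟩)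
    any_goals rfl
    have hE := map_eq f
    by_cases hxy : x₁ = x₂ ∧ y₁ = (Ecurve K).negY x₂ y₂
    · rw [Point.add_of_Y_eq hxy.1 hxy.2, Point.add_of_Y_eq (congrArg f hxy.1)
        (by rw [hxy.2, negY_eq, negY_eq, map_neg])]
    · have hxy' : ¬ (f x₁ = f x₂ ∧ f y₁ = (Ecurve K').negY (f x₂) (f y₂)) := by
        rw [negY_eq, ← map_neg]
        rw [negY_eq] at hxy
        exact fun h => hxy ⟨f.injective h.1, f.injective h.2⟩
      rw [Point.add_some hxy, Point.add_some hxy', Point.some.injEq]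
      have hs : (Ecurve K').slope (f x₁) (f x₂) (f y₁) (f y₂) =
          f ((Ecurve K).slope x₁ x₂ y₁ y₂) := by rw [← hE, map_slope]
      rw [hs]
      constructor
      · rw [← hE, map_addX]
      · rw [← hE, map_addY]

section Map

variable [DecidableEq K] [DecidableEq K'] [DecidableEq K'']

theorem map_mk [NeZero (2 : K)] [NeZero (2 : K')] (f : K →+* K') {x y : K}
    (h : y ^ 2 = x ^ 3 - x) :
    map f (mk h) = mk (x := f x) (y := f y) (by simp only [← map_pow, ← map_sub, h]) := rfl

theorem map_map (f : K →+* K') (g : K' →+* K'') (P : (Ecurve K).Point) :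
    map g (map f P) = map (g.comp f) P := by
  cases P <;> rfl

theorem map_id (f : K →+* K) (hf : ∀ x, f x = x) (P : (Ecurve K).Point) : map f P = P := by
  rcases P with _ | ⟨x, y, h⟩
  · rfl
  · exact (Point.some.injEq ..).mpr ⟨hf x, hf y⟩

theorem map_injective (f : K →+* K') : Function.Injective (map f) := by
  rintro (_ | ⟨x₁, y₁, h₁⟩) (_ | ⟨x₂, y₂, h₂⟩) h
  · rfl
  · exact absurd h.symm (Point.some_ne_zero _)
  · exact absurd h (Point.some_ne_zero _)
  · have := (Point.some.injEq ..).mp h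
    exact (Point.some.injEq ..).mpr ⟨f.injective this.1, f.injective this.2⟩

end Map

end Ecurve

end PointArithmetic

section Descent

open Matrix

namespace ConjugateTriple

variable {F L : Type*} [Field F] [Field L] [Algebra F L] {K : CubicKummer F L}
  (T : ConjugateTriple K)

theorem y₁_eq : T.y₁ = T.μ * T.x₁ + T.b := rfl

theorem exists_sub_eq_of_affine [NeZero (2 : L)] [DecidableEq L] {a c : L}
    (ha : K.σ a = -T.μ - a - c) (hc : K.σ c = a) (h : T.form ![1, a, c] = 0) :
    ∃ Q : (Ecurve L).Point, Q - Ecurve.map (K.σ : L →+* L) Q = Ecurve.mk T.y₁_sq := by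
  have h2 : (2 : L) ≠ 0 := two_ne_zero
  have hD := T.sub_ne_zero
  have hac : a + c ≠ 0 := by
    intro h0
    have h1 : K.σ a = -T.μ := by rw [ha]; linear_combination -h0
    have h3 : a = -T.μ := K.σ.injective (by rw [h1, map_neg, T.σ_μ])
    have h4 : c = -T.μ := K.σ.injective (by rw [hc, h3, map_neg, T.σ_μ])
    rw [h3, h4] at h0 h
    have h5 : T.μ = 0 := by
      refine (mul_eq_zero.1 (?_ : 2 * T.μ = 0)).resolve_left h2
      linear_combination -h0
    have h6 : T.b = 0 := by
      refine (mul_eq_zero.1 (?_ : 2 * T.b = 0)).resolve_left h2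
      simp [CollinearTriple.form, h5] at h
      simp [h.resolve_left h2]
    have h7 := T.prod_eq
    rw [h6, zero_pow two_ne_zero] at h7
    have h8 : T.x₁ = 0 ∧ T.x₂ = 0 := by
      have e2 : T.x₁ = 0 ↔ T.x₂ = 0 := by
        rw [← T.σ_x₁, map_eq_zero]
      have e3 : T.x₂ = 0 ↔ T.x₃ = 0 := by
        rw [← T.σ_x₂, map_eq_zero]
      simp only [mul_eq_zero] at h7
      tauto
    exact T.ne₁₂ (h8.1.trans h8.2.symm)
  obtain ⟨e, he⟩ : ∃ e, a + c = e * (T.x₁ - T.x₃) :=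
    ⟨(a + c) / (T.x₁ - T.x₃), (div_mul_cancel₀ _ hD).symm⟩
  have he0 : e ≠ 0 := by
    rintro rfl
    exact hac (by rw [he, zero_mul])
  obtain ⟨X, hX⟩ : ∃ X, X = -(a * c) - T.μ * (a + c) - T.x₁ - T.x₃ := ⟨_, rfl⟩
  have hμ := T.sum_eq
  have hform : (a + T.μ) * (-a - c) * (c + T.μ) -
      ((a + T.μ) * T.x₁ + (-a - c) * T.x₂ + (c + T.μ) * T.x₃) - 2 * T.b = 0 := by
    simpa [CollinearTriple.form] using h
  have hX1 : (a + c) * X = a * T.x₁ + c * T.x₃ + T.y₁ + T.y₃ := by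
    rw [hX, CollinearTriple.y₁, CollinearTriple.y₃]
    linear_combination hform - (a + c) * hμ
  have hk := T.k_mul
  have hXe : e * (X - T.x₁) = T.k - c := by
    refine mul_right_cancel₀ hD ?_
    linear_combination hX1 - (X - T.x₁) * he - hk
  have hkμ := T.k_mul_μ
  have hb := T.two_b
  have hy1 : 2 * T.y₁ = (T.k + T.μ) * (T.x₁ - T.x₃) := by
    rw [CollinearTriple.y₁]
    linear_combination hb
  obtain ⟨Y, hY⟩ : ∃ Y, Y = a * (X - T.x₁) - T.y₁ := ⟨_, rfl⟩
  have hbr : a ^ 2 * (X - T.x₁) - 2 * a * T.y₁ - (X ^ 2 + X * T.x₁ + T.x₁ ^ 2 - 1) = 0 := by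
    have hWX : X - T.x₁ = -(a * c) - T.μ * (a + c) - 2 * T.x₁ - T.x₃ := by rw [hX]; ring
    linear_combination (-(X - T.x₁) - (T.x₁ - T.x₃)) * hWX + (X - T.x₁) * (a + T.μ) * he +
      (a + T.μ) * (T.x₁ - T.x₃) * hXe - a * hy1 + hkμ
  have hXY : Y ^ 2 = X ^ 3 - X := by
    rw [hY]
    linear_combination (X - T.x₁) * hbr + T.y₁_sq
  have hσX : X + K.σ X + T.x₁ = a ^ 2 := by
    rw [hX]
    simp only [map_sub, map_neg, map_add, map_mul, ha, hc, T.σ_μ, T.σ_x₁, T.σ_x₃]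
    linear_combination -hμ
  have hσy₁ : K.σ T.y₁ = T.μ * T.x₂ + T.b := by
    rw [y₁_eq, map_add, map_mul, T.σ_μ, T.σ_x₁, T.σ_b]
  have hσY : K.σ Y = -(a * (K.σ X - T.x₁) - T.y₁) := by
    have h1 := congrArg K.σ hX1
    simp only [CollinearTriple.y₃, map_add, map_mul, ha, hc, hσy₁, T.σ_μ, T.σ_x₁, T.σ_x₃,
      T.σ_b] at h1
    rw [hY, map_sub, map_mul, map_sub, hσy₁, ha, T.σ_x₁, CollinearTriple.y₁]
    linear_combination h1
  have hσXY : (K.σ Y) ^ 2 = (K.σ X) ^ 3 - K.σ X := by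
    rw [← map_pow, hXY, map_sub, map_pow]
  refine ⟨Ecurve.mk hXY, ?_⟩
  rw [Ecurve.map_mk]
  change Ecurve.mk hXY - Ecurve.mk hσXY = _
  by_cases hx : X = T.x₁
  · have hne : K.σ X ≠ T.x₁ := by
      rw [hx, T.σ_x₁]
      exact T.ne₁₂.symm
    rw [sub_eq_iff_eq_add', Ecurve.chord hσXY T.y₁_sq hXY hne (-a)]
    · rw [hσY]; ring
    · linear_combination hσX
    · rw [hσY, hY]; ring
  · rw [sub_eq_iff_eq_add, eq_comm, ← eq_neg_add_iff_add_eq, Ecurve.neg_mk, add_comm,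
      Ecurve.chord hXY _ hσXY hx a]
    · rw [hY]; ring
    · linear_combination hσX
    · rw [hσY, hY]; ring

theorem exists_sub_eq [CharZero F] [NeZero (2 : L)] [DecidableEq L] {m : Fin 3 → F} (hm : m ≠ 0)
    (h : T.form (T.coord *ᵥ fun i => algebraMap F L (m i)) = 0) :
    ∃ Q : (Ecurve L).Point, Q - Ecurve.map (K.σ : L →+* L) Q = Ecurve.mk T.y₁_sq := by
  obtain ⟨v, hv⟩ : ∃ v, v = T.coord *ᵥ fun i => algebraMap F L (m i) := ⟨_, rfl⟩
  have hσv : (fun i => K.σ (v i)) = T.rot *ᵥ v := by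
    rw [hv, mulVec_map, coord_map, ← mulVec_mulVec]
    simp only [K.σ_algebraMap]
  rw [← hv] at h
  have e1 : K.σ (v 1) = -T.μ * v 0 - v 1 - v 2 := by
    rw [congrFun hσv 1]
    simp [CollinearTriple.rot, mulVec, dotProduct, Fin.sum_univ_three]
    ring
  have e2 : K.σ (v 2) = v 1 := by
    rw [congrFun hσv 2]
    simp [CollinearTriple.rot, mulVec, dotProduct, Fin.sum_univ_three]
  have e0 : K.σ (v 0) = v 0 := by
    rw [congrFun hσv 0]
    simp [CollinearTriple.rot, mulVec, dotProduct, Fin.sum_univ_three]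
  have hv0 : v 0 ≠ 0 := by
    intro h0
    have h3 : v 1 = 0 := by
      simp only [CollinearTriple.form, h0] at h
      rw [h0] at e1
      have i1 : v 1 = 0 ↔ -v 1 - v 2 = 0 := by
        rw [← map_eq_zero K.σ, e1]; simp
      have i2 : v 2 = 0 ↔ v 1 = 0 := by rw [← map_eq_zero K.σ, e2]
      have : v 1 * (-v 1 - v 2) * v 2 = 0 := by linear_combination h
      simp only [mul_eq_zero] at this
      tauto
    have h4 : v 2 = 0 := by rw [← map_eq_zero K.σ, e2, h3]
    have hv' : v = 0 := by
      ext i; fin_cases i <;> simp [h0, h3, h4]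
    rw [hv] at hv'
    have := eq_zero_of_mulVec_eq_zero T.coord_det_ne_zero hv'
    refine hm (funext fun i => ?_)
    have h5 := congrFun this i
    simpa using h5
  refine T.exists_sub_eq_of_affine (a := v 1 / v 0) (c := v 2 / v 0) ?_ ?_ ?_
  · rw [map_div₀, e0, e1]; field_simp
  · rw [map_div₀, e0, e2]
  · have : v = v 0 • ![1, v 1 / v 0, v 2 / v 0] := by
      ext i; fin_cases i <;> simp [mul_div_cancel₀, hv0]
    rw [this, CollinearTriple.form_smul] at h
    exact (mul_eq_zero.1 h).resolve_left (pow_ne_zero _ hv0)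

end ConjugateTriple

end Descent

section Newton

open IsDedekindDomain

theorem newton_step {F Γ : Type*} [Field F] [LinearOrderedCommGroupWithZero Γ] (w : Valuation F Γ)
    {p q t : F} (h3 : (3 : F) ≠ 0) (ht : w t = 1) (hq : w q < 1)
    (h₁ : w ((t ^ 3 - p) / 3) ≤ w q) (h₂ : w ((t ^ 3 - p) ^ 2 / 27) ≤ w q) :
    ∃ t', w t' = 1 ∧ w ((t' ^ 3 - p) / 3) ≤ w q ∧ w ((t' ^ 3 - p) ^ 2 / 27) ≤ w q ∧
      w (t' ^ 3 - p) ≤ w (t ^ 3 - p) * w q := by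
  have ht0 : t ≠ 0 := by
    rintro rfl; rw [map_zero] at ht; exact zero_ne_one ht
  have h27 : (27 : F) ≠ 0 := by
    have : (27 : F) = 3 ^ 3 := by norm_num
    rw [this]; exact pow_ne_zero _ h3
  obtain ⟨E, hE⟩ : ∃ E, E = t ^ 3 - p := ⟨_, rfl⟩
  rw [← hE] at h₁ h₂ ⊢
  have hstep : (t - E / 3 / t ^ 2) ^ 3 - p = E * (E / 3 / t ^ 3 - E ^ 2 / 27 / t ^ 6) := by
    have hp : p = t ^ 3 - E := by rw [hE]; ring
    rw [hp]
    field_simp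
    ring
  have hle : w ((t - E / 3 / t ^ 2) ^ 3 - p) ≤ w E * w q := by
    rw [hstep, map_mul]
    refine mul_le_mul_right ?_ _
    refine w.map_sub_le ?_ ?_
    · rw [map_div₀ w (E / 3), map_pow, ht, one_pow, div_one]; exact h₁
    · rw [map_div₀ w (E ^ 2 / 27), map_pow, ht, one_pow, div_one]; exact h₂
  have hle' : w ((t - E / 3 / t ^ 2) ^ 3 - p) ≤ w E :=
    hle.trans (mul_le_of_le_one_right' hq.le)
  refine ⟨t - E / 3 / t ^ 2, ?_, ?_, ?_, hle⟩
  · have : w (E / 3 / t ^ 2) < w t := by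
      rw [map_div₀ w (E / 3), map_pow, ht, one_pow, div_one]
      exact h₁.trans_lt hq
    rw [Valuation.map_sub_eq_of_lt_left w this, ht]
  · refine le_trans ?_ h₁
    rw [map_div₀, map_div₀]
    exact div_le_div_of_nonneg_right hle' zero_le
  · refine le_trans ?_ h₂
    rw [map_div₀, map_div₀, map_pow, map_pow]
    exact div_le_div_of_nonneg_right (pow_le_pow_left₀ zero_le hle' 2) zero_le

theorem exists_cube_near {F Γ : Type*} [Field F] [LinearOrderedCommGroupWithZero Γ]
    (w : Valuation F Γ) {p q t : F} (h3 : (3 : F) ≠ 0) (ht : w t = 1) (hq : w q < 1)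
    (h₁ : w ((t ^ 3 - p) / 3) ≤ w q) (h₂ : w ((t ^ 3 - p) ^ 2 / 27) ≤ w q) (n : ℕ) :
    ∃ t', w t' = 1 ∧ w ((t' ^ 3 - p) / 3) ≤ w q ∧ w ((t' ^ 3 - p) ^ 2 / 27) ≤ w q ∧
      w (t' ^ 3 - p) ≤ w (t ^ 3 - p) * w q ^ n := by
  induction n with
  | zero => exact ⟨t, ht, h₁, h₂, by simp⟩
  | succ n ih =>
    obtain ⟨t', i1, i2, i3, i4⟩ := ih
    obtain ⟨t'', j1, j2, j3, j4⟩ := newton_step w h3 i1 hq i2 i3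
    refine ⟨t'', j1, j2, j3, j4.trans ?_⟩
    rw [pow_succ (w q), ← mul_assoc]
    exact mul_le_mul_left i4 _

variable {O F L : Type*} [CommRing O] [IsDedekindDomain O] [Field F] [Algebra O F]
  [IsFractionRing O F] [Field L] [Algebra F L]

namespace CubicKummer

variable (K : CubicKummer F L) {A : ValuationSubring L} {v : HeightOneSpectrum O}

theorem exists_valuation_le (hθ : A.valuation K.θ ≤ 1) (x : L) :
    ∃ d : F, d ≠ 0 ∧ A.valuation x ≤ A.valuation (algebraMap F L d) := by
  obtain ⟨a, b, c, rfl⟩ := K.span x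
  obtain ⟨d, hd0, h1, h2, h3⟩ : ∃ d : F, d ≠ 0 ∧ A.valuation (algebraMap F L a) ≤
      A.valuation (algebraMap F L d) ∧ A.valuation (algebraMap F L b) ≤
      A.valuation (algebraMap F L d) ∧ A.valuation (algebraMap F L c) ≤
      A.valuation (algebraMap F L d) := by
    obtain ⟨i, hi⟩ := Finite.exists_max
      (fun i : Fin 4 => A.valuation (algebraMap F L (![a, b, c, 1] i)))
    refine ⟨![a, b, c, 1] i, fun h0 => ?_, hi 0, hi 1, hi 2⟩
    have := hi 3
    rw [h0] at this
    simp at this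
  refine ⟨d, hd0, A.valuation.map_add_le (A.valuation.map_add_le h1 ?_) ?_⟩
  · rw [map_mul]; exact (mul_le_of_le_one_right' hθ).trans h2
  · rw [map_mul, map_pow]; exact (mul_le_of_le_one_right' (pow_le_one₀ zero_le hθ)).trans h3

theorem dense_of_approx (hθ : A.valuation K.θ ≤ 1)
    (h : ∀ ε : F, ε ≠ 0 → ∃ t : F, A.valuation (K.θ - algebraMap F L t) ≤
      A.valuation (algebraMap F L ε)) (x ε : L) (hε : ε ≠ 0) :
    ∃ a : F, A.valuation (x - algebraMap F L a) ≤ A.valuation ε := by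
  obtain ⟨d, hd0, hd⟩ := K.exists_valuation_le hθ ε⁻¹
  obtain ⟨a, b, c, rfl⟩ := K.span x
  obtain ⟨m, hm0, hb, hc⟩ : ∃ m : F, m ≠ 0 ∧ A.valuation (algebraMap F L b) ≤
      A.valuation (algebraMap F L m) ∧ A.valuation (algebraMap F L c) ≤
      A.valuation (algebraMap F L m) := by
    obtain ⟨i, hi⟩ := Finite.exists_max
      (fun i : Fin 3 => A.valuation (algebraMap F L (![b, c, 1] i)))
    refine ⟨![b, c, 1] i, fun h0 => ?_, hi 0, hi 1⟩
    have := hi 2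
    rw [h0] at this
    simp at this
  have hdε : A.valuation (algebraMap F L d)⁻¹ ≤ A.valuation ε := by
    rw [map_inv₀] at hd ⊢
    have h1 : 0 < A.valuation ε := zero_lt_iff.2 ((A.valuation.ne_zero_iff).2 hε)
    exact inv_le_of_inv_le₀ h1 hd
  have hone : ∃ δ : F, δ ≠ 0 ∧ A.valuation (algebraMap F L δ) ≤ 1 ∧
      A.valuation (algebraMap F L δ) ≤ A.valuation (algebraMap F L (d⁻¹ * m⁻¹)) := by
    rcases le_total (A.valuation (algebraMap F L (d⁻¹ * m⁻¹))) 1 with h1 | h1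
    · exact ⟨_, mul_ne_zero (inv_ne_zero hd0) (inv_ne_zero hm0), h1, le_rfl⟩
    · exact ⟨1, one_ne_zero, by simp, by simpa using h1⟩
  obtain ⟨δ, hδ0, hδ1, hδ⟩ := hone
  obtain ⟨t, ht⟩ := h δ hδ0
  have ht1 : A.valuation (algebraMap F L t) ≤ 1 := by
    have e : algebraMap F L t = K.θ - (K.θ - algebraMap F L t) := by ring
    rw [e]
    exact A.valuation.map_sub_le hθ (ht.trans hδ1)
  refine ⟨a + b * t + c * t ^ 2, ?_⟩
  have e : algebraMap F L a + algebraMap F L b * K.θ + algebraMap F L c * K.θ ^ 2 -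
      algebraMap F L (a + b * t + c * t ^ 2) = (K.θ - algebraMap F L t) *
        (algebraMap F L b + algebraMap F L c * (K.θ + algebraMap F L t)) := by
    simp only [map_add, map_mul, map_pow]; ring
  rw [e, map_mul]
  have hlin : A.valuation (algebraMap F L b + algebraMap F L c * (K.θ + algebraMap F L t)) ≤
      A.valuation (algebraMap F L m) := by
    refine A.valuation.map_add_le hb ?_
    rw [map_mul]
    exact (mul_le_of_le_one_right' (A.valuation.map_add_le hθ ht1)).trans hc
  calc _ ≤ A.valuation (algebraMap F L (d⁻¹ * m⁻¹)) * A.valuation (algebraMap F L m) :=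
        mul_le_mul' (ht.trans hδ) hlin
    _ = A.valuation (algebraMap F L d)⁻¹ := by
        rw [← map_mul, ← map_mul, inv_mul_cancel_right₀ hm0, map_inv₀]
    _ ≤ _ := hdε

theorem ω_ne_one [CharZero F] : K.ω ≠ 1 := by
  intro h
  have := K.hω
  rw [h] at this
  norm_num at this

theorem valuation_ω (A : ValuationSubring L) : A.valuation (algebraMap F L K.ω) = 1 := by
  have h := congrArg A.valuation K.ω_cube
  rw [map_pow, map_one] at h
  exact (pow_eq_one_iff_of_nonneg zero_le three_ne_zero).1 h

theorem valuation_one_sub_ω_sq (A : ValuationSubring L) :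
    A.valuation (1 - algebraMap F L K.ω ^ 2) = A.valuation (1 - algebraMap F L K.ω) := by
  have : 1 - algebraMap F L K.ω ^ 2 =
      -(algebraMap F L K.ω ^ 2) * (1 - algebraMap F L K.ω) := by
    linear_combination (1 - algebraMap F L K.ω) * K.hω'
  rw [this, map_mul, Valuation.map_neg, map_pow, K.valuation_ω, one_pow, one_mul]

theorem valuation_sub_le_of_cube_near (hθ : A.valuation K.θ = 1) {t ε : F}
    (hε : A.valuation (algebraMap F L (t ^ 3 - K.p)) ≤
      A.valuation (algebraMap F L ε) * A.valuation (1 - algebraMap F L K.ω) ^ 2)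
    (ht : A.valuation (algebraMap F L t - K.θ) < A.valuation (1 - algebraMap F L K.ω)) :
    A.valuation (K.θ - algebraMap F L t) ≤ A.valuation (algebraMap F L ε) := by
  have e : algebraMap F L (t ^ 3 - K.p) = (algebraMap F L t - K.θ) *
      ((algebraMap F L t - K.θ) + (1 - algebraMap F L K.ω) * K.θ) *
      ((algebraMap F L t - K.θ) + (1 - algebraMap F L K.ω ^ 2) * K.θ) := by
    rw [map_sub, map_pow, ← K.hθ]
    have h := K.hω'
    linear_combination (algebraMap F L t ^ 2 * K.θ - algebraMap F L t * K.θ ^ 2 *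
      algebraMap F L K.ω + K.θ ^ 3 * (algebraMap F L K.ω - 1)) * h
  have h1 : A.valuation ((algebraMap F L t - K.θ) + (1 - algebraMap F L K.ω) * K.θ) =
      A.valuation (1 - algebraMap F L K.ω) := by
    rw [Valuation.map_add_eq_of_lt_right, map_mul, hθ, mul_one]
    rwa [map_mul, hθ, mul_one]
  have h2 : A.valuation ((algebraMap F L t - K.θ) + (1 - algebraMap F L K.ω ^ 2) * K.θ) =
      A.valuation (1 - algebraMap F L K.ω) := by
    rw [Valuation.map_add_eq_of_lt_right, map_mul, hθ, mul_one, K.valuation_one_sub_ω_sq]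
    rwa [map_mul, hθ, mul_one, K.valuation_one_sub_ω_sq]
  have h0 : 0 < A.valuation (1 - algebraMap F L K.ω) := zero_le.trans_lt ht
  rw [e, map_mul, map_mul, h1, h2, mul_assoc, ← pow_two] at hε
  rw [Valuation.map_sub_swap]
  exact le_of_mul_le_mul_right hε (pow_pos h0 2)

theorem approx_of_cube_near [CharZero F] (hA : A.IsAbove v F)
    (h : ∀ ε : F, ε ≠ 0 → ∃ t : F, v.valuation F (t ^ 3 - K.p) ≤ v.valuation F ε)
    (hθ : A.valuation K.θ = 1) (ε : F) (hε : ε ≠ 0) : ∃ t : F,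
      A.valuation (K.θ - algebraMap F L t) ≤ A.valuation (algebraMap F L ε) := by
  wlog hε1 : A.valuation (algebraMap F L ε) ≤ 1 generalizing ε
  · obtain ⟨t, ht⟩ := this 1 one_ne_zero (by simp)
    refine ⟨t, ht.trans ?_⟩
    rw [map_one, map_one]
    exact (not_le.1 hε1).le
  obtain ⟨ϖ, hϖ⟩ := v.valuation_exists_uniformizer F
  have hϖ0 : ϖ ≠ 0 := by
    rintro rfl; rw [map_zero] at hϖ; exact WithZero.exp_ne_zero hϖ.symm
  have hϖ1 : A.valuation (algebraMap F L ϖ) < 1 := by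
    rw [hA.valuation_lt_one_iff, hϖ, ← WithZero.exp_zero, WithZero.exp_lt_exp]; norm_num
  have hl0 : 1 - K.ω ≠ 0 := sub_ne_zero.2 K.ω_ne_one.symm
  have hl : algebraMap F L (1 - K.ω) = 1 - algebraMap F L K.ω := by simp
  have hlpos : 0 < A.valuation (1 - algebraMap F L K.ω) := by
    rw [← hl, zero_lt_iff, Valuation.ne_zero_iff, Ne, map_eq_zero]; exact hl0
  have hl1 : A.valuation (1 - algebraMap F L K.ω) ≤ 1 :=
    A.valuation.map_sub_le (by simp) (K.valuation_ω A).le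
  obtain ⟨t, ht⟩ := h (ε * ϖ * (1 - K.ω) ^ 3) (by positivity)
  rw [← hA.valuation_le_iff (L := L)] at ht
  simp only [map_mul, map_pow, hl] at ht
  have hlt : A.valuation (algebraMap F L ε) * A.valuation (algebraMap F L ϖ) < 1 :=
    mul_lt_one_of_nonneg_of_lt_one_right hε1 zero_le hϖ1
  have hE3 : A.valuation (algebraMap F L (t ^ 3 - K.p)) <
      A.valuation (1 - algebraMap F L K.ω) ^ 3 :=
    ht.trans_lt (mul_lt_of_lt_one_left (pow_pos hlpos 3) hlt)
  have hE2 : A.valuation (algebraMap F L (t ^ 3 - K.p)) ≤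
      A.valuation (algebraMap F L ε) * A.valuation (1 - algebraMap F L K.ω) ^ 2 := by
    refine ht.trans (mul_le_mul' (mul_le_of_le_one_right' hϖ1.le) ?_)
    rw [pow_succ]
    exact mul_le_of_le_one_right' hl1
  have hω3 : K.ω ^ 3 = 1 := by linear_combination (K.ω - 1) * K.hω
  by_cases c0 : A.valuation (algebraMap F L t - K.θ) < A.valuation (1 - algebraMap F L K.ω)
  · exact ⟨t, K.valuation_sub_le_of_cube_near hθ hE2 c0⟩
  by_cases c1 : A.valuation (algebraMap F L (K.ω * t) - K.θ) <
      A.valuation (1 - algebraMap F L K.ω)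
  · refine ⟨_, K.valuation_sub_le_of_cube_near hθ ?_ c1⟩
    rwa [mul_pow, hω3, one_mul]
  by_cases c2 : A.valuation (algebraMap F L (K.ω ^ 2 * t) - K.θ) <
      A.valuation (1 - algebraMap F L K.ω)
  · refine ⟨_, K.valuation_sub_le_of_cube_near hθ ?_ c2⟩
    rwa [mul_pow, ← pow_mul, mul_comm 2 3, pow_mul, hω3, one_pow, one_mul]
  exfalso
  rw [not_lt] at c0 c1 c2
  have e : algebraMap F L (t ^ 3 - K.p) = (algebraMap F L t - K.θ) *
      (algebraMap F L (K.ω * t) - K.θ) * (algebraMap F L (K.ω ^ 2 * t) - K.θ) := by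
    simp only [map_sub, map_pow, map_mul, ← K.hθ]
    have h := K.hω'
    linear_combination (- algebraMap F L t ^ 3 * (algebraMap F L K.ω - 1) +
      algebraMap F L t ^ 2 * K.θ * algebraMap F L K.ω - algebraMap F L t * K.θ ^ 2) * h
  rw [e, map_mul, map_mul] at hE3
  refine absurd hE3 (not_lt.2 ?_)
  rw [pow_succ, pow_two]
  exact mul_le_mul' (mul_le_mul' c0 c1) c2

theorem exists_cube_le {p q t : F} (h3 : (3 : F) ≠ 0) (ht : v.valuation F t = 1)
    (hp : v.valuation F p ≤ 1) (hq : v.valuation F q < 1)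
    (h₁ : v.valuation F ((t ^ 3 - p) / 3) ≤ v.valuation F q)
    (h₂ : v.valuation F ((t ^ 3 - p) ^ 2 / 27) ≤ v.valuation F q) (ε : F) (hε : ε ≠ 0) :
    ∃ t : F, v.valuation F (t ^ 3 - p) ≤ v.valuation F ε := by
  obtain ⟨n, hn⟩ := exists_pow_lt₀ hq (Units.mk0 _ ((Valuation.ne_zero_iff _).2 hε))
  obtain ⟨t', -, -, -, h⟩ := exists_cube_near (v.valuation F) h3 ht hq h₁ h₂ n
  refine ⟨t', h.trans ((mul_le_of_le_one_left' ?_).trans hn.le)⟩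
  exact Valuation.map_sub_le _ (by rw [map_pow, ht, one_pow]) hp

theorem valuation_θ_eq_one (hA : A.IsAbove v F) (hp : v.valuation F K.p = 1) :
    A.valuation K.θ = 1 := by
  have h := congrArg A.valuation K.hθ
  rw [map_pow, hA.valuation_eq_one_iff.2 hp] at h
  exact (pow_eq_one_iff_of_nonneg zero_le three_ne_zero).1 h

theorem locallySplit_of_cube_near [CharZero F] (hA : A.IsAbove v F) {q t : F}
    (ht : v.valuation F t = 1) (hp : v.valuation F K.p = 1) (hq : v.valuation F q < 1)
    (h₁ : v.valuation F ((t ^ 3 - K.p) / 3) ≤ v.valuation F q)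
    (h₂ : v.valuation F ((t ^ 3 - K.p) ^ 2 / 27) ≤ v.valuation F q)
    {G : Matrix (Fin 3) (Fin 3) L} (hG : G.det ≠ 0) : LocallySplit F A G := by
  have hθ := K.valuation_θ_eq_one hA hp
  obtain ⟨ϖ, hϖ⟩ := v.valuation_exists_uniformizer F
  refine locallySplit_of_dense A (η := algebraMap F L ϖ) ?_ ?_ (K.dense_of_approx hθ.le
    (K.approx_of_cube_near hA (exists_cube_le three_ne_zero ht hp.le hq h₁ h₂) hθ)) hG
  · rw [Ne, map_eq_zero]
    rintro rfl
    rw [map_zero] at hϖ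
    exact WithZero.exp_ne_zero hϖ.symm
  · rw [hA.valuation_lt_one_iff, hϖ, ← WithZero.exp_zero, WithZero.exp_lt_exp]; norm_num

end CubicKummer

end Newton

section Unramified

open IsDedekindDomain Matrix

theorem ValuationSubring.mem_of_pow_mem {L : Type*} [Field L] (A : ValuationSubring L) {x : L}
    {n : ℕ} (hn : n ≠ 0) (h : x ^ n ∈ A) : x ∈ A := by
  rw [← A.valuation_le_one_iff, map_pow] at h
  rw [← A.valuation_le_one_iff]
  exact (pow_le_one_iff_of_nonneg zero_le hn).1 h

namespace ConjugateTriple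

variable {F L : Type*} [Field F] [Field L] [Algebra F L] {K : CubicKummer F L}
  (T : ConjugateTriple K)

theorem exists_integral_frame (A : ValuationSubring L) :
    ∃ G κ r s, T.IsFrame G κ r s ∧ r ∈ A ∧ s ∈ A := by
  have key : ∀ {G : Matrix (Fin 3) (Fin 3) L} {κ r s : L}, T.IsFrame G κ r s → r ∈ A → s ∈ A := by
    intro G κ r s h hr
    refine A.mem_of_pow_mem two_ne_zero ?_
    rw [h.curve]
    exact sub_mem (pow_mem hr 3) hr
  by_cases hr : T.r ∈ A
  · exact ⟨_, _, _, _, T.isFrame_frame, hr, key T.isFrame_frame hr⟩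
  · have hr0 : T.r ≠ 0 := fun h => hr (h ▸ A.zero_mem)
    have h := T.isFrame_frame.mul_translation hr0
    have hr' : -1 / T.r ∈ A := by
      rw [neg_div, one_div]
      exact neg_mem ((A.mem_or_inv_mem T.r).resolve_left hr)
    exact ⟨_, _, _, _, h, hr', key h hr'⟩

/-- The local condition needed at the place `A`. -/
def LocalCondition (A : ValuationSubring L) : Prop :=
  ∃ G κ r s, T.IsFrame G κ r s ∧ r ∈ A ∧ s ∈ A ∧ LocallySplit F A (T.coord⁻¹ * G)

end ConjugateTriple

variable {O F L : Type*} [CommRing O] [IsDedekindDomain O] [Field F] [Algebra O F]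
  [IsFractionRing O F] [Field L] [Algebra F L]

namespace CubicKummer

variable (K : CubicKummer F L) {A : ValuationSubring L} {v : HeightOneSpectrum O}

theorem lt_one_of_linear (hθ : A.valuation K.θ = 1)
    (hno : ∀ t : F, ¬ A.valuation (algebraMap F L (t ^ 3 - K.p)) < 1) {a b : F}
    (hb : A.valuation (algebraMap F L b) ≤ 1)
    (h : A.valuation (algebraMap F L a + algebraMap F L b * K.θ) < 1) :
    A.valuation (algebraMap F L a) < 1 ∧ A.valuation (algebraMap F L b) < 1 := by
  rcases hb.lt_or_eq with hb1 | hb1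
  · refine ⟨?_, hb1⟩
    have e : algebraMap F L a = (algebraMap F L a + algebraMap F L b * K.θ) -
      algebraMap F L b * K.θ := by ring
    rw [e]
    exact A.valuation.map_sub_lt h (by rwa [map_mul, hθ, mul_one])
  · exfalso
    have hb0 : b ≠ 0 := by
      rintro rfl; simp at hb1
    have hb0' : algebraMap F L b ≠ 0 := by rwa [Ne, map_eq_zero]
    refine hno (-(a / b)) ?_
    have e : algebraMap F L ((-(a / b)) ^ 3 - K.p) =
        -((algebraMap F L a + algebraMap F L b * K.θ) / algebraMap F L b) *
        (algebraMap F L (a / b) ^ 2 - algebraMap F L (a / b) * K.θ + K.θ ^ 2) := by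
      rw [map_sub, map_pow, ← K.hθ, map_neg, map_div₀]
      field_simp
      ring
    have ha : A.valuation (algebraMap F L a) ≤ 1 := by
      have e : algebraMap F L a = (algebraMap F L a + algebraMap F L b * K.θ) -
        algebraMap F L b * K.θ := by ring
      rw [e]
      exact A.valuation.map_sub_le h.le (by rw [map_mul, hθ, mul_one, hb1])
    have hab : A.valuation (algebraMap F L (a / b)) ≤ 1 := by
      rwa [map_div₀, map_div₀, hb1, div_one]
    rw [e, map_mul, Valuation.map_neg, map_div₀, hb1, div_one]
    refine mul_lt_one_of_lt_of_le h (A.valuation.map_add_le (A.valuation.map_sub_le ?_ ?_) ?_)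
    · rw [map_pow]; exact pow_le_one₀ zero_le hab
    · rw [map_mul, hθ, mul_one]; exact hab
    · rw [map_pow, hθ, one_pow]

theorem lt_one_of_quadratic (hθ : A.valuation K.θ = 1)
    (hno : ∀ t : F, ¬ A.valuation (algebraMap F L (t ^ 3 - K.p)) < 1) {a b c : F}
    (ha : A.valuation (algebraMap F L a) ≤ 1)
    (hb : A.valuation (algebraMap F L b) ≤ 1) (hc : A.valuation (algebraMap F L c) ≤ 1)
    (h : A.valuation (algebraMap F L a + algebraMap F L b * K.θ + algebraMap F L c * K.θ ^ 2) < 1) :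
    A.valuation (algebraMap F L a) < 1 ∧ A.valuation (algebraMap F L b) < 1 ∧
      A.valuation (algebraMap F L c) < 1 := by
  rcases hc.lt_or_eq with hc1 | hc1
  · have e : algebraMap F L a + algebraMap F L b * K.θ = (algebraMap F L a +
      algebraMap F L b * K.θ + algebraMap F L c * K.θ ^ 2) - algebraMap F L c * K.θ ^ 2 := by ring
    have := K.lt_one_of_linear hθ hno hb (a := a) (by
      rw [e]
      exact A.valuation.map_sub_lt h (by rwa [map_mul, map_pow, hθ, one_pow, mul_one]))
    exact ⟨this.1, this.2, hc1⟩
  · exfalso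
    have hc0 : c ≠ 0 := by
      rintro rfl; simp at hc1
    have hp : A.valuation (algebraMap F L K.p) = 1 := by rw [← K.hθ, map_pow, hθ, one_pow]
    have hb' : A.valuation (algebraMap F L (a * c - b ^ 2)) ≤ 1 := by
      rw [map_sub, map_mul, map_pow]
      refine A.valuation.map_sub_le ?_ ?_
      · rw [map_mul]; exact mul_le_one₀ ha zero_le hc
      · rw [map_pow]; exact pow_le_one₀ zero_le hb
    have := K.lt_one_of_linear hθ hno hb' (a := K.p * c ^ 2 - a * b) (by
      have e : algebraMap F L (K.p * c ^ 2 - a * b) + algebraMap F L (a * c - b ^ 2) * K.θ =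
          (algebraMap F L a + algebraMap F L b * K.θ + algebraMap F L c * K.θ ^ 2) *
          (algebraMap F L c * K.θ - algebraMap F L b) := by
        simp only [map_sub, map_mul, map_pow, ← K.hθ]
        ring
      rw [e, map_mul]
      refine mul_lt_one_of_lt_of_le h (A.valuation.map_sub_le ?_ hb)
      rw [map_mul, hθ, mul_one, hc1])
    refine hno (b / c) ?_
    have e : algebraMap F L ((b / c) ^ 3 - K.p) = -(algebraMap F L (K.p * c ^ 2 - a * b) *
        algebraMap F L c + algebraMap F L (a * c - b ^ 2) * algebraMap F L b) /
        algebraMap F L c ^ 3 := by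
      simp only [← map_mul, ← map_add, ← map_neg, ← map_pow, ← map_div₀]
      congr 1
      field_simp
      ring
    rw [e, map_div₀, Valuation.map_neg, map_pow, hc1, one_pow, div_one]
    refine A.valuation.map_add_lt ?_ ?_
    · rw [map_mul, hc1, mul_one]; exact this.1
    · rw [map_mul]; exact mul_lt_one_of_lt_of_le this.2 hb

theorem valuation_σ_of_not_cube (hθ : A.valuation K.θ = 1)
    (hno : ∀ t : F, ¬ A.valuation (algebraMap F L (t ^ 3 - K.p)) < 1) (x : L) :
    A.valuation (K.σ x) = A.valuation x := by
  obtain ⟨a, b, c, rfl⟩ := K.span x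
  obtain ⟨d, hd⟩ : ∃ d, d = ![a, b, c] := ⟨_, rfl⟩
  obtain ⟨i, hi⟩ := Finite.exists_max (fun i => A.valuation (algebraMap F L (d i)))
  have hω := K.valuation_ω A
  by_cases h0 : d i = 0
  · have hz : ∀ j, d j = 0 := fun j => by
      have := hi j
      rw [h0, map_zero, map_zero, le_zero_iff, Valuation.zero_iff, map_eq_zero] at this
      exact this
    have h1 : a = 0 := by simpa [hd] using hz 0
    have h2 : b = 0 := by simpa [hd] using hz 1
    have h3 : c = 0 := by simpa [hd] using hz 2
    simp [h1, h2, h3]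
  have key : ∀ u : Fin 3 → F, (∀ j, A.valuation (algebraMap F L (u j)) =
      A.valuation (algebraMap F L (d j))) →
      A.valuation (algebraMap F L (u 0) + algebraMap F L (u 1) * K.θ +
        algebraMap F L (u 2) * K.θ ^ 2) = A.valuation (algebraMap F L (d i)) := by
    intro u hu
    have hdi : algebraMap F L (d i) ≠ 0 := by rwa [Ne, map_eq_zero]
    have hdi' : 0 < A.valuation (algebraMap F L (d i)) := by
      rw [zero_lt_iff, Valuation.ne_zero_iff]; exact hdi
    have hle : ∀ j, A.valuation (algebraMap F L (u j / d i)) ≤ 1 := fun j => by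
      rw [map_div₀, map_div₀, hu, div_le_one₀ hdi']
      exact hi j
    have e : algebraMap F L (u 0) + algebraMap F L (u 1) * K.θ + algebraMap F L (u 2) * K.θ ^ 2 =
      (algebraMap F L (u 0 / d i) + algebraMap F L (u 1 / d i) * K.θ +
        algebraMap F L (u 2 / d i) * K.θ ^ 2) * algebraMap F L (d i) := by
      simp only [map_div₀]
      field_simp
    rw [e, map_mul]
    refine mul_eq_right₀ hdi'.ne' |>.2 ?_
    refine le_antisymm (A.valuation.map_add_le (A.valuation.map_add_le (hle 0) ?_) ?_) ?_
    · rw [map_mul, hθ, mul_one]; exact hle 1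
    · rw [map_mul, map_pow, hθ, one_pow, mul_one]; exact hle 2
    · rw [← not_lt]
      intro hlt
      have h3 := K.lt_one_of_quadratic hθ hno (hle 0) (hle 1) (hle 2) hlt
      have h4 : ∀ j, A.valuation (algebraMap F L (u j / d i)) < 1 := by
        intro j; fin_cases j
        · exact h3.1
        · exact h3.2.1
        · exact h3.2.2
      have := h4 i
      rw [map_div₀, map_div₀, hu, div_self hdi'.ne'] at this
      exact lt_irrefl _ this
  have k1 := key d fun _ => rfl
  have k2 := key ![a, K.ω * b, K.ω ^ 2 * c] (by
    intro j; fin_cases j <;> simp [hd, hω])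
  have e : K.σ (algebraMap F L a + algebraMap F L b * K.θ + algebraMap F L c * K.θ ^ 2) =
      algebraMap F L a + algebraMap F L (K.ω * b) * K.θ +
      algebraMap F L (K.ω ^ 2 * c) * K.θ ^ 2 := by
    simp only [map_add, map_mul, map_pow, K.σ_algebraMap, K.hσ]
    ring
  rw [e]
  simp only [hd, cons_val_zero, cons_val_one, cons_val_two, head_cons, tail_cons] at k1 k2
  rw [k1, k2]

end CubicKummer

namespace ConjugateTriple

variable {K : CubicKummer F L} (T : ConjugateTriple K) {A : ValuationSubring L}
  {v : HeightOneSpectrum O}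

theorem cocycle_entries_mem [CharZero F] (h2 : A.valuation 2 = 1)
    (hσ : ∀ x, A.valuation (K.σ x) = A.valuation x) {G : Matrix (Fin 3) (Fin 3) L} {κ r s : L}
    (hG : T.IsFrame G κ r s) (hr : r ∈ A) (hs : s ∈ A) (i j : Fin 3) : T.cocycle G i j ∈ A := by
  have hmem : ∀ x, x ∈ A → K.σ x ∈ A := fun x hx => by
    rw [← A.valuation_le_one_iff] at hx ⊢
    rwa [hσ]
  have hdet : T.cocycle G * (T.cocycle G)⁻¹ = 1 := by
    refine mul_nonsing_inv _ (isUnit_iff_ne_zero.2 ?_)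
    rw [det_cocycle hG]
    exact div_ne_zero (by simpa using hG.ne_zero) hG.ne_zero
  refine entries_mem_of_cubicForm_comp (A := A) h2 ⟨r, hr⟩ ⟨s, hs⟩ ⟨K.σ r, hmem r hr⟩
    ⟨K.σ s, hmem s hs⟩ ?_ ?_ (c := K.σ κ / κ) ?_ hdet (fun y => cubicForm_cocycle hG y) i j
  · exact Subtype.ext hG.curve
  · refine Subtype.ext ?_
    change K.σ s ^ 2 = K.σ r ^ 3 - K.σ r
    rw [← map_pow, hG.curve, map_sub, map_pow]
  · rw [map_div₀, hσ, div_self]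
    rw [Valuation.ne_zero_iff]; exact hG.ne_zero

theorem localCondition_of_not_cube [CharZero F] (h2 : A.valuation 2 = 1) (h3 : A.valuation 3 = 1)
    (hθ : A.valuation K.θ = 1)
    (hno : ∀ t : F, ¬ A.valuation (algebraMap F L (t ^ 3 - K.p)) < 1) : T.LocalCondition A := by
  obtain ⟨G, κ, r, s, hG, hr, hs⟩ := T.exists_integral_frame A
  have hσ := K.valuation_σ_of_not_cube hθ hno
  exact ⟨G, κ, r, s, hG, hr, hs, locallySplit_of_three_unit A K.σ (fun x => K.exists_of_fixed)
    K.σ_cube hσ (det_coord_inv_mul_ne_zero hG) (map_eq_mul_cocycle hG)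
    (T.cocycle_entries_mem h2 hσ hG hr hs) K.hω K.hσ hθ h3⟩

theorem localCondition_of_cube_near [CharZero F] (hA : A.IsAbove v F) {q t : F}
    (ht : v.valuation F t = 1) (hp : v.valuation F K.p = 1) (hq : v.valuation F q < 1)
    (h₁ : v.valuation F ((t ^ 3 - K.p) / 3) ≤ v.valuation F q)
    (h₂ : v.valuation F ((t ^ 3 - K.p) ^ 2 / 27) ≤ v.valuation F q) : T.LocalCondition A := by
  obtain ⟨G, κ, r, s, hG, hr, hs⟩ := T.exists_integral_frame A
  exact ⟨G, κ, r, s, hG, hr, hs,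
    K.locallySplit_of_cube_near hA ht hp hq h₁ h₂ (det_coord_inv_mul_ne_zero hG)⟩

end ConjugateTriple

end Unramified

section Ramified

open IsDedekindDomain

variable {O F L : Type*} [CommRing O] [IsDedekindDomain O] [Field F] [Algebra O F]
  [IsFractionRing O F] [Field L] [Algebra F L]

theorem ValuationSubring.IsAbove.eq_zero_of_mul_pow_eq {A : ValuationSubring L}
    {v : HeightOneSpectrum O} (hA : A.IsAbove v F) {l : F}
    (hl : v.valuation F l = WithZero.exp (-1)) {ϖ : L}
    (hϖ : A.valuation ϖ ^ 3 = A.valuation (algebraMap F L l)) {a b : F} {i j : ℕ} (hi : i < 3)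
    (hj : j < 3) (hij : i ≠ j) (h : A.valuation (algebraMap F L a * ϖ ^ i) =
      A.valuation (algebraMap F L b * ϖ ^ j)) : a = 0 ∧ b = 0 := by
  have hl0 : l ≠ 0 := by
    rintro rfl; rw [map_zero] at hl; exact WithZero.exp_ne_zero hl.symm
  have hϖ0 : ϖ ≠ 0 := by
    rintro rfl
    rw [map_zero, zero_pow three_ne_zero, eq_comm, Valuation.zero_iff, map_eq_zero] at hϖ
    exact hl0 hϖ
  by_cases ha : a = 0
  · refine ⟨ha, ?_⟩
    rw [ha, map_zero, zero_mul, map_zero, eq_comm, Valuation.zero_iff, mul_eq_zero,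
      map_eq_zero] at h
    exact h.resolve_right (pow_ne_zero _ hϖ0)
  by_cases hb : b = 0
  · rw [hb, map_zero, zero_mul, map_zero, Valuation.zero_iff, mul_eq_zero, map_eq_zero] at h
    exact absurd (h.resolve_right (pow_ne_zero _ hϖ0)) ha
  exfalso
  have h3 := congrArg (· ^ 3) h
  simp only [map_mul, map_pow, mul_pow] at h3
  rw [← pow_mul, mul_comm i, pow_mul, hϖ, ← pow_mul, mul_comm j, pow_mul, hϖ] at h3
  simp only [← map_mul, ← map_pow] at h3
  have h4 : v.valuation F (a ^ 3 * l ^ i) = v.valuation F (b ^ 3 * l ^ j) :=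
    le_antisymm (hA.valuation_le_iff.1 h3.le) (hA.valuation_le_iff.1 h3.ge)
  have hva : v.valuation F a ≠ 0 := (Valuation.ne_zero_iff _).2 ha
  have hvb : v.valuation F b ≠ 0 := (Valuation.ne_zero_iff _).2 hb
  have h5 := congrArg WithZero.log h4
  simp only [map_mul, map_pow, hl] at h5
  rw [WithZero.log_mul (pow_ne_zero _ hva) (pow_ne_zero _ WithZero.exp_ne_zero),
    WithZero.log_mul (pow_ne_zero _ hvb) (pow_ne_zero _ WithZero.exp_ne_zero),
    WithZero.log_pow, WithZero.log_pow, WithZero.log_pow, WithZero.log_pow,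
    WithZero.log_exp] at h5
  simp only [nsmul_eq_mul] at h5
  push_cast at h5
  omega

theorem ValuationSubring.IsAbove.valuation_expansion {A : ValuationSubring L}
    {v : HeightOneSpectrum O} (hA : A.IsAbove v F) {l : F}
    (hl : v.valuation F l = WithZero.exp (-1)) {ϖ : L}
    (hϖ : A.valuation ϖ ^ 3 = A.valuation (algebraMap F L l)) (a b c : F) :
    A.valuation (algebraMap F L a + algebraMap F L b * ϖ + algebraMap F L c * ϖ ^ 2) =
      max (max (A.valuation (algebraMap F L a)) (A.valuation (algebraMap F L b * ϖ)))
        (A.valuation (algebraMap F L c * ϖ ^ 2)) := by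
  have key : ∀ {x y : L}, (A.valuation x = A.valuation y → x = 0 ∧ y = 0) →
      A.valuation (x + y) = max (A.valuation x) (A.valuation y) := by
    intro x y h
    by_cases hxy : A.valuation x = A.valuation y
    · obtain ⟨rfl, rfl⟩ := h hxy
      simp
    · exact Valuation.map_add_of_distinct_val _ hxy
  have h01 : A.valuation (algebraMap F L a) = A.valuation (algebraMap F L b * ϖ) →
      algebraMap F L a = 0 ∧ algebraMap F L b * ϖ = 0 := fun h => by
    obtain ⟨rfl, rfl⟩ := hA.eq_zero_of_mul_pow_eq hl hϖ (a := a) (b := b) (i := 0) (j := 1)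
      (by norm_num) (by norm_num) (by norm_num) (by simpa using h)
    simp
  have h02 : A.valuation (algebraMap F L a) = A.valuation (algebraMap F L c * ϖ ^ 2) →
      algebraMap F L a = 0 ∧ algebraMap F L c * ϖ ^ 2 = 0 := fun h => by
    obtain ⟨rfl, rfl⟩ := hA.eq_zero_of_mul_pow_eq hl hϖ (a := a) (b := c) (i := 0) (j := 2)
      (by norm_num) (by norm_num) (by norm_num) (by simpa using h)
    simp
  have h12 : A.valuation (algebraMap F L b * ϖ) = A.valuation (algebraMap F L c * ϖ ^ 2) →
      algebraMap F L b * ϖ = 0 ∧ algebraMap F L c * ϖ ^ 2 = 0 := fun h => by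
    obtain ⟨rfl, rfl⟩ := hA.eq_zero_of_mul_pow_eq hl hϖ (a := b) (b := c) (i := 1) (j := 2)
      (by norm_num) (by norm_num) (by norm_num) (by simpa using h)
    simp
  rw [key, key h01]
  rw [key h01]
  intro h
  rcases max_choice (A.valuation (algebraMap F L a)) (A.valuation (algebraMap F L b * ϖ)) with hm | hm
  · rw [hm] at h
    obtain ⟨h1, h2⟩ := h02 h
    have h3 : A.valuation (algebraMap F L b * ϖ) ≤ 0 := by
      rw [h1, map_zero] at hm; exact max_eq_left_iff.1 hm
    rw [le_zero_iff, Valuation.zero_iff] at h3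
    exact ⟨by rw [h1, h3, add_zero], h2⟩
  · rw [hm] at h
    obtain ⟨h1, h2⟩ := h12 h
    have h3 : A.valuation (algebraMap F L a) ≤ 0 := by
      rw [h1, map_zero] at hm; exact max_eq_right_iff.1 hm
    rw [le_zero_iff, Valuation.zero_iff] at h3
    exact ⟨by rw [h1, h3, add_zero], h2⟩

/-- A place of `L` totally ramified over `F`, with uniformizer `ϖ`. -/
structure CubicKummer.IsRamified (K : CubicKummer F L) (A : ValuationSubring L)
    (v : HeightOneSpectrum O) (ϖ : L) : Prop where
  isAbove : A.IsAbove v F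
  cube : ∃ l : F, v.valuation F l = WithZero.exp (-1) ∧
    A.valuation ϖ ^ 3 = A.valuation (algebraMap F L l)
  span : ∀ x : L, ∃ a b c : F,
    x = algebraMap F L a + algebraMap F L b * ϖ + algebraMap F L c * ϖ ^ 2
  valuation_map : A.valuation (K.σ ϖ) = A.valuation ϖ

namespace CubicKummer.IsRamified

variable {K : CubicKummer F L} {A : ValuationSubring L} {v : HeightOneSpectrum O} {ϖ : L}

theorem valuation_σ (h : K.IsRamified A v ϖ) (x : L) : A.valuation (K.σ x) = A.valuation x := by
  obtain ⟨a, b, c, rfl⟩ := h.span x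
  obtain ⟨l, hl, hϖ⟩ := h.cube
  simp only [map_add, map_mul, map_pow, K.σ_algebraMap]
  rw [h.isAbove.valuation_expansion hl hϖ, h.isAbove.valuation_expansion hl (h.valuation_map ▸ hϖ)]
  simp only [map_mul, map_pow, h.valuation_map]

theorem ne_zero (h : K.IsRamified A v ϖ) : ϖ ≠ 0 := by
  rintro rfl
  obtain ⟨l, hl, hϖ⟩ := h.cube
  rw [map_zero, zero_pow three_ne_zero, eq_comm, Valuation.zero_iff, map_eq_zero] at hϖ
  rw [hϖ, map_zero] at hl
  exact WithZero.exp_ne_zero hl.symm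

theorem valuation_pos (h : K.IsRamified A v ϖ) : 0 < A.valuation ϖ := by
  rw [zero_lt_iff, Valuation.ne_zero_iff]; exact h.ne_zero

theorem valuation_lt_one (h : K.IsRamified A v ϖ) : A.valuation ϖ < 1 := by
  obtain ⟨l, hl, hϖ⟩ := h.cube
  rw [← pow_lt_one_iff_of_nonneg zero_le three_ne_zero, hϖ, h.isAbove.valuation_lt_one_iff, hl,
    ← WithZero.exp_zero, WithZero.exp_lt_exp]
  norm_num

theorem zpow_le_zpow_iff (h : K.IsRamified A v ϖ) {m n : ℤ} :
    A.valuation ϖ ^ m ≤ A.valuation ϖ ^ n ↔ n ≤ m :=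
  zpow_le_zpow_iff_right_of_lt_one₀ h.valuation_pos h.valuation_lt_one

theorem zpow_lt_zpow_iff (h : K.IsRamified A v ϖ) {m n : ℤ} :
    A.valuation ϖ ^ m < A.valuation ϖ ^ n ↔ n < m :=
  zpow_lt_zpow_iff_right_of_lt_one₀ h.valuation_pos h.valuation_lt_one

theorem exists_zpow_algebraMap (h : K.IsRamified A v ϖ) {a : F} (ha : a ≠ 0) :
    ∃ n : ℤ, A.valuation (algebraMap F L a) = A.valuation ϖ ^ (3 * n) := by
  obtain ⟨l, hl, hϖ⟩ := h.cube
  have hva : v.valuation F a ≠ 0 := (Valuation.ne_zero_iff _).2 ha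
  refine ⟨-WithZero.log (v.valuation F a), ?_⟩
  have h1 : v.valuation F a = v.valuation F (l ^ (-WithZero.log (v.valuation F a))) := by
    rw [map_zpow₀, hl, ← WithZero.exp_zsmul]
    simp [WithZero.exp_log hva]
  rw [_root_.zpow_mul, zpow_ofNat, hϖ, ← map_zpow₀, ← map_zpow₀]
  exact le_antisymm (h.isAbove.valuation_le_iff.2 h1.le) (h.isAbove.valuation_le_iff.2 h1.ge)

theorem exists_zpow (h : K.IsRamified A v ϖ) {x : L} (hx : x ≠ 0) :
    ∃ n : ℤ, A.valuation x = A.valuation ϖ ^ n := by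
  have key : ∀ (a : F) (i : ℕ), A.valuation (algebraMap F L a * ϖ ^ i) ≠ 0 →
      ∃ n : ℤ, A.valuation (algebraMap F L a * ϖ ^ i) = A.valuation ϖ ^ n := by
    intro a i h0
    have ha : a ≠ 0 := by rintro rfl; simp at h0
    obtain ⟨n, hn⟩ := h.exists_zpow_algebraMap ha
    refine ⟨3 * n + i, ?_⟩
    rw [map_mul, hn, map_pow, zpow_add₀ h.valuation_pos.ne', zpow_natCast]
  have hx0 : A.valuation x ≠ 0 := (Valuation.ne_zero_iff _).2 hx
  obtain ⟨l, hl, hϖ⟩ := h.cube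
  obtain ⟨a, b, c, rfl⟩ := h.span x
  rw [h.isAbove.valuation_expansion hl hϖ] at hx0 ⊢
  have k0 := key a 0
  have k1 := key b 1
  have k2 := key c 2
  rw [pow_zero, mul_one] at k0
  rw [pow_one] at k1
  rcases max_choice (max (A.valuation (algebraMap F L a)) (A.valuation (algebraMap F L b * ϖ)))
    (A.valuation (algebraMap F L c * ϖ ^ 2)) with hm | hm
  · rw [hm] at hx0 ⊢
    rcases max_choice (A.valuation (algebraMap F L a)) (A.valuation (algebraMap F L b * ϖ))
      with hm | hm
    · rw [hm] at hx0 ⊢; exact k0 hx0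
    · rw [hm] at hx0 ⊢; exact k1 hx0
  · rw [hm] at hx0 ⊢; exact k2 hx0

theorem le_uniformizer (h : K.IsRamified A v ϖ) {x : L} (hx : A.valuation x < 1) :
    A.valuation x ≤ A.valuation ϖ := by
  rcases eq_or_ne x 0 with rfl | hx0
  · simp
  obtain ⟨n, hn⟩ := h.exists_zpow hx0
  rw [hn, ← zpow_zero (A.valuation ϖ), h.zpow_lt_zpow_iff] at hx
  rw [hn]
  nth_rewrite 2 [← zpow_one (A.valuation ϖ)]
  exact h.zpow_le_zpow_iff.2 hx

theorem exists_residue (h : K.IsRamified A v ϖ) {x : L} (hx : A.valuation x ≤ 1) :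
    ∃ a : F, A.valuation (algebraMap F L a) ≤ 1 ∧
      A.valuation (x - algebraMap F L a) ≤ A.valuation ϖ := by
  obtain ⟨l, hl, hϖ⟩ := h.cube
  obtain ⟨a, b, c, rfl⟩ := h.span x
  have key : ∀ (a : F) (i : ℕ), 0 < i → i < 3 → A.valuation (algebraMap F L a * ϖ ^ i) ≤ 1 →
      A.valuation (algebraMap F L a * ϖ ^ i) ≤ A.valuation ϖ := by
    intro a i hi hi3 h0
    refine h.le_uniformizer (lt_of_le_of_ne h0 ?_)
    intro h1
    have := h.isAbove.eq_zero_of_mul_pow_eq hl hϖ (a := a) (b := 1) (i := i) (j := 0) hi3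
      (by norm_num) hi.ne' (by simpa using h1)
    exact one_ne_zero this.2
  rw [h.isAbove.valuation_expansion hl hϖ, max_le_iff, max_le_iff] at hx
  refine ⟨a, hx.1.1, ?_⟩
  rw [show algebraMap F L a + algebraMap F L b * ϖ + algebraMap F L c * ϖ ^ 2 - algebraMap F L a =
    algebraMap F L b * ϖ ^ 1 + algebraMap F L c * ϖ ^ 2 by ring]
  exact (A.valuation.map_add _ _).trans (max_le
    (key b 1 (by norm_num) (by norm_num) (by simpa using hx.1.2))
    (key c 2 (by norm_num) (by norm_num) hx.2))

end CubicKummer.IsRamified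

end Ramified

namespace CollinearTriple

variable {K : Type*} [Field K] (T : CollinearTriple K)

theorem x₁_mul_sub_sq : T.x₁ * (T.r - T.x₃) ^ 2 =
    -T.r - T.x₃ - 2 * (T.s * T.y₃) + T.r ^ 2 * T.x₃ + T.r * T.x₃ ^ 2 := by
  have h1 : T.s - T.y₃ = -T.k * (T.r - T.x₃) := by
    rw [s]; linear_combination T.k_mul
  have h2 : T.k ^ 2 = T.r + T.x₁ + T.x₃ := by rw [r]; ring
  linear_combination -(T.s - T.y₃ - T.k * (T.r - T.x₃)) * h1 - (T.r - T.x₃) ^ 2 * h2 +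
    T.s_sq + T.y₃_sq

theorem sub_mul_add : (T.x₁ - T.x₃) * (T.s + T.k * T.r) = T.x₁ * T.y₃ + T.x₃ * T.y₁ := by
  rw [s]; linear_combination T.x₁ * T.k_mul

theorem add_sq : (T.s + T.k * T.r) ^ 2 = T.x₁ * T.x₃ * T.r := by
  have hr : (T.x₁ - T.x₃) ^ 2 * T.r =
      (T.y₁ + T.y₃) ^ 2 - (T.x₁ + T.x₃) * (T.x₁ - T.x₃) ^ 2 := by
    rw [r]; linear_combination (T.k * (T.x₁ - T.x₃) + T.y₁ + T.y₃) * T.k_mul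
  refine mul_left_cancel₀ (pow_ne_zero 2 T.sub_ne_zero) ?_
  linear_combination ((T.x₁ - T.x₃) * (T.s + T.k * T.r) + T.x₁ * T.y₃ + T.x₃ * T.y₁) *
    T.sub_mul_add - T.x₁ * T.x₃ * hr + (T.x₁ - T.x₃) * (T.x₁ * T.y₃_sq - T.x₃ * T.y₁_sq)

/-- The frame for the model centred at the translate by `(0, 0)`. -/
def translatedFrame : Matrix (Fin 3) (Fin 3) K := T.frame * translation T.r T.s

theorem translatedFrame_eq : T.translatedFrame =
    !![-T.s / T.r ^ 2, T.k + T.s / T.r, 1 / T.r;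
      1 + T.k * T.s / T.r ^ 2, -T.k ^ 2 + T.x₃ - T.k * T.s / T.r, -T.k / T.r;
      -1 - T.k * T.s / T.r ^ 2, -T.x₁ + T.k ^ 2 + T.k * T.s / T.r, T.k / T.r] := by
  ext i j
  fin_cases i <;> fin_cases j <;>
    simp [translatedFrame, frame, translation, Matrix.mul_apply, Fin.sum_univ_three] <;> ring

/-- The image of the second basis vector determines its preimage under the rotated frame. -/
theorem x₁_mul_eq (hr : T.r ≠ 0) (hx₁ : T.x₁ ≠ 0) (hx₃ : T.x₃ ≠ 0) (n : Fin 3 → K)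
    (hn : T.rotate.translatedFrame.mulVec n =
      (T.rot * T.translatedFrame).mulVec (Pi.single 1 1)) : T.x₁ * n 0 = n 1 := by
  set z := T.k + T.s / T.r with hz
  rw [← Matrix.mulVec_mulVec, Matrix.mulVec_single_one] at hn
  rw [translatedFrame_eq, translatedFrame_eq] at hn
  have e0 : -T.rotate.s / T.rotate.r ^ 2 * n 0 + (T.rotate.k + T.rotate.s / T.rotate.r) * n 1 + 1 / T.rotate.r * n 2 = z := by
    simpa [rot, Matrix.mulVec, dotProduct, Fin.sum_univ_three, ← hz] using congrFun hn 0
  have e1 : (1 + T.rotate.k * T.rotate.s / T.rotate.r ^ 2) * n 0 + (-T.rotate.k ^ 2 + T.x₁ - T.rotate.k * T.rotate.s / T.rotate.r) * n 1 + -T.rotate.k / T.rotate.r * n 2 =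
      -(T.μ * z) - (-T.k ^ 2 + T.x₃ - T.k * T.s / T.r) -
        (-T.x₁ + T.k ^ 2 + T.k * T.s / T.r) := by
    have := congrFun hn 1
    simp [rot, Matrix.mulVec, dotProduct, Fin.sum_univ_three, ← hz] at this
    have hx2 : T.rotate.x₃ = T.x₁ := rfl
    rw [hx2] at this
    linear_combination this
  have e2 : (-1 - T.rotate.k * T.rotate.s / T.rotate.r ^ 2) * n 0 + (-T.x₂ + T.rotate.k ^ 2 + T.rotate.k * T.rotate.s / T.rotate.r) * n 1 + T.rotate.k / T.rotate.r * n 2 =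
      -T.k ^ 2 + T.x₃ - T.k * T.s / T.r := by
    have := congrFun hn 2
    simp [rot, Matrix.mulVec, dotProduct, Fin.sum_univ_three, ← hz] at this
    have hx1 : T.rotate.x₁ = T.x₂ := rfl
    rw [hx1] at this
    linear_combination this
  have hzr : z * T.r = T.s + T.k * T.r := by rw [hz]; field_simp; ring
  have hk₂ : T.rotate.k * (T.x₂ - T.x₁) = T.μ * T.x₂ + T.b + T.y₁ := T.rotate.k_mul
  have f1 : (T.x₁ - T.x₂) * n 1 = T.x₁ - (T.k + T.μ) * z := by
    linear_combination e1 + e2 + T.k * hz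
  have f2 : n 0 + T.x₁ * n 1 = T.rotate.k * z - T.μ * z - T.x₃ + T.x₁ := by
    linear_combination e1 + T.rotate.k * e0
  have hH : T.x₁ * T.y₃ + T.x₃ * T.y₁ ≠ 0 := by
    rw [← T.sub_mul_add]
    refine mul_ne_zero T.sub_ne_zero fun h0 => ?_
    have := T.add_sq
    rw [h0, zero_pow two_ne_zero, eq_comm] at this
    exact mul_ne_zero (mul_ne_zero hx₁ hx₃) hr this
  have hzH : z * (T.x₁ * T.y₃ + T.x₃ * T.y₁) = T.x₁ * T.x₃ * (T.x₁ - T.x₃) := by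
    refine mul_right_cancel₀ hr ?_
    rw [← T.sub_mul_add]
    linear_combination (T.x₁ - T.x₃) * (T.s + T.k * T.r) * hzr + (T.x₁ - T.x₃) * T.add_sq
  have hkμ : (T.k + T.μ) * (T.x₁ - T.x₃) = 2 * T.y₁ := by
    have h3 := T.k_mul
    rw [y₃] at h3
    have hy : T.y₁ = T.μ * T.x₁ + T.b := rfl
    linear_combination h3 - hy
  have hy : T.y₁ = T.μ * T.x₁ + T.b := rfl
  have key : (T.x₁ * T.y₃ + T.x₃ * T.y₁) * (T.x₂ * T.x₃ + T.μ * T.b) +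
      T.x₃ * T.y₁ * (T.x₁ * T.x₃ + 1) = 0 := by
    rw [y₁, y₃]
    linear_combination T.x₃ * (T.μ * T.x₁ + T.b) * T.pair_eq + T.μ * (T.x₃ - T.x₁) * T.prod_eq
  refine mul_left_cancel₀ (_root_.sub_ne_zero.2 T.ne₁₂) (mul_left_cancel₀ T.sub_ne_zero
    (mul_left_cancel₀ hH ?_))
  set H := T.x₁ * T.y₃ + T.x₃ * T.y₁
  linear_combination H * (T.x₁ - T.x₃) * ((T.x₁ - T.x₂) * T.x₁ * f2 - (T.x₁ ^ 2 + 1) * f1 -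
    T.x₁ * z * hk₂) + H * (T.x₁ ^ 2 + 1) * z * hkμ + 2 * T.y₁ * (T.x₁ * T.x₃ + 1) * hzH -
    H * (T.x₁ - T.x₃) * T.x₁ * T.pair_eq + 2 * (T.x₁ - T.x₃) * T.x₁ * key +
    H * z * (T.x₁ - T.x₃) * T.x₁ * hy

end CollinearTriple

section Residue

open Matrix

theorem scalar_of_cubicForm_comp {k : Type*} [Field k] (h2 : (2 : k) ≠ 0)
    (M : Matrix (Fin 3) (Fin 3) k) {c : k} (hc : c ≠ 0) (h10 : M 1 0 = 0) (h12 : M 1 2 = 0)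
    (hdet : M.det = c)
    (hf : ∀ y, cubicForm 0 0 (M *ᵥ y) = c * cubicForm 0 0 y) {n : Fin 3 → k} (hn0 : n 0 = 0)
    (hn : M *ᵥ n = Pi.single 1 1) : M = M 0 0 • 1 ∧ M 0 0 ^ 3 = c := by
  have hf' : ∀ e x u : k, (M 2 0 * e + M 2 1 * x + M 2 2 * u) ^ 2 * (M 1 1 * x) -
      (M 0 0 * e + M 0 1 * x + M 0 2 * u) * (M 1 1 * x) ^ 2 +
      (M 0 0 * e + M 0 1 * x + M 0 2 * u) ^ 3 = c * (u ^ 2 * x - e * x ^ 2 + e ^ 3) := by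
    intro e x u
    have := hf ![e, x, u]
    simp [cubicForm, pointCubic, mulVec, dotProduct, Fin.sum_univ_three, h10, h12] at this
    linear_combination this
  have h02 : M 0 2 = 0 := by
    have := hf' 0 0 1
    refine pow_eq_zero_iff (three_ne_zero) |>.1 ?_
    linear_combination this
  have e0 : M 0 1 * n 1 = 0 := by
    have := congrFun hn 0
    simp [mulVec, dotProduct, Fin.sum_univ_three, hn0, h02] at this
    simpa using this
  have e1 : M 1 1 * n 1 = 1 := by
    have := congrFun hn 1
    simpa [mulVec, dotProduct, Fin.sum_univ_three, hn0, h12] using this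
  have hτ : M 1 1 ≠ 0 := left_ne_zero_of_mul_eq_one e1
  have h01 : M 0 1 = 0 := (mul_eq_zero.1 e0).resolve_right (right_ne_zero_of_mul_eq_one e1)
  have h21 : M 2 1 = 0 := by
    have := hf' 0 1 0
    rw [h01] at this
    refine pow_eq_zero_iff (two_ne_zero) |>.1 ((mul_eq_zero.1 (?_ : M 2 1 ^ 2 * M 1 1 = 0)).resolve_right hτ)
    linear_combination this
  simp only [h01, h02, h21, zero_mul, add_zero] at hf'
  have p1 := hf' 0 1 1
  have p2 := hf' 1 0 0
  have p3 := hf' 1 1 0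
  have p4 := hf' 1 (-1) 0
  have h20 : M 2 0 = 0 := by
    refine pow_eq_zero_iff (two_ne_zero) |>.1 ((mul_eq_zero.1
      (?_ : M 2 0 ^ 2 * (2 * M 1 1) = 0)).resolve_right (mul_ne_zero h2 hτ))
    linear_combination p3 - p4
  rw [det_fin_three, h10, h12, h01, h02, h20, h21] at hdet
  rw [h20] at p3
  have ha3 : M 0 0 ^ 3 = c := by linear_combination p2
  have ha : M 0 0 ≠ 0 := by
    intro h0; rw [h0] at ha3; exact hc (by linear_combination -ha3)
  have hsq : M 1 1 ^ 2 = M 0 0 ^ 2 := mul_left_cancel₀ ha (by linear_combination -p3)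
  have hd : M 2 2 = M 1 1 := by
    refine mul_left_cancel₀ (mul_ne_zero ha hτ) ?_
    linear_combination hdet - ha3 - M 0 0 * hsq
  have hτa : M 1 1 = M 0 0 := by
    refine mul_left_cancel₀ (pow_ne_zero 2 ha) ?_
    rw [hd] at p1
    linear_combination p1 - ha3 - M 1 1 * hsq
  refine ⟨?_, ha3⟩
  ext i j
  fin_cases i <;> fin_cases j <;> simp [h10, h12, h01, h02, h20, h21, hd, hτa]

end Residue

section Expansion

open Matrix

variable {L : Type*} [Field L] (A : ValuationSubring L)

namespace CollinearTriple

variable {A} (T : CollinearTriple L)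

theorem valuation_s_sq (h : 1 < A.valuation T.r) :
    A.valuation T.s ^ 2 = A.valuation T.r ^ 3 := by
  rw [← map_pow, T.s_sq, Valuation.map_sub_eq_of_lt_left, map_pow]
  rw [map_pow]
  exact lt_self_pow₀ h (by norm_num)

theorem valuation_x₁_le_r (h : 1 < A.valuation T.x₁) (h3 : A.valuation T.x₃ = A.valuation T.x₁) :
    A.valuation T.x₁ ≤ A.valuation T.r := by
  by_contra! hr
  set X := A.valuation T.x₁
  have hX0 : 0 < X := zero_lt_one.trans h
  have hX3 : X < X ^ 3 := lt_self_pow₀ h (by norm_num)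
  have hs : A.valuation T.s ^ 2 < X ^ 3 := by
    rw [← map_pow, T.s_sq]
    refine Valuation.map_sub_lt _ ?_ (hr.trans hX3)
    rw [map_pow]
    exact pow_lt_pow_left₀ hr zero_le (by norm_num)
  have hy : A.valuation T.y₃ ^ 2 = X ^ 3 := by
    rw [← map_pow, T.y₃_sq, Valuation.map_sub_eq_of_lt_left, map_pow, h3]
    rw [map_pow, h3]
    exact lt_self_pow₀ h (by norm_num)
  have hsy : A.valuation (2 * (T.s * T.y₃)) < X ^ 3 := by
    have h2 : A.valuation 2 ≤ 1 := (A.valuation_le_one_iff 2).2 (natCast_mem A 2)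
    rw [map_mul]
    refine (mul_le_of_le_one_left zero_le h2).trans_lt ?_
    rw [← pow_lt_pow_iff_left₀ zero_le zero_le two_ne_zero, map_mul, mul_pow, hy, sq (X ^ 3)]
    exact mul_lt_mul_of_pos_right hs (pow_pos hX0 3)
  have hl : A.valuation (T.x₁ * (T.r - T.x₃) ^ 2) = X ^ 3 := by
    rw [map_mul, map_pow, Valuation.map_sub_swap, Valuation.map_sub_eq_of_lt_left, h3]
    · exact (pow_succ' X 2).symm
    · rwa [h3]
  rw [T.x₁_mul_sub_sq] at hl
  refine hl.not_lt (Valuation.map_add_lt _ (Valuation.map_add_lt _ (Valuation.map_sub_lt _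
    (Valuation.map_sub_lt _ ?_ ?_) hsy) ?_) ?_)
  · rw [Valuation.map_neg]; exact hr.trans hX3
  · rw [h3]; exact hX3
  · rw [map_mul, map_pow, h3, show X ^ 3 = X ^ 2 * X from pow_succ X 2]
    exact mul_lt_mul_of_pos_right (pow_lt_pow_left₀ hr zero_le two_ne_zero) hX0
  · rw [map_mul, map_pow, h3, show X ^ 3 = X * X ^ 2 from pow_succ' X 2]
    exact mul_lt_mul_of_pos_right hr (pow_pos hX0 2)

/-- Valuations of the first row of the translated frame. -/
theorem valuation_translatedFrame (h : 1 < A.valuation T.x₁)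
    (h3 : A.valuation T.x₃ = A.valuation T.x₁) :
    A.valuation (T.translatedFrame 0 0) = A.valuation (T.translatedFrame 0 1) * (A.valuation T.x₁)⁻¹ ∧
    A.valuation (T.translatedFrame 0 2) ≤
      A.valuation (T.translatedFrame 0 1) * (A.valuation T.x₁)⁻¹ ∧
    A.valuation (T.translatedFrame 0 1) ≠ 0 := by
  have hr := T.valuation_x₁_le_r h h3
  have hs := T.valuation_s_sq (h.trans_le hr)
  have hadd : A.valuation (T.s + T.k * T.r) ^ 2 = A.valuation T.x₁ ^ 2 * A.valuation T.r := by
    rw [← map_pow, T.add_sq, map_mul, map_mul, h3, sq]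
  have hX0 : 0 < A.valuation T.x₁ := zero_lt_one.trans h
  have hR0 : 0 < A.valuation T.r := hX0.trans_le hr
  have hr0 : T.r ≠ 0 := (Valuation.ne_zero_iff _).1 hR0.ne'
  have h00 : A.valuation (T.translatedFrame 0 0) ^ 2 = (A.valuation T.r)⁻¹ := by
    rw [translatedFrame_eq]
    simp only [of_apply, cons_val', cons_val_zero, cons_val_fin_one, map_div₀, Valuation.map_neg,
      map_pow, div_pow, hs]
    field_simp
  have h01 : A.valuation (T.translatedFrame 0 1) ^ 2 =
      A.valuation T.x₁ ^ 2 * (A.valuation T.r)⁻¹ := by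
    rw [translatedFrame_eq]
    have : T.k + T.s / T.r = (T.s + T.k * T.r) / T.r := by field_simp; ring
    simp only [of_apply, cons_val', cons_val_zero, cons_val_one, cons_val_fin_one, this, map_div₀,
      div_pow, hadd]
    field_simp
  have h02 : A.valuation (T.translatedFrame 0 2) = (A.valuation T.r)⁻¹ := by
    rw [translatedFrame_eq]
    simp
  refine ⟨?_, ?_, ?_⟩
  · refine (pow_left_inj₀ zero_le zero_le two_ne_zero).1 ?_
    rw [h00, mul_pow, h01]
    field_simp
  · refine (pow_le_pow_iff_left₀ zero_le zero_le two_ne_zero).1 ?_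
    rw [h02, mul_pow, h01]
    field_simp
    exact (h.trans_le hr).le
  · intro h0
    rw [h0, zero_pow two_ne_zero, eq_comm] at h01
    exact mul_ne_zero (pow_ne_zero 2 hX0.ne') (inv_ne_zero hR0.ne') h01

end CollinearTriple

end Expansion

section RamifiedFrame

open IsDedekindDomain Matrix

variable {F L : Type*} [Field F] [Field L] [Algebra F L] {K : CubicKummer F L}

/-- A frame with supersingular-type reduction whose cocycle is scalar modulo the maximal ideal. -/
structure ConjugateTriple.IsScalarFrame (T : ConjugateTriple K) (A : ValuationSubring L)
    (G : Matrix (Fin 3) (Fin 3) L) (κ r s : L) : Prop where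
  isFrame : T.IsFrame G κ r s
  r_lt : A.valuation r < 1
  s_lt : A.valuation s < 1
  row_zero : A.valuation (T.cocycle G 1 0) ≤ (A.valuation T.x₁)⁻¹
  row_two : A.valuation (T.cocycle G 1 2) ≤ (A.valuation T.x₁)⁻¹
  diag : A.valuation (T.cocycle G 0 0) = 1
  scalar : ∀ i j, A.valuation ((T.cocycle G - T.cocycle G 0 0 • (1 : Matrix (Fin 3) (Fin 3) L)) i j) < 1

namespace ConjugateTriple

variable (T : ConjugateTriple K) {A : ValuationSubring L}

theorem map_translatedFrame :
    T.translatedFrame.map K.σ = T.rotate.translatedFrame := by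
  have hx1 : K.σ T.x₁ = T.rotate.x₁ := T.σ_x₁
  have hx3 : K.σ T.x₃ = T.rotate.x₃ := T.σ_x₃
  have hy₁ : K.σ T.y₁ = T.rotate.y₁ := by
    simp [CollinearTriple.y₁, T.σ_μ, T.σ_b, hx1]; rfl
  have hy₃ : K.σ T.y₃ = T.rotate.y₃ := by
    simp [CollinearTriple.y₃, T.σ_μ, T.σ_b, hx3]; rfl
  have hk : K.σ T.k = T.rotate.k := by
    simp only [CollinearTriple.k, map_div₀, map_add, map_sub, hx1, hx3, hy₁, hy₃]
  have hr : K.σ T.r = T.rotate.r := by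
    simp only [CollinearTriple.r, map_sub, map_pow, hk, hx1, hx3]
  have hs : K.σ T.s = T.rotate.s := by
    simp only [CollinearTriple.s, map_sub, map_mul, map_neg, hk, hx1, hr, hy₁]
  rw [T.translatedFrame_eq, T.rotate.translatedFrame_eq, ← hx1, ← hx3, ← hk, ← hr, ← hs]
  ext i j
  fin_cases i <;> fin_cases j <;> simp

/-- The translated frame of a triple with a pole at a totally ramified place. -/
theorem isScalarFrame_translatedFrame [CharZero F] (hσ : ∀ x, A.valuation (K.σ x) = A.valuation x)
    (h2 : A.valuation 2 = 1) (hX : 1 < A.valuation T.x₁) :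
    T.IsScalarFrame A T.translatedFrame (-(T.x₁ - T.x₃) / T.r) (-1 / T.r) (T.s / T.r ^ 2) := by
  have h3 : A.valuation T.x₃ = A.valuation T.x₁ := by rw [← T.σ_x₃, hσ]
  have hX0 : 0 < A.valuation T.x₁ := zero_lt_one.trans hX
  have hx₁ : T.x₁ ≠ 0 := (Valuation.ne_zero_iff _).1 hX0.ne'
  have hx₃ : T.x₃ ≠ 0 := (Valuation.ne_zero_iff A.valuation).1 (h3 ▸ hX0.ne')
  have hR := hX.trans_le (T.valuation_x₁_le_r hX h3)
  have hR0 : 0 < A.valuation T.r := zero_lt_one.trans hR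
  have hr0 : T.r ≠ 0 := (Valuation.ne_zero_iff _).1 hR0.ne'
  have hG : T.IsFrame T.translatedFrame (-(T.x₁ - T.x₃) / T.r) (-1 / T.r) (T.s / T.r ^ 2) :=
    T.isFrame_frame.mul_translation hr0
  have hr : A.valuation (-1 / T.r) < 1 := by
    rw [map_div₀, Valuation.map_neg, map_one, one_div]
    exact inv_lt_one_of_one_lt₀ hR
  have hs : A.valuation (T.s / T.r ^ 2) < 1 := by
    rw [← pow_lt_one_iff_of_nonneg zero_le two_ne_zero, map_div₀, div_pow, T.valuation_s_sq hR,
      map_pow, div_lt_one₀ (pow_pos (pow_pos hR0 2) 2), ← pow_mul]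
    exact pow_lt_pow_right₀ hR (by norm_num)
  set κ := -(T.x₁ - T.x₃) / T.r
  set r := -1 / T.r
  set s := T.s / T.r ^ 2
  set M := T.cocycle T.translatedFrame with hMdef
  have hmem : ∀ i j, A.valuation (M i j) ≤ 1 := fun i j => (A.valuation_le_one_iff _).2
    (T.cocycle_entries_mem h2 hσ hG ((A.valuation_le_one_iff _).1 hr.le)
      ((A.valuation_le_one_iff _).1 hs.le) i j)
  obtain ⟨g0, g2, g1⟩ := T.valuation_translatedFrame hX h3
  have hrow : ∀ j, K.σ (T.translatedFrame 0 j) = T.translatedFrame 0 0 * M 0 j +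
      T.translatedFrame 0 1 * M 1 j + T.translatedFrame 0 2 * M 2 j := by
    intro j
    have := congrFun (congrFun (map_eq_rot_mul hG) 0) j
    rw [map_apply, Matrix.mul_assoc] at this
    rw [this, mul_apply]
    simp [CollinearTriple.rot, Fin.sum_univ_three, mul_apply, hMdef]
  set g := A.valuation (T.translatedFrame 0 1)
  have hrow' : ∀ j, A.valuation (T.translatedFrame 0 j) ≤ g * (A.valuation T.x₁)⁻¹ →
      A.valuation (M 1 j) ≤ (A.valuation T.x₁)⁻¹ := by
    intro j hj
    refine (mul_le_mul_iff_right₀ (zero_lt_iff.2 g1)).1 ?_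
    rw [← map_mul]
    have : T.translatedFrame 0 1 * M 1 j = K.σ (T.translatedFrame 0 j) -
        (T.translatedFrame 0 0 * M 0 j + T.translatedFrame 0 2 * M 2 j) := by
      rw [hrow j]; ring
    rw [this]
    refine (A.valuation.map_sub _ _).trans (max_le ((hσ _).le.trans hj)
      (Valuation.map_add_le _ ?_ ?_))
    · rw [map_mul, g0]
      exact mul_le_of_le_one_right zero_le (hmem _ _)
    · rw [map_mul]
      exact (mul_le_of_le_one_right zero_le (hmem _ _)).trans g2
  have hXinv : (A.valuation T.x₁)⁻¹ < 1 := inv_lt_one_of_one_lt₀ hX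
  have h10 := hrow' 0 g0.le
  have h12 := hrow' 2 g2
  have hκ : A.valuation (K.σ κ / κ) = 1 := by
    rw [map_div₀, hσ, div_self]
    rw [Valuation.ne_zero_iff]; exact hG.ne_zero
  have hσr : A.valuation (K.σ r) < 1 := by rwa [hσ]
  have hσs : A.valuation (K.σ s) < 1 := by rwa [hσ]
  let ι : A →+* L := A.subtype
  obtain ⟨N, hN⟩ : ∃ N : Matrix (Fin 3) (Fin 3) A, M = N.map ι :=
    ⟨of fun i j => ⟨M i j, (A.valuation_le_one_iff _).1 (hmem i j)⟩, rfl⟩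
  have toA : ∀ x, A.valuation x ≤ 1 → ∃ a : A, ι a = x := fun x hx =>
    ⟨⟨x, (A.valuation_le_one_iff _).1 hx⟩, rfl⟩
  obtain ⟨c, hc⟩ := toA _ hκ.le
  obtain ⟨r₁, hr₁⟩ := toA _ hr.le
  obtain ⟨s₁, hs₁⟩ := toA _ hs.le
  obtain ⟨r₂, hr₂⟩ := toA _ hσr.le
  obtain ⟨s₂, hs₂⟩ := toA _ hσs.le
  let π : A →+* IsLocalRing.ResidueField A := IsLocalRing.residue A
  have hπ : ∀ a : A, π a = 0 ↔ A.valuation (ι a) < 1 := A.residue_eq_zero_iff_valuation_lt_one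
  have hdetN : N.det = c := by
    apply A.subtype_injective
    change ι N.det = ι c
    rw [hc, ← det_cocycle hG, RingHom.map_det]
    exact congrArg det hN.symm
  have hcu : IsUnit N.det := by
    rw [hdetN, A.valuation_eq_one_iff]
    exact (congrArg A.valuation hc).trans hκ
  set n : Fin 3 → A := N⁻¹ *ᵥ Pi.single 1 1
  have hNn : N *ᵥ n = Pi.single 1 1 := by
    rw [mulVec_mulVec, mul_nonsing_inv _ hcu, one_mulVec]
  have hMn : M *ᵥ (ι ∘ n) = Pi.single 1 1 := by
    ext i
    rw [hN, ← RingHom.map_mulVec, hNn]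
    fin_cases i <;> simp
  have hn : T.x₁ * ι (n 0) = ι (n 1) := by
    refine T.x₁_mul_eq hr0 hx₁ hx₃ (ι ∘ n) ?_
    rw [← T.map_translatedFrame, map_eq_rot_mul hG, ← mulVec_mulVec, hMn]
  have hn0 : π (n 0) = 0 := by
    rw [hπ]
    have h4 : ι (n 0) = T.x₁⁻¹ * ι (n 1) := by rw [← hn, inv_mul_cancel_left₀ hx₁]
    rw [h4, map_mul, map_inv₀]
    exact (mul_le_of_le_one_right zero_le (A.valuation_le_one (n 1))).trans_lt hXinv
  have hf : ∀ Y : Fin 3 → A, cubicForm r₁ s₁ (N *ᵥ Y) = c * cubicForm r₂ s₂ Y := by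
    intro Y
    apply A.subtype_injective
    have := cubicForm_cocycle hG (ι ∘ Y)
    rw [← hMdef, hN, ← hr₂, ← hs₂, ← hr₁, ← hs₁, ← hc] at this
    refine (map_pointCubic ι ..).trans (Eq.trans ?_ (this.trans ?_))
    · simp only [cubicForm, RingHom.map_mulVec]
    · rw [map_mul]
      exact congrArg (ι c * ·) (map_pointCubic ι ..).symm
  have hsc := scalar_of_cubicForm_comp (k := IsLocalRing.ResidueField A) ?_ (N.map π) (c := π c)
    ?_ ?_ ?_ ?_ ?_ (n := π ∘ n) hn0 ?_
  · refine ⟨hG, hr, hs, h10, h12, ?_, ?_⟩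
    · refine le_antisymm (hmem 0 0) (not_lt.1 fun hlt => ?_)
      have h0 : π (N 0 0) = 0 := by
        rw [hπ, ← map_apply (f := ι), ← hN]; exact hlt
      have h1 := hsc.2
      rw [map_apply, h0, zero_pow three_ne_zero, eq_comm, hπ, hc] at h1
      exact h1.ne hκ
    · intro i j
      have h1 : π ((N - N 0 0 • (1 : Matrix (Fin 3) (Fin 3) A)) i j) = 0 := by
        have := congrFun (congrFun hsc.1 i) j
        simp only [map_apply, Matrix.smul_apply, Matrix.one_apply, smul_eq_mul, mul_ite, mul_one,
          mul_zero] at this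
        simp only [Matrix.sub_apply, Matrix.smul_apply, Matrix.one_apply, smul_eq_mul, mul_ite,
          mul_one, mul_zero, map_sub, this]
        split_ifs <;> simp
      rw [hπ] at h1
      rw [← hMdef, hN]
      convert h1 using 2
      simp only [Matrix.sub_apply, Matrix.smul_apply, Matrix.one_apply, smul_eq_mul, map_apply,
        map_sub, map_mul]
      split_ifs <;> simp
  · rw [← map_ofNat π 2, Ne, hπ]
    exact fun h => h.ne ((congrArg A.valuation (map_ofNat ι 2)).trans h2)
  · rw [Ne, hπ, hc]
    exact hκ.not_lt
  · rw [map_apply, hπ, ← map_apply (f := ι), ← hN]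
    exact h10.trans_lt hXinv
  · rw [map_apply, hπ, ← map_apply (f := ι), ← hN]
    exact h12.trans_lt hXinv
  · rw [← hdetN, RingHom.map_det]; rfl
  · intro y
    obtain ⟨Y, rfl⟩ : ∃ Y : Fin 3 → A, y = π ∘ Y := by
      choose Y hY using fun i => IsLocalRing.residue_surjective (y i)
      exact ⟨Y, funext fun i => (hY i).symm⟩
    have h4 := congrArg π (hf Y)
    have e₁ : π r₁ = 0 := by rw [hπ, hr₁]; exact hr
    have e₂ : π s₁ = 0 := by rw [hπ, hs₁]; exact hs
    have e₃ : π r₂ = 0 := by rw [hπ, hr₂]; exact hσr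
    have e₄ : π s₂ = 0 := by rw [hπ, hs₂]; exact hσs
    rw [map_mul, cubicForm, cubicForm, map_pointCubic, map_pointCubic, e₁, e₂, e₃, e₄] at h4
    simpa only [cubicForm, RingHom.map_mulVec, Function.comp_apply] using h4
  · ext i
    rw [← RingHom.map_mulVec, hNn]
    fin_cases i <;> simp

end ConjugateTriple

end RamifiedFrame

section Tame

open IsDedekindDomain Matrix

variable {O F L : Type*} [CommRing O] [IsDedekindDomain O] [Field F] [Algebra O F]
  [IsFractionRing O F] [Field L] [Algebra F L] {K : CubicKummer F L}

theorem CubicKummer.IsRamified.valuation_σ_sub_lt {A : ValuationSubring L}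
    {v : HeightOneSpectrum O} {ϖ : L} (h : K.IsRamified A v ϖ) {x : L} (hx : A.valuation x ≤ 1) :
    A.valuation (K.σ x - x) < 1 := by
  obtain ⟨a, -, ha⟩ := h.exists_residue hx
  have h1 := ha.trans_lt h.valuation_lt_one
  have h2 : K.σ x - x = K.σ (x - algebraMap F L a) - (x - algebraMap F L a) := by
    rw [map_sub, K.σ_algebraMap]; ring
  rw [h2]
  exact Valuation.map_sub_lt _ (by rwa [h.valuation_σ]) h1

namespace ConjugateTriple

variable {T : ConjugateTriple K} {A : ValuationSubring L}

theorem cocycle_smul [CharZero F] {G : Matrix (Fin 3) (Fin 3) L} {κ r s : L}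
    (hG : T.IsFrame G κ r s) {c : L} (hc : c ≠ 0) :
    T.cocycle (c • G) = (K.σ c / c) • T.cocycle G := by
  have hu : IsUnit (T.coord⁻¹ * G).det := isUnit_iff_ne_zero.2 (det_coord_inv_mul_ne_zero hG)
  have h1 : (T.coord⁻¹ * (c • G)).map K.σ = K.σ c • (T.coord⁻¹ * G).map K.σ := by
    rw [mul_smul_comm]
    ext i j
    simp only [map_apply, Matrix.smul_apply, smul_eq_mul, map_mul]
  have h2 : (T.coord⁻¹ * (c • G))⁻¹ = c⁻¹ • (T.coord⁻¹ * G)⁻¹ := by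
    rw [mul_smul_comm]
    refine inv_eq_right_inv ?_
    rw [smul_mul_smul_comm, mul_inv_cancel₀ hc, mul_nonsing_inv _ hu, one_smul]
  rw [cocycle, h1, h2, smul_mul_smul_comm, cocycle, div_eq_inv_mul]

theorem cocycle_mul_map [CharZero F] {G : Matrix (Fin 3) (Fin 3) L} {κ r s : L}
    (hG : T.IsFrame G κ r s) :
    T.cocycle G * (T.cocycle G).map K.σ * ((T.cocycle G).map K.σ).map K.σ = 1 := by
  have hu : IsUnit (T.coord⁻¹ * G).det := isUnit_iff_ne_zero.2 (det_coord_inv_mul_ne_zero hG)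
  have hm := map_eq_mul_cocycle hG
  generalize T.coord⁻¹ * G = g at hu hm
  generalize T.cocycle G = M at hm ⊢
  have hmul : ∀ P Q : Matrix (Fin 3) (Fin 3) L, (P * Q).map K.σ = P.map K.σ * Q.map K.σ :=
    fun P Q => by ext i j; simp [mul_apply]
  have h3 : ((g.map K.σ).map K.σ).map K.σ = g := by
    ext i j; simp [K.σ_cube]
  rw [hm, hmul, hmul, hm, hmul, hm] at h3
  have h4 := congrArg (g⁻¹ * ·) h3
  simp only [nonsing_inv_mul _ hu, ← Matrix.mul_assoc, one_mul] at h4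
  exact h4

namespace IsScalarFrame

variable {G : Matrix (Fin 3) (Fin 3) L} {κ r s : L}

theorem valuation_off_diag (h : T.IsScalarFrame A G κ r s) {i j : Fin 3} (hij : i ≠ j) :
    A.valuation (T.cocycle G i j) < 1 := by
  have := h.scalar i j
  simpa [Matrix.sub_apply, Matrix.smul_apply, Matrix.one_apply_ne hij] using this

theorem valuation_le_one (h : T.IsScalarFrame A G κ r s) (i j : Fin 3) :
    A.valuation (T.cocycle G i j) ≤ 1 := by
  by_cases hij : i = j
  · subst hij
    have h1 := h.scalar i i
    have h2 : T.cocycle G i i =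
        (T.cocycle G - T.cocycle G 0 0 • (1 : Matrix (Fin 3) (Fin 3) L)) i i + T.cocycle G 0 0 := by
      simp [Matrix.sub_apply, Matrix.smul_apply]
    rw [h2]
    exact Valuation.map_add_le _ h1.le h.diag.le
  · exact (h.valuation_off_diag hij).le

theorem valuation_pow_three_sub_one [CharZero F] (h : T.IsScalarFrame A G κ r s)
    (hσ : ∀ x, A.valuation (K.σ x) = A.valuation x)
    (hres : ∀ x, A.valuation x ≤ 1 → A.valuation (K.σ x - x) < 1) :
    A.valuation (T.cocycle G 0 0 ^ 3 - 1) < 1 := by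
  have h1 := congrFun (congrFun (cocycle_mul_map h.isFrame) 0) 0
  have hle := h.valuation_le_one
  have h01 := h.valuation_off_diag (i := 0) (j := 1) (by decide)
  have h02 := h.valuation_off_diag (i := 0) (j := 2) (by decide)
  have h10 := h.valuation_off_diag (i := 1) (j := 0) (by decide)
  have h20 := h.valuation_off_diag (i := 2) (j := 0) (by decide)
  set M := T.cocycle G
  simp only [mul_apply, Fin.sum_univ_three, map_apply, one_apply_eq] at h1
  set a := M 0 0
  have ha := hres a (hle 0 0)
  have ha2 := hres (K.σ a) ((hσ a).le.trans (hle 0 0))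
  have hl : ∀ i j k l m n, A.valuation (M i j) < 1 →
      A.valuation (M i j * K.σ (M k l) * K.σ (K.σ (M m n))) < 1 := by
    intro i j k l m n h
    rw [map_mul, map_mul, hσ, hσ, hσ]
    exact (mul_le_of_le_one_right zero_le (hle m n)).trans_lt
      ((mul_le_of_le_one_right zero_le (hle k l)).trans_lt h)
  have hr : ∀ i j k l m n, A.valuation (M m n) < 1 →
      A.valuation (M i j * K.σ (M k l) * K.σ (K.σ (M m n))) < 1 := by
    intro i j k l m n h
    rw [map_mul, map_mul, hσ, hσ, hσ]
    exact (mul_le_of_le_one_left zero_le (mul_le_one' (hle i j) (hle k l))).trans_lt h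
  have e1 : a ^ 3 - 1 = (a * K.σ a * K.σ (K.σ a) - 1) - (a * K.σ a * (K.σ (K.σ a) - K.σ a) +
      (a * (K.σ a + a)) * (K.σ a - a)) := by ring
  have e2 : a * K.σ a * K.σ (K.σ a) - 1 = -((M 0 1 * K.σ (M 1 0) * K.σ (K.σ (M 0 0)) +
      M 0 2 * K.σ (M 2 0) * K.σ (K.σ (M 0 0))) +
      (M 0 0 * K.σ (M 0 1) * K.σ (K.σ (M 1 0)) + M 0 1 * K.σ (M 1 1) * K.σ (K.σ (M 1 0)) +
        M 0 2 * K.σ (M 2 1) * K.σ (K.σ (M 1 0))) +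
      (M 0 0 * K.σ (M 0 2) * K.σ (K.σ (M 2 0)) + M 0 1 * K.σ (M 1 2) * K.σ (K.σ (M 2 0)) +
        M 0 2 * K.σ (M 2 2) * K.σ (K.σ (M 2 0)))) := by
    linear_combination h1
  have ha1 : A.valuation a ≤ 1 := hle 0 0
  have ha3 : A.valuation (K.σ a) ≤ 1 := (hσ a).le.trans ha1
  rw [e1]
  refine Valuation.map_sub_lt _ ?_ (Valuation.map_add_lt _ ?_ ?_)
  · rw [e2, Valuation.map_neg]
    exact Valuation.map_add_lt _ (Valuation.map_add_lt _
      (Valuation.map_add_lt _ (hl _ _ _ _ _ _ h01) (hl _ _ _ _ _ _ h02))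
      (Valuation.map_add_lt _ (Valuation.map_add_lt _ (hr _ _ _ _ _ _ h10) (hr _ _ _ _ _ _ h10))
        (hr _ _ _ _ _ _ h10)))
      (Valuation.map_add_lt _ (Valuation.map_add_lt _ (hr _ _ _ _ _ _ h20) (hr _ _ _ _ _ _ h20))
        (hr _ _ _ _ _ _ h20))
  · rw [map_mul, map_mul]
    exact (mul_le_of_le_one_left zero_le (mul_le_one' ha1 ha3)).trans_lt ha2
  · rw [map_mul, map_mul]
    exact (mul_le_of_le_one_left zero_le (mul_le_one' ha1
      (Valuation.map_add_le _ ha3 ha1))).trans_lt ha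

end IsScalarFrame

end ConjugateTriple

end Tame

section TameDescent

open IsDedekindDomain Matrix

variable {F L : Type*} [Field F] [Field L] [Algebra F L] {K : CubicKummer F L}

namespace ConjugateTriple

variable {T : ConjugateTriple K} {A : ValuationSubring L}

theorem localCondition_of_cocycle_near_one [CharZero F] {G : Matrix (Fin 3) (Fin 3) L} {κ r s : L}
    (hG : T.IsFrame G κ r s) (hr : r ∈ A) (hs : s ∈ A)
    (hσ : ∀ x, A.valuation (K.σ x) = A.valuation x) {c : L} (hc : c + K.σ c + K.σ (K.σ c) = 1)
    (h : ∀ i j, A.valuation (c * (T.cocycle G - 1) i j) < 1) : T.LocalCondition A :=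
  ⟨G, κ, r, s, hG, hr, hs, locallySplit_of_cocycle_near_one A K.σ (fun _ => K.exists_of_fixed)
    K.σ_cube hσ (det_coord_inv_mul_ne_zero hG) (map_eq_mul_cocycle hG) hc h⟩

namespace IsScalarFrame

variable {G : Matrix (Fin 3) (Fin 3) L} {κ r s : L}

theorem localCondition_of_tame [CharZero F] (h : T.IsScalarFrame A G κ r s)
    (hσ : ∀ x, A.valuation (K.σ x) = A.valuation x)
    (hres : ∀ x, A.valuation x ≤ 1 → A.valuation (K.σ x - x) < 1) (h3 : A.valuation 3 = 1) :
    T.LocalCondition A := by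
  have ha := h.valuation_pow_three_sub_one hσ hres
  have hs := h.scalar
  have hcy := fun j : ℕ => cocycle_smul h.isFrame (pow_ne_zero j K.θ_ne_zero)
  set M := T.cocycle G
  set a := M 0 0
  have hω := K.valuation_ω A
  set w := algebraMap F L K.ω
  have hw : w ^ 2 + w + 1 = 0 := K.hω'
  have hw3 : w ^ 3 = 1 := K.ω_cube
  obtain ⟨j, hj⟩ : ∃ j : ℕ, A.valuation (w ^ j * a - 1) < 1 := by
    by_contra! hcon
    have e : a ^ 3 - 1 = (w ^ 0 * a - 1) * (w ^ 1 * a - 1) * (w ^ 2 * a - 1) := by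
      linear_combination -a ^ 3 * hw3 + (a ^ 2 * w - a) * hw
    rw [e, map_mul, map_mul] at ha
    exact (one_le_mul (one_le_mul (hcon 0) (hcon 1)) (hcon 2)).not_gt ha
  have h30 : (3 : L) ≠ 0 := (Valuation.ne_zero_iff A.valuation).1 (h3 ▸ one_ne_zero)
  refine localCondition_of_cocycle_near_one (h.isFrame.smul (pow_ne_zero j K.θ_ne_zero))
    ((A.valuation_le_one_iff _).1 h.r_lt.le) ((A.valuation_le_one_iff _).1 h.s_lt.le) hσ
    (c := 1 / 3) (by rw [map_div₀, map_one, map_ofNat, map_div₀, map_one, map_ofNat]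
                     field_simp; norm_num) fun i k => ?_
  have hθ : K.σ (K.θ ^ j) / K.θ ^ j = w ^ j := by
    rw [map_pow, K.hσ, mul_pow, mul_div_cancel_right₀ _ (pow_ne_zero j K.θ_ne_zero)]
  rw [hcy, hθ, map_mul, map_div₀, map_one, h3, div_one, one_mul]
  have e : (w ^ j • M - 1) i k = w ^ j * (M - a • (1 : Matrix (Fin 3) (Fin 3) L)) i k +
      (w ^ j * a - 1) * (1 : Matrix (Fin 3) (Fin 3) L) i k := by
    simp only [Matrix.sub_apply, Matrix.smul_apply, smul_eq_mul]; ring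
  rw [e]
  refine Valuation.map_add_lt _ ?_ ?_
  · rw [map_mul, map_pow, hω, one_pow, one_mul]
    exact hs i k
  · rw [map_mul]
    refine (mul_le_of_le_one_right zero_le ?_).trans_lt hj
    rw [one_apply]
    split_ifs <;> simp

end IsScalarFrame

end ConjugateTriple

end TameDescent

section FirstOrder

open Matrix

theorem pointCubic_add_mul {R : Type*} [CommRing R] {t r s : R} (ht : t * t = 0) (hr : t * r = 0)
    (hs : t * s = 0) (e x u e' x' u' : R) :
    pointCubic r s (e + t * e') (x + t * x') (u + t * u') =
      pointCubic r s e x u + t * (2 * u * x * u' + u ^ 2 * x' - x ^ 2 * e' - 2 * e * x * x' +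
        3 * e ^ 2 * e') := by
  have h : pointCubic r s (e + t * e') (x + t * x') (u + t * u') =
      pointCubic r s e x u + t * pointCubicDeriv r s e x u e' x' u' := by
    have h := congrArg (· * (pointCubicDeriv r s e' x' u' e x u + t * pointCubic r s e' x' u')) ht
    simp only [pointCubic, pointCubicDeriv] at h ⊢
    linear_combination h
  rw [h]
  simp only [pointCubicDeriv]
  linear_combination (-(2 * u * e * u') - u ^ 2 * e' - 2 * e * x * e' - e ^ 2 * x' -
    3 * r * e ^ 2 * e') * hr - (4 * u * e * e' + 2 * e ^ 2 * u') * hs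

/-- The infinitesimal automorphisms, in characteristic three, of a supersingular cubic. -/
theorem first_order_of_cubicForm_comp {R : Type*} [CommRing R] {t r s c : R} (ht : t * t = 0)
    (hr : t * r = 0) (hs : t * s = 0) (h3 : t * 3 = 0)
    (N : Matrix (Fin 3) (Fin 3) R)
    (h10 : t * N 1 0 = 0) (h12 : t * N 1 2 = 0)
    (hf : ∀ y, cubicForm r s ((1 + t • N) *ᵥ y) = (1 + t * c) * cubicForm r s y) :
    t * N 0 1 = 0 ∧ t * N 2 0 = 0 ∧ t * N 0 0 = t * N 1 1 ∧ t * N 2 2 = t * N 1 1 ∧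
      t * N 0 2 = - (t * N 2 1) := by
  have key : ∀ e x u : R, t * (2 * u * x * (N 2 0 * e + N 2 1 * x + N 2 2 * u) +
      u ^ 2 * (N 1 1 * x) - x ^ 2 * (N 0 0 * e + N 0 1 * x + N 0 2 * u) -
      2 * e * x * (N 1 1 * x)) = t * (c * (u ^ 2 * x - e * x ^ 2 + e ^ 3)) := by
    intro e x u
    have h := hf ![e, x, u]
    have e1 : ∀ i, ((1 + t • N) *ᵥ ![e, x, u]) i =
        ![e, x, u] i + t * (N i 0 * e + N i 1 * x + N i 2 * u) := by
      intro i
      rw [add_mulVec, one_mulVec, smul_mulVec]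
      simp [mulVec, dotProduct, Fin.sum_univ_three]
    simp only [cubicForm, e1] at h
    rw [pointCubic_add_mul ht hr hs] at h
    simp only [pointCubic, cons_val_zero, cons_val_one, cons_val] at h
    linear_combination h - (u ^ 2 - 2 * e * x) * (e * h10 + u * h12) -
      e ^ 2 * (N 0 0 * e + N 0 1 * x + N 0 2 * u) * h3 -
      c * (e * u ^ 2 + x * e ^ 2 + r * e ^ 3) * hr - c * (2 * u * e ^ 2) * hs
  have h01 : t * N 0 1 = 0 := by linear_combination -(key 0 1 0)
  have hc : t * c = 0 := by linear_combination -(key 1 0 0)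
  have hB : t * (2 * N 2 1 - N 0 2) = 0 := by
    linear_combination key 0 1 (-1) - key 0 1 1 + (2 * N 2 1 - N 0 2) * h3
  have hC : t * (2 * N 2 2 + N 1 1) = 0 := by
    linear_combination key 0 1 1 - hB + h01 + hc
  have hD : t * (N 0 0 + 2 * N 1 1) = 0 := by
    linear_combination -(key 1 1 0) - h01
  refine ⟨h01, ?_, ?_, ?_, ?_⟩
  · linear_combination -(key 1 1 1) - h01 - hc + hB + hC - hD + N 2 0 * h3
  · linear_combination hD - N 1 1 * h3
  · linear_combination -hC + N 2 2 * h3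
  · linear_combination -hB + N 2 1 * h3

end FirstOrder

section Wild

open IsDedekindDomain

variable {O F L : Type*} [CommRing O] [IsDedekindDomain O] [Field F] [Algebra O F]
  [IsFractionRing O F] [Field L] [Algebra F L]

namespace CubicKummer

theorem IsRamified.exists_expansion {K : CubicKummer F L} {A : ValuationSubring L}
    {v : HeightOneSpectrum O} {ϖ : L} (h : K.IsRamified A v ϖ) {x : L} {n : ℤ}
    (hx : A.valuation x ≤ A.valuation ϖ ^ n) : ∃ a b c : F,
      x = algebraMap F L a + algebraMap F L b * ϖ + algebraMap F L c * ϖ ^ 2 ∧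
      A.valuation (algebraMap F L a) ≤ A.valuation ϖ ^ n ∧
      A.valuation (algebraMap F L b) ≤ A.valuation ϖ ^ (n - 1) ∧
      A.valuation (algebraMap F L c) ≤ A.valuation ϖ ^ (n - 2) := by
  obtain ⟨l, hl, hϖ⟩ := h.cube
  obtain ⟨a, b, c, rfl⟩ := h.span x
  rw [h.isAbove.valuation_expansion hl hϖ, max_le_iff, max_le_iff] at hx
  refine ⟨a, b, c, rfl, hx.1.1, ?_, ?_⟩
  · have := hx.1.2
    rw [map_mul, ← le_div_iff₀ h.valuation_pos] at this
    rwa [zpow_sub₀ h.valuation_pos.ne', zpow_one]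
  · have := hx.2
    rw [map_mul, map_pow, ← le_div_iff₀ (pow_pos h.valuation_pos 2)] at this
    rwa [zpow_sub₀ h.valuation_pos.ne']

theorem IsRamified.valuation_algebraMap_le {K : CubicKummer F L} {A : ValuationSubring L}
    {v : HeightOneSpectrum O} {ϖ : L} (h : K.IsRamified A v ϖ) {a : F} {n m : ℤ}
    (ha : A.valuation (algebraMap F L a) ≤ A.valuation ϖ ^ n) (hm : 3 * m < n + 3) :
    A.valuation (algebraMap F L a) ≤ A.valuation ϖ ^ (3 * m) := by
  rcases eq_or_ne a 0 with rfl | ha0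
  · simp
  obtain ⟨k, hk⟩ := h.exists_zpow_algebraMap ha0
  rw [hk, h.zpow_le_zpow_iff] at ha ⊢
  omega

/-- A wildly ramified place above three whose ramification is as mild as possible. -/
structure IsWild (K : CubicKummer F L) (A : ValuationSubring L)
    (v : HeightOneSpectrum O) (ϖ : L) : Prop extends K.IsRamified A v ϖ where
  sub : A.valuation (K.σ ϖ - ϖ) = A.valuation ϖ ^ 2
  trace : A.valuation (ϖ + K.σ ϖ + K.σ (K.σ ϖ)) = A.valuation ϖ ^ 3
  trace_sq : A.valuation (ϖ ^ 2 + K.σ (ϖ ^ 2) + K.σ (K.σ (ϖ ^ 2))) ≤ A.valuation ϖ ^ 4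
  three : A.valuation 3 ≤ A.valuation ϖ ^ 4
  residue : ∀ x, A.valuation x ≤ 1 →
    A.valuation x < 1 ∨ A.valuation (x - 1) < 1 ∨ A.valuation (x + 1) < 1

namespace IsWild

variable {K : CubicKummer F L} {A : ValuationSubring L} {v : HeightOneSpectrum O} {ϖ : L}

theorem valuation_two (h : K.IsWild A v ϖ) : A.valuation 2 = 1 := by
  have h1 : (2 : L) = 3 - 1 := by norm_num
  rw [h1, Valuation.map_sub_eq_of_lt_right, map_one]
  rw [map_one]
  exact h.three.trans_lt (pow_lt_one₀ zero_le h.valuation_lt_one (by norm_num))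

theorem σ_sub_expansion (a b c : F) : K.σ (algebraMap F L a + algebraMap F L b * ϖ +
    algebraMap F L c * ϖ ^ 2) - (algebraMap F L a + algebraMap F L b * ϖ +
    algebraMap F L c * ϖ ^ 2) = algebraMap F L b * (K.σ ϖ - ϖ) +
      algebraMap F L c * ((K.σ ϖ - ϖ) * (K.σ ϖ + ϖ)) := by
  simp only [map_add, map_mul, map_pow, K.σ_algebraMap]; ring

theorem valuation_σ_add_le (h : K.IsWild A v ϖ) :
    A.valuation ((K.σ ϖ - ϖ) * (K.σ ϖ + ϖ)) ≤ A.valuation ϖ ^ 3 := by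
  rw [map_mul, h.sub, pow_succ _ 2]
  exact mul_le_mul_right (Valuation.map_add_le _ h.valuation_map.le le_rfl) _

theorem valuation_σ_sub_le (h : K.IsWild A v ϖ) {x : L} (hx : A.valuation x ≤ 1) :
    A.valuation (K.σ x - x) ≤ A.valuation ϖ ^ 2 := by
  rw [← zpow_zero (A.valuation ϖ)] at hx
  obtain ⟨a, b, c, rfl, -, hb, hc⟩ := h.exists_expansion hx
  have hb' := h.valuation_algebraMap_le hb (m := 0) (by norm_num)
  have hc' := h.valuation_algebraMap_le hc (m := 0) (by norm_num)
  rw [mul_zero, zpow_zero] at hb' hc'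
  rw [σ_sub_expansion]
  refine Valuation.map_add_le _ ?_ ?_ <;> rw [map_mul]
  · exact (mul_le_of_le_one_left zero_le hb').trans h.sub.le
  · exact (mul_le_of_le_one_left zero_le hc').trans (h.valuation_σ_add_le.trans
      (pow_le_pow_of_le_one zero_le h.valuation_lt_one.le (by norm_num)))

theorem valuation_σ_sub_le_of_le_sq (h : K.IsWild A v ϖ) {x : L}
    (hx : A.valuation x ≤ A.valuation ϖ ^ 2) :
    A.valuation (K.σ x - x) ≤ A.valuation ϖ ^ 3 := by
  rw [← zpow_ofNat] at hx
  obtain ⟨a, b, c, rfl, -, hb, hc⟩ := h.exists_expansion hx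
  have hb' := h.valuation_algebraMap_le hb (m := 1) (by norm_num)
  have hc' := h.valuation_algebraMap_le hc (m := 0) (by norm_num)
  rw [mul_zero, zpow_zero] at hc'
  rw [σ_sub_expansion]
  refine Valuation.map_add_le _ ?_ ?_ <;> rw [map_mul]
  · refine (mul_le_of_le_one_right zero_le (h.sub.le.trans
      (pow_le_one₀ zero_le h.valuation_lt_one.le))).trans (hb'.trans_eq (zpow_ofNat _ 3))
  · exact (mul_le_of_le_one_left zero_le hc').trans h.valuation_σ_add_le

theorem valuation_le_sq_of_trace (h : K.IsWild A v ϖ) {x : L}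
    (hx : A.valuation x ≤ A.valuation ϖ)
    (ht : A.valuation (x + K.σ x + K.σ (K.σ x)) ≤ A.valuation ϖ ^ 4) :
    A.valuation x ≤ A.valuation ϖ ^ 2 := by
  have hq := h.valuation_lt_one
  rw [← zpow_one (A.valuation ϖ)] at hx
  obtain ⟨a, b, c, rfl, ha, hb, hc⟩ := h.exists_expansion hx
  have ha' := (h.valuation_algebraMap_le ha (m := 1) (by norm_num)).trans_eq (zpow_ofNat _ 3)
  have hc' := h.valuation_algebraMap_le hc (m := 0) (by norm_num)
  have hb' := h.valuation_algebraMap_le hb (m := 0) (by norm_num)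
  rw [mul_zero, zpow_zero] at hb' hc'
  have hb1 : A.valuation (algebraMap F L b) < 1 := by
    refine lt_of_le_of_ne hb' fun hb1 => ?_
    have e : algebraMap F L b * (ϖ + K.σ ϖ + K.σ (K.σ ϖ)) =
        (algebraMap F L a + algebraMap F L b * ϖ + algebraMap F L c * ϖ ^ 2 +
        K.σ (algebraMap F L a + algebraMap F L b * ϖ + algebraMap F L c * ϖ ^ 2) +
        K.σ (K.σ (algebraMap F L a + algebraMap F L b * ϖ + algebraMap F L c * ϖ ^ 2))) -
        (algebraMap F L a * 3 +
          algebraMap F L c * (ϖ ^ 2 + K.σ (ϖ ^ 2) + K.σ (K.σ (ϖ ^ 2)))) := by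
      simp only [map_add, map_mul, map_pow, K.σ_algebraMap]; ring
    have h1 := congrArg A.valuation e
    rw [map_mul, hb1, one_mul, h.trace] at h1
    refine absurd (h1.trans_le ((A.valuation.map_sub _ _).trans (max_le ht
      (Valuation.map_add_le _ ?_ ?_)))) (pow_lt_pow_right_of_lt_one₀ h.valuation_pos hq
        (by norm_num)).not_ge
    · rw [map_mul]
      exact (mul_le_of_le_one_left zero_le (ha'.trans (pow_le_one₀ zero_le hq.le))).trans h.three
    · rw [map_mul]
      exact (mul_le_of_le_one_left zero_le hc').trans h.trace_sq
  refine Valuation.map_add_le _ (Valuation.map_add_le _ (ha'.trans ?_) ?_) ?_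
  · exact pow_le_pow_of_le_one zero_le hq.le (by norm_num)
  · rw [map_mul, sq]
    exact mul_le_mul_left (h.le_uniformizer hb1) _
  · rw [map_mul, map_pow]
    exact mul_le_of_le_one_left zero_le hc'

end IsWild

end CubicKummer

end Wild

section WildDescent

open IsDedekindDomain Matrix

/-- A matrix congruent to the identity modulo an element of valuation `q`, whose first-order term
is tangent to the automorphisms of a supersingular cubic fixing the point at infinity. -/
structure ValuationSubring.IsTangent {L : Type*} [Field L] (A : ValuationSubring L)
    (q : A.ValueGroup) (M : Matrix (Fin 3) (Fin 3) L) : Prop where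
  near_one : ∀ i j, A.valuation ((M - 1) i j) ≤ q
  entry₀₁ : A.valuation (M 0 1) ≤ q ^ 2
  entry₁₀ : A.valuation (M 1 0) ≤ q ^ 2
  entry₁₂ : A.valuation (M 1 2) ≤ q ^ 2
  entry₂₀ : A.valuation (M 2 0) ≤ q ^ 2
  diag₀ : A.valuation (M 0 0 - M 1 1) ≤ q ^ 2
  diag₂ : A.valuation (M 2 2 - M 1 1) ≤ q ^ 2
  anti : A.valuation (M 0 2 + M 2 1) ≤ q ^ 2

variable {O F L : Type*} [CommRing O] [IsDedekindDomain O] [Field F] [Algebra O F]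
  [IsFractionRing O F] [Field L] [Algebra F L] {K : CubicKummer F L}

theorem ConjugateTriple.IsScalarFrame.isTangent [CharZero F] {T : ConjugateTriple K}
    {A : ValuationSubring L} {v : HeightOneSpectrum O} {ϖ : L} (hw : K.IsWild A v ϖ)
    {G : Matrix (Fin 3) (Fin 3) L} {κ r s : L} (h : T.IsScalarFrame A G κ r s)
    (hX : (A.valuation T.x₁)⁻¹ ≤ A.valuation ϖ ^ 2) :
    A.IsTangent (A.valuation ϖ) (T.cocycle G) := by
  have hϖ0 := hw.ne_zero
  have hq := hw.valuation_lt_one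
  have hσ := hw.valuation_σ
  have ha3 := h.valuation_pow_three_sub_one hσ fun x hx => hw.valuation_σ_sub_lt hx
  have h30 : A.valuation 3 < 1 := hw.three.trans_lt (pow_lt_one₀ zero_le hq (by norm_num))
  have hG := h.isFrame
  set M := T.cocycle G with hMdef
  have ha : A.valuation (M 0 0 - 1) < 1 := by
    have e : (M 0 0 - 1) ^ 3 = (M 0 0 ^ 3 - 1) - 3 * (M 0 0 * (M 0 0 - 1)) := by ring
    rw [← pow_lt_one_iff_of_nonneg zero_le three_ne_zero, ← map_pow, e]
    refine Valuation.map_sub_lt _ ha3 ?_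
    rw [map_mul, map_mul]
    refine (mul_le_of_le_one_right zero_le (mul_le_one' h.diag.le ?_)).trans_lt h30
    exact (A.valuation.map_sub _ _).trans (max_le h.diag.le (map_one _).le)
  have hM1 : ∀ i j, A.valuation ((M - 1) i j) < 1 := by
    intro i j
    have e : (M - 1) i j = (M - M 0 0 • (1 : Matrix (Fin 3) (Fin 3) L)) i j +
        (M 0 0 - 1) * (1 : Matrix (Fin 3) (Fin 3) L) i j := by
      simp only [Matrix.sub_apply, Matrix.smul_apply, smul_eq_mul]; ring
    rw [e]
    refine Valuation.map_add_lt _ (h.scalar i j) ?_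
    rw [map_mul]
    refine (mul_le_of_le_one_right zero_le ?_).trans_lt ha
    rw [one_apply]
    split_ifs <;> simp
  let ι : A →+* L := A.subtype
  have toA : ∀ x, A.valuation x ≤ 1 → ∃ a : A, ι a = x := fun x hx =>
    ⟨⟨x, (A.valuation_le_one_iff _).1 hx⟩, rfl⟩
  have divA : ∀ x, A.valuation x < 1 → ∃ a : A, ϖ * ι a = x := by
    intro x hx
    obtain ⟨a, ha⟩ := toA (x / ϖ) (by
      rw [map_div₀]; exact div_le_one_of_le₀ (hw.le_uniformizer hx) zero_le)
    exact ⟨a, by rw [ha, mul_div_cancel₀ _ hϖ0]⟩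
  obtain ⟨t, ht⟩ := toA ϖ hq.le
  choose N hN using fun i j => divA _ (hM1 i j)
  have hMN : M = (1 + t • of N : Matrix (Fin 3) (Fin 3) A).map ι := by
    ext i j
    have e := hN i j
    rw [Matrix.sub_apply] at e
    simp only [map_apply, Matrix.add_apply, Matrix.smul_apply, of_apply, smul_eq_mul, map_add,
      map_mul, ht, e, one_apply]
    split_ifs <;> simp
  have hdet : K.σ κ / κ = ι (1 + t • of N : Matrix (Fin 3) (Fin 3) A).det := by
    rw [← det_cocycle hG, RingHom.map_det, ← hMdef, hMN]; rfl
  have hκ : A.valuation (K.σ κ / κ - 1) < 1 := by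
    have e : IsLocalRing.residue A ((1 + t • of N : Matrix (Fin 3) (Fin 3) A).det - 1) = 0 := by
      have h0 : IsLocalRing.residue A t = 0 := by
        rw [A.residue_eq_zero_iff_valuation_lt_one]; exact (congrArg A.valuation ht).trans_lt hq
      have h1 : (IsLocalRing.residue A).mapMatrix (1 + t • of N) = 1 := by
        rw [map_add, map_one]
        ext i j
        simp [h0]
      rw [map_sub, map_one, RingHom.map_det, h1, det_one, sub_self]
    rw [A.residue_eq_zero_iff_valuation_lt_one] at e
    rw [hdet]
    exact e
  obtain ⟨c, hc⟩ := divA _ hκ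
  obtain ⟨r₁, hr₁⟩ := divA _ h.r_lt
  obtain ⟨s₁, hs₁⟩ := divA _ h.s_lt
  obtain ⟨r₂, hr₂⟩ := toA (K.σ r) ((hσ r).le.trans h.r_lt.le)
  obtain ⟨s₂, hs₂⟩ := toA (K.σ s) ((hσ s).le.trans h.s_lt.le)
  let φ : A →+* A ⧸ Ideal.span {t ^ 2} := Ideal.Quotient.mk _
  have hφ : ∀ a : A, φ a = 0 ↔ A.valuation (ι a) ≤ A.valuation ϖ ^ 2 := by
    intro a
    rw [Ideal.Quotient.eq_zero_iff_mem, Ideal.mem_span_singleton, ← map_pow, ← ht, ← map_pow]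
    rw [A.valuation_le_iff]
    constructor
    · rintro ⟨b, rfl⟩
      exact ⟨b, by rw [mul_comm]; rfl⟩
    · rintro ⟨b, hb⟩
      exact ⟨b, A.subtype_injective (by rw [mul_comm, map_mul]; exact hb.symm)⟩
  have hf : ∀ Y : Fin 3 → A, cubicForm (t * r₁) (t * s₁) ((1 + t • of N) *ᵥ Y) =
      (1 + t * c) * cubicForm r₂ s₂ Y := by
    intro Y
    apply A.subtype_injective
    have := cubicForm_cocycle hG (ι ∘ Y)
    rw [← hMdef, hMN, ← hr₂, ← hs₂, ← hr₁, ← hs₁, ← sub_add_cancel (K.σ κ / κ) 1, ← hc, ← ht,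
      ← map_mul, ← map_mul, ← map_mul, ← map_one ι, ← map_add, add_comm _ (1 : A)] at this
    refine (map_pointCubic ι ..).trans (Eq.trans ?_ (this.trans ?_))
    · simp only [cubicForm, RingHom.map_mulVec]
    · rw [map_mul]
      exact congrArg (ι (1 + t * c) * ·) (map_pointCubic ι ..).symm
  have hr : φ r₂ = φ (t * r₁) := by
    rw [← sub_eq_zero, ← map_sub, hφ, map_sub, hr₂, map_mul, ht, hr₁]
    exact hw.valuation_σ_sub_le h.r_lt.le
  have hs : φ s₂ = φ (t * s₁) := by
    rw [← sub_eq_zero, ← map_sub, hφ, map_sub, hs₂, map_mul, ht, hs₁]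
    exact hw.valuation_σ_sub_le h.s_lt.le
  have small : ∀ a : A, A.valuation (ι a) ≤ A.valuation ϖ → φ t * φ a = 0 := by
    intro a ha
    rw [← map_mul, hφ, map_mul, map_mul, ht, sq]
    exact mul_le_mul_right ha _
  have hMN' : ∀ i j, i ≠ j → M i j = ι (t * N i j) := by
    intro i j hij
    have e := hN i j
    rw [Matrix.sub_apply, one_apply_ne hij, sub_zero] at e
    rw [← e, map_mul, ht]
  have hMN₁ : ∀ i, M i i = ι (1 + t * N i i) := by
    intro i
    have e := hN i i
    rw [Matrix.sub_apply, one_apply_eq] at e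
    rw [map_add, map_one, map_mul, ht, e, add_sub_cancel]
  have key := first_order_of_cubicForm_comp (t := φ t) (r := φ (t * r₁)) (s := φ (t * s₁))
    (c := φ c) (by rw [← map_mul, hφ, map_mul, map_mul, ht, sq]) (small _ ?_) (small _ ?_) ?_
    ((of N).map φ) ?_ ?_ ?_
  · simp only [map_apply, of_apply, ← map_mul] at key
    obtain ⟨k₁, k₂, k₃, k₄, k₅⟩ := key
    rw [← sub_eq_zero, ← map_sub, hφ] at k₃ k₄
    rw [eq_neg_iff_add_eq_zero, ← map_add, hφ] at k₅
    refine ⟨fun i j => hw.le_uniformizer (hM1 i j), ?_, h.row_zero.trans hX, h.row_two.trans hX,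
      ?_, ?_, ?_, ?_⟩
    · rw [hMN' 0 1 (by decide)]; exact (hφ _).1 k₁
    · rw [hMN' 2 0 (by decide)]; exact (hφ _).1 k₂
    · rwa [hMN₁, hMN₁, ← map_sub, add_sub_add_left_eq_sub]
    · rwa [hMN₁, hMN₁, ← map_sub, add_sub_add_left_eq_sub]
    · rwa [hMN' 0 2 (by decide), hMN' 2 1 (by decide), ← map_add]
  · rw [map_mul, ht, hr₁]; exact hw.le_uniformizer h.r_lt
  · rw [map_mul, ht, hs₁]; exact hw.le_uniformizer h.s_lt
  · rw [← map_ofNat φ 3]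
    refine small _ (hw.le_uniformizer ?_)
    rwa [map_ofNat]
  · rw [map_apply, of_apply, ← map_mul, hφ, ← hMN' 1 0 (by decide)]
    exact h.row_zero.trans hX
  · rw [map_apply, of_apply, ← map_mul, hφ, ← hMN' 1 2 (by decide)]
    exact h.row_two.trans hX
  · intro y
    obtain ⟨Y, rfl⟩ : ∃ Y : Fin 3 → A, y = φ ∘ Y := by
      choose Y hY using fun i => Ideal.Quotient.mk_surjective (y i)
      exact ⟨Y, funext fun i => (hY i).symm⟩
    have h4 := congrArg φ (hf Y)
    have e : (1 + t • of N : Matrix (Fin 3) (Fin 3) A).map φ = 1 + φ t • (of N).map φ := by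
      ext i j
      simp only [map_apply, Matrix.add_apply, Matrix.smul_apply, of_apply, smul_eq_mul, map_add,
        map_mul, one_apply]
      split_ifs <;> simp
    rw [map_mul, cubicForm, cubicForm, map_pointCubic, map_pointCubic, hr, hs, map_add, map_one,
      map_mul φ t c] at h4
    rw [← e]
    simpa only [cubicForm, RingHom.map_mulVec, Function.comp_apply] using h4

end WildDescent

section WildDescent

open IsDedekindDomain Matrix

theorem ValuationSubring.inv_entries_mem {L : Type*} [Field L] (A : ValuationSubring L)
    {U : Matrix (Fin 3) (Fin 3) L} (hU : ∀ i j, U i j ∈ A) (hd : A.valuation U.det = 1)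
    (i j : Fin 3) : U⁻¹ i j ∈ A := by
  let ι : A →+* L := A.subtype
  let N : Matrix (Fin 3) (Fin 3) A := of fun i j => ⟨U i j, hU i j⟩
  have hN : U = N.map ι := rfl
  have hu : IsUnit N.det := by
    rw [A.valuation_eq_one_iff]
    rw [hN] at hd
    exact (congrArg A.valuation (RingHom.map_det ι N)).trans hd
  have h1 : U * N⁻¹.map ι = 1 := by
    rw [hN, ← Matrix.map_mul, mul_nonsing_inv _ hu]
    exact Matrix.map_one ι (map_zero ι) (map_one ι)
  rw [inv_eq_right_inv h1]
  exact (N⁻¹ i j).2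

theorem LocallySplit.of_mul {F L : Type*} [Field F] [Field L] [Algebra F L]
    {A : ValuationSubring L} {G U : Matrix (Fin 3) (Fin 3) L} (hU : ∀ i j, U i j ∈ A)
    (hd : A.valuation U.det = 1) (h : LocallySplit F A (G * U)) : LocallySplit F A G := by
  obtain ⟨B, hB, hBd⟩ := h
  have hu : IsUnit U.det := isUnit_iff_ne_zero.2 fun h0 => by
    rw [h0, map_zero] at hd; exact zero_ne_one hd
  have e : G⁻¹ * B.map (algebraMap F L) = U * ((G * U)⁻¹ * B.map (algebraMap F L)) := by
    rw [Matrix.mul_inv_rev, ← Matrix.mul_assoc, ← Matrix.mul_assoc, mul_nonsing_inv _ hu, Matrix.one_mul]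
  refine ⟨B, fun i j => ?_, ?_⟩
  · rw [e, mul_apply]
    exact A.toSubring.sum_mem fun k _ => A.mul_mem _ _ (hU i k) (hB k j)
  · rw [e, det_mul, map_mul, hd, hBd, one_mul]

variable {O F L : Type*} [CommRing O] [IsDedekindDomain O] [Field F] [Algebra O F]
  [IsFractionRing O F] [Field L] [Algebra F L] {K : CubicKummer F L}
  {A : ValuationSubring L} {v : HeightOneSpectrum O} {ϖ : L}

theorem ValuationSubring.IsTangent.smul {q : A.ValueGroup} {M : Matrix (Fin 3) (Fin 3) L}
    (h : A.IsTangent q M) {ε : L} (hε : A.valuation ε = 1) (hε1 : A.valuation (ε - 1) ≤ q) :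
    A.IsTangent q (ε • M) := by
  have key : ∀ {x : L} {n : ℕ}, A.valuation x ≤ q ^ n → A.valuation (ε * x) ≤ q ^ n := by
    intro x n hx
    rwa [map_mul, hε, one_mul]
  refine ⟨fun i j => ?_, key h.entry₀₁, key h.entry₁₀, key h.entry₁₂, key h.entry₂₀, ?_, ?_, ?_⟩
  · have e : (ε • M - 1) i j = ε * (M - 1) i j + (ε - 1) * (1 : Matrix (Fin 3) (Fin 3) L) i j := by
      simp only [Matrix.sub_apply, Matrix.smul_apply, smul_eq_mul]; ring
    rw [e]
    refine Valuation.map_add_le _ ?_ ?_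
    · rw [map_mul, hε, one_mul]; exact h.near_one i j
    · rw [map_mul]
      refine (mul_le_of_le_one_right zero_le ?_).trans hε1
      rw [one_apply]
      split_ifs <;> simp
  · simp only [Matrix.smul_apply, smul_eq_mul, ← mul_sub]; exact key h.diag₀
  · simp only [Matrix.smul_apply, smul_eq_mul, ← mul_sub]; exact key h.diag₂
  · simp only [Matrix.smul_apply, smul_eq_mul, ← mul_add]; exact key h.anti

namespace CubicKummer.IsWild

theorem exists_pow_mul_near_one (hw : K.IsWild A v ϖ) {m : L}
    (hm : A.valuation (m - 1) ≤ A.valuation ϖ) :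
    ∃ j : ℕ, A.valuation ((K.σ ϖ / ϖ) ^ j * m - 1) ≤ A.valuation ϖ ^ 2 := by
  have hϖ0 := hw.ne_zero
  set δ := (K.σ ϖ - ϖ) / ϖ with hδdef
  have hδ : A.valuation δ = A.valuation ϖ := by
    rw [map_div₀, hw.sub, sq, mul_div_cancel_right₀ _ hw.valuation_pos.ne']
  have hδ0 : δ ≠ 0 := (Valuation.ne_zero_iff _).1 (hδ ▸ hw.valuation_pos.ne')
  have hε : K.σ ϖ / ϖ = 1 + δ := by rw [hδdef]; field_simp; ring
  obtain ⟨x, hx⟩ : ∃ x, m = 1 + x * δ := ⟨(m - 1) / δ, by field_simp; ring⟩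
  have hx1 : A.valuation x ≤ 1 := by
    rw [hx, add_sub_cancel_left, map_mul, hδ] at hm
    exact (mul_le_iff_le_one_left hw.valuation_pos).1 hm
  have hd : ∀ {y z : L}, A.valuation y < 1 → A.valuation z ≤ 1 →
      A.valuation (y * δ + z * δ ^ 2) ≤ A.valuation ϖ ^ 2 := by
    intro y z hy hz
    refine Valuation.map_add_le _ ?_ ?_
    · rw [map_mul, hδ, sq]
      exact mul_le_mul_left (hw.le_uniformizer hy) _
    · rw [map_mul, map_pow, hδ]
      exact mul_le_of_le_one_left zero_le hz
  rw [hε, hx]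
  rcases hw.residue x hx1 with h | h | h
  · refine ⟨0, ?_⟩
    have := hd h (z := 0) (by simp)
    convert this using 2; ring
  · refine ⟨2, ?_⟩
    have h3 : A.valuation (x - 1 + 3) < 1 := Valuation.map_add_lt _ h
      (hw.three.trans_lt (pow_lt_one₀ zero_le hw.valuation_lt_one (by norm_num)))
    have := hd h3 (z := 1 + 2 * x + x * δ) (Valuation.map_add_le _ (Valuation.map_add_le _
      (map_one _).le (by rwa [map_mul, hw.valuation_two, one_mul])) (by
        rw [map_mul, hδ]; exact mul_le_one' hx1 hw.valuation_lt_one.le))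
    convert this using 2; ring
  · refine ⟨1, ?_⟩
    have := hd h hx1
    convert this using 2; ring

theorem near_one_of_isTangent (hw : K.IsWild A v ϖ) {M : Matrix (Fin 3) (Fin 3) L}
    (h : A.IsTangent (A.valuation ϖ) M) (h11 : A.valuation (M 1 1 - 1) ≤ A.valuation ϖ ^ 2)
    (hM : M * M.map K.σ * (M.map K.σ).map K.σ = 1) (i j : Fin 3) :
    A.valuation ((M - 1) i j) ≤ A.valuation ϖ ^ 2 := by
  have hq := hw.valuation_lt_one
  set q := A.valuation ϖ
  have cadd : ∀ {n : ℕ} {x y : L}, A.valuation x ≤ q ^ n → A.valuation y ≤ q ^ n →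
    A.valuation (x + y) ≤ q ^ n := fun hx hy => Valuation.map_add_le _ hx hy
  have cmul : ∀ {k n : ℕ} {x y : L}, A.valuation x ≤ q ^ k → A.valuation y ≤ q ^ n →
      A.valuation (x * y) ≤ q ^ (k + n) := fun hx hy => by
    rw [map_mul, pow_add]; exact mul_le_mul' hx hy
  have cle : ∀ {k n : ℕ} {x : L}, A.valuation x ≤ q ^ k → n ≤ k → A.valuation x ≤ q ^ n :=
    fun hx hn => hx.trans (pow_le_pow_of_le_one zero_le hq.le hn)
  have cσ : ∀ {n : ℕ} {x : L}, A.valuation x ≤ q ^ n → A.valuation (K.σ x) ≤ q ^ n :=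
    fun hx => (hw.valuation_σ _).trans_le hx
  have hoff : ∀ i j, i ≠ j → A.valuation (M i j) ≤ q ^ 1 := by
    intro i j hij
    have := h.near_one i j
    rwa [Matrix.sub_apply, one_apply_ne hij, sub_zero, ← pow_one q] at this
  have h22 : A.valuation (M 2 2 - 1) ≤ q ^ 2 := by
    rw [← sub_add_sub_cancel (M 2 2) (M 1 1)]; exact cadd h.diag₂ h11
  have h00 : A.valuation (M 0 0 - 1) ≤ q ^ 2 := by
    rw [← sub_add_sub_cancel (M 0 0) (M 1 1)]; exact cadd h.diag₀ h11
  have c1 : ∀ {x : L}, A.valuation (x - 1) ≤ q ^ 2 → A.valuation x ≤ q ^ 0 := by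
    intro x hx
    rw [← sub_add_cancel x 1]
    exact cadd (cle hx (by norm_num)) (by simp)
  have h21 : A.valuation (M 2 1) ≤ q ^ 2 := by
    have hm := hoff 2 1 (by decide)
    refine hw.valuation_le_sq_of_trace (hm.trans_eq (pow_one q)) ?_
    have e := congrFun (congrFun hM 2) 1
    simp only [mul_apply, Fin.sum_univ_three, map_apply, one_apply_ne (show (2 : Fin 3) ≠ 1 by decide)]
      at e
    have hx : ∀ {x : L}, A.valuation x ≤ q ^ 2 → A.valuation (K.σ x - x) ≤ q ^ 3 :=
      fun h => hw.valuation_σ_sub_le_of_le_sq h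
    have hx' : ∀ {x : L}, A.valuation x ≤ q ^ 2 → A.valuation (K.σ (K.σ x) - x) ≤ q ^ 3 :=
      fun h => by
        rw [← sub_add_sub_cancel _ (K.σ _)]
        exact cadd (hx (cσ h)) (hx h)
    have hm1 := hm.trans (pow_le_one₀ zero_le hq.le)
    have hy1 := hw.valuation_σ_sub_le hm1
    have hy2 : A.valuation (K.σ (K.σ (M 2 1)) - M 2 1) ≤ q ^ 2 := by
      rw [← sub_add_sub_cancel _ (K.σ _)]
      exact cadd (hw.valuation_σ_sub_le ((hw.valuation_σ _).trans_le hm1)) hy1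
    have t1 := cmul (cmul h.entry₂₀ (cσ (c1 h00))) (cσ (cσ h.entry₀₁))
    have t2 := cmul (cmul h.entry₂₀ (cσ h.entry₀₁)) (cσ (cσ (c1 h11)))
    have t3 := cmul (cmul h.entry₂₀ (cσ (hoff 0 2 (by decide)))) (cσ (cσ hm))
    have t4 := cle (cmul (cmul hm (cσ h.entry₁₀)) (cσ (cσ h.entry₀₁))) (show 4 ≤ _ by norm_num)
    have t5 := cmul (cmul hm (cσ h.entry₁₂)) (cσ (cσ hm))
    have t6 := cmul (cmul (c1 h22) (cσ h.entry₂₀)) (cσ (cσ h.entry₀₁))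
    have x1 := hx h11
    have x2 := hx' h11
    have x3 := hx h22
    rw [map_sub K.σ, map_one K.σ] at x1 x3
    rw [map_sub K.σ, map_one K.σ, map_sub K.σ, map_one K.σ] at x2
    obtain ⟨d, hd⟩ : ∃ d, d = M 1 1 - 1 := ⟨_, rfl⟩
    obtain ⟨f, hf⟩ : ∃ f, f = M 2 2 - 1 := ⟨_, rfl⟩
    obtain ⟨p₁, hp₁⟩ : ∃ p, p = K.σ (M 1 1) - 1 - (M 1 1 - 1) := ⟨_, rfl⟩
    obtain ⟨p₂, hp₂⟩ : ∃ p, p = K.σ (K.σ (M 1 1)) - 1 - (M 1 1 - 1) := ⟨_, rfl⟩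
    obtain ⟨p₃, hp₃⟩ : ∃ p, p = K.σ (M 2 2) - 1 - (M 2 2 - 1) := ⟨_, rfl⟩
    obtain ⟨y₁, hy₁⟩ : ∃ p, p = K.σ (M 2 1) - M 2 1 := ⟨_, rfl⟩
    obtain ⟨y₂, hy₂⟩ : ∃ p, p = K.σ (K.σ (M 2 1)) - M 2 1 := ⟨_, rfl⟩
    rw [← hd] at h11
    rw [← hf] at h22
    rw [← hp₁] at x1
    rw [← hp₂] at x2
    rw [← hp₃] at x3
    rw [← hy₁] at hy1
    rw [← hy₂] at hy2
    have x1' := cle x1 (show 2 ≤ _ by norm_num)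
    have x2' := cle x2 (show 2 ≤ _ by norm_num)
    have x3' := cle x3 (show 2 ≤ _ by norm_num)
    have P1 := cadd (cadd x1 x2) (cle (cmul (cadd h11 x1') (cadd h11 x2')) (show 3 ≤ _ by norm_num))
    have P2 := cadd x2 (cle (cmul h22 (cadd h11 x2')) (show 3 ≤ _ by norm_num))
    have P3 := cadd x3 (cle (cmul h22 (cadd h22 x3')) (show 3 ≤ _ by norm_num))
    have s1 := cle (cmul (cmul hw.three hm) (cadd h11 h22)) (show 4 ≤ _ by norm_num)
    have s2 := cmul hm (cadd (cadd P1 P2) P3)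
    have s3 := cmul hy1 (cadd (cadd h22 h11) (cle P2 (show 2 ≤ _ by norm_num)))
    have s4 := cmul hy2 (cadd (cadd h22 h22) (cle P3 (show 2 ≤ _ by norm_num)))
    have := cadd (cadd (cadd s1 s2) (cadd s3 s4))
      (cadd (cadd (cadd t1 t2) (cadd t3 t4)) (cadd t5 t6))
    rw [← Valuation.map_neg] at this
    convert this using 2
    have g1 : M 1 1 = 1 + d := by rw [hd]; ring
    have g2 : M 2 2 = 1 + f := by rw [hf]; ring
    have g3 : K.σ (M 1 1) = 1 + d + p₁ := by rw [hp₁, hd]; ring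
    have g4 : K.σ (K.σ (M 1 1)) = 1 + d + p₂ := by rw [hp₂, hd]; ring
    have g5 : K.σ (M 2 2) = 1 + f + p₃ := by rw [hp₃, hf]; ring
    have g6 : K.σ (M 2 1) = M 2 1 + y₁ := by rw [hy₁]; ring
    have g7 : K.σ (K.σ (M 2 1)) = M 2 1 + y₂ := by rw [hy₂]; ring
    clear * - e g1 g2 g3 g4 g5 g6 g7
    generalize K.σ (K.σ (M 1 1)) = a at *
    generalize K.σ (K.σ (M 2 1)) = b at *
    generalize K.σ (M 1 1) = a at *
    generalize K.σ (M 2 1) = b at *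
    generalize K.σ (M 2 2) = c at *
    generalize M 1 1 = a at *
    generalize M 2 2 = c at *
    subst g1 g2 g3 g4 g5 g6 g7
    linear_combination e
  have h02 : A.valuation (M 0 2) ≤ q ^ 2 := by
    rw [← add_sub_cancel_right (M 0 2) (M 2 1)]
    exact (A.valuation.map_sub _ _).trans (max_le h.anti h21)
  fin_cases i <;> fin_cases j <;> simp [Matrix.sub_apply] <;> first
    | exact h00 | exact h11 | exact h22 | exact h.entry₀₁ | exact h02 | exact h.entry₁₀
    | exact h.entry₁₂ | exact h.entry₂₀ | exact h21

end CubicKummer.IsWild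

end WildDescent

section WildSplitting

open IsDedekindDomain Matrix

variable {O F L : Type*} [CommRing O] [IsDedekindDomain O] [Field F] [Algebra O F]
  [IsFractionRing O F] [Field L] [Algebra F L] {K : CubicKummer F L}
  {A : ValuationSubring L} {v : HeightOneSpectrum O} {ϖ : L}

theorem CubicKummer.IsWild.locallySplit [CharZero F] (hw : K.IsWild A v ϖ)
    {G M : Matrix (Fin 3) (Fin 3) L} (hG : G.det ≠ 0) (hM : G.map K.σ = G * M)
    (h : ∀ i j, A.valuation ((M - 1) i j) ≤ A.valuation ϖ ^ 2) : LocallySplit F A G := by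
  have hq := hw.valuation_lt_one
  have hq0 := hw.valuation_pos
  have hδ0 : K.σ ϖ - ϖ ≠ 0 :=
    (Valuation.ne_zero_iff A.valuation).1 (hw.sub ▸ (pow_pos hq0 2).ne')
  have hC : ∀ i j, ∃ a : F, A.valuation (algebraMap F L a) ≤ 1 ∧
      A.valuation ((M - 1) i j + (K.σ ϖ - ϖ) * algebraMap F L a) ≤ A.valuation ϖ ^ 3 := by
    intro i j
    obtain ⟨a, ha, ha'⟩ := hw.exists_residue (x := -(M - 1) i j / (K.σ ϖ - ϖ)) (by
      rw [map_div₀, Valuation.map_neg, hw.sub]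
      exact (div_le_one₀ (pow_pos hq0 2)).2 (h i j))
    refine ⟨a, ha, ?_⟩
    have e : (M - 1) i j + (K.σ ϖ - ϖ) * algebraMap F L a =
        -((K.σ ϖ - ϖ) * (-(M - 1) i j / (K.σ ϖ - ϖ) - algebraMap F L a)) := by
      rw [mul_sub, mul_div_cancel₀ _ hδ0]; ring
    rw [e, Valuation.map_neg, map_mul, hw.sub, pow_succ _ 2]
    exact mul_le_mul_right ha' _
  choose C hC1 hC2 using hC
  let D : Matrix (Fin 3) (Fin 3) L := of fun i j => algebraMap F L (C i j)
  have hDσ : D.map K.σ = D := by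
    ext i j
    simp only [D, map_apply, of_apply, K.σ_algebraMap]
  obtain ⟨U, hUdef⟩ : ∃ U, U = 1 + ϖ • D := ⟨_, rfl⟩
  have hU1 : ∀ i j, A.valuation ((U - 1) i j) < 1 := by
    intro i j
    rw [hUdef, add_sub_cancel_left, Matrix.smul_apply, smul_eq_mul, map_mul]
    exact (mul_le_of_le_one_right zero_le (hC1 i j)).trans_lt hq
  obtain ⟨hU, hUd⟩ := entries_mem_and_det_of_sub_one A hU1
  have hu : IsUnit U.det := isUnit_iff_ne_zero.2 fun h0 => by
    rw [h0, map_zero] at hUd; exact zero_ne_one hUd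
  have hUσ : U.map K.σ = 1 + K.σ ϖ • D := by
    ext i j
    have := congrFun (congrFun hDσ i) j
    simp only [map_apply] at this
    simp only [hUdef, map_apply, Matrix.add_apply, Matrix.smul_apply, smul_eq_mul, map_add K.σ,
      map_mul K.σ, this, one_apply, apply_ite K.σ, map_one K.σ, map_zero K.σ]
  have hbound : ∀ i j, A.valuation ((M * U.map K.σ - U) i j) ≤ A.valuation ϖ ^ 3 := by
    intro i j
    have e : M * U.map K.σ - U = (M - 1 + (K.σ ϖ - ϖ) • D) + K.σ ϖ • ((M - 1) * D) := by
      rw [hUσ, hUdef, mul_add, mul_smul_comm, sub_mul, smul_sub, sub_smul, mul_one, one_mul]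
      abel
    rw [e, Matrix.add_apply, Matrix.smul_apply, smul_eq_mul]
    refine Valuation.map_add_le _ (hC2 i j) ?_
    rw [map_mul, hw.valuation_σ, pow_succ', mul_apply]
    refine mul_le_mul_right (Valuation.map_sum_le _ fun k _ => ?_) _
    rw [map_mul]
    exact (mul_le_of_le_one_right zero_le (hC1 k j)).trans (h i k)
  refine LocallySplit.of_mul hU hUd ?_
  have hN : (G * U).map K.σ = G * U * (U⁻¹ * (M * U.map K.σ)) := by
    rw [Matrix.map_mul, hM, Matrix.mul_assoc G U, mul_nonsing_inv_cancel_left _ _ hu,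
      Matrix.mul_assoc]
  have ht : ϖ + K.σ ϖ + K.σ (K.σ ϖ) ≠ 0 :=
    (Valuation.ne_zero_iff A.valuation).1 (hw.trace ▸ (pow_pos hq0 3).ne')
  refine locallySplit_of_cocycle_near_one A K.σ (fun _ => K.exists_of_fixed) K.σ_cube hw.valuation_σ
    (by rw [det_mul]; exact mul_ne_zero hG hu.ne_zero) hN
    (c := ϖ / (ϖ + K.σ ϖ + K.σ (K.σ ϖ))) ?_ fun i j => ?_
  · simp only [map_div₀, map_add, K.σ_cube]
    rw [show K.σ ϖ + K.σ (K.σ ϖ) + ϖ = ϖ + K.σ ϖ + K.σ (K.σ ϖ) by ring,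
      show K.σ (K.σ ϖ) + ϖ + K.σ ϖ = ϖ + K.σ ϖ + K.σ (K.σ ϖ) by ring, ← add_div, ← add_div,
      div_self ht]
  · have e : U⁻¹ * (M * U.map K.σ) - 1 = U⁻¹ * (M * U.map K.σ - U) := by
      rw [mul_sub, nonsing_inv_mul _ hu]
    rw [e, map_mul, map_div₀, hw.trace, mul_apply]
    have h3 : A.valuation (∑ k, U⁻¹ i k * (M * U.map K.σ - U) k j) ≤ A.valuation ϖ ^ 3 :=
      Valuation.map_sum_le _ fun k _ => by
        rw [map_mul]
        exact (mul_le_of_le_one_left zero_le ((A.valuation_le_one_iff _).2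
          (A.inv_entries_mem hU hUd i k))).trans (hbound k j)
    refine (mul_le_mul_right h3 _).trans_lt ?_
    rwa [div_mul_cancel₀ _ (pow_pos hq0 3).ne']

namespace ConjugateTriple

variable {T : ConjugateTriple K}

theorem IsScalarFrame.localCondition_of_wild [CharZero F] (hw : K.IsWild A v ϖ)
    {G : Matrix (Fin 3) (Fin 3) L} {κ r s : L} (h : T.IsScalarFrame A G κ r s)
    (hX : (A.valuation T.x₁)⁻¹ ≤ A.valuation ϖ ^ 2) : T.LocalCondition A := by
  have htan := h.isTangent hw hX
  have h11 := htan.near_one 1 1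
  rw [Matrix.sub_apply, one_apply_eq] at h11
  obtain ⟨j, hj⟩ := hw.exists_pow_mul_near_one h11
  have hσϖ0 : K.σ ϖ / ϖ ≠ 0 := div_ne_zero (by simpa using hw.ne_zero) hw.ne_zero
  have hε : A.valuation (K.σ ϖ / ϖ) = 1 := by
    rw [map_div₀, hw.valuation_map, div_self hw.valuation_pos.ne']
  have hε1 : ∀ n : ℕ, A.valuation ((K.σ ϖ / ϖ) ^ n - 1) ≤ A.valuation ϖ := by
    intro n
    have e : (K.σ ϖ / ϖ) ^ n - 1 = (K.σ ϖ - ϖ) / ϖ *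
        ∑ i ∈ Finset.range n, (K.σ ϖ / ϖ) ^ i := by
      rw [← geom_sum_mul, sub_div, div_self hw.ne_zero, mul_comm]
    rw [e, map_mul, map_div₀, hw.sub, sq, mul_div_cancel_right₀ _ hw.valuation_pos.ne']
    refine mul_le_of_le_one_right zero_le (Valuation.map_sum_le _ fun i _ => ?_)
    rw [map_pow, hε, one_pow]
  have hc := pow_ne_zero j hw.ne_zero
  have hG' := h.isFrame.smul hc
  have hcy := cocycle_smul h.isFrame hc
  rw [map_pow, ← div_pow] at hcy
  have htan' := htan.smul (ε := (K.σ ϖ / ϖ) ^ j) (by rw [map_pow, hε, one_pow]) (hε1 j)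
  rw [← hcy] at htan'
  refine ⟨_, _, r, s, hG', (A.valuation_le_one_iff _).1 h.r_lt.le,
    (A.valuation_le_one_iff _).1 h.s_lt.le, hw.locallySplit (det_coord_inv_mul_ne_zero hG')
      (map_eq_mul_cocycle hG') fun i k => hw.near_one_of_isTangent htan' ?_ (cocycle_mul_map hG') i k⟩
  rw [hcy]
  exact hj

end ConjugateTriple

end WildSplitting

section WildUniformizer

open IsDedekindDomain

variable {O F L : Type*} [CommRing O] [IsDedekindDomain O] [Field F] [Algebra O F]
  [IsFractionRing O F] [Field L] [Algebra F L] {K : CubicKummer F L}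
  {A : ValuationSubring L} {v : HeightOneSpectrum O}

theorem CubicKummer.exists_isWild (hA : A.IsAbove v F)
    (hl : v.valuation F (1 - K.ω) = WithZero.exp (-1)) (hp : v.valuation F K.p = 1)
    (hp2 : v.valuation F (K.p ^ 2 - 1) = v.valuation F 3)
    (hres : ∀ a : F, v.valuation F a ≤ 1 →
      v.valuation F a < 1 ∨ v.valuation F (a - 1) < 1 ∨ v.valuation F (a + 1) < 1) :
    ∃ ϖ, K.IsWild A v ϖ := by
  obtain ⟨w, hwdef⟩ : ∃ w, w = algebraMap F L K.ω := ⟨_, rfl⟩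
  obtain ⟨p, hpdef⟩ : ∃ p, p = algebraMap F L K.p := ⟨_, rfl⟩
  have hw : w ^ 2 + w + 1 = 0 := hwdef ▸ K.hω'
  have hσw : K.σ w = w := hwdef ▸ K.σ_algebraMap _
  have hσp : K.σ p = p := hpdef ▸ K.σ_algebraMap _
  have hθ : K.θ ^ 3 = p := hpdef ▸ K.hθ
  have hσθ : K.σ K.θ = w * K.θ := hwdef ▸ K.hσ
  have vw : A.valuation w = 1 := hwdef ▸ K.valuation_ω A
  have vp : A.valuation p = 1 := hpdef ▸ hA.valuation_eq_one_iff.2 hp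
  have vθ : A.valuation K.θ = 1 := by
    rw [← pow_eq_one_iff_of_nonneg zero_le three_ne_zero, ← map_pow, hθ, vp]
  have hℓ : A.valuation (1 - w) < 1 := by
    have := hA.valuation_lt_one_iff.2 (hl.trans_lt (by rw [← WithZero.exp_zero, WithZero.exp_lt_exp]; norm_num) : v.valuation F (1 - K.ω) < 1)
    rwa [map_sub (algebraMap F L), map_one (algebraMap F L), ← hwdef] at this
  have hl0 : 1 - w ≠ 0 := by
    intro h0
    rw [sub_eq_zero] at h0
    have h1 : (1 : L) - algebraMap F L K.ω = 0 := by rw [← hwdef, ← h0, sub_self]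
    rw [← map_one (algebraMap F L), ← map_sub, map_eq_zero] at h1
    rw [h1, map_zero] at hl
    exact WithZero.exp_ne_zero hl.symm
  have v3 : A.valuation 3 = A.valuation (1 - w) ^ 2 := by
    rw [← map_pow, show (1 - w) ^ 2 = -(3 * w) by linear_combination hw, Valuation.map_neg,
      map_mul, vw, mul_one]
  have vpp : A.valuation (p ^ 2 - 1) = A.valuation (1 - w) ^ 2 := by
    have h1 : A.valuation (algebraMap F L (K.p ^ 2 - 1)) = A.valuation (algebraMap F L 3) :=
      le_antisymm (hA.valuation_le_iff.2 hp2.le) (hA.valuation_le_iff.2 hp2.ge)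
    rwa [map_sub (algebraMap F L), map_one (algebraMap F L), map_pow (algebraMap F L), ← hpdef,
      map_ofNat, v3] at h1
  have hℓ0 : 0 < A.valuation (1 - w) := (Valuation.pos_iff _).2 hl0
  obtain ⟨τ, hτ⟩ : ∃ τ, τ = K.θ - p := ⟨_, rfl⟩
  have hτ3 : τ ^ 3 = -(p * (p ^ 2 - 1)) - 3 * (p * τ * (τ + p)) := by
    rw [hτ]; linear_combination hθ
  have vτ1 : A.valuation τ ≤ 1 := by
    rw [hτ]; exact (A.valuation.map_sub _ _).trans (by rw [vθ, vp, max_self])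
  have vτ : A.valuation τ ^ 3 = A.valuation (1 - w) ^ 2 := by
    have h1 : A.valuation (p * (p ^ 2 - 1)) = A.valuation (1 - w) ^ 2 := by
      rw [map_mul, vp, one_mul, vpp]
    have h2 : A.valuation (3 * (p * τ * (τ + p))) ≤ A.valuation (1 - w) ^ 2 * A.valuation τ := by
      rw [map_mul, map_mul, map_mul, vp, one_mul, v3]
      exact mul_le_mul_right (mul_le_of_le_one_right zero_le
        (Valuation.map_add_le _ vτ1 vp.le)) _
    have h3 : A.valuation τ < 1 := by
      by_contra! hcon
      have h4 : A.valuation (τ ^ 3) ≤ A.valuation (1 - w) ^ 2 := by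
        rw [hτ3]
        refine (A.valuation.map_sub _ _).trans (max_le ?_ ?_)
        · rw [Valuation.map_neg, h1]
        · exact h2.trans (mul_le_of_le_one_right zero_le vτ1)
      rw [map_pow] at h4
      exact ((one_le_pow₀ hcon).trans h4).not_gt (pow_lt_one₀ zero_le hℓ two_ne_zero)
    rw [← map_pow, hτ3, Valuation.map_sub_eq_of_lt_left, Valuation.map_neg, h1]
    rw [Valuation.map_neg, h1]
    exact h2.trans_lt (mul_lt_of_lt_one_right (pow_pos hℓ0 2) h3)
  have hτ0 : τ ≠ 0 := by
    rintro h0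
    rw [h0, map_zero, zero_pow three_ne_zero] at vτ
    exact (pow_pos hℓ0 2).ne vτ
  have vτ0 : 0 < A.valuation τ := (Valuation.pos_iff _).2 hτ0
  obtain ⟨q, hq⟩ : ∃ q, q = A.valuation ((1 - w) / τ) := ⟨_, rfl⟩
  have hq3 : A.valuation (1 - w) = q ^ 3 := by
    rw [hq, map_div₀, div_pow, vτ]
    field_simp
  have hq0 : 0 < q := by rw [hq, map_div₀]; exact div_pos hℓ0 vτ0
  have hq1 : q < 1 := by
    rw [hq3] at hℓ
    exact (pow_lt_one_iff_of_nonneg zero_le three_ne_zero).1 hℓ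
  have hτq : A.valuation τ = q ^ 2 := by
    have : A.valuation τ = A.valuation (1 - w) / q := by
      rw [hq, map_div₀, div_div_cancel₀ hℓ0.ne']
    rw [this, hq3, pow_succ, mul_div_cancel_right₀ _ hq0.ne']
  have hστ : K.σ τ = τ - (1 - w) * K.θ := by
    rw [hτ, map_sub, hσθ, hσp]; ring
  have vστ : A.valuation (K.σ τ) = q ^ 2 := by
    rw [hστ, Valuation.map_sub_eq_of_lt_left, hτq]
    rw [map_mul, vθ, mul_one, hq3, hτq]
    exact pow_lt_pow_right_of_lt_one₀ hq0 hq1 (by norm_num)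
  have hστ0 : K.σ τ ≠ 0 := by simpa using hτ0
  have hσστ0 : K.σ (K.σ τ) ≠ 0 := by simpa using hτ0
  have hσσ : K.σ (K.σ τ) = w ^ 2 * K.θ - p := by
    rw [hτ, map_sub, map_sub, hσθ, map_mul, hσw, hσp, hσθ, hσp]; ring
  have hσϖ : K.σ ((1 - w) / τ) = (1 - w) / K.σ τ := by rw [map_div₀, map_sub, map_one, hσw]
  have hσσϖ : K.σ ((1 - w) / K.σ τ) = (1 - w) / K.σ (K.σ τ) := by
    rw [map_div₀, map_sub, map_one, hσw]
  have e3 : τ * K.σ τ * K.σ (K.σ τ) = -(p * (p ^ 2 - 1)) := by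
    rw [hσσ, hστ, hτ]
    linear_combination w ^ 3 * hθ + (p * (w - 1) - p * K.θ * (K.θ * w - p)) * hw
  have e2 : τ * K.σ τ + τ * K.σ (K.σ τ) + K.σ τ * K.σ (K.σ τ) = 3 * p ^ 2 := by
    rw [hσσ, hστ, hτ]
    linear_combination (K.θ ^ 2 * w - 2 * p * K.θ) * hw
  have e1 : τ + K.σ τ + K.σ (K.σ τ) = -(3 * p) := by
    rw [hσσ, hστ, hτ]
    linear_combination K.θ * hw
  have hp0 : p ≠ 0 := (Valuation.ne_zero_iff A.valuation).1 (vp ▸ one_ne_zero)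
  have hpp0 : p ^ 2 - 1 ≠ 0 := (Valuation.ne_zero_iff A.valuation).1 (vpp ▸ (pow_pos hℓ0 2).ne')
  have hu : A.valuation (3 / (p ^ 2 - 1)) = 1 := by
    rw [map_div₀, v3, vpp, div_self (pow_pos hℓ0 2).ne']
  have t1 : 1 / τ + 1 / K.σ τ + 1 / K.σ (K.σ τ) = -(p * (3 / (p ^ 2 - 1))) := by
    have : 1 / τ + 1 / K.σ τ + 1 / K.σ (K.σ τ) =
      (τ * K.σ τ + τ * K.σ (K.σ τ) + K.σ τ * K.σ (K.σ τ)) / (τ * K.σ τ * K.σ (K.σ τ)) := by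
      field_simp; ring
    rw [this, e2, e3]
    field_simp
  have t2 : 1 / τ ^ 2 + 1 / K.σ τ ^ 2 + 1 / K.σ (K.σ τ) ^ 2 =
      (p * (3 / (p ^ 2 - 1))) ^ 2 - 2 * (3 / (p ^ 2 - 1)) := by
    have : 1 / τ ^ 2 + 1 / K.σ τ ^ 2 + 1 / K.σ (K.σ τ) ^ 2 =
      (1 / τ + 1 / K.σ τ + 1 / K.σ (K.σ τ)) ^ 2 - 2 *
        ((τ + K.σ τ + K.σ (K.σ τ)) / (τ * K.σ τ * K.σ (K.σ τ))) := by
      field_simp; ring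
    rw [this, t1, e1, e3]
    field_simp
  have hram : K.IsRamified A v ((1 - w) / τ) := by
    refine ⟨hA, ⟨_, hl, ?_⟩, fun x => ?_, ?_⟩
    · rw [← hq, ← hq3, map_sub (algebraMap F L), map_one (algebraMap F L), hwdef]
    · obtain ⟨a, b, c, h⟩ := K.span (x * τ ^ 2)
      refine ⟨c, (b + 2 * c * K.p) / (1 - K.ω), (a + b * K.p + c * K.p ^ 2) / (1 - K.ω) ^ 2, ?_⟩
      simp only [map_add, map_mul, map_pow, map_div₀, map_sub, map_one, map_ofNat, ← hwdef,
        ← hpdef]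
      field_simp
      rw [h, hτ]
      ring
    · rw [hσϖ, map_div₀, map_div₀, vστ, hτq]
  refine ⟨(1 - w) / τ, hram, ?_, ?_, ?_, ?_, fun x hx => ?_⟩
  · rw [hσϖ, ← hq, show (1 - w) / K.σ τ - (1 - w) / τ = (1 - w) * ((1 - w) * K.θ) / (τ * K.σ τ) by
      rw [div_sub_div _ _ hστ0 hτ0, mul_comm τ]; congr 1; rw [hστ]; ring]
    rw [map_div₀, map_mul, map_mul, map_mul, vθ, hq3, hτq, vστ]
    field_simp
  · rw [hσϖ, hσσϖ, ← hq, show (1 - w) / τ + (1 - w) / K.σ τ + (1 - w) / K.σ (K.σ τ) =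
      (1 - w) * (1 / τ + 1 / K.σ τ + 1 / K.σ (K.σ τ)) by ring, t1, map_mul, Valuation.map_neg,
      map_mul, vp, hu, hq3, one_mul, mul_one]
  · rw [map_pow, map_pow, hσϖ, hσσϖ, ← hq, show ((1 - w) / τ) ^ 2 + ((1 - w) / K.σ τ) ^ 2 +
      ((1 - w) / K.σ (K.σ τ)) ^ 2 = (1 - w) ^ 2 * (1 / τ ^ 2 + 1 / K.σ τ ^ 2 + 1 / K.σ (K.σ τ) ^ 2)
      by ring, t2, map_mul, map_pow, hq3, ← pow_mul]
    refine (mul_le_of_le_one_right zero_le ((A.valuation.map_sub _ _).trans (max_le ?_ ?_))).trans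
      (pow_le_pow_of_le_one zero_le hq1.le (by norm_num))
    · rw [map_pow, map_mul, vp, hu, one_mul, one_pow]
    · rw [map_mul, hu, mul_one]
      exact A.valuation_le_one 2
  · rw [v3, hq3, ← hq, ← pow_mul]
    exact pow_le_pow_of_le_one zero_le hq1.le (by norm_num)
  · obtain ⟨a, ha, hxa⟩ := hram.exists_residue hx
    rw [← hq] at hxa
    have hlt := hxa.trans_lt hq1
    rcases hres a (hA.valuation_le_one_iff.1 ha) with h | h | h
    · left
      rw [← sub_add_cancel x (algebraMap F L a)]
      exact Valuation.map_add_lt _ hlt (hA.valuation_lt_one_iff.2 h)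
    · right; left
      have := hA.valuation_lt_one_iff.2 h
      rw [map_sub (algebraMap F L), map_one (algebraMap F L)] at this
      rw [← sub_add_sub_cancel x (algebraMap F L a)]
      exact Valuation.map_add_lt _ hlt this
    · right; right
      have := hA.valuation_lt_one_iff.2 h
      rw [map_add (algebraMap F L), map_one (algebraMap F L)] at this
      rw [show x + 1 = x - algebraMap F L a + (algebraMap F L a + 1) by ring]
      exact Valuation.map_add_lt _ hlt this

end WildUniformizer

section ThreeTorsion

open IsDedekindDomain

variable {O F L : Type*} [CommRing O] [IsDedekindDomain O] [Field F] [Algebra O F]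
  [IsFractionRing O F] [Field L] [Algebra F L] {K : CubicKummer F L}
  {A : ValuationSubring L} {v : HeightOneSpectrum O} {ϖ : L}

namespace ConjugateTriple

variable (T : ConjugateTriple K)

theorem localCondition_of_wild [CharZero F] (hw : K.IsWild A v ϖ) (hX : 1 < A.valuation T.x₁) :
    T.LocalCondition A := by
  refine (T.isScalarFrame_translatedFrame hw.valuation_σ hw.valuation_two hX).localCondition_of_wild
    hw ?_
  have hx0 : T.x₁ ≠ 0 := (Valuation.ne_zero_iff _).1 (zero_lt_one.trans hX).ne'
  have hlt : A.valuation T.x₁ < A.valuation (T.x₁ ^ 3) := by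
    rw [map_pow]
    exact lt_self_pow₀ hX (by norm_num)
  have hy : A.valuation T.y₁ ^ 2 = A.valuation T.x₁ ^ 3 := by
    rw [← map_pow, T.y₁_sq, Valuation.map_sub_eq_of_lt_left _ hlt, map_pow]
  have hy0 : T.y₁ ≠ 0 := by
    intro h0
    rw [h0, map_zero, zero_pow two_ne_zero] at hy
    exact (pow_pos (zero_lt_one.trans hX) 3).ne hy
  obtain ⟨m, hm⟩ := hw.exists_zpow hx0
  obtain ⟨n, hn⟩ := hw.exists_zpow hy0
  have hq0 := hw.valuation_pos.ne'
  rw [hm, hn, ← zpow_natCast, ← zpow_natCast, ← zpow_mul, ← zpow_mul] at hy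
  have h1 := hw.zpow_le_zpow_iff.1 hy.le
  have h2 := hw.zpow_le_zpow_iff.1 hy.ge
  rw [hm, ← zpow_zero (A.valuation ϖ), hw.zpow_lt_zpow_iff] at hX
  rw [hm, ← zpow_neg, ← zpow_natCast, hw.zpow_le_zpow_iff]
  push_cast at h1 h2 ⊢
  omega

theorem localCondition_of_tame [CharZero F] (h : K.IsRamified A v ϖ) (h2 : A.valuation 2 = 1)
    (h3 : A.valuation 3 = 1) (hX : 1 < A.valuation T.x₁) : T.LocalCondition A :=
  (T.isScalarFrame_translatedFrame h.valuation_σ h2 hX).localCondition_of_tame h.valuation_σ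
    (fun _ hx => h.valuation_σ_sub_lt hx) h3

open Classical in
theorem exists_three_torsion (hσ : ∀ x, A.valuation (K.σ x) = A.valuation x)
    (hres : ∀ x, A.valuation x ≤ 1 → A.valuation (K.σ x - x) < 1) (h2 : A.valuation 2 = 1)
    (hX : A.valuation T.x₁ ≤ 1) :
    ∃ P : (Ecurve (IsLocalRing.ResidueField A)).Point, P ≠ 0 ∧ 3 • P = 0 := by
  have i1 : T.x₁ ∈ A := (A.valuation_le_one_iff _).1 hX
  have h2X : A.valuation T.x₂ ≤ 1 := by rwa [← T.σ_x₁, hσ]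
  have i2 : T.x₂ ∈ A := (A.valuation_le_one_iff _).1 h2X
  have i3 : T.x₃ ∈ A := (A.valuation_le_one_iff _).1 (by rwa [← T.σ_x₂, hσ])
  have iμ : T.μ ∈ A := A.mem_of_pow_mem two_ne_zero (by
    rw [← T.sum_eq]; exact A.add_mem _ _ (A.add_mem _ _ i1 i2) i3)
  have ib : T.b ∈ A := A.mem_of_pow_mem two_ne_zero (by
    rw [← T.prod_eq]; exact A.mul_mem _ _ (A.mul_mem _ _ i1 i2) i3)
  let π := IsLocalRing.residue A
  have e12 : π ⟨_, i2⟩ = π ⟨_, i1⟩ := by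
    rw [← sub_eq_zero, ← map_sub, A.residue_eq_zero_iff_valuation_lt_one]
    have := hres _ hX
    rwa [T.σ_x₁] at this
  have e13 : π ⟨_, i3⟩ = π ⟨_, i1⟩ := by
    rw [← e12, ← sub_eq_zero, ← map_sub, A.residue_eq_zero_iff_valuation_lt_one]
    have := hres _ h2X
    rwa [T.σ_x₂] at this
  have s1 := congrArg π (Subtype.ext T.sum_eq :
    (⟨_, i1⟩ + ⟨_, i2⟩ + ⟨_, i3⟩ : A) = (⟨_, iμ⟩ : A) ^ 2)
  have s2 := congrArg π (Subtype.ext T.pair_eq :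
    (⟨_, i1⟩ * ⟨_, i2⟩ + ⟨_, i1⟩ * ⟨_, i3⟩ + ⟨_, i2⟩ * ⟨_, i3⟩ : A) =
      -1 - 2 * (⟨_, iμ⟩ : A) * ⟨_, ib⟩)
  have s3 := congrArg π (Subtype.ext T.prod_eq :
    (⟨_, i1⟩ * ⟨_, i2⟩ * ⟨_, i3⟩ : A) = (⟨_, ib⟩ : A) ^ 2)
  simp only [map_add, map_mul, map_pow, map_sub, map_neg, map_one, map_ofNat, e12, e13] at s1 s2 s3
  have h20 : (2 : IsLocalRing.ResidueField A) ≠ 0 := by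
    intro h0
    rw [← map_ofNat π 2, A.residue_eq_zero_iff_valuation_lt_one] at h0
    exact h0.ne h2
  have : NeZero (2 : IsLocalRing.ResidueField A) := ⟨h20⟩
  generalize π ⟨_, i1⟩ = x at *
  generalize π ⟨_, iμ⟩ = m at *
  generalize π ⟨_, ib⟩ = b at *
  have hP : (m * x + b) ^ 2 = x ^ 3 - x := by
    linear_combination -x ^ 2 * s1 + x * s2 - s3
  have hP' : (-(m * x + b)) ^ 2 = x ^ 3 - x := by rw [neg_sq, hP]
  have hy : m * x + b ≠ 0 := by
    intro h0
    have hb : b = -(m * x) := by linear_combination h0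
    have hx : x = 0 := by
      have : 2 * x ^ 3 = 0 := by
        rw [hb] at s3
        linear_combination x ^ 2 * s1 - s3
      simpa [h20] using this
    rw [hx] at hb s2
    simp [hb] at s2
  refine ⟨Ecurve.mk hP, Ecurve.mk_ne_zero hP, ?_⟩
  have htwo := Ecurve.tangent hP hP' hy m (by linear_combination 2 * x * s1 - s2)
    (by linear_combination s1) (by ring)
  rw [succ_nsmul, two_nsmul, htwo]
  exact Ecurve.mk_add_mk_neg _ _ rfl

end ConjugateTriple

open Polynomial in
theorem nonempty_ringHom_galoisField {k : Type*} [Field k] {p : ℕ} (hp : p.Prime) [CharP k p]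
    (hp3 : p ≠ 3) {w : k} (hw : w ^ 2 + w + 1 = 0)
    (h : ∀ x : k, ∃ m n : ℤ, x = m + n * w) :
    Nonempty (k →+* @GaloisField p ⟨hp⟩ (if p % 3 = 1 then 1 else 2)) := by
  have : Fact p.Prime := ⟨hp⟩
  set f := if p % 3 = 1 then 1 else 2 with hf
  have hf0 : f ≠ 0 := by rw [hf]; split_ifs <;> norm_num
  have hw3 : w ^ 3 = 1 := by linear_combination (w - 1) * hw
  have hw1 : w ≠ 1 := by
    rintro rfl
    have h3 : ((3 : ℕ) : k) = 0 := by push_cast; linear_combination hw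
    rw [CharP.cast_eq_zero_iff k p] at h3
    exact hp3 ((Nat.prime_dvd_prime_iff_eq hp Nat.prime_three).1 h3)
  have hord : orderOf w = 3 := orderOf_eq_prime hw3 hw1
  have hmod : p ^ f % 3 = 1 := by
    have h3 : p % 3 ≠ 0 := fun h0 =>
      hp3 ((Nat.prime_dvd_prime_iff_eq Nat.prime_three hp).1 (Nat.dvd_of_mod_eq_zero h0)).symm
    rw [Nat.pow_mod, hf]
    have := Nat.mod_lt p (show 0 < 3 by norm_num)
    interval_cases hm : p % 3 <;> simp_all
  have hwf : w ^ p ^ f = w := by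
    rw [← Nat.div_add_mod (p ^ f) 3, hmod, pow_add, pow_mul, hw3, one_pow, one_mul, pow_one]
  have hz : ∀ z : ℤ, (z : k) ^ p ^ f = z := fun z => by
    rw [← iterateFrobenius_def, map_intCast]
  have hx : ∀ x : k, x ^ p ^ f = x := by
    intro x
    obtain ⟨m, n, rfl⟩ := h x
    rw [add_pow_char_pow, mul_pow, hz, hz, hwf]
  have hp1 : 1 < p ^ f := Nat.one_lt_pow hf0 hp.one_lt
  have hroot : ∀ x : k, x ∈ (X ^ p ^ f - X : k[X]).rootSet k := fun x => by
    rw [mem_rootSet_of_ne (FiniteField.X_pow_card_sub_X_ne_zero k hp1)]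
    simp [hx x]
  have hfin : Finite k := Set.finite_univ_iff.1 ((Set.finite_mem_finset _).subset fun x _ => hroot x)
  have : Fintype k := Fintype.ofFinite k
  have hcard : Fintype.card k ≤ p ^ f := by
    classical
    have h1 : Finset.univ ⊆ (X ^ p ^ f - X : k[X]).roots.toFinset := fun x _ => by
      have := hroot x
      rwa [rootSet_def, aroots_def, Algebra.algebraMap_self, map_id] at this
    calc Fintype.card k ≤ _ := Finset.card_le_card h1
      _ ≤ _ := Multiset.toFinset_card_le _
      _ ≤ _ := card_roots' _
      _ = p ^ f := FiniteField.X_pow_card_sub_X_natDegree_eq k hp1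
  obtain ⟨n, -, hn⟩ := FiniteField.card k p
  have hnf : (n : ℕ) ≤ f := (Nat.pow_le_pow_iff_right hp.one_lt).1 (hn ▸ hcard)
  let : Algebra (ZMod p) k := ZMod.algebra k p
  have hdim : Module.finrank (ZMod p) k = n := by
    have h1 : Fintype.card k = Fintype.card (ZMod p) ^ Module.finrank (ZMod p) k :=
      Module.card_eq_pow_finrank
    rw [hn, ZMod.card] at h1
    exact (Nat.pow_right_injective hp.two_le h1).symm
  have hdvd : (n : ℕ) ∣ f := by
    have h0 := n.pos
    have h2 : f ≤ 2 := by rw [hf]; split_ifs <;> norm_num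
    rcases Nat.eq_or_lt_of_le h0 with h1 | h1
    · rw [← h1]; exact one_dvd _
    · rw [show (n : ℕ) = f by omega]
  obtain ⟨φ⟩ := FiniteField.nonempty_algHom_of_finrank_dvd (F := ZMod p) (K := k)
    (L := GaloisField p f) (by rw [hdim, GaloisField.finrank p hf0]; exact hdvd)
  exact ⟨φ.toRingHom⟩

end ThreeTorsion

section ConditionPTorsion

open IsDedekindDomain

variable {O F L : Type*} [CommRing O] [IsDedekindDomain O] [Field F] [Algebra O F]
  [IsFractionRing O F] [Field L] [Algebra F L] {K : CubicKummer F L}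
  {A : ValuationSubring L} {v : HeightOneSpectrum O} {ϖ : L}

theorem valuation_natCast_eq_one {p n : ℕ} (hv : v.valuation F (p : F) < 1)
    (hn : Nat.Coprime n p) : v.valuation F (n : F) = 1 := by
  have hle : ∀ z : ℤ, v.valuation F (z : F) ≤ 1 := fun z => by
    rw [← map_intCast (algebraMap O F) z]
    exact v.valuation_le_one _
  refine le_antisymm (by exact_mod_cast hle n) (not_lt.1 fun hlt => ?_)
  have e : (1 : F) = (n : F) * ((Nat.gcdA n p : ℤ) : F) + (p : F) * ((Nat.gcdB n p : ℤ) : F) := by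
    have := Nat.gcd_eq_gcd_ab n p
    rw [hn.gcd_eq_one] at this
    exact_mod_cast congrArg (Int.cast : ℤ → F) this
  have h1 : v.valuation F 1 < 1 := by
    rw [e]
    refine Valuation.map_add_lt _ ?_ ?_
    · rw [map_mul]; exact (mul_le_of_le_one_right zero_le (hle _)).trans_lt hlt
    · rw [map_mul]; exact (mul_le_of_le_one_right zero_le (hle _)).trans_lt hv
  rw [map_one] at h1
  exact lt_irrefl _ h1

open Classical in
theorem ConjugateTriple.one_lt_valuation_x₁ [CharZero F] (T : ConjugateTriple K)
    (h : K.IsRamified A v ϖ) {p : ℕ} (hp : p.Prime) (hp2 : p ≠ 2) (hp3 : p ≠ 3)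
    (hP : ConditionP p hp) (hv : v.valuation F (p : F) < 1)
    (hres : ∀ a : F, v.valuation F a ≤ 1 → ∃ m n : ℤ, v.valuation F (a - (m + n * K.ω)) < 1) :
    1 < A.valuation T.x₁ := by
  by_contra! hX
  have hA := h.isAbove
  have h2 : A.valuation 2 = 1 := by
    have := hA.valuation_eq_one_iff.2 (valuation_natCast_eq_one hv
      ((Nat.coprime_primes Nat.prime_two hp).2 hp2.symm))
    rwa [Nat.cast_ofNat, map_ofNat] at this
  obtain ⟨P, hP0, hP3⟩ := T.exists_three_torsion h.valuation_σ
    (fun _ hx => h.valuation_σ_sub_lt hx) h2 hX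
  have hpA : IsLocalRing.residue A (p : A) = 0 := by
    rw [A.residue_eq_zero_iff_valuation_lt_one]
    have := hA.valuation_lt_one_iff.2 hv
    rwa [map_natCast] at this
  have hchar : CharP (IsLocalRing.ResidueField A) p := by
    rw [map_natCast] at hpA
    exact ringChar.of_eq (CharP.ringChar_of_prime_eq_zero hp hpA)
  have hwA : algebraMap F L K.ω ∈ A := (A.valuation_le_one_iff _).1 (K.valuation_ω A).le
  obtain ⟨φ⟩ := nonempty_ringHom_galoisField hp hp3 (k := IsLocalRing.ResidueField A)
    (w := IsLocalRing.residue A ⟨_, hwA⟩) (by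
      have := congrArg (IsLocalRing.residue A) (Subtype.ext K.hω' :
        (⟨_, hwA⟩ ^ 2 + ⟨_, hwA⟩ + 1 : A) = 0)
      simpa only [map_add, map_pow, map_one, map_zero] using this) fun x => by
    obtain ⟨a, rfl⟩ := IsLocalRing.residue_surjective x
    obtain ⟨c, hc, hac⟩ := h.exists_residue ((A.valuation_le_one_iff _).2 a.2)
    obtain ⟨m, n, hmn⟩ := hres c (hA.valuation_le_one_iff.1 hc)
    refine ⟨m, n, ?_⟩
    rw [← map_intCast (IsLocalRing.residue A), ← map_intCast (IsLocalRing.residue A), ← map_mul,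
      ← map_add, ← sub_eq_zero, ← map_sub, A.residue_eq_zero_iff_valuation_lt_one]
    have h1 := hA.valuation_lt_one_iff.2 hmn
    have h2 := Valuation.map_add_lt _ (hac.trans_lt h.valuation_lt_one) h1
    rwa [map_sub (algebraMap F L), sub_add_sub_cancel, map_add (algebraMap F L),
      map_mul (algebraMap F L), map_intCast, map_intCast] at h2
  have hφ := Ecurve.map_injective φ
  have hord : addOrderOf (Ecurve.map φ P) = 3 :=
    addOrderOf_eq_prime (by rw [← map_nsmul, hP3, map_zero])
      (fun h0 => hP0 (hφ (by rw [h0, map_zero])))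
  have hdvd := addOrderOf_dvd_natCard (Ecurve.map φ P)
  rw [hord] at hdvd
  exact hP hdvd

theorem CubicKummer.isRamified_θ (hA : A.IsAbove v F)
    (hv : v.valuation F K.p = WithZero.exp (-1)) : K.IsRamified A v K.θ where
  isAbove := hA
  cube := ⟨K.p, hv, by rw [← map_pow, K.hθ]⟩
  span := K.span
  valuation_map := by rw [K.hσ, map_mul, K.valuation_ω, one_mul]

end ConditionPTorsion

section Divisibility

namespace Ecurve

variable {K Γ : Type*} [Field K] [LinearOrderedCommGroupWithZero Γ]

/-- A set of points is zero if multiplication by some integer is onto on it and pushes the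
points of the set towards the origin. -/
theorem eq_zero_of_contracting [NeZero (2 : K)] (w : Valuation K Γ) (q : Γ)
    (harch : ∀ x, ∃ n : ℕ, w x * q ^ n ≤ 1) (S : Set (Ecurve K).Point)
    (h1 : ∀ x y (h : y ^ 2 = x ^ 3 - x), mk h ∈ S → 1 < w x)
    (h2 : ∀ x y (h : y ^ 2 = x ^ 3 - x), mk h ∈ S → ∃ x' y', ∃ h' : y' ^ 2 = x' ^ 3 - x',
      mk h' ∈ S ∧ w x' ≤ w x * q) {P : (Ecurve K).Point} (hP : P ∈ S) : P = 0 := by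
  rcases eq_zero_or_mk P with h | ⟨x, y, h, rfl⟩
  · exact h
  exfalso
  have key : ∀ n : ℕ, ∃ x' y', ∃ h' : y' ^ 2 = x' ^ 3 - x', mk h' ∈ S ∧ w x' ≤ w x * q ^ n := by
    intro n
    induction n with
    | zero => exact ⟨x, y, h, hP, by simp⟩
    | succ n ih =>
      obtain ⟨x', y', h', hS, hle⟩ := ih
      obtain ⟨x'', y'', h'', hS', hle'⟩ := h2 x' y' h' hS
      refine ⟨x'', y'', h'', hS', hle'.trans ?_⟩
      rw [pow_succ, ← mul_assoc]
      exact mul_le_mul_left hle _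
  obtain ⟨n, hn⟩ := harch x
  obtain ⟨x', y', h', hS, hle⟩ := key n
  exact absurd (h1 x' y' h' hS) (not_lt.2 (hle.trans hn))

variable [DecidableEq K]

theorem mk_add_self_eq_zero [NeZero (2 : K)] {x y : K} (h : y ^ 2 = x ^ 3 - x) (hy : y = 0) :
    mk h + mk h = 0 :=
  mk_add_mk_neg h h (by rw [hy, neg_zero])

theorem exists_add_self [NeZero (2 : K)] {x y : K} (h : y ^ 2 = x ^ 3 - x) (hy : y ≠ 0) :
    ∃ x' y' l, ∃ h' : y' ^ 2 = x' ^ 3 - x', mk h + mk h = mk h' ∧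
      3 * x ^ 2 - 1 = l * (2 * y) ∧ x' = l ^ 2 - 2 * x ∧ y' = -(y + l * (x' - x)) := by
  have h2y : 2 * y ≠ 0 := mul_ne_zero two_ne_zero hy
  obtain ⟨l, hl⟩ : ∃ l, 3 * x ^ 2 - 1 = l * (2 * y) :=
    ⟨(3 * x ^ 2 - 1) / (2 * y), (div_mul_cancel₀ _ h2y).symm⟩
  obtain ⟨x', hx'⟩ : ∃ x', x' = l ^ 2 - 2 * x := ⟨_, rfl⟩
  obtain ⟨y', hy'⟩ : ∃ y', y' = -(y + l * (x' - x)) := ⟨_, rfl⟩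
  have h' : y' ^ 2 = x' ^ 3 - x' := by
    rw [hy', hx']
    linear_combination h - (l ^ 2 - 3 * x) * hl
  exact ⟨x', y', l, h', tangent h h' hy l hl hx' hy', hl, hx', hy'⟩

theorem four_mul_of_add_self [NeZero (2 : K)] {x y x' y' : K} {h : y ^ 2 = x ^ 3 - x}
    {h' : y' ^ 2 = x' ^ 3 - x'} (hd : mk h + mk h = mk h') :
    4 * (x ^ 3 - x) * x' = (x ^ 2 + 1) ^ 2 := by
  have hy : y ≠ 0 := fun h0 => mk_ne_zero h' (by rw [← hd, mk_add_self_eq_zero h h0])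
  obtain ⟨x₂, y₂, l, h₂, e, hl, hx, -⟩ := exists_add_self h hy
  obtain ⟨rfl, rfl⟩ := (mk_inj h' h₂).1 (hd.symm.trans e)
  rw [hx]
  linear_combination (-4 * l ^ 2) * h - (2 * y * l + 3 * x ^ 2 - 1) * hl

theorem mul_sq_of_add_add [NeZero (2 : K)] {x y x' y' : K} {h : y ^ 2 = x ^ 3 - x}
    {h' : y' ^ 2 = x' ^ 3 - x'} (ht : mk h + mk h + mk h = mk h') (hy : y ≠ 0) :
    x' * (3 * x ^ 4 - 6 * x ^ 2 - 1) ^ 2 =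
      x ^ 9 + 12 * x ^ 7 + 30 * x ^ 5 - 36 * x ^ 3 + 9 * x := by
  obtain ⟨x₂, y₂, m, h₂, e, hm, hx, hy₂⟩ := exists_add_self h hy
  have hd : -(4 * y ^ 2 * (x₂ - x)) = 3 * x ^ 4 - 6 * x ^ 2 - 1 := by
    rw [hx]
    linear_combination (12 * x) * h + (3 * x ^ 2 - 1 + m * (2 * y)) * hm
  have hne : x₂ ≠ x := by
    rintro rfl
    rw [e, mk_add_mk_neg h₂ h (by rw [hy₂, sub_self, mul_zero, add_zero])] at ht
    exact mk_ne_zero h' ht.symm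
  obtain ⟨l, hl⟩ : ∃ l, y₂ - y = l * (x₂ - x) :=
    ⟨(y₂ - y) / (x₂ - x), (div_mul_cancel₀ _ (sub_ne_zero.2 hne)).symm⟩
  obtain ⟨x₃, hx₃⟩ : ∃ x₃, x₃ = l ^ 2 - x₂ - x := ⟨_, rfl⟩
  obtain ⟨y₃, hy₃⟩ : ∃ y₃, y₃ = -(y₂ + l * (x₃ - x₂)) := ⟨_, rfl⟩
  have h₃ : y₃ ^ 2 = x₃ ^ 3 - x₃ := by
    rw [hy₃]
    have hs := sub_ne_zero.2 hne
    have e2 : y₂ ^ 2 - y ^ 2 = (x₂ - x) * (x₂ ^ 2 + x₂ * x + x ^ 2 - 1) := by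
      rw [h₂, h]; ring
    have e3 : l * (y₂ + y) = x₂ ^ 2 + x₂ * x + x ^ 2 - 1 := by
      apply mul_left_cancel₀ hs
      rw [← e2]
      linear_combination -(y₂ + y) * hl
    have hx₃' : l ^ 2 = x₃ + x₂ + x := by rw [hx₃]; ring
    linear_combination h₂ + (x₃ - x₂) * e3 + (x₃ - x₂) * l * hl + (x₃ - x₂) * (x₃ - x) * hx₃'
  have e4 := chord h₂ h h₃ hne l hl hx₃ hy₃
  rw [e, e4, mk_inj] at ht
  obtain ⟨rfl, -⟩ := ht
  have hlψ : l * (3 * x ^ 4 - 6 * x ^ 2 - 1) = 8 * y ^ 3 - m * (3 * x ^ 4 - 6 * x ^ 2 - 1) := by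
    rw [← hd]
    linear_combination (4 * y ^ 2) * hl - (4 * y ^ 2) * hy₂
  rw [hx₃, hx]
  generalize hψe : 3 * x ^ 4 - 6 * x ^ 2 - 1 = ψ at *
  have h6 : y ^ 6 = (x ^ 3 - x) ^ 3 := by rw [← h]; ring
  have e6 : (l ^ 2 - (m ^ 2 - 2 * x) - x) * ψ ^ 2 =
      64 * (x ^ 3 - x) ^ 3 - 8 * (x ^ 3 - x) * (3 * x ^ 2 - 1) * ψ + x * ψ ^ 2 := by
    linear_combination (l * ψ + (8 * y ^ 3 - m * ψ)) * hlψ + 64 * h6 - 8 * (3 * x ^ 2 - 1) * ψ * h + 8 * y ^ 2 * ψ * hm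
  rw [e6, ← hψe]
  ring

end Ecurve

end Divisibility

section TernaryPlace

variable {L : Type*} [Field L]

/-- A place of residue field `𝔽₃` with uniformizer `ϖ`. -/
structure ValuationSubring.IsTernary (A : ValuationSubring L) (ϖ : L) : Prop where
  lt_one : A.valuation ϖ < 1
  le_uniformizer : ∀ x, A.valuation x < 1 → A.valuation x ≤ A.valuation ϖ
  three : A.valuation 3 < 1
  residue : ∀ x, A.valuation x ≤ 1 →
    A.valuation x < 1 ∨ A.valuation (x - 1) < 1 ∨ A.valuation (x + 1) < 1
  archimedean : ∀ x, ∃ n : ℕ, A.valuation x * A.valuation ϖ ^ n ≤ 1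

namespace Ecurve

theorem valuation_cube_sub {Γ : Type*} [LinearOrderedCommGroupWithZero Γ] (w : Valuation L Γ)
    {x : L} (hx : 1 < w x) : w (x ^ 3 - x) = w x ^ 3 := by
  have hlt : w x < w (x ^ 3) := by
    rw [map_pow]
    exact lt_self_pow₀ hx (by norm_num)
  rw [Valuation.map_sub_eq_of_lt_left _ hlt, map_pow]

theorem valuation_sq_add_one {Γ : Type*} [LinearOrderedCommGroupWithZero Γ] (w : Valuation L Γ)
    {x : L} (hx : 1 < w x) : w (x ^ 2 + 1) = w x ^ 2 := by
  have hlt : w 1 < w (x ^ 2) := by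
    rw [map_pow, map_one]
    exact one_lt_pow₀ hx two_ne_zero
  rw [Valuation.map_add_eq_of_lt_left _ hlt, map_pow]

variable [NeZero (2 : L)] [DecidableEq L] {A : ValuationSubring L} {ϖ : L}
  {x y x' y' : L} {h : y ^ 2 = x ^ 3 - x} {h' : y' ^ 2 = x' ^ 3 - x'}

theorem one_lt_valuation_of_add_self (hA : A.IsTernary ϖ) (hd : mk h + mk h = mk h') :
    1 < A.valuation x' := by
  have key := congrArg A.valuation (four_mul_of_add_self hd)
  have h2 : A.valuation 2 = 1 := by
    have := Valuation.map_sub_eq_of_lt_right A.valuation (x := 3) (y := 1)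
      (by rw [map_one]; exact hA.three)
    rwa [map_one, show (3 : L) - 1 = 2 by norm_num] at this
  have h4 : A.valuation 4 = 1 := by
    rw [show (4 : L) = 2 ^ 2 by norm_num, map_pow, h2, one_pow]
  rw [map_mul, map_mul, h4, one_mul, map_pow] at key
  rcases lt_or_ge 1 (A.valuation x) with hx | hx
  · rw [valuation_cube_sub _ hx, valuation_sq_add_one _ hx, ← pow_mul, pow_succ _ 3] at key
    rwa [mul_left_cancel₀ (pow_pos (zero_lt_one.trans hx) 3).ne' key]
  · have hc : A.valuation (x ^ 3 - x) < 1 := by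
      rw [show x ^ 3 - x = x * (x - 1) * (x + 1) by ring, map_mul, map_mul]
      have hm := A.valuation.map_sub x 1
      have hp := A.valuation.map_add x 1
      rw [map_one, max_eq_right hx] at hm hp
      rcases hA.residue x hx with h0 | h0 | h0
      · exact mul_lt_one_of_nonneg_of_lt_one_left zero_le (mul_lt_one_of_nonneg_of_lt_one_left zero_le h0 hm) hp
      · exact mul_lt_one_of_nonneg_of_lt_one_left zero_le (mul_lt_one_of_nonneg_of_lt_one_right hx zero_le h0) hp
      · exact mul_lt_one_of_nonneg_of_lt_one_right (mul_le_one' hx hm) zero_le h0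
    have hu : A.valuation (x ^ 2 + 1) = 1 := by
      have hm := A.valuation.map_sub x 1
      have hp := A.valuation.map_add x 1
      rw [map_one, max_eq_right hx] at hm hp
      have h5 : A.valuation ((x - 1) * (x + 1)) < 1 → A.valuation (x ^ 2 + 1) = 1 := by
        intro h5
        rw [show x ^ 2 + 1 = (x - 1) * (x + 1) + 2 by ring,
          Valuation.map_add_eq_of_lt_right _ (by rwa [h2]), h2]
      rcases hA.residue x hx with h0 | h0 | h0
      · rw [Valuation.map_add_eq_of_lt_right _ ?_, map_one]
        rw [map_one, map_pow]
        exact pow_lt_one₀ zero_le h0 two_ne_zero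
      · exact h5 (by rw [map_mul]; exact mul_lt_one_of_nonneg_of_lt_one_left zero_le h0 hp)
      · exact h5 (by rw [map_mul]; exact mul_lt_one_of_nonneg_of_lt_one_right hm zero_le h0)
    rw [hu, one_pow] at key
    by_contra! hle
    exact absurd key (mul_lt_one_of_nonneg_of_lt_one_left zero_le hc hle).ne

theorem valuation_le_of_add_add (hA : A.IsTernary ϖ) (hx : 1 < A.valuation x)
    (ht : mk h + mk h + mk h = mk h') : A.valuation x ≤ A.valuation x' * A.valuation ϖ := by
  have hx0 := zero_lt_one.trans hx
  have hy : y ≠ 0 := by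
    rintro rfl
    have := valuation_cube_sub A.valuation hx
    rw [← h, zero_pow two_ne_zero, map_zero] at this
    exact (pow_pos hx0 3).ne this
  have key := congrArg A.valuation (mul_sq_of_add_add ht hy)
  have hxn : x ≠ 0 := (Valuation.pos_iff _).1 hx0
  have hn : A.valuation (x ^ 9 + 12 * x ^ 7 + 30 * x ^ 5 - 36 * x ^ 3 + 9 * x) =
      A.valuation x ^ 9 := by
    rw [show x ^ 9 + 12 * x ^ 7 + 30 * x ^ 5 - 36 * x ^ 3 + 9 * x =
      x ^ 9 + 3 * (x * (4 * x ^ 6 + 10 * x ^ 4 - 12 * x ^ 2 + 3)) by ring,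
      Valuation.map_add_eq_of_lt_left, map_pow]
    have hi : ∀ n : ℕ, A.valuation (n : L) ≤ 1 := fun n => by
      rw [A.valuation_le_one_iff]; exact natCast_mem A n
    have hb : ∀ (n k : ℕ), k ≤ 6 → A.valuation ((n : L) * x ^ k) ≤ A.valuation x ^ 6 := by
      intro n k hk
      rw [map_mul, map_pow]
      exact (mul_le_of_le_one_left' (hi n)).trans (pow_le_pow_right₀ hx.le hk)
    have h1 := hb 4 6 le_rfl
    have h2 := hb 10 4 (by norm_num)
    have h3 := hb 12 2 (by norm_num)
    have h4 := hb 3 0 (by norm_num)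
    push_cast at h1 h2 h3 h4
    rw [pow_zero, mul_one] at h4
    have h5 : A.valuation (4 * x ^ 6 + 10 * x ^ 4 - 12 * x ^ 2 + 3) ≤ A.valuation x ^ 6 :=
      A.valuation.map_add_le ((A.valuation.map_sub _ _).trans
        (max_le (A.valuation.map_add_le h1 h2) h3)) h4
    rw [map_mul, map_mul, map_pow]
    refine lt_of_le_of_lt (mul_le_of_le_one_left' hA.three.le) ?_
    refine lt_of_le_of_lt (mul_le_mul_right h5 _) ?_
    rw [← pow_succ']
    exact pow_lt_pow_right₀ hx (by norm_num)
  have hi : A.valuation ϖ * A.valuation x ≥ 1 := by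
    have := hA.le_uniformizer x⁻¹ (by rw [map_inv₀]; exact inv_lt_one_of_one_lt₀ hx)
    rw [map_inv₀] at this
    have := mul_le_mul_left this (A.valuation x)
    rwa [inv_mul_cancel₀ hx0.ne'] at this
  have hψ : A.valuation (3 * x ^ 4 - 6 * x ^ 2 - 1) ≤ A.valuation ϖ * A.valuation x ^ 4 := by
    have h3 := hA.le_uniformizer 3 hA.three
    have hb : A.valuation (3 * (x ^ 4 - 2 * x ^ 2)) ≤ A.valuation ϖ * A.valuation x ^ 4 := by
      rw [map_mul]
      refine (mul_le_mul_left h3 _).trans (mul_le_mul_right ?_ _)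
      refine (A.valuation.map_sub _ _).trans (max_le (by rw [map_pow]) ?_)
      rw [map_mul, map_pow]
      refine (mul_le_of_le_one_left' ?_).trans (pow_le_pow_right₀ hx.le (by norm_num))
      rw [A.valuation_le_one_iff]; exact ofNat_mem A 2
    have h1 : A.valuation 1 ≤ A.valuation ϖ * A.valuation x ^ 4 := by
      rw [map_one, pow_succ', ← mul_assoc]
      exact one_le_mul hi (one_le_pow₀ hx.le)
    rw [show 3 * x ^ 4 - 6 * x ^ 2 - 1 = 3 * (x ^ 4 - 2 * x ^ 2) - 1 by ring]
    exact (A.valuation.map_sub _ _).trans (max_le hb h1)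
  rw [hn, map_mul, map_pow] at key
  have h9 : A.valuation x ^ 8 * A.valuation x ≤
      A.valuation x ^ 8 * (A.valuation x' * A.valuation ϖ ^ 2) := by
    rw [← pow_succ, ← key]
    refine (mul_le_mul_right (pow_le_pow_left₀ zero_le hψ 2) _).trans (le_of_eq ?_)
    rw [mul_pow, ← pow_mul]
    ac_rfl
  refine (le_of_mul_le_mul_left h9 (pow_pos hx0 8)).trans (mul_le_mul_right ?_ _)
  exact pow_le_of_le_one zero_le hA.lt_one.le two_ne_zero

theorem eq_zero_of_three_divisible (hA : A.IsTernary ϖ) (S : Set (Ecurve L).Point)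
    (h2 : ∀ P ∈ S, ∃ R, P = R + R) (h3 : ∀ P ∈ S, ∃ Q ∈ S, P = Q + Q + Q)
    {P : (Ecurve L).Point} (hP : P ∈ S) : P = 0 := by
  have h1 : ∀ x y (h : y ^ 2 = x ^ 3 - x), mk h ∈ S → 1 < A.valuation x := by
    intro x y h hS
    obtain ⟨R, hR⟩ := h2 _ hS
    rcases eq_zero_or_mk R with rfl | ⟨x', y', h', rfl⟩
    · exact absurd (hR.trans (add_zero 0)) (mk_ne_zero h)
    · exact one_lt_valuation_of_add_self hA hR.symm
  refine eq_zero_of_contracting A.valuation _ hA.archimedean S h1 (fun x y h hS => ?_) hP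
  obtain ⟨Q, hQ, hQ3⟩ := h3 _ hS
  rcases eq_zero_or_mk Q with rfl | ⟨x', y', h', rfl⟩
  · exact absurd (hQ3.trans (by rw [add_zero, add_zero])) (mk_ne_zero h)
  · exact ⟨x', y', h', hQ, valuation_le_of_add_add hA (h1 _ _ _ hQ) hQ3.symm⟩

end Ecurve

end TernaryPlace

section BinaryPlace

namespace Ecurve

variable {F Γ : Type*} [Field F] [LinearOrderedCommGroupWithZero Γ] [NeZero (2 : F)]
  [DecidableEq F]

theorem one_lt_of_add_self_of_two (w : Valuation F Γ) (h2 : w 2 < 1)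
    (hle : ∀ x, w x < 1 → w x ≤ w 2) {x y x' y' : F} {h : y ^ 2 = x ^ 3 - x}
    {h' : y' ^ 2 = x' ^ 3 - x'} (hd : mk h + mk h = mk h') : 1 < w x' := by
  have key := congrArg w (four_mul_of_add_self hd)
  have h20 : 0 < w 2 := (Valuation.pos_iff _).2 two_ne_zero
  rw [map_mul, map_mul, map_pow, show (4 : F) = 2 ^ 2 by norm_num, map_pow] at key
  rcases lt_or_ge 1 (w x) with hx | hx
  · rw [valuation_cube_sub _ hx, valuation_sq_add_one _ hx] at key
    have h3 := pow_pos (zero_lt_one.trans hx) 3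
    have e : w x ^ 3 * (w 2 ^ 2 * w x') = w x ^ 3 * w x := by
      rw [← pow_succ, pow_mul _ 2 2, ← key]
      rw [mul_left_comm, mul_assoc]
    rw [mul_left_cancel_iff_of_pos h3] at e
    rw [← e] at hx
    exact hx.trans_le (mul_le_of_le_one_left' (pow_le_one₀ zero_le h2.le))
  · by_contra! hx'
    have hm := (w.map_sub x 1).trans (max_le hx (map_one w).le)
    have hp := (w.map_add x 1).trans (max_le hx (map_one w).le)
    have hc : x ^ 3 - x = x * ((x - 1) * (x + 1)) := by ring
    have hq : w 2 ^ 2 < w 2 := pow_lt_self_of_lt_one₀ h20 h2 one_lt_two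
    rcases hm.lt_or_eq with h1 | h1
    · have hm2 := hle _ h1
      have hp2 : w (x + 1) ≤ w 2 := by
        rw [show x + 1 = (x - 1) + 2 by ring]
        exact (w.map_add _ _).trans (max_le hm2 le_rfl)
      have hxx : w ((x - 1) * (x + 1)) ≤ w 2 ^ 2 := by
        rw [map_mul, sq]
        exact mul_le_mul' hm2 hp2
      have hu : w (x ^ 2 + 1) = w 2 := by
        rw [show x ^ 2 + 1 = (x - 1) * (x + 1) + 2 by ring,
          Valuation.map_add_eq_of_lt_right _ (hxx.trans_lt hq)]
      rw [hu, hc, map_mul] at key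
      have : w 2 ^ 2 * (w x * w ((x - 1) * (x + 1))) * w x' ≤ w 2 ^ 2 * w 2 ^ 2 := by
        refine (mul_le_of_le_one_right' hx').trans (mul_le_mul_right ?_ _)
        exact (mul_le_of_le_one_left' hx).trans hxx
      rw [key] at this
      have h4 : w 2 ^ 2 * w 2 ^ 2 < w 2 ^ 2 := by
        rw [← pow_add]
        exact pow_lt_pow_right_of_lt_one₀ h20 h2 (by norm_num)
      exact absurd this (not_le.2 h4)
    · have hp1 : w (x + 1) = 1 := by
        rw [show x + 1 = (x - 1) + 2 by ring,
          Valuation.map_add_eq_of_lt_left _ (by rwa [h1]), h1]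
      have hu : w (x ^ 2 + 1) = 1 := by
        rw [show x ^ 2 + 1 = (x + 1) ^ 2 - 2 * x by ring, Valuation.map_sub_eq_of_lt_left,
          map_pow, hp1, one_pow]
        rw [map_pow, hp1, one_pow, map_mul]
        exact mul_lt_one_of_nonneg_of_lt_one_left zero_le h2 hx
      rw [hu, one_pow, hc, map_mul, map_mul, h1, hp1, mul_one, mul_one] at key
      refine absurd key (ne_of_lt ?_)
      exact mul_lt_one_of_nonneg_of_lt_one_left zero_le
        (mul_lt_one_of_nonneg_of_lt_one_left zero_le (hq.trans h2) hx) hx'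

theorem eq_zero_of_two_divisible (w : Valuation F Γ) (h2 : w 2 < 1)
    (hle : ∀ x, w x < 1 → w x ≤ w 2) (harch : ∀ x, ∃ n : ℕ, w x * w 2 ^ n ≤ 1)
    (S : Set (Ecurve F).Point) (hS : ∀ P ∈ S, ∃ Q ∈ S, P = Q + Q) {P : (Ecurve F).Point}
    (hP : P ∈ S) : P = 0 := by
  have h1 : ∀ x y (h : y ^ 2 = x ^ 3 - x), mk h ∈ S → 1 < w x := by
    intro x y h hS'
    obtain ⟨R, -, hR⟩ := hS _ hS'
    rcases eq_zero_or_mk R with rfl | ⟨x', y', h', rfl⟩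
    · exact absurd (hR.trans (add_zero 0)) (mk_ne_zero h)
    · exact one_lt_of_add_self_of_two w h2 hle hR.symm
  refine eq_zero_of_contracting w _ harch S h1 (fun x y h hS' => ?_) hP
  obtain ⟨Q, hQ, hQ2⟩ := hS _ hS'
  rcases eq_zero_or_mk Q with rfl | ⟨x', y', h', rfl⟩
  · exact absurd (hQ2.trans (by rw [add_zero])) (mk_ne_zero h)
  refine ⟨x', y', h', hQ, ?_⟩
  have hx := h1 _ _ _ hQ
  have key := congrArg w (four_mul_of_add_self hQ2.symm)
  rw [map_mul, map_mul, map_pow, show (4 : F) = 2 ^ 2 by norm_num, map_pow,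
    valuation_cube_sub _ hx, valuation_sq_add_one _ hx] at key
  have h3 := pow_pos (zero_lt_one.trans hx) 3
  have e : w x' ^ 3 * (w 2 ^ 2 * w x) = w x' ^ 3 * w x' := by
    rw [← pow_succ, pow_mul _ 2 2, ← key]
    rw [mul_left_comm, mul_assoc]
  rw [mul_left_cancel_iff_of_pos h3] at e
  rw [← e, mul_comm]
  exact mul_le_mul_right (pow_le_of_le_one zero_le h2.le two_ne_zero) _

end Ecurve

end BinaryPlace

section Halving

namespace Ecurve

variable {F : Type*} [Field F] [NeZero (2 : F)] [DecidableEq F]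

theorem exists_add_self_eq {x y a b c : F} (h : y ^ 2 = x ^ 3 - x) (ha : x = a ^ 2)
    (hb : x - 1 = b ^ 2) (hc : x + 1 = c ^ 2) : ∃ Q, Q + Q = mk h := by
  wlog hy : y = a * b * c generalizing a
  · refine this (a := -a) (by rw [ha, neg_sq]) ?_
    have : (y - a * b * c) * (y + a * b * c) = 0 := by
      have e : a ^ 2 * b ^ 2 * c ^ 2 = x ^ 3 - x := by rw [← ha, ← hb, ← hc]; ring
      linear_combination h - e
    linear_combination (mul_eq_zero.1 this).resolve_left (sub_ne_zero.2 hy)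
  have h2 : (2 : F) ≠ 0 := two_ne_zero
  have hp : a + b ≠ 0 := fun h0 => one_ne_zero (α := F) (by
    linear_combination (a - b) * h0 + ha - hb)
  have hr : c + a ≠ 0 := fun h0 => one_ne_zero (α := F) (by
    linear_combination (c - a) * h0 + hc - ha)
  have hq : b + c ≠ 0 := fun h0 => h2 (by linear_combination (c - b) * h0 + hc - hb)
  have e1 : x + (a * b + b * c + c * a) = (a + b) * (c + a) := by rw [ha]; ring
  have e2 : x + (a * b + b * c + c * a) - 1 = (a + b) * (b + c) := by linear_combination hb
  have e3 : x + (a * b + b * c + c * a) + 1 = (b + c) * (c + a) := by linear_combination hc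
  generalize hX : x + (a * b + b * c + c * a) = X at e1 e2 e3
  have hQ : ((a + b) * (b + c) * (c + a)) ^ 2 = X ^ 3 - X := by
    rw [show X ^ 3 - X = X * (X - 1) * (X + 1) by ring, e3, e2, e1]; ring
  refine ⟨mk hQ, tangent hQ h (mul_ne_zero (mul_ne_zero hp hq) hr) (a + b + c) ?_ ?_ ?_⟩
  · rw [show 3 * X ^ 2 - 1 = X * (X - 1) + X * (X + 1) + (X - 1) * (X + 1) by ring, e3, e2, e1]
    ring
  · rw [← hX]; linear_combination ha + hb + hc
  · rw [hy, ← hX]; ring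

/-- Translation by a point of order two. -/
theorem exists_add_translate {x y e d : F} (h : y ^ 2 = x ^ 3 - x) (he : e ^ 3 = e)
    (hd : d * (x - e) = 3 * e ^ 2 - 1) (hx : x ≠ e) :
    ∃ t : (Ecurve F).Point, t + t = 0 ∧ ∃ y', ∃ h' : y' ^ 2 = (e + d) ^ 3 - (e + d),
      mk h + t = mk h' := by
  have ht : (0 : F) ^ 2 = e ^ 3 - e := by rw [he]; ring
  obtain ⟨l, hl⟩ : ∃ l, y - 0 = l * (x - e) :=
    ⟨(y - 0) / (x - e), (div_mul_cancel₀ _ (sub_ne_zero.2 hx)).symm⟩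
  have hs := sub_ne_zero.2 hx
  have hX : e + d = l ^ 2 - x - e := by
    apply mul_left_cancel₀ hs
    apply mul_left_cancel₀ hs
    linear_combination (x - e) * hd - h + (y + l * (x - e)) * hl - he
  refine ⟨mk ht, mk_add_self_eq_zero ht rfl, -(y + l * ((e + d) - x)), ?_, ?_⟩
  · have e3 : l * (y + 0) = x ^ 2 + x * e + e ^ 2 - 1 := by
      apply mul_left_cancel₀ hs
      linear_combination -(y + 0) * hl + h + he
    have hX' : l ^ 2 = (e + d) + x + e := by rw [hX]; ring
    generalize e + d = x₃ at *
    linear_combination h + (x₃ - x) * e3 + (x₃ - x) * l * hl + (x₃ - x) * (x₃ - e) * hX'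
  · exact chord h ht _ hx l hl hX rfl

end Ecurve

theorem even_of_sq_add_sq {R : Type*} [CommRing R] [IsDomain R] (h2 : Prime (2 : R)) {X Y : R}
    (h : 4 ∣ X ^ 2 + Y ^ 2) : 2 ∣ X ∧ 2 ∣ Y := by
  obtain ⟨k, hk⟩ := h
  have hs : (2 : R) ∣ X + Y := h2.dvd_of_dvd_pow (n := 2) ⟨2 * k + X * Y, by
    linear_combination hk⟩
  obtain ⟨m, hm⟩ := hs
  have hp : (2 : R) ∣ X * Y := ⟨m ^ 2 - k, by
    apply mul_left_cancel₀ h2.ne_zero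
    linear_combination (X + Y + 2 * m) * hm - hk⟩
  rcases h2.dvd_or_dvd hp with ⟨c, hc⟩ | ⟨c, hc⟩
  · exact ⟨⟨c, hc⟩, m - c, by linear_combination hm - hc⟩
  · exact ⟨⟨m - c, by linear_combination hm - hc⟩, c, hc⟩

theorem false_of_sq_add_sq {R : Type*} [CommRing R] [IsDomain R] (h2 : Prime (2 : R))
    {A B C D : R} (hAD : ¬ (2 ∣ A ∧ 2 ∣ D)) (h₁ : A ^ 2 + B ^ 2 = D ^ 2)
    (h₃ : A ^ 2 + D ^ 2 + C ^ 2 = 0) : False := by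
  have hn := h2.ne_zero
  have hD : ¬ 2 ∣ D := by
    rintro ⟨d, hd⟩
    have := even_of_sq_add_sq h2 (X := A) (Y := B) ⟨d ^ 2, by rw [h₁, hd]; ring⟩
    exact hAD ⟨this.1, d, hd⟩
  have hA : ¬ 2 ∣ A := by
    rintro ⟨a, ha⟩
    exact hD (even_of_sq_add_sq h2 (X := D) (Y := C) ⟨-a ^ 2, by
      linear_combination h₃ - (A + 2 * a) * ha⟩).1
  obtain ⟨e, he⟩ : (2 : R) ∣ A + B - D := h2.dvd_of_dvd_pow (n := 2)
    ⟨D ^ 2 + A * B - A * D - B * D, by linear_combination h₁⟩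
  have hAB : (2 : R) ∣ A * B := ⟨D * e + e ^ 2, by
    apply mul_left_cancel₀ hn
    linear_combination (A + B + D + 2 * e) * he - h₁⟩
  obtain ⟨b, hb⟩ := (h2.dvd_or_dvd hAB).resolve_left hA
  have hC : (2 : R) ∣ C := h2.dvd_of_dvd_pow (n := 2) ⟨2 * b ^ 2 - D ^ 2, by
    linear_combination h₃ - h₁ + (B + 2 * b) * hb⟩
  obtain ⟨c, hc⟩ := hC
  refine hD (h2.dvd_of_dvd_pow (n := 2) ⟨b ^ 2 - c ^ 2, ?_⟩)
  apply mul_left_cancel₀ hn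
  linear_combination h₃ - h₁ + (B + 2 * b) * hb - (C + 2 * c) * hc

theorem false_of_sq_add_two_mul_sq {R : Type*} [CommRing R] [IsDomain R] (h2 : Prime (2 : R))
    {A B C D : R} (hAD : ¬ (2 ∣ A ∧ 2 ∣ D)) (h₁ : A ^ 2 + 2 * B ^ 2 = D ^ 2)
    (h₃ : A ^ 2 + D ^ 2 + 2 * C ^ 2 = 0) : False := by
  have hn := h2.ne_zero
  obtain ⟨e, he⟩ : (2 : R) ∣ D - A := h2.dvd_of_dvd_pow (n := 2)
    ⟨A ^ 2 + B ^ 2 - A * D, by linear_combination -h₁⟩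
  obtain ⟨b, hb⟩ : (2 : R) ∣ B := h2.dvd_of_dvd_pow (n := 2) ⟨A * e + e ^ 2, by
    apply mul_left_cancel₀ hn
    linear_combination h₁ + (D + A + 2 * e) * he⟩
  have hA := (even_of_sq_add_sq h2 (X := A) (Y := C) ⟨-b ^ 2, by
    apply mul_left_cancel₀ hn
    linear_combination h₃ + h₁ - 2 * (B + 2 * b) * hb⟩).1
  obtain ⟨a, ha⟩ := hA
  exact hAD ⟨⟨a, ha⟩, a + e, by linear_combination he + ha⟩

end Halving

section SquareClasses

open IsDedekindDomain

variable {O F : Type*} [CommRing O] [IsDedekindDomain O] [Field F] [Algebra O F]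
  [IsFractionRing O F]

/-- The place defined by a prime element. -/
def HeightOneSpectrum.ofPrimeElement {π : O} (hπ : Prime π) : HeightOneSpectrum O where
  asIdeal := Ideal.span {π}
  isPrime := (Ideal.span_singleton_prime hπ.ne_zero).2 hπ
  ne_bot := by simpa using hπ.ne_zero

theorem HeightOneSpectrum.valuation_ofPrimeElement {π : O} (hπ : Prime π) :
    (ofPrimeElement hπ).valuation F (algebraMap O F π) = WithZero.exp (-1) := by
  rw [HeightOneSpectrum.valuation_of_algebraMap]
  exact HeightOneSpectrum.intValuation_singleton _ hπ.ne_zero rfl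

theorem HeightOneSpectrum.asIdeal_eq_span {v : HeightOneSpectrum O} {q : O} (hq : Prime q)
    (h : q ∈ v.asIdeal) : v.asIdeal = Ideal.span {q} := by
  refine (((ofPrimeElement hq).isMaximal.eq_of_le v.isPrime.ne_top ?_)).symm
  exact (Ideal.span_singleton_le_iff_mem _).2 h

theorem HeightOneSpectrum.eq_ofPrimeElement {v : HeightOneSpectrum O} {q : O} (hq : Prime q)
    (h : q ∈ v.asIdeal) : v = ofPrimeElement hq :=
  HeightOneSpectrum.ext (asIdeal_eq_span hq h)

theorem WithZero.le_exp_neg_one {g : WithZero (Multiplicative ℤ)} (h : g < 1) :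
    g ≤ WithZero.exp (-1) := by
  rcases eq_or_ne g 0 with rfl | h0
  · exact zero_le
  rw [← WithZero.exp_log h0, ← WithZero.exp_zero, WithZero.exp_lt_exp] at h
  rw [← WithZero.exp_log h0, WithZero.exp_le_exp]
  omega

theorem exists_eq_unit_mul_pow_mul_sq [IsPrincipalIdealRing O] {q : O} (hq : Prime q) (b : O)
    (hb : b ≠ 0)
    (h : ∀ v : HeightOneSpectrum O, q ∉ v.asIdeal → ∃ g, v.intValuation b = g ^ 2) :
    ∃ (ε : Oˣ) (n : ℕ) (s : O), b = ε * q ^ n * s ^ 2 := by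
  induction b using IsWellFounded.induction (DvdNotUnit (α := O)) with
  | _ b ih =>
    by_cases hu : IsUnit b
    · exact ⟨hu.unit, 0, 1, by simp⟩
    obtain ⟨π, hi, c, rfl⟩ := WfDvdMonoid.exists_irreducible_factor hu hb
    have hπ := hi.prime
    have hc : c ≠ 0 := right_ne_zero_of_mul hb
    by_cases hqπ : q ∈ Ideal.span {π}
    · obtain ⟨d, hd⟩ := Ideal.mem_span_singleton.1 hqπ
      obtain ⟨u, hu'⟩ : Associated q π := ((hi.associated_of_dvd hq.irreducible ⟨d, hd⟩)).symm
      obtain ⟨ε, n, s, hs⟩ := ih c ⟨hc, π, hi.not_isUnit, mul_comm _ _⟩ hc (fun v hv => by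
        obtain ⟨g, hg⟩ := h v hv
        refine ⟨g, ?_⟩
        rw [← hg, map_mul, (HeightOneSpectrum.intValuation_eq_one_iff (x := π)).2, one_mul]
        rw [← hu']
        intro hm
        rcases v.isPrime.mem_or_mem hm with hm | hm
        · exact hv hm
        · exact v.isPrime.ne_top (Ideal.eq_top_of_isUnit_mem _ hm u.isUnit))
      refine ⟨u * ε, n + 1, s, ?_⟩
      rw [hs, ← hu', Units.val_mul]
      ring
    · obtain ⟨g, hg⟩ := h (HeightOneSpectrum.ofPrimeElement hπ) hqπ
      have hv : (HeightOneSpectrum.ofPrimeElement hπ).intValuation π = WithZero.exp (-1) :=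
        HeightOneSpectrum.intValuation_singleton _ hπ.ne_zero rfl
      have hlt : g < 1 := by
        by_contra! hge
        have h1 : (HeightOneSpectrum.ofPrimeElement hπ).intValuation (π * c) < 1 := by
          rw [HeightOneSpectrum.intValuation_lt_one_iff_mem]
          exact Ideal.mem_span_singleton.2 (dvd_mul_right _ _)
        rw [hg] at h1
        exact absurd h1 (not_lt.2 (one_le_pow₀ hge))
      have hle := pow_le_pow_left₀ zero_le (WithZero.le_exp_neg_one hlt) 2
      rw [← hg, map_mul, hv, sq] at hle
      have hc1 := le_of_mul_le_mul_left hle (WithZero.exp_pos)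
      have hcm : (HeightOneSpectrum.ofPrimeElement hπ).intValuation c < 1 :=
        hc1.trans_lt (by rw [← WithZero.exp_zero, WithZero.exp_lt_exp]; norm_num)
      rw [HeightOneSpectrum.intValuation_lt_one_iff_mem] at hcm
      obtain ⟨d, rfl⟩ := Ideal.mem_span_singleton.1 hcm
      have hd : d ≠ 0 := right_ne_zero_of_mul hc
      have hsq : π * (π * d) = d * π ^ 2 := by ring
      obtain ⟨ε, n, s, hs⟩ := ih d ⟨hd, π ^ 2, by
          rw [isUnit_pow_iff two_ne_zero]; exact hi.not_isUnit, hsq⟩ hd (fun v hv => by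
        obtain ⟨g, hg⟩ := h v hv
        have h0 := v.intValuation_ne_zero π hπ.ne_zero
        refine ⟨g / v.intValuation π, ?_⟩
        rw [div_pow, ← hg, hsq, map_mul, map_pow, mul_div_cancel_right₀ _ (pow_ne_zero 2 h0)])
      refine ⟨ε, n, π * s, ?_⟩
      rw [hs]
      ring

theorem exists_eq_mul_sq_of_valuation [IsPrincipalIdealRing O] {q : O} (hq : Prime q)
    (hunit : ∀ ε : Oˣ, ∃ z : O, (ε : O) = z ^ 2 ∨ (ε : O) = -z ^ 2) {a : F} (ha : a ≠ 0)
    (h : ∀ v : HeightOneSpectrum O, q ∉ v.asIdeal → ∃ g, v.valuation F a = g ^ 2) :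
    ∃ s : F, a = s ^ 2 ∨ a = -s ^ 2 ∨ a = algebraMap O F q * s ^ 2 ∨
      a = -(algebraMap O F q * s ^ 2) := by
  obtain ⟨m, d, hd, rfl⟩ := IsFractionRing.div_surjective (A := O) a
  have hd0 : d ≠ 0 := nonZeroDivisors.ne_zero hd
  have hdF : algebraMap O F d ≠ 0 := by simpa using hd0
  have hm0 : m ≠ 0 := by rintro rfl; simp at ha
  obtain ⟨ε, n, s, hs⟩ := exists_eq_unit_mul_pow_mul_sq hq (m * d) (mul_ne_zero hm0 hd0)
    (fun v hv => by
      obtain ⟨g, hg⟩ := h v hv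
      refine ⟨g * v.intValuation d, ?_⟩
      have e : ∀ r : O, v.valuation F (algebraMap O F r) = v.intValuation r :=
        v.valuation_of_algebraMap
      rw [mul_pow, ← hg, ← e, ← e, ← map_pow, ← map_mul, map_mul (algebraMap O F)]
      congr 1
      field_simp)
  obtain ⟨z, hz⟩ := hunit ε
  have hsF := congrArg (algebraMap O F) hs
  simp only [map_mul, map_pow] at hsF
  have key : algebraMap O F m / algebraMap O F d =
      algebraMap O F ε * algebraMap O F q ^ n * (algebraMap O F s / algebraMap O F d) ^ 2 := by
    rw [div_pow, ← mul_div_assoc, ← hsF]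
    field_simp
  obtain ⟨k, rfl | rfl⟩ := n.even_or_odd'
  · refine ⟨algebraMap O F z * algebraMap O F q ^ k * (algebraMap O F s / algebraMap O F d), ?_⟩
    rcases hz with hz | hz <;> rw [hz] at key <;> simp only [map_neg, map_pow] at key
    · left; rw [key]; ring
    · right; left; rw [key]; ring
  · refine ⟨algebraMap O F z * algebraMap O F q ^ k * (algebraMap O F s / algebraMap O F d), ?_⟩
    rcases hz with hz | hz <;> rw [hz] at key <;> simp only [map_neg, map_pow] at key
    · right; right; left; rw [key]; ring
    · right; right; right; rw [key]; ring

theorem sq_valuation_mul {Γ : Type*} [LinearOrderedCommGroupWithZero Γ] (w : Valuation F Γ)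
    {x y : F} (h : y ^ 2 = x ^ 3 - x) : w y ^ 2 = w x * w (x - 1) * w (x + 1) := by
  rw [← map_pow, h, ← map_mul, ← map_mul]
  congr 1
  ring

theorem valuation_eq_sq_of_one_lt {Γ : Type*} [LinearOrderedCommGroupWithZero Γ]
    (w : Valuation F Γ) {x y : F} (h : y ^ 2 = x ^ 3 - x) (hx : 1 < w x) :
    w x = (w y / w x) ^ 2 := by
  rw [div_pow, sq_valuation_mul w h, Valuation.map_add_eq_of_lt_left _ (by rwa [map_one]),
    Valuation.map_sub_eq_of_lt_left _ (by rwa [map_one])]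
  have h0 := (zero_lt_one.trans hx).ne'
  field_simp

/-- The abscissa of a point has even order at every place. -/
theorem exists_sq_valuation {Γ : Type*} [LinearOrderedCommGroupWithZero Γ] (w : Valuation F Γ)
    {x y : F} (h : y ^ 2 = x ^ 3 - x) : ∃ g, w x = g ^ 2 := by
  rcases lt_trichotomy 1 (w x) with hx | hx | hx
  · exact ⟨_, valuation_eq_sq_of_one_lt w h hx⟩
  · exact ⟨1, by rw [← hx, one_pow]⟩
  · refine ⟨w y, ?_⟩
    rw [sq_valuation_mul w h, Valuation.map_add_eq_of_lt_right _ (by rwa [map_one]),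
      Valuation.map_sub_eq_of_lt_right _ (by rwa [map_one]), map_one, mul_one, mul_one]

/-- At a place not dividing `2`, the number `x + 1` has even order. -/
theorem exists_sq_valuation_add_one {Γ : Type*} [LinearOrderedCommGroupWithZero Γ]
    (w : Valuation F Γ) (h2 : w 2 = 1) {x y : F} (h : y ^ 2 = x ^ 3 - x) :
    ∃ g, w (x + 1) = g ^ 2 := by
  rcases lt_or_ge 1 (w x) with hx | hx
  · exact ⟨_, (Valuation.map_add_eq_of_lt_left _ (by rwa [map_one])).trans
      (valuation_eq_sq_of_one_lt w h hx)⟩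
  rcases ((w.map_add x 1).trans (max_le hx (map_one w).le)).lt_or_eq with h3 | h3
  · refine ⟨w y, ?_⟩
    rw [sq_valuation_mul w h, show x = (x + 1) - 1 by ring,
      Valuation.map_sub_eq_of_lt_right _ (by rwa [map_one]),
      show x + 1 - 1 - 1 = (x + 1) - 2 by ring,
      Valuation.map_sub_eq_of_lt_right _ (by rwa [h2]), h2, map_one, one_mul, one_mul,
      sub_add_cancel]
  · exact ⟨1, by rw [h3, one_pow]⟩

end SquareClasses

section TwoDescent

open IsDedekindDomain

theorem WithZero.exp_neg_one_ne_sq (g : WithZero (Multiplicative ℤ)) :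
    WithZero.exp (-1 : ℤ) ≠ g ^ 2 := by
  intro h
  have h0 : g ≠ 0 := by
    rintro rfl
    rw [zero_pow two_ne_zero] at h
    exact WithZero.exp_ne_zero h
  have := congrArg WithZero.log h
  rw [WithZero.log_exp, WithZero.log_pow] at this
  simp at this
  omega

theorem WithZero.exists_mul_exp_neg_one_pow_le (g : WithZero (Multiplicative ℤ)) :
    ∃ n : ℕ, g * WithZero.exp (-1 : ℤ) ^ n ≤ 1 := by
  rcases eq_or_ne g 0 with rfl | h0
  · exact ⟨0, by simp⟩
  refine ⟨(WithZero.log g).toNat, ?_⟩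
  rw [← WithZero.exp_log h0, ← WithZero.exp_nsmul, ← WithZero.exp_add, ← WithZero.exp_zero,
    WithZero.exp_le_exp, WithZero.log_exp]
  simp

variable {O F : Type*} [CommRing O] [IsDedekindDomain O] [Field F]
  [Algebra O F] [IsFractionRing O F]

theorem exists_algebraMap_eq_of_mul_sq (h2 : Prime (2 : O)) {γ : O} (hγ : γ = 1 ∨ γ = 2)
    {z : F} {c : O} (h : algebraMap O F γ * z ^ 2 = algebraMap O F c) :
    ∃ b : O, algebraMap O F b = z := by
  rcases hγ with rfl | rfl
  · rw [map_one, one_mul] at h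
    exact IsIntegrallyClosed.exists_algebraMap_eq_of_isIntegral_pow two_pos
      (h ▸ isIntegral_algebraMap)
  · have h20 : algebraMap O F 2 ≠ 0 := by simpa using h2.ne_zero
    obtain ⟨b, hb⟩ := IsIntegrallyClosed.exists_algebraMap_eq_of_isIntegral_pow (R := O)
      (x := algebraMap O F 2 * z) two_pos (by
        rw [show (algebraMap O F 2 * z) ^ 2 = algebraMap O F (2 * c) by
          rw [map_mul, ← h]; ring]
        exact isIntegral_algebraMap)
    have hb2 : b ^ 2 = 2 * c := by
      apply IsFractionRing.injective O F
      rw [map_pow, hb, map_mul, ← h]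
      ring
    obtain ⟨d, rfl⟩ := h2.dvd_of_dvd_pow (Dvd.intro _ hb2.symm)
    exact ⟨d, mul_left_cancel₀ h20 (by rw [← hb, map_mul])⟩

variable [IsPrincipalIdealRing O]

theorem false_of_sq_add_mul_sq (h2 : Prime (2 : O)) {γ : O} (hγ : γ = 1 ∨ γ = 2) {s t u : F}
    (h₁ : s ^ 2 + algebraMap O F γ * t ^ 2 = 1) (h₃ : s ^ 2 + 1 + algebraMap O F γ * u ^ 2 = 0) :
    False := by
  obtain ⟨A, ⟨D, hD⟩, hrel, hs⟩ := IsFractionRing.exists_reduced_fraction (A := O) s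
  rw [IsFractionRing.mk'_eq_div] at hs
  simp only at hs hrel
  have hD0 : algebraMap O F D ≠ 0 := by simpa using nonZeroDivisors.ne_zero hD
  have hA : algebraMap O F A = s * algebraMap O F D := by rw [← hs, div_mul_cancel₀ _ hD0]
  obtain ⟨B, hB⟩ := exists_algebraMap_eq_of_mul_sq (z := t * algebraMap O F D)
    (c := D ^ 2 - A ^ 2) h2 hγ (by
      rw [map_sub, map_pow, map_pow, hA]
      linear_combination (algebraMap O F D ^ 2) * h₁)
  obtain ⟨C, hC⟩ := exists_algebraMap_eq_of_mul_sq (z := u * algebraMap O F D)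
    (c := -D ^ 2 - A ^ 2) h2 hγ (by
      rw [map_sub, map_neg, map_pow, map_pow, hA]
      linear_combination (algebraMap O F D ^ 2) * h₃)
  have hAD : ¬ ((2 : O) ∣ A ∧ 2 ∣ D) := fun h => h2.not_isUnit (hrel h.1 h.2)
  have e₁ : A ^ 2 + γ * B ^ 2 = D ^ 2 := by
    apply IsFractionRing.injective O F
    simp only [map_add, map_mul, map_pow, hA, hB]
    linear_combination (algebraMap O F D ^ 2) * h₁
  have e₃ : A ^ 2 + D ^ 2 + γ * C ^ 2 = 0 := by
    apply IsFractionRing.injective O F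
    simp only [map_add, map_mul, map_pow, hA, hC, map_zero]
    linear_combination (algebraMap O F D ^ 2) * h₃
  rcases hγ with rfl | rfl
  · rw [one_mul] at e₁ e₃
    exact false_of_sq_add_sq h2 hAD e₁ e₃
  · exact false_of_sq_add_two_mul_sq h2 hAD e₁ e₃

namespace Ecurve

theorem exists_sub_one_eq {K : Type*} [Field K] {x y g s u c : K}
    (h : x * ((x - 1) * (x + 1)) = y ^ 2) (hg : g ≠ 0) (hs : s ≠ 0) (hu : u ≠ 0)
    (hx : x = c * s ^ 2) (hc : c ≠ 0) (hx1 : x + 1 = -(g * u ^ 2)) :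
    ∃ t, x - 1 = -(c * (g * t ^ 2)) := by
  refine ⟨y / (c * g * s * u), ?_⟩
  have hne : c * s ^ 2 * (g * u ^ 2) ≠ 0 :=
    mul_ne_zero (mul_ne_zero hc (pow_ne_zero 2 hs)) (mul_ne_zero hg (pow_ne_zero 2 hu))
  rw [hx1] at h
  nth_rewrite 1 [hx] at h
  rw [show c * (g * (y / (c * g * s * u)) ^ 2) = y ^ 2 / (c * s ^ 2 * (g * u ^ 2)) by
    field_simp, eq_comm, neg_eq_iff_eq_neg, div_eq_iff hne]
  linear_combination -h

variable [CharZero F]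

theorem abscissa_classes (h2 : Prime (2 : O))
    (hunit : ∀ ε : Oˣ, ∃ z : O, (ε : O) = z ^ 2 ∨ (ε : O) = -z ^ 2) {x y : F}
    (h : y ^ 2 = x ^ 3 - x) (hy : y ≠ 0) :
    (∃ s, x = s ^ 2 ∨ x = -s ^ 2) ∧ ∃ u, x + 1 = u ^ 2 ∨ x + 1 = 2 * u ^ 2 := by
  have hxy : x * ((x - 1) * (x + 1)) = y ^ 2 := by rw [h]; ring
  have hx0 : x ≠ 0 := by rintro rfl; exact hy (by simpa using h)
  have hx1 : x + 1 ≠ 0 := by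
    intro h0; rw [h0] at hxy; exact hy (by simpa using hxy.symm)
  have h2F : algebraMap O F 2 = 2 := map_ofNat _ 2
  have hv2 : ∀ v : HeightOneSpectrum O, 2 ∉ v.asIdeal → v.valuation F (2 : F) = 1 := by
    intro v hv
    rw [← h2F]
    exact v.valuation_eq_one_iff_notMem.2 hv
  have hw := HeightOneSpectrum.valuation_ofPrimeElement (F := F) h2
  have hno : ∀ s : F, x ≠ 0 → (HeightOneSpectrum.ofPrimeElement h2).valuation F x ≠
      (HeightOneSpectrum.ofPrimeElement h2).valuation F (algebraMap O F 2 * s ^ 2) := by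
    intro s _ he
    obtain ⟨g, hg⟩ := exists_sq_valuation ((HeightOneSpectrum.ofPrimeElement h2).valuation F) h
    have hx' := (Valuation.ne_zero_iff ((HeightOneSpectrum.ofPrimeElement h2).valuation F)).2 hx0
    rw [he, map_mul, hw, map_pow] at hg hx'
    have hs := right_ne_zero_of_mul hx'
    refine WithZero.exp_neg_one_ne_sq
      (g / (HeightOneSpectrum.ofPrimeElement h2).valuation F s) ?_
    rw [div_pow, ← hg, mul_div_cancel_right₀ _ hs]
  obtain ⟨s, hs⟩ := exists_eq_mul_sq_of_valuation h2 hunit hx0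
    (fun v _ => exists_sq_valuation _ h)
  obtain ⟨u, hu⟩ := exists_eq_mul_sq_of_valuation h2 hunit hx1
    (fun v hv => exists_sq_valuation_add_one _ (hv2 v hv) h)
  have hs' : x = s ^ 2 ∨ x = -s ^ 2 := by
    rcases hs with hs | hs | hs | hs
    · exact Or.inl hs
    · exact Or.inr hs
    · exact absurd (congrArg _ hs) (hno s hx0)
    · exact absurd ((congrArg _ hs).trans (Valuation.map_neg _ _)) (hno s hx0)
  have hs0 : s ≠ 0 := by
    rintro rfl
    exact hx0 (by simpa using hs')
  have hneg : ∀ γ : O, γ = 1 ∨ γ = 2 → x + 1 ≠ -(algebraMap O F γ * u ^ 2) := by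
    intro γ hγ he
    have hγ0 : algebraMap O F γ ≠ 0 := by
      rcases hγ with rfl | rfl
      · simp
      · simpa using h2.ne_zero
    have hu0 : u ≠ 0 := by
      rintro rfl
      exact hx1 (by simpa using he)
    rcases hs' with hs | hs
    · obtain ⟨t, ht⟩ := exists_sub_one_eq (c := 1) hxy hγ0 hs0 hu0 (by rw [hs, one_mul])
        one_ne_zero he
      exact false_of_sq_add_mul_sq (F := F) (s := s) (t := t) (u := u) h2 hγ
        (by linear_combination ht - hs) (by linear_combination he - hs)
    · obtain ⟨t, ht⟩ := exists_sub_one_eq (c := -1) hxy hγ0 hs0 hu0 (by rw [hs, neg_one_mul])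
        (neg_ne_zero.2 one_ne_zero) he
      refine false_of_sq_add_mul_sq (F := F) (s := s⁻¹) (t := u / s) (u := t / s) h2 hγ ?_ ?_
      · field_simp
        linear_combination he - hs
      · field_simp
        linear_combination hs - ht
  refine ⟨⟨s, hs'⟩, u, ?_⟩
  rcases hu with hu | hu | hu | hu
  · exact Or.inl hu
  · exact absurd hu (by simpa using hneg 1 (Or.inl rfl))
  · exact Or.inr (by rw [hu, h2F])
  · exact absurd hu (hneg 2 (Or.inr rfl))

variable [DecidableEq F]

theorem exists_add_add_self (h2 : Prime (2 : O))
    (hunit : ∀ ε : Oˣ, ∃ z : O, (ε : O) = z ^ 2 ∨ (ε : O) = -z ^ 2) (R : (Ecurve F).Point) :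
    ∃ Q, R + R = (Q + Q) + (Q + Q) := by
  suffices ∃ t, t + t = 0 ∧ ∃ Q, Q + Q = R + t by
    obtain ⟨t, ht, Q, hQ⟩ := this
    exact ⟨Q, by rw [hQ, add_add_add_comm, ht, add_zero]⟩
  rcases eq_zero_or_mk R with rfl | ⟨x, y, h, rfl⟩
  · exact ⟨0, add_zero _, 0, rfl⟩
  rcases eq_or_ne y 0 with hy | hy
  · exact ⟨mk h, mk_add_self_eq_zero h hy, 0, by rw [mk_add_self_eq_zero h hy, add_zero]⟩
  obtain ⟨⟨s, hs⟩, u, hu⟩ := abscissa_classes h2 hunit h hy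
  have hxy : x * ((x - 1) * (x + 1)) = y ^ 2 := by rw [h]; ring
  have hy2 := pow_ne_zero 2 hy
  rw [← hxy] at hy2
  have hx0 : x ≠ 0 := left_ne_zero_of_mul hy2
  have hxm : x - 1 ≠ 0 := left_ne_zero_of_mul (right_ne_zero_of_mul hy2)
  have hxp : x + 1 ≠ 0 := right_ne_zero_of_mul (right_ne_zero_of_mul hy2)
  have hs0 : s ≠ 0 := by rintro rfl; exact hx0 (by simpa using hs)
  have hu0 : u ≠ 0 := by rintro rfl; exact hxp (by simpa using hu)
  have h20 : (2 : F) ≠ 0 := two_ne_zero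
  rcases hs with hs | hs <;> rcases hu with hu | hu
  · obtain ⟨Q, hQ⟩ := exists_add_self_eq h hs (b := y / (s * u)) (by
      rw [div_pow, mul_pow, ← hs, ← hu, ← hxy]; field_simp) hu
    exact ⟨0, add_zero _, Q, by rw [hQ, add_zero]⟩
  · obtain ⟨t, ht, y', h', e⟩ := exists_add_translate (e := 1) (d := 2 / (x - 1)) h (by norm_num)
      (by field_simp; norm_num) (sub_ne_zero.1 hxm)
    obtain ⟨Q, hQ⟩ := exists_add_self_eq h' (a := 2 * s * u ^ 2 / y) (b := 2 * s * u / y)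
      (c := 2 * s ^ 2 * u / y) (by
        rw [div_pow, ← hxy, show (2 * s * u ^ 2) ^ 2 = x * (x + 1) ^ 2 by rw [hu, hs]; ring]
        field_simp; ring) (by
        rw [div_pow, ← hxy, show (2 * s * u) ^ 2 = 2 * x * (x + 1) by rw [hu, hs]; ring]
        field_simp; ring) (by
        rw [div_pow, ← hxy, show (2 * s ^ 2 * u) ^ 2 = 2 * x ^ 2 * (x + 1) by rw [hu, hs]; ring]
        field_simp; ring)
    exact ⟨t, ht, Q, by rw [hQ, e]⟩
  · obtain ⟨t, ht, y', h', e⟩ := exists_add_translate (e := 0) (d := -1 / x) h (by norm_num)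
      (by field_simp; norm_num) hx0
    obtain ⟨Q, hQ⟩ := exists_add_self_eq h' (a := 1 / s) (b := u / s)
      (c := y / (s ^ 2 * u)) (by
        rw [div_pow, show s ^ 2 = -x by rw [hs, neg_neg]]; field_simp; ring) (by
        rw [div_pow, ← hu, show s ^ 2 = -x by rw [hs, neg_neg]]; field_simp; ring) (by
        rw [div_pow, ← hxy, mul_pow, ← hu, show s ^ 2 = -x by rw [hs, neg_neg]]
        field_simp; ring)
    exact ⟨t, ht, Q, by rw [hQ, e]⟩
  · obtain ⟨t, ht, y', h', e⟩ := exists_add_translate (e := -1) (d := 2 / (x + 1)) h (by norm_num)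
      (by rw [sub_neg_eq_add, div_mul_cancel₀ _ hxp]; norm_num)
      (fun h0 => hxp (by rw [h0]; norm_num))
    obtain ⟨Q, hQ⟩ := exists_add_self_eq h' (a := y / (2 * s * u ^ 2)) (b := s / u)
      (c := 1 / u) (by
        rw [div_pow, ← hxy, show (2 * s * u ^ 2) ^ 2 = -x * (x + 1) ^ 2 by rw [hu, hs]; ring]
        field_simp; ring) (by
        rw [hu, div_pow]; field_simp; linear_combination hu - hs) (by
        rw [hu, div_pow]; field_simp; ring)
    exact ⟨t, ht, Q, by rw [hQ, e]⟩

theorem add_self_eq_zero_of_prime_two (h2 : Prime (2 : O))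
    (hunit : ∀ ε : Oˣ, ∃ z : O, (ε : O) = z ^ 2 ∨ (ε : O) = -z ^ 2) (P : (Ecurve F).Point) :
    P + P = 0 := by
  have hw := HeightOneSpectrum.valuation_ofPrimeElement (F := F) h2
  rw [show algebraMap O F 2 = 2 from map_ofNat _ 2] at hw
  have hlt : WithZero.exp (-1 : ℤ) < 1 := by
    rw [← WithZero.exp_zero, WithZero.exp_lt_exp]; norm_num
  refine eq_zero_of_two_divisible ((HeightOneSpectrum.ofPrimeElement h2).valuation F)
    (hw ▸ hlt) (fun x hx => hw ▸ WithZero.le_exp_neg_one hx)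
    (fun x => hw ▸ WithZero.exists_mul_exp_neg_one_pow_le _) {P | ∃ R, P = R + R} ?_ ⟨P, rfl⟩
  rintro _ ⟨R, rfl⟩
  obtain ⟨Q, hQ⟩ := exists_add_add_self h2 hunit R
  exact ⟨Q + Q, ⟨Q, rfl⟩, hQ⟩

end Ecurve

end TwoDescent

section TernaryInstances

open IsDedekindDomain

variable {O F L : Type*} [CommRing O] [IsDedekindDomain O] [Field F] [Algebra O F]
  [IsFractionRing O F] [Field L] [Algebra F L] {K : CubicKummer F L} {A : ValuationSubring L}
  {v : HeightOneSpectrum O} {ϖ : L}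

theorem WithZero.exp_neg_one_lt_one : WithZero.exp (-1 : ℤ) < 1 := by
  rw [← WithZero.exp_zero, WithZero.exp_lt_exp]; norm_num

theorem CubicKummer.IsWild.isTernary (h : K.IsWild A v ϖ) : A.IsTernary ϖ where
  lt_one := h.valuation_lt_one
  le_uniformizer _ hx := h.le_uniformizer hx
  three := h.three.trans_lt (pow_lt_one₀ zero_le h.valuation_lt_one (by norm_num))
  residue := h.residue
  archimedean x := by
    rcases eq_or_ne x 0 with rfl | hx
    · exact ⟨0, by simp⟩
    obtain ⟨n, hn⟩ := h.exists_zpow hx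
    refine ⟨n.natAbs, ?_⟩
    rw [hn, ← zpow_natCast, ← zpow_add₀ h.valuation_pos.ne', ← zpow_zero (A.valuation ϖ),
      h.zpow_le_zpow_iff]
    omega

namespace CubicKummer

theorem valuation_three (K : CubicKummer F L) (hl : v.valuation F (1 - K.ω) = WithZero.exp (-1)) :
    v.valuation F 3 = WithZero.exp (-1) ^ 2 := by
  have h3 : (3 : F) = -K.ω ^ 2 * (1 - K.ω) ^ 2 := by
    linear_combination (3 - 3 * K.ω + K.ω ^ 2) * K.hω
  have hω : v.valuation F K.ω ^ 3 = 1 := by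
    rw [← map_pow, ← map_one (v.valuation F)]
    congr 1
    linear_combination (K.ω - 1) * K.hω
  rw [h3, map_mul, Valuation.map_neg, map_pow, map_pow, hl,
    (pow_eq_one_iff_of_nonneg zero_le three_ne_zero).1 hω, one_pow, one_mul]

theorem isTernary_of_cube_near [CharZero F] (K : CubicKummer F L) (hA : A.IsAbove v F)
    (hl : v.valuation F (1 - K.ω) = WithZero.exp (-1))
    (hres : ∀ a : F, v.valuation F a ≤ 1 →
      v.valuation F a < 1 ∨ v.valuation F (a - 1) < 1 ∨ v.valuation F (a + 1) < 1) {q t : F}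
    (ht : v.valuation F t = 1) (hp : v.valuation F K.p = 1) (hq : v.valuation F q < 1)
    (h₁ : v.valuation F ((t ^ 3 - K.p) / 3) ≤ v.valuation F q)
    (h₂ : v.valuation F ((t ^ 3 - K.p) ^ 2 / 27) ≤ v.valuation F q) :
    A.IsTernary (algebraMap F L (1 - K.ω)) := by
  have hθ := K.valuation_θ_eq_one hA hp
  have hl1 : v.valuation F (1 - K.ω) < 1 := hl ▸ WithZero.exp_neg_one_lt_one
  have hlA : A.valuation (algebraMap F L (1 - K.ω)) < 1 := hA.valuation_lt_one_iff.2 hl1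
  have hl0 : algebraMap F L (1 - K.ω) ≠ 0 := by
    rw [Ne, map_eq_zero]
    intro h0
    rw [h0, map_zero] at hl
    exact WithZero.exp_ne_zero hl.symm
  have dense := K.dense_of_approx hθ.le
    (K.approx_of_cube_near hA (exists_cube_le three_ne_zero ht hp.le hq h₁ h₂) hθ)
  have near : ∀ x : L, ∃ a : F, A.valuation (x - algebraMap F L a) ≤
      A.valuation (algebraMap F L (1 - K.ω)) := fun x => dense x _ hl0
  have shift : ∀ (x : L) (a : F), A.valuation (x - algebraMap F L a) ≤
      A.valuation (algebraMap F L (1 - K.ω)) → v.valuation F a < 1 → A.valuation x < 1 := by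
    intro x a hx ha
    rw [← sub_add_cancel x (algebraMap F L a)]
    exact A.valuation.map_add_lt (hx.trans_lt hlA) (hA.valuation_lt_one_iff.2 ha)
  refine ⟨hlA, fun x hx => ?_, ?_, fun x hx => ?_, fun x => ?_⟩
  · obtain ⟨a, ha⟩ := near x
    have ha1 : v.valuation F a < 1 := by
      rw [← hA.valuation_lt_one_iff, ← sub_sub_cancel x (algebraMap F L a)]
      exact (A.valuation.map_sub _ _).trans_lt (max_lt hx (ha.trans_lt hlA))
    rw [← sub_add_cancel x (algebraMap F L a)]
    exact A.valuation.map_add_le ha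
      (hA.valuation_le_iff.2 (hl ▸ WithZero.le_exp_neg_one ha1))
  · rw [← map_ofNat (algebraMap F L), hA.valuation_lt_one_iff, K.valuation_three hl]
    exact pow_lt_one₀ zero_le WithZero.exp_neg_one_lt_one two_ne_zero
  · obtain ⟨a, ha⟩ := near x
    have ha1 : v.valuation F a ≤ 1 := by
      rw [← hA.valuation_le_one_iff, ← sub_sub_cancel x (algebraMap F L a)]
      exact (A.valuation.map_sub _ _).trans (max_le hx (ha.trans hlA.le))
    rcases hres a ha1 with h | h | h
    · exact Or.inl (shift x a ha h)
    · refine Or.inr (Or.inl (shift (x - 1) (a - 1) ?_ h))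
      rwa [map_sub (algebraMap F L), map_one, sub_sub_sub_cancel_right]
    · refine Or.inr (Or.inr (shift (x + 1) (a + 1) ?_ h))
      rwa [map_add (algebraMap F L), map_one, add_sub_add_right_eq_sub]
  · obtain ⟨d, hd0, hd⟩ := K.exists_valuation_le hθ.le x
    obtain ⟨n, hn⟩ := WithZero.exists_mul_exp_neg_one_pow_le (v.valuation F d)
    refine ⟨n, (mul_le_mul_left hd _).trans ?_⟩
    rw [← map_pow, ← map_mul, ← map_pow, ← map_mul, hA.valuation_le_one_iff, map_mul, map_pow, hl]
    exact hn

end CubicKummer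

end TernaryInstances

section CyclicDescent

theorem three_divisible_of_cyclic {E : Type*} [AddCommGroup E] (σ : E →+ E)
    (hσ : ∀ P, σ (σ (σ P)) = P) (hfix : ∀ P, σ P = P → P + P = 0)
    (h : ∀ P, P + σ P + σ (σ P) = 0 → ∃ Q, Q - σ Q = P + P) {P : E}
    (hP : P + σ P + σ (σ P) = 0) : ∃ Q, Q + σ Q + σ (σ Q) = 0 ∧ P = Q + Q + Q := by
  have step : ∀ P, P + σ P + σ (σ P) = 0 → ∃ Q, Q + σ Q + σ (σ Q) = 0 ∧ Q - σ Q = P := by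
    intro P hP
    obtain ⟨Q, hQ⟩ := h P hP
    obtain ⟨t, ht⟩ : ∃ t, Q + σ Q + σ (σ Q) = t := ⟨_, rfl⟩
    have hσt : σ t = t := by rw [← ht, map_add, map_add, hσ]; abel
    have h2t := hfix t hσt
    have hσP : σ (σ P) = -P - σ P := by rw [← sub_eq_zero, ← hP]; abel
    have hσQ : σ (σ Q) = t - Q - σ Q := by rw [← ht]; abel
    refine ⟨P + σ P + P - (Q - t), ?_, ?_⟩
    · have e : P + σ P + P - (Q - t) + σ (P + σ P + P - (Q - t)) +
          σ (σ (P + σ P + P - (Q - t))) = t + t := by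
        simp only [map_add, map_sub, map_neg, hσP, hσt, hσQ]; abel
      rw [e, h2t]
    · have e : P + σ P + P - (Q - t) - σ (P + σ P + P - (Q - t)) =
          P + (P + P - (Q - σ Q)) := by
        simp only [map_add, map_sub, hσP, hσt]; abel
      rw [e, hQ, sub_self, add_zero]
  obtain ⟨B, hB, rfl⟩ := step P hP
  obtain ⟨C, hC, rfl⟩ := step B hB
  refine ⟨-σ C, ?_, ?_⟩
  · rw [map_neg, map_neg, ← neg_add, ← neg_add, ← map_add, ← map_add, hC, map_zero, neg_zero]
  · rw [map_sub, show σ (σ C) = -C - σ C by rw [← sub_eq_zero, ← hC]; abel]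
    abel

namespace CubicKummer

variable {F L : Type*} [Field F] [Field L] [Algebra F L] (K : CubicKummer F L)
  [NeZero (2 : L)] [DecidableEq L]

theorem exists_conjugateTriple (hfix : ∀ P : (Ecurve L).Point,
    Ecurve.map (K.σ : L →+* L) P = P → P + P = 0) {x y : L} (h : y ^ 2 = x ^ 3 - x)
    (htr : Ecurve.mk h + Ecurve.map (K.σ : L →+* L) (Ecurve.mk h) +
      Ecurve.map (K.σ : L →+* L) (Ecurve.map (K.σ : L →+* L) (Ecurve.mk h)) = 0) :
    ∃ T : ConjugateTriple K, T.x₁ = x ∧ T.y₁ = y := by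
  have hσh : ∀ {x y : L}, y ^ 2 = x ^ 3 - x → (K.σ y) ^ 2 = (K.σ x) ^ 3 - K.σ x := fun h => by
    rw [← map_pow, h, map_sub K.σ, map_pow]
  have htr' : Ecurve.mk h + Ecurve.mk (hσh h) + Ecurve.mk (hσh (hσh h)) = 0 := htr
  have hne : ¬ (K.σ x = x ∧ K.σ y = y) := by
    intro hxy
    have he : Ecurve.map (K.σ : L →+* L) (Ecurve.mk h) = Ecurve.mk h :=
      (Ecurve.mk_inj (hσh h) h).2 hxy
    rw [he, he, hfix _ he, zero_add] at htr
    exact Ecurve.mk_ne_zero h htr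
  have hx : x ≠ K.σ x := by
    intro hx
    have hy : (y - K.σ y) * (y + K.σ y) = 0 := by
      have := hσh h
      rw [← hx] at this
      linear_combination h - this
    rcases mul_eq_zero.1 hy with hy | hy
    · exact hne ⟨hx.symm, (sub_eq_zero.1 hy).symm⟩
    · have h1 : K.σ y = -y := by linear_combination hy
      have h2 := K.σ_cube y
      rw [h1, map_neg, h1, neg_neg, h1] at h2
      exact hne ⟨hx.symm, h1.trans h2⟩
  have hinj : ∀ {a b : L}, a ≠ b → K.σ a ≠ K.σ b := fun hab he => hab (K.σ.injective he)
  have hx' := hinj hx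
  have hx'' := hinj hx'
  rw [K.σ_cube] at hx''
  obtain ⟨l, hl⟩ : ∃ l, y - K.σ y = l * (x - K.σ x) :=
    ⟨_, (div_mul_cancel₀ _ (sub_ne_zero.2 hx)).symm⟩
  have hsum : K.σ (K.σ x) = l ^ 2 - x - K.σ x ∧
      K.σ (K.σ y) = y + l * (K.σ (K.σ x) - x) := by
    obtain ⟨X, hX⟩ : ∃ X, X = l ^ 2 - x - K.σ x := ⟨_, rfl⟩
    have h3 : (-(y + l * (X - x))) ^ 2 = X ^ 3 - X := by
      have e3 : l * (y + K.σ y) = x ^ 2 + x * K.σ x + K.σ x ^ 2 - 1 := by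
        apply mul_left_cancel₀ (sub_ne_zero.2 hx)
        linear_combination -(y + K.σ y) * hl + h - hσh h
      have hl2 : l ^ 2 = X + x + K.σ x := by rw [hX]; ring
      linear_combination h + (X - x) * e3 + (X - x) * l * hl + (X - x) * (X - K.σ x) * hl2
    have hc := Ecurve.chord h (hσh h) h3 hx l hl hX rfl
    rw [hc, add_eq_zero_iff_eq_neg, Ecurve.neg_mk, Ecurve.mk_inj] at htr'
    obtain ⟨e₁, e₂⟩ := htr'
    rw [← e₁]
    exact ⟨hX, by linear_combination e₂⟩
  obtain ⟨hsx, hsy⟩ := hsum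
  have hσl : K.σ l = l := by
    have := congrArg K.σ hl
    rw [map_mul, map_sub K.σ, map_sub K.σ] at this
    apply mul_right_cancel₀ (sub_ne_zero.2 hx')
    rw [← this]
    linear_combination -hl - hsy
  have hpair : x * K.σ x + x * K.σ (K.σ x) + K.σ x * K.σ (K.σ x) =
      -1 - 2 * l * (y - l * x) := by
    apply mul_left_cancel₀ (sub_ne_zero.2 hx)
    rw [hsx]
    linear_combination h - hσh h - (K.σ y + y - l * (x - K.σ x)) * hl
  refine ⟨⟨⟨x, K.σ x, K.σ (K.σ x), l, y - l * x, by rw [hsx]; ring, hpair, ?_, hx, hx''.symm, hx'⟩,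
    rfl, rfl, K.σ_cube x, hσl, ?_⟩, rfl, ?_⟩
  · have hs : x + K.σ x + K.σ (K.σ x) = l ^ 2 := by rw [hsx]; ring
    linear_combination x * hpair - h - x ^ 2 * hs
  · rw [map_sub K.σ, map_mul, hσl]
    linear_combination -hl
  · change l * x + (y - l * x) = y
    ring

variable [CharZero F] [DecidableEq F]

theorem exists_map_of_fixed {P : (Ecurve L).Point}
    (hP : Ecurve.map (K.σ : L →+* L) P = P) : ∃ Q, Ecurve.map (algebraMap F L) Q = P := by
  rcases Ecurve.eq_zero_or_mk P with rfl | ⟨x, y, h, rfl⟩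
  · exact ⟨0, map_zero _⟩
  rw [Ecurve.map_mk, Ecurve.mk_inj] at hP
  obtain ⟨x, rfl⟩ := K.exists_of_fixed hP.1
  obtain ⟨y, rfl⟩ := K.exists_of_fixed hP.2
  have h' : y ^ 2 = x ^ 3 - x := by
    apply (algebraMap F L).injective
    rw [map_pow, h, map_sub, map_pow]
  exact ⟨Ecurve.mk h', Ecurve.map_mk _ h'⟩

theorem six_nsmul_eq_zero {A : ValuationSubring L} {ϖ : L} (hA : A.IsTernary ϖ)
    (hF : ∀ P : (Ecurve F).Point, P + P = 0)
    (h : ∀ T : ConjugateTriple K, 1 < A.valuation T.x₁ → ∃ m : Fin 3 → F, m ≠ 0 ∧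
      T.form (T.coord.mulVec fun i => algebraMap F L (m i)) = 0) (P : (Ecurve L).Point) :
    6 • P = 0 := by
  obtain ⟨σ, hσ⟩ : ∃ σ, σ = Ecurve.map (K.σ : L →+* L) := ⟨_, rfl⟩
  have hσ3 : ∀ P, σ (σ (σ P)) = P := fun P => by
    rw [hσ, Ecurve.map_map, Ecurve.map_map]
    exact Ecurve.map_id _ K.σ_cube P
  have hfix : ∀ P, σ P = P → P + P = 0 := fun P hP => by
    rw [hσ] at hP
    obtain ⟨Q, rfl⟩ := K.exists_map_of_fixed hP
    rw [← map_add, hF, map_zero]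
  have hdesc : ∀ P, P + σ P + σ (σ P) = 0 → ∃ Q, Q - σ Q = P + P := fun P hP => by
    rcases Ecurve.eq_zero_or_mk (P + P) with h0 | ⟨x, y, hxy, h0⟩
    · exact ⟨0, by rw [h0, map_zero, sub_zero]⟩
    rcases Ecurve.eq_zero_or_mk P with rfl | ⟨x', y', hxy', rfl⟩
    · exact absurd (h0.symm.trans (add_zero 0)) (Ecurve.mk_ne_zero hxy)
    have hval := Ecurve.one_lt_valuation_of_add_self hA h0
    have htr : Ecurve.mk hxy + σ (Ecurve.mk hxy) + σ (σ (Ecurve.mk hxy)) = 0 := by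
      rw [← h0, map_add, map_add, ← add_zero (0 : (Ecurve L).Point), ← hP]
      abel
    rw [hσ] at htr
    obtain ⟨T, rfl, rfl⟩ := K.exists_conjugateTriple (hσ ▸ hfix) hxy htr
    obtain ⟨m, hm, hform⟩ := h T hval
    rw [h0, hσ]
    exact T.exists_sub_eq hm hform
  have hzero : ∀ P, P + σ P + σ (σ P) = 0 → P + P = 0 := by
    intro P hP
    refine Ecurve.eq_zero_of_three_divisible hA
      {R | ∃ P, P + σ P + σ (σ P) = 0 ∧ R = P + P} ?_ ?_ ⟨P, hP, rfl⟩
    · rintro _ ⟨P, -, rfl⟩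
      exact ⟨P, rfl⟩
    · rintro _ ⟨P, hP, rfl⟩
      obtain ⟨Q, hQ, rfl⟩ := three_divisible_of_cyclic σ hσ3 hfix hdesc hP
      exact ⟨Q + Q, ⟨Q, hQ, rfl⟩, by abel⟩
  have htr := hfix (P + σ P + σ (σ P)) (by rw [map_add, map_add, hσ3]; abel)
  have h1 := hzero (P + P + P - (P + σ P + σ (σ P))) (by
    simp only [map_add, map_sub, hσ3]; abel)
  rw [show 6 • P = (P + P + P - (P + σ P + σ (σ P))) + (P + P + P - (P + σ P + σ (σ P))) +
    ((P + σ P + σ (σ P)) + (P + σ P + σ (σ P))) by abel, h1, htr, zero_add]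

end CubicKummer

end CyclicDescent

section Eisenstein

variable {O : Type*} [CommRing O] [CharZero O] {η : O}

theorem eisenstein_intCast_add_mul_eq_zero (hη : η ^ 2 + η + 1 = 0) {m n : ℤ}
    (h : (m + n * η : O) = 0) : m = 0 ∧ n = 0 := by
  have h1 : ((m * m - m * n + n * n : ℤ) : O) = 0 := by
    push_cast
    linear_combination (m - n - n * η : O) * h + (n : O) ^ 2 * hη
  have h2 : m * m - m * n + n * n = 0 := Int.cast_eq_zero.1 h1
  have hm : 3 * (m * m) + (m - 2 * n) * (m - 2 * n) = 0 := by linear_combination 4 * h2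
  have hn : 3 * (n * n) + (n - 2 * m) * (n - 2 * m) = 0 := by linear_combination 4 * h2
  constructor
  · exact mul_self_eq_zero.1 (by linarith [mul_self_nonneg m, mul_self_nonneg (m - 2 * n)])
  · exact mul_self_eq_zero.1 (by linarith [mul_self_nonneg n, mul_self_nonneg (n - 2 * m)])

theorem eisenstein_two_dvd_iff (hη : η ^ 2 + η + 1 = 0)
    (hspan : ∀ x : O, ∃ m n : ℤ, x = m + n * η) {m n : ℤ} :
    (2 : O) ∣ m + n * η ↔ Even m ∧ Even n := by
  constructor
  · rintro ⟨x, hx⟩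
    obtain ⟨a, b, rfl⟩ := hspan x
    have h := eisenstein_intCast_add_mul_eq_zero hη (m := m - 2 * a) (n := n - 2 * b)
      (by push_cast; linear_combination hx)
    exact ⟨⟨a, by linarith [h.1]⟩, ⟨b, by linarith [h.2]⟩⟩
  · rintro ⟨⟨a, rfl⟩, ⟨b, rfl⟩⟩
    exact ⟨a + b * η, by push_cast; ring⟩

theorem eisenstein_prime_two [IsDomain O] (hη : η ^ 2 + η + 1 = 0)
    (hspan : ∀ x : O, ∃ m n : ℤ, x = m + n * η) : Prime (2 : O) := by
  have h2 := @eisenstein_two_dvd_iff O _ _ η hη hspan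
  refine ⟨two_ne_zero, fun h => ?_, fun x y h => ?_⟩
  · have := h2 (m := 1) (n := 0) |>.1 (h.dvd)
    simp at this
  · obtain ⟨a, b, rfl⟩ := hspan x
    obtain ⟨c, d, rfl⟩ := hspan y
    have h' : (2 : O) ∣ ((a * c - b * d : ℤ) : O) + ((a * d + b * c - b * d : ℤ) : O) * η := by
      convert h using 1
      push_cast
      linear_combination -(b * d : O) * hη
    rw [h2] at h' ⊢
    rw [h2]
    simp only [Int.even_sub, Int.even_add, Int.even_mul] at h'
    tauto

/-- A rational prime `p ≠ 3` is unramified in the Eisenstein integers. -/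
theorem eisenstein_dvd_pow_sub (hη : η ^ 2 + η + 1 = 0)
    (hspan : ∀ x : O, ∃ m n : ℤ, x = m + n * η) {p : ℕ} (hp : p.Prime) (hp3 : p ≠ 3) (x : O) :
    (p : O) ∣ x ^ p ^ 2 - x := by
  obtain ⟨m, n, rfl⟩ := hspan x
  have hint : ∀ m : ℤ, (p : O) ∣ (m : O) ^ p ^ 2 - m := fun m => by
    have : Fact p.Prime := ⟨hp⟩
    have h : (p : ℤ) ∣ m ^ p ^ 2 - m := by
      rw [← ZMod.intCast_zmod_eq_zero_iff_dvd]
      push_cast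
      rw [ZMod.pow_card_pow, sub_self]
    obtain ⟨k, hk⟩ := h
    exact ⟨k, by exact_mod_cast congrArg (Int.cast : ℤ → O) hk⟩
  have hη3 : η ^ 3 = 1 := by linear_combination (η - 1) * hη
  have hηp : η ^ p ^ 2 = η := by
    have h1 : p ^ 2 % 3 = 1 := by
      have : p % 3 ≠ 0 := fun h =>
        hp3 ((Nat.prime_dvd_prime_iff_eq Nat.prime_three hp).1 (Nat.dvd_of_mod_eq_zero h)).symm
      rw [Nat.pow_mod]
      have : p % 3 < 3 := Nat.mod_lt _ (by norm_num)
      interval_cases p % 3 <;> simp_all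
    rw [← Nat.div_add_mod (p ^ 2) 3, h1, pow_add, pow_mul, hη3, one_pow, one_mul, pow_one]
  obtain ⟨r, hr⟩ := exists_add_pow_prime_pow_eq hp (m : O) (n * η) 2
  obtain ⟨s, hs⟩ := hint m
  obtain ⟨t, ht⟩ := hint n
  refine ⟨s + t * η + m * (n * η) * r, ?_⟩
  rw [hr, mul_pow, hηp]
  linear_combination hs + η * ht

end Eisenstein

section EisensteinPlaces

open IsDedekindDomain

variable {O F L : Type*} [CommRing O] [IsDedekindDomain O] [Field F] [Algebra O F]
  [IsFractionRing O F] [Field L] [Algebra F L] {K : CubicKummer F L}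
  {A : ValuationSubring L} {v : HeightOneSpectrum O}

theorem valuation_intCast_le_one (v : HeightOneSpectrum O) (m : ℤ) :
    v.valuation F (m : F) ≤ 1 := by
  rw [← map_intCast (algebraMap O F) m]
  exact v.valuation_le_one _

theorem valuation_natCast_le_one (v : HeightOneSpectrum O) (m : ℕ) :
    v.valuation F (m : F) ≤ 1 := by
  rw [← map_natCast (algebraMap O F) m]
  exact v.valuation_le_one _

/-- An integer dividing `x ^ q - x` for all `x` is at most exactly divisible by any prime. -/
theorem valuation_natCast_eq_exp_neg_one {p q : ℕ} (hq : 2 ≤ q)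
    (h : ∀ x : O, (p : O) ∣ x ^ q - x) (hv : v.valuation F (p : F) < 1) :
    v.valuation F (p : F) = WithZero.exp (-1) := by
  refine le_antisymm (WithZero.le_exp_neg_one hv) ?_
  obtain ⟨π, hπ⟩ := v.intValuation_exists_uniformizer
  obtain ⟨k, hk⟩ := h π
  have e : ∀ r : O, v.valuation F (algebraMap O F r) = v.intValuation r := v.valuation_of_algebraMap
  have hlt : v.valuation F (algebraMap O F π ^ q) < v.valuation F (algebraMap O F π) := by
    rw [map_pow, e, hπ]
    exact pow_lt_self_of_lt_one₀ WithZero.exp_pos WithZero.exp_neg_one_lt_one (by omega)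
  have h1 : v.valuation F (algebraMap O F π ^ q - algebraMap O F π) = WithZero.exp (-1) := by
    rw [Valuation.map_sub_eq_of_lt_right _ hlt, e, hπ]
  rw [← map_pow, ← map_sub, hk, map_mul, map_natCast, map_mul] at h1
  rw [← h1]
  exact mul_le_of_le_one_right zero_le (v.valuation_le_one _)

theorem exists_int_add_mul_near {η : O} (hspan : ∀ x : O, ∃ m n : ℤ, x = m + n * η)
    {ω : F} (hω : algebraMap O F η = ω) (v : HeightOneSpectrum O) (a : F)
    (ha : v.valuation F a ≤ 1) : ∃ m n : ℤ, v.valuation F (a - (m + n * ω)) < 1 := by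
  obtain ⟨z, hz⟩ := v.exists_valuation_sub_lt_of_integer ha 1
  obtain ⟨m, n, rfl⟩ := hspan z
  refine ⟨m, n, ?_⟩
  rw [Valuation.map_sub_swap]
  simpa [hω] using hz

theorem near_zero_or_one_or_neg_one {η : O} (hspan : ∀ x : O, ∃ m n : ℤ, x = m + n * η)
    {ω : F} (hω : algebraMap O F η = ω) (h3 : v.valuation F 3 < 1)
    (hl : v.valuation F (1 - ω) < 1) (a : F) (ha : v.valuation F a ≤ 1) :
    v.valuation F a < 1 ∨ v.valuation F (a - 1) < 1 ∨ v.valuation F (a + 1) < 1 := by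
  obtain ⟨m, n, h⟩ := exists_int_add_mul_near hspan hω v a ha
  have key : ∀ r k : ℤ, m + n = r + 3 * k → v.valuation F (a - r) < 1 := fun r k e => by
    have e' : (m + n : F) = r + 3 * k := by exact_mod_cast congrArg (Int.cast : ℤ → F) e
    rw [show a - r = (a - (m + n * ω)) + (3 * k - n * (1 - ω)) by linear_combination e']
    refine Valuation.map_add_lt _ h (Valuation.map_sub_lt _ ?_ ?_)
    · rw [map_mul]
      exact (mul_le_of_le_one_right zero_le (valuation_intCast_le_one v k)).trans_lt h3
    · rw [map_mul]
      exact (mul_le_of_le_one_left zero_le (valuation_intCast_le_one v n)).trans_lt hl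
  have hmod := Int.emod_add_mul_ediv (m + n) 3
  have : (m + n) % 3 = 0 ∨ (m + n) % 3 = 1 ∨ (m + n) % 3 = 2 := by omega
  rcases this with h | h | h
  · exact .inl (by simpa using key 0 ((m + n) / 3) (by omega))
  · exact .inr (.inl (by simpa using key 1 ((m + n) / 3) (by omega)))
  · exact .inr (.inr (by simpa using key (-1) ((m + n) / 3 + 1) (by omega)))

theorem CubicKummer.exists_isTernary [CharZero F] (hA : A.IsAbove v F)
    (hl : v.valuation F (1 - K.ω) = WithZero.exp (-1))
    (hres : ∀ a : F, v.valuation F a ≤ 1 →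
      v.valuation F a < 1 ∨ v.valuation F (a - 1) < 1 ∨ v.valuation F (a + 1) < 1)
    {p : ℕ} (hp : p.Prime) (hp3 : p ≠ 3) (hK : K.p = p) :
    ∃ ϖ, A.IsTernary ϖ ∧ ∀ T : ConjugateTriple K, 1 < A.valuation T.x₁ → T.LocalCondition A := by
  have h3 : v.valuation F 3 < 1 := by
    rw [K.valuation_three hl]
    exact pow_lt_one₀ zero_le WithZero.exp_neg_one_lt_one two_ne_zero
  have h3' : v.valuation F ((3 : ℕ) : F) < 1 := by exact_mod_cast h3
  have hc : Nat.Coprime p 3 := (Nat.coprime_primes hp Nat.prime_three).2 hp3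
  have hvp : v.valuation F K.p = 1 := by rw [hK]; exact valuation_natCast_eq_one h3' hc
  have near : ∀ t : F, v.valuation F t = 1 → (∃ k : ℤ, t ^ 3 - K.p = 9 * k) →
      ∃ ϖ, A.IsTernary ϖ ∧
        ∀ T : ConjugateTriple K, 1 < A.valuation T.x₁ → T.LocalCondition A := by
    rintro t ht ⟨k, hk⟩
    have h₁ : v.valuation F ((t ^ 3 - K.p) / 3) ≤ v.valuation F 3 := by
      rw [hk, show (9 * k / 3 : F) = 3 * k by ring, map_mul]
      exact mul_le_of_le_one_right zero_le (valuation_intCast_le_one v k)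
    have h₂ : v.valuation F ((t ^ 3 - K.p) ^ 2 / 27) ≤ v.valuation F 3 := by
      rw [hk, show ((9 * k) ^ 2 / 27 : F) = 3 * (k ^ 2 : ℤ) by push_cast; ring, map_mul]
      exact mul_le_of_le_one_right zero_le (valuation_intCast_le_one v _)
    exact ⟨_, K.isTernary_of_cube_near hA hl hres ht hvp h3 h₁ h₂,
      fun T _ => T.localCondition_of_cube_near hA ht hvp h3 h₁ h₂⟩
  have hm : p % 9 = 1 ∨ p % 9 = 8 ∨ ∃ m, p ^ 2 = 1 + 3 * m ∧ Nat.Coprime m 3 := by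
    have h0 : p % 3 ≠ 0 := fun h =>
      hp3 ((Nat.prime_dvd_prime_iff_eq Nat.prime_three hp).1 (Nat.dvd_of_mod_eq_zero h)).symm
    have hlt : p % 9 < 9 := Nat.mod_lt _ (by norm_num)
    have hsq : p ^ 2 % 9 = (p % 9) ^ 2 % 9 := Nat.pow_mod _ _ _
    have : p % 9 % 3 = p % 3 := Nat.mod_mod_of_dvd _ (by norm_num)
    have hcop : ∀ m, m % 3 ≠ 0 → Nat.Coprime m 3 := fun m h =>
      ((Nat.prime_three.coprime_iff_not_dvd).2 fun hd => h (Nat.mod_eq_zero_of_dvd hd)).symm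
    generalize hr : p % 9 = r at *
    interval_cases r
    all_goals first
      | omega
      | exact .inr (.inr ⟨(p ^ 2 - 1) / 3, by omega, hcop _ (by omega)⟩)
  rcases hm with h | h | ⟨m, hm, hmc⟩
  · obtain ⟨k, rfl⟩ : ∃ k, p = 1 + 9 * k := ⟨p / 9, by omega⟩
    exact near 1 (map_one _) ⟨-k, by rw [hK]; push_cast; ring⟩
  · obtain ⟨k, rfl⟩ : ∃ k, p = 8 + 9 * k := ⟨p / 9, by omega⟩
    exact near (-1) (by rw [Valuation.map_neg, map_one]) ⟨-(k + 1), by rw [hK]; push_cast; ring⟩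
  · obtain ⟨ϖ, hw⟩ := K.exists_isWild hA hl hvp (by
      have e : (p : F) ^ 2 - 1 = 3 * m := by
        have : ((p ^ 2 : ℕ) : F) = (1 + 3 * m : ℕ) := by rw [hm]
        push_cast at this
        linear_combination this
      rw [hK, e, map_mul, valuation_natCast_eq_one h3' hmc, mul_one]) hres
    exact ⟨ϖ, hw.isTernary, fun T hT => T.localCondition_of_wild hw hT⟩

theorem ConjugateTriple.localCondition_of_two [CharZero F] (T : ConjugateTriple K)
    (hA : A.IsAbove v F) (h2 : v.valuation F 2 < 1) {p : ℕ} (hp : p.Prime) (hp2 : p ≠ 2)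
    (hK : K.p = p) : T.LocalCondition A := by
  have h2' : v.valuation F ((2 : ℕ) : F) < 1 := by exact_mod_cast h2
  have h3 : v.valuation F 3 = 1 := by
    exact_mod_cast valuation_natCast_eq_one (n := 3) h2' (by norm_num)
  have hvp : v.valuation F K.p = 1 := by
    rw [hK]; exact valuation_natCast_eq_one h2' ((Nat.coprime_primes hp Nat.prime_two).2 hp2)
  have hle : v.valuation F (1 ^ 3 - K.p) ≤ v.valuation F 2 := by
    obtain ⟨k, rfl⟩ := hp.odd_of_ne_two hp2
    rw [hK, show (1 ^ 3 - (2 * k + 1 : ℕ) : F) = 2 * (-k : ℤ) by push_cast; ring, map_mul]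
    exact mul_le_of_le_one_right zero_le (valuation_intCast_le_one v _)
  have h27 : v.valuation F 27 = 1 := by
    rw [show (27 : F) = 3 ^ 3 by norm_num, map_pow, h3, one_pow]
  refine T.localCondition_of_cube_near hA (map_one _) hvp h2 ?_ ?_
  · rwa [map_div₀, h3, div_one]
  · rw [map_div₀, h27, div_one,
      map_pow, pow_two]
    exact (mul_le_of_le_one_right zero_le (hle.trans h2.le)).trans hle

theorem ConjugateTriple.localCondition_of_unramified [CharZero F] (T : ConjugateTriple K)
    (hA : A.IsAbove v F) (h2 : v.valuation F 2 = 1) (h3 : v.valuation F 3 = 1)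
    (hp : v.valuation F K.p = 1) : T.LocalCondition A := by
  by_cases ht : ∃ t : F, v.valuation F (t ^ 3 - K.p) < 1
  · obtain ⟨t, ht⟩ := ht
    obtain ⟨q, hq⟩ := v.valuation_exists_uniformizer F
    have ht1 : v.valuation F t = 1 := by
      have h : v.valuation F (t ^ 3) = 1 := by
        rw [show t ^ 3 = (t ^ 3 - K.p) + K.p by ring,
          Valuation.map_add_eq_of_lt_right _ (by rwa [hp]), hp]
      rwa [map_pow, pow_eq_one_iff_of_nonneg zero_le three_ne_zero] at h
    have hle : v.valuation F (t ^ 3 - K.p) ≤ v.valuation F q := by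
      rw [hq]; exact WithZero.le_exp_neg_one ht
    have hq1 : v.valuation F q < 1 := by rw [hq]; exact WithZero.exp_neg_one_lt_one
    have h27 : v.valuation F 27 = 1 := by
      rw [show (27 : F) = 3 ^ 3 by norm_num, map_pow, h3, one_pow]
    refine T.localCondition_of_cube_near hA ht1 hp hq1 ?_ ?_
    · rwa [map_div₀, h3, div_one]
    · rw [map_div₀, h27, div_one,
        map_pow, pow_two]
      exact (mul_le_of_le_one_right zero_le ht.le).trans hle
  · push Not at ht
    refine T.localCondition_of_not_cube ?_ ?_ (K.valuation_θ_eq_one hA hp) fun t => ?_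
    · rw [← map_ofNat (algebraMap F L) 2]
      exact hA.valuation_eq_one_iff.2 h2
    · rw [← map_ofNat (algebraMap F L) 3]
      exact hA.valuation_eq_one_iff.2 h3
    · rw [hA.valuation_lt_one_iff, not_lt]
      exact ht t

end EisensteinPlaces

section EisensteinDescent

open IsDedekindDomain

variable {O F L : Type*} [CommRing O] [IsDedekindDomain O] [Field F] [CharZero F] [Algebra O F]
  [IsFractionRing O F] [Field L] [Algebra F L] {K : CubicKummer F L} {η : O} {p : ℕ}

theorem ConjugateTriple.exists_localCondition (T : ConjugateTriple K)
    (hη : algebraMap O F η = K.ω) (hspan : ∀ x : O, ∃ m n : ℤ, x = m + n * η)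
    (hp : p.Prime) (hp2 : p ≠ 2) (hp3 : p ≠ 3) (hP : ConditionP p hp) (hK : K.p = p)
    (v : HeightOneSpectrum O) (h3 : v.valuation F 3 = 1) :
    ∃ A : ValuationSubring L, A.IsAbove v F ∧ T.LocalCondition A := by
  have hη' : η ^ 2 + η + 1 = 0 := by
    apply FaithfulSMul.algebraMap_injective O F
    simpa [hη] using K.hω
  have : CharZero O := (algebraMap O F).charZero
  obtain ⟨A, hA⟩ := exists_isAbove F L v
  refine ⟨A, hA, ?_⟩
  have hle : v.valuation F (2 : F) ≤ 1 := by exact_mod_cast valuation_natCast_le_one v 2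
  rcases hle.lt_or_eq with h2 | h2
  · exact T.localCondition_of_two hA h2 hp hp2 hK
  rcases (valuation_natCast_le_one (F := F) v p).lt_or_eq with hv | hv
  · have hr := K.isRamified_θ hA (hK ▸ valuation_natCast_eq_exp_neg_one
      (by nlinarith [hp.two_le]) (eisenstein_dvd_pow_sub hη' hspan hp hp3) hv)
    refine T.localCondition_of_tame hr ?_ ?_ (T.one_lt_valuation_x₁ hr hp hp2 hp3 hP hv
      (exists_int_add_mul_near hspan hη v))
    · rw [← map_ofNat (algebraMap F L) 2]
      exact hA.valuation_eq_one_iff.2 h2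
    · rw [← map_ofNat (algebraMap F L) 3]
      exact hA.valuation_eq_one_iff.2 h3
  · exact T.localCondition_of_unramified hA h2 h3 (hK ▸ hv)

theorem CubicKummer.six_nsmul_eq_zero_of_conditionP [IsPrincipalIdealRing O] [NeZero (2 : L)]
    [DecidableEq L] [DecidableEq F] (K : CubicKummer F L)
    (hη : algebraMap O F η = K.ω) (hspan : ∀ x : O, ∃ m n : ℤ, x = m + n * η)
    (hunit : ∀ ε : Oˣ, ∃ z : O, (ε : O) = z ^ 2 ∨ (ε : O) = -z ^ 2) (hl : Prime (1 - η))
    (hp : p.Prime) (hp2 : p ≠ 2) (hp3 : p ≠ 3) (hP : ConditionP p hp) (hK : K.p = p)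
    (ι : L →+* ℂ) (P : (Ecurve L).Point) : 6 • P = 0 := by
  have hη' : η ^ 2 + η + 1 = 0 := by
    apply FaithfulSMul.algebraMap_injective O F
    simpa [hη] using K.hω
  have : CharZero O := (algebraMap O F).charZero
  have h3 : (3 : O) = (1 - η) * (2 + η) := by linear_combination hη'
  obtain ⟨v₃, hv₃⟩ : ∃ v, v = HeightOneSpectrum.ofPrimeElement hl := ⟨_, rfl⟩
  have hl₃ : v₃.valuation F (1 - K.ω) = WithZero.exp (-1) := by
    rw [← hη, ← map_one (algebraMap O F), ← map_sub, hv₃]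
    exact HeightOneSpectrum.valuation_ofPrimeElement hl
  have h3₃ : v₃.valuation F 3 < 1 := by
    rw [K.valuation_three hl₃]
    exact pow_lt_one₀ zero_le WithZero.exp_neg_one_lt_one two_ne_zero
  obtain ⟨A, hA⟩ := exists_isAbove F L v₃
  obtain ⟨ϖ, hϖ, hloc⟩ := K.exists_isTernary hA hl₃ (near_zero_or_one_or_neg_one hspan hη h3₃
    (hl₃.trans_lt WithZero.exp_neg_one_lt_one)) hp hp3 hK
  refine K.six_nsmul_eq_zero hϖ (Ecurve.add_self_eq_zero_of_prime_two
    (eisenstein_prime_two hη' hspan) hunit) (fun T hT => T.exists_zero (O := O) ι ?_ ?_) P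
  · intro z
    constructor
    · rintro ⟨a, rfl⟩
      obtain ⟨m, n, rfl⟩ := hspan a
      exact ⟨m, n, by simp [hη]⟩
    · rintro ⟨m, n, rfl⟩
      exact ⟨m + n * η, by simp [hη]⟩
  · intro v
    rcases (show v.valuation F (3 : F) ≤ 1 by
      exact_mod_cast valuation_natCast_le_one v 3).lt_or_eq with h | h
    · have hmem : (1 - η) * (2 + η) ∈ v.asIdeal := by
        rw [← h3]
        have h' : v.valuation F (algebraMap O F 3) < 1 := by rwa [map_ofNat]
        exact (v.valuation_lt_one_iff_mem (K := F) _).1 h'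
      have hv : v = v₃ := by
        rcases v.isPrime.mem_or_mem hmem with h' | h'
        · rw [hv₃]
          exact HeightOneSpectrum.eq_ofPrimeElement hl h'
        · rw [hv₃]
          refine HeightOneSpectrum.eq_ofPrimeElement hl ?_
          have := v.asIdeal.mul_mem_left (-η) h'
          rwa [show -η * (2 + η) = 1 - η by linear_combination -hη'] at this
      exact ⟨A, hv ▸ hA, hloc T hT⟩
    · exact T.exists_localCondition hη hspan hp hp2 hp3 hP hK v h

end EisensteinDescent

section CubicAdjoin

open Polynomial IsDedekindDomain

theorem CubicKummer.exists_adjoinRoot {F : Type*} [Field F] {ω p : F} (hω : ω ^ 2 + ω + 1 = 0)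
    [Fact (Irreducible (X ^ 3 - C p))] : ∃ K : CubicKummer F (AdjoinRoot (X ^ 3 - C p)),
      K.ω = ω ∧ K.p = p ∧ K.θ = AdjoinRoot.root _ := by
  have hω3 : ω ^ 3 = 1 := by linear_combination (ω - 1) * hω
  have hdeg : (X ^ 3 - C p).natDegree = 3 := natDegree_X_pow_sub_C
  have hne : X ^ 3 - C p ≠ 0 := X_pow_sub_C_ne_zero (by norm_num) p
  have hdim : (AdjoinRoot.powerBasis hne).dim = 3 := by
    rw [AdjoinRoot.powerBasis_dim, hdeg]
  let b := (AdjoinRoot.powerBasis hne).basis.reindex (finCongr hdim)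
  have hb : ∀ i : Fin 3, b i = AdjoinRoot.root (X ^ 3 - C p) ^ (i : ℕ) := fun i => by
    simp [b, PowerBasis.coe_basis]
  have hsum : ∀ a : Fin 3 → F, ∑ i, a i • b i = algebraMap F _ (a 0) +
      algebraMap F _ (a 1) * AdjoinRoot.root (X ^ 3 - C p) +
      algebraMap F _ (a 2) * AdjoinRoot.root (X ^ 3 - C p) ^ 2 := fun a => by
    simp [Fin.sum_univ_three, hb, Algebra.smul_def]
  refine ⟨{
    σ := autAdjoinRootXPowSubC 3 p (rootsOfUnity.mkOfPowEq ω hω3)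
    ω := ω
    p := p
    θ := AdjoinRoot.root _
    hω := hω
    hσ := ?_
    hθ := ?_
    span := fun x => ⟨b.repr x 0, b.repr x 1, b.repr x 2, ?_⟩
    indep := fun a c d h => ?_ }, rfl, rfl, rfl⟩
  · rw [autAdjoinRootXPowSubC_root, Algebra.smul_def]
    rfl
  · exact root_X_pow_sub_C_pow 3 p
  · rw [← hsum, b.sum_repr]
  · have := Fintype.linearIndependent_iff.1 b.linearIndependent ![a, c, d] (by
      rw [hsum]; exact h)
    exact ⟨this 0, this 1, this 2⟩

theorem eisenstein_pow_three_ne {O F : Type*} [CommRing O] [IsDedekindDomain O] [CharZero O]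
    [Field F] [Algebra O F] [IsFractionRing O F] {η : O} (hη : η ^ 2 + η + 1 = 0)
    (hspan : ∀ x : O, ∃ m n : ℤ, x = m + n * η) {p : ℕ} (hp : p.Prime) (hp3 : p ≠ 3) (b : F) :
    b ^ 3 ≠ p := by
  intro hb
  have hnu : (p : O) ∈ nonunits O := by
    intro hu
    obtain ⟨k, hk⟩ := hu.dvd (a := 1)
    obtain ⟨m, n, rfl⟩ := hspan k
    have h := (eisenstein_intCast_add_mul_eq_zero hη (m := 1 - p * m) (n := -(p * n)) (by
      push_cast; linear_combination hk)).1
    exact hp.one_lt.ne' (Nat.eq_one_of_mul_eq_one_right (m := p) (n := m.natAbs) (by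
      have : (p : ℤ) * m = 1 := by linear_combination -h
      have := congrArg Int.natAbs this
      simpa [Int.natAbs_mul] using this))
  obtain ⟨I, hI, hpI⟩ := exists_max_ideal_of_mem_nonunits hnu
  let v : HeightOneSpectrum O := ⟨I, hI.isPrime, fun h => by
    rw [h, Ideal.mem_bot, Nat.cast_eq_zero] at hpI
    exact hp.ne_zero hpI⟩
  have hv : v.valuation F (p : F) < 1 := by
    rw [← map_natCast (algebraMap O F)]
    exact (v.valuation_lt_one_iff_mem _).2 hpI
  have hval := valuation_natCast_eq_exp_neg_one (by nlinarith [hp.two_le])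
    (eisenstein_dvd_pow_sub hη hspan hp hp3) hv
  have hb0 : v.valuation F b ≠ 0 := fun h => by
    rw [← hb, map_pow, h, zero_pow three_ne_zero] at hval
    exact WithZero.exp_ne_zero hval.symm
  rw [← hb, map_pow, ← WithZero.exp_log hb0, ← WithZero.exp_nsmul, WithZero.exp_inj] at hval
  have hval' : 3 * WithZero.log (v.valuation F b) = -1 := by simpa using hval
  omega

end CubicAdjoin

section EisensteinField

open NumberField Polynomial

variable {F : Type*} [Field F] [NumberField F] [IsCyclotomicExtension {3} ℚ F] {ζ : F}

theorem eisenstein_span (hζ : IsPrimitiveRoot ζ 3) (x : 𝓞 F) :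
    ∃ m n : ℤ, x = m + n * hζ.toInteger := by
  have hdim : hζ.integralPowerBasis.dim = 2 := by
    rw [IsPrimitiveRoot.integralPowerBasis_dim]; decide
  let b := hζ.integralPowerBasis.basis.reindex (finCongr hdim)
  refine ⟨b.repr x 0, b.repr x 1, ?_⟩
  nth_rewrite 1 [← b.sum_repr x]
  simp [Fin.sum_univ_two, b, PowerBasis.coe_basis, IsPrimitiveRoot.integralPowerBasis_gen]

theorem eisenstein_unit_eq_sq (hζ : IsPrimitiveRoot ζ 3) (ε : (𝓞 F)ˣ) :
    ∃ z : 𝓞 F, (ε : 𝓞 F) = z ^ 2 ∨ (ε : 𝓞 F) = -z ^ 2 := by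
  have h3 := hζ.toInteger_cube_eq_one
  have h := IsCyclotomicExtension.Rat.Three.Units.mem hζ ε
  simp only [List.mem_cons, List.not_mem_nil, or_false] at h
  have hη : hζ.toInteger = (hζ.toInteger ^ 2) ^ 2 := by linear_combination -hζ.toInteger * h3
  rcases h with rfl | rfl | rfl | rfl | rfl | rfl
  · exact ⟨1, .inl (by simp)⟩
  · exact ⟨1, .inr (by simp)⟩
  · exact ⟨hζ.toInteger ^ 2, .inl hη⟩
  · exact ⟨hζ.toInteger ^ 2, .inr (congrArg Neg.neg hη)⟩
  · exact ⟨hζ.toInteger, .inl rfl⟩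
  · exact ⟨hζ.toInteger, .inr rfl⟩

theorem exists_six_nsmul_eq_zero (F : Type) [Field F] [NumberField F]
    [IsCyclotomicExtension {3} ℚ F] {p : ℕ} (hp : p.Prime) (hp2 : p ≠ 2) (hp3 : p ≠ 3)
    (hP : ConditionP p hp) {r : ℂ} (hr : r ^ 3 = p) :
    ∃ (L : Type) (_ : Field L) (_ : DecidableEq L) (_ : NeZero (2 : L)) (ι : L →+* ℂ),
      r ∈ ι.range ∧ ∀ P : (Ecurve L).Point, 6 • P = 0 := by
  classical
  have hζ := IsCyclotomicExtension.zeta_spec 3 ℚ F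
  have hpid : IsPrincipalIdealRing (𝓞 F) := IsCyclotomicExtension.Rat.three_pid F
  have hspan := eisenstein_span hζ
  have hη : hζ.toInteger ^ 2 + hζ.toInteger + 1 = 0 :=
    IsCyclotomicExtension.Rat.Three.eta_sq_add_eta_add_one hζ
  have hζ' := congrArg (algebraMap (𝓞 F) F) hη
  simp only [map_add, map_pow, map_one, map_zero] at hζ'
  have : Fact (Irreducible (X ^ 3 - C (p : F))) :=
    ⟨X_pow_sub_C_irreducible_of_prime Nat.prime_three (eisenstein_pow_three_ne hη hspan hp hp3)⟩
  obtain ⟨K, hω, hK, hθ⟩ := CubicKummer.exists_adjoinRoot hζ' (p := (p : F))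
  have : CharZero (AdjoinRoot (X ^ 3 - C (p : F))) :=
    charZero_of_injective_algebraMap (algebraMap F _).injective
  obtain ⟨φ⟩ : Nonempty (F →+* ℂ) := inferInstance
  let ι : AdjoinRoot (X ^ 3 - C (p : F)) →+* ℂ := AdjoinRoot.lift φ r (by
    rw [eval₂_sub, eval₂_X_pow, eval₂_C, map_natCast, hr, sub_self])
  have : Fact (Nat.Prime 3) := ⟨Nat.prime_three⟩
  have hl : Prime (1 - hζ.toInteger) := by
    rw [← neg_sub]
    exact hζ.zeta_sub_one_prime'.neg
  exact ⟨_, inferInstance, inferInstance, inferInstance, ι, ⟨AdjoinRoot.root _,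
    AdjoinRoot.lift_root _⟩,
    K.six_nsmul_eq_zero_of_conditionP hω.symm hspan (eisenstein_unit_eq_sq hζ) hl hp hp2 hp3
      hP hK ι⟩

end EisensteinField

/-- If `p ∉ {2,3}` is a prime satisfying condition (P), then every point of the elliptic
curve `y² = x³ - x` over the field `ℚ(∛p)` (the subfield of `ℝ` generated by the real cube
root of `p`) is torsion; i.e. the Mordell–Weil rank of this curve over `ℚ(∛p)` is `0`. -/
theorem rank_zero_over_Q_cbrt_p (p : ℕ) (hp : p.Prime) (hp2 : p ≠ 2) (hp3 : p ≠ 3)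
    (hP : ConditionP p hp) :
    ∀ P : (Ecurve (IntermediateField.adjoin ℚ {realCbrt p} : IntermediateField ℚ ℝ)).Point,
      ∃ n : ℤ, n ≠ 0 ∧ n • P = 0 := by
  classical
  intro P
  have hr : ((realCbrt p : ℝ) : ℂ) ^ 3 = p := by
    rw [← Complex.ofReal_pow, realCbrt, ← Real.rpow_natCast, ← Real.rpow_mul (by positivity)]
    norm_num
  have : IsCyclotomicExtension {3} ℚ (CyclotomicField 3 ℚ) :=
    CyclotomicField.isCyclotomicExtension 3 ℚ
  obtain ⟨L, _, _, _, ι, ⟨θ, hθ⟩, h6⟩ :=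
    exists_six_nsmul_eq_zero (CyclotomicField 3 ℚ) hp hp2 hp3 hP hr
  refine ⟨6, by norm_num, ?_⟩
  let f : (IntermediateField.adjoin ℚ {realCbrt p} : IntermediateField ℚ ℝ) →+* ℂ :=
    Complex.ofRealHom.comp (algebraMap _ ℝ)
  have : CharZero L := ι.charZero
  have hf : ∀ x, ∃ y, ι y = f x := by
    rintro ⟨x, hx⟩
    have hle : IntermediateField.adjoin ℚ {realCbrt p} ≤
        ({ ι.fieldRange.comap Complex.ofRealHom with
          algebraMap_mem' := fun q => ⟨q, by simp⟩ } : IntermediateField ℚ ℝ) := by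
      rw [IntermediateField.adjoin_simple_le_iff]
      exact ⟨θ, hθ⟩
    exact hle hx
  have key : 6 • P = 0 := by
    rcases Ecurve.eq_zero_or_mk P with rfl | ⟨x, y, h, rfl⟩
    · exact smul_zero _
    obtain ⟨x', hx⟩ := hf x
    obtain ⟨y', hy⟩ := hf y
    have h' : y' ^ 2 = x' ^ 3 - x' := ι.injective (by
      simp only [map_pow, map_sub, hx, hy]
      simpa using congrArg f h)
    have e : Ecurve.map ι (Ecurve.mk h') = Ecurve.map f (Ecurve.mk h) := by
      rw [Ecurve.map_mk, Ecurve.map_mk, Ecurve.mk_inj]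
      exact ⟨hx, hy⟩
    apply Ecurve.map_injective f
    rw [map_nsmul, ← e, ← map_nsmul, h6, map_zero, map_zero]
  rw [← key]
  exact ofNat_zsmul P 6
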